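/- There are infinitely many pairs (m, n) of natural numbers for which m, m+16n², and m+25n² are all prime numbers congruent to 11 modulo 24. -/

import Mathlib

set_option linter.unusedSectionVars false

namespace PolyPattern

section

/-- The value at `n` of the quadratic polynomial `a n² + b n` encoded by `(a, b)`. -/
def quadEval (p : ℤ × ℤ) (n : ℤ) : ℤ := p.1 * n ^ 2 + p.2 * n

/-- Every finite colouring of `ℤ` has a monochromatic `{x} ∪ {x + p n : p ∈ P}` of bounded size. -/
def QuadRegular (P : Finset (ℤ × ℤ)) : Prop :=
  ∀ (κ : Type) [Finite κ], ∃ N : ℕ, ∀ c : ℤ → κ, ∃ x : ℤ, ∃ n : ℕ,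
    |x| ≤ N ∧ 1 ≤ n ∧ n ≤ N ∧ ∀ p ∈ P, c (x + quadEval p n) = c x

/-- The polynomials `p (m + n) - p n - p₁ m` for `p ∈ P` and `n ≤ N`. -/
def quadDerived (P : Finset (ℤ × ℤ)) (p₁ : ℤ × ℤ) (N : ℕ) : Finset (ℤ × ℤ) :=
  Finset.image₂ (fun p (n : ℕ) => (p.1 - p₁.1, p.2 + 2 * p.1 * n - p₁.2)) P (Finset.range (N + 1))

lemma exists_quadEval_bound (P : Finset (ℤ × ℤ)) (N : ℕ) :
    ∃ B : ℕ, ∀ p ∈ P, ∀ n : ℕ, n ≤ N → |quadEval p n| ≤ B := by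
  refine ⟨∑ p ∈ P, ∑ n ∈ Finset.range (N + 1), (quadEval p n).natAbs, fun p hp n hn => ?_⟩
  rw [← Int.natCast_natAbs]
  have h1 : (quadEval p n).natAbs ≤ ∑ n ∈ Finset.range (N + 1), (quadEval p n).natAbs :=
    Finset.single_le_sum (f := fun n : ℕ => (quadEval p n).natAbs) (fun _ _ => Nat.zero_le _)
      (Finset.mem_range.2 (Nat.lt_succ_of_le hn))
  have h2 := Finset.single_le_sum
    (f := fun p => ∑ n ∈ Finset.range (N + 1), (quadEval p n).natAbs)
    (fun _ _ => Nat.zero_le _) hp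
  exact_mod_cast h1.trans h2

lemma quad_focus {P : Finset (ℤ × ℤ)} {p₁ : ℤ × ℤ} (hp₁ : p₁ ∈ P)
    (hP : ∀ N, QuadRegular (quadDerived P p₁ N)) (κ : Type) [Finite κ] (t : ℕ) :
    ∃ N : ℕ, ∀ c : ℤ → κ,
      (∃ x : ℤ, ∃ n : ℕ, |x| ≤ N ∧ 1 ≤ n ∧ n ≤ N ∧ ∀ p ∈ P, c (x + quadEval p n) = c x) ∨
      ∃ x : ℤ, ∃ n : Fin t → ℕ, ∃ col : Fin t → κ, |x| ≤ N ∧ Function.Injective col ∧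
        ∀ j, 1 ≤ n j ∧ n j ≤ N ∧ ∀ p ∈ P, c (x + quadEval p (n j)) = col j := by
  induction t with
  | zero =>
    refine ⟨0, fun c => Or.inr ⟨0, Fin.elim0, Fin.elim0, by simp, fun i => i.elim0,
      fun j => j.elim0⟩⟩
  | succ t ih =>
    obtain ⟨N, hN⟩ := ih
    obtain ⟨B, hB⟩ := exists_quadEval_bound P N
    obtain ⟨M, hM⟩ := hP N (↥(Finset.Icc (-(N + B : ℤ)) (N + B)) → κ)
    obtain ⟨S, hS⟩ := exists_quadEval_bound P M
    refine ⟨N + M + S, fun c => ?_⟩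
    obtain ⟨z, m, hz, hm1, hmM, hC⟩ := hM fun z w => c (z + w)
    have key : ∀ p ∈ P, ∀ n : ℕ, n ≤ N → ∀ w : ℤ, |w| ≤ N + B →
        c (z + w - quadEval p₁ m + (quadEval p (n + m) - quadEval p n)) = c (z + w) := by
      intro p hp n hn w hw
      have h := hC _ (Finset.mem_image₂_of_mem hp (Finset.mem_range.2 (Nat.lt_succ_of_le hn)))
      have h' := congrFun h ⟨w, Finset.mem_Icc.2 (abs_le.1 hw)⟩
      rw [← h']
      congr 1
      simp only [quadEval]
      ring
    push_cast
    rcases hN fun w => c (z + w) with ⟨x, n, hx, hn1, hnN, h⟩ | ⟨x, n, col, hx, hcol, h⟩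
    · refine Or.inl ⟨z + x, n, ?_, hn1, by omega, fun p hp => ?_⟩
      · exact (abs_add_le _ _).trans (by linarith [Int.natCast_nonneg S])
      · rw [add_assoc]; exact h p hp
    by_cases hc : ∃ j, col j = c (z + x)
    · obtain ⟨j, hj⟩ := hc
      refine Or.inl ⟨z + x, n j, ?_, (h j).1, by have := (h j).2.1; omega, fun p hp => ?_⟩
      · exact (abs_add_le _ _).trans (by linarith [Int.natCast_nonneg S])
      · rw [add_assoc, ← hj]; exact (h j).2.2 p hp
    push Not at hc
    refine Or.inr ⟨z + x - quadEval p₁ m, Fin.cons m fun j => n j + m,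
      Fin.cons (c (z + x)) col, ?_, ?_, ?_⟩
    · have := hS p₁ hp₁ m hmM
      exact (abs_sub _ _).trans (by linarith [abs_add_le z x])
    · rw [Fin.cons_injective_iff]
      exact ⟨fun ⟨j, hj⟩ => hc j hj, hcol⟩
    · intro j
      refine Fin.cases ?_ (fun j => ?_) j
      · refine ⟨hm1, by simp only [Fin.cons_zero]; omega, fun p hp => ?_⟩
        have := key p hp 0 (Nat.zero_le _) x (by linarith [Int.natCast_nonneg B])
        simpa [quadEval] using this
      · have hj := h j
        refine ⟨by simp only [Fin.cons_succ]; omega, by simp only [Fin.cons_succ]; omega,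
          fun p hp => ?_⟩
        have hb := hB p hp (n j) hj.2.1
        have h1 := key p hp (n j) hj.2.1 (x + quadEval p (n j)) ((abs_add_le _ _).trans (by linarith))
        have h2 := hj.2.2 p hp
        simp only [Fin.cons_succ]
        rw [← h2, ← h1]
        congr 1
        push_cast
        ring

lemma quadRegular_of_derived {P : Finset (ℤ × ℤ)} {p₁ : ℤ × ℤ} (hp₁ : p₁ ∈ P)
    (hP : ∀ N, QuadRegular (quadDerived P p₁ N)) : QuadRegular P := by
  intro κ _
  have := Fintype.ofFinite κ
  obtain ⟨N, hN⟩ := quad_focus hp₁ hP κ (Fintype.card κ + 1)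
  refine ⟨N, fun c => (hN c).resolve_right ?_⟩
  rintro ⟨x, n, col, -, hcol, -⟩
  have := Fintype.card_le_of_injective col hcol
  simp at this

lemma quadRegular_of_erase {P : Finset (ℤ × ℤ)} (h : QuadRegular (P.erase 0)) :
    QuadRegular P := by
  intro κ _
  obtain ⟨N, hN⟩ := h κ
  refine ⟨N, fun c => ?_⟩
  obtain ⟨x, n, hx, h1, hn, hc⟩ := hN c
  refine ⟨x, n, hx, h1, hn, fun p hp => ?_⟩
  by_cases h0 : p = 0
  · simp [h0, quadEval]
  · exact hc p (Finset.mem_erase.2 ⟨h0, hp⟩)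

lemma quadRegular_of_card (s t : ℕ) (P : Finset (ℤ × ℤ)) (h0 : (0 : ℤ × ℤ) ∉ P)
    (hs : ((P.image Prod.fst).erase 0).card ≤ s)
    (ht : ((P.filter fun p => p.1 = 0).image Prod.snd).card ≤ t) : QuadRegular P := by
  induction s generalizing t P with
  | zero =>
    induction t generalizing P with
    | zero =>
      intro κ _
      refine ⟨1, fun c => ⟨0, 1, by simp, le_rfl, le_rfl, fun p hp => ?_⟩⟩
      have h1 : p.1 = 0 := by
        by_contra h
        have := Finset.card_eq_zero.1 (Nat.le_zero.1 hs)
        have h2 : p.1 ∈ (P.image Prod.fst).erase 0 :=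
          Finset.mem_erase.2 ⟨h, Finset.mem_image_of_mem _ hp⟩
        simp [this] at h2
      have := Finset.card_eq_zero.1 (Nat.le_zero.1 ht)
      have h2 : p.2 ∈ (P.filter fun p => p.1 = 0).image Prod.snd :=
        Finset.mem_image_of_mem _ (Finset.mem_filter.2 ⟨hp, h1⟩)
      simp [this] at h2
    | succ t ih => exact linear_step P h0 hs ht ih
  | succ s ihs =>
    induction t generalizing P with
    | zero =>
      by_cases h : ((P.image Prod.fst).erase 0).card ≤ s
      · exact ihs 0 P h0 h ht
      have hne : ((P.image Prod.fst).erase 0).Nonempty := Finset.card_pos.1 (by omega)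
      obtain ⟨a, ha⟩ := hne
      have ha' := ha
      obtain ⟨ha0, ha⟩ := Finset.mem_erase.1 ha
      obtain ⟨p₁, hp₁, rfl⟩ := Finset.mem_image.1 ha
      refine quadRegular_of_derived hp₁ fun N => quadRegular_of_erase
        (ihs _ _ (Finset.notMem_erase _ _) ?_ le_rfl)
      have : (((quadDerived P p₁ N).erase 0).image Prod.fst).erase 0 ⊆
          (((P.image Prod.fst).erase 0).erase p₁.1).image (fun a => a - p₁.1) := by
        intro a ha
        simp only [quadDerived, Finset.mem_erase, Finset.mem_image, Finset.mem_image₂] at ha ⊢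
        obtain ⟨h1, _, ⟨-, p, hp, n, -, rfl⟩, rfl⟩ := ha
        refine ⟨p.1, ⟨fun h => h1 (by simp [h]), fun hp1 => ?_, p, hp, rfl⟩, rfl⟩
        have := Finset.card_eq_zero.1 (Nat.le_zero.1 ht)
        have h2 : p.2 ∈ (P.filter fun p => p.1 = 0).image Prod.snd :=
          Finset.mem_image_of_mem _ (Finset.mem_filter.2 ⟨hp, hp1⟩)
        simp [this] at h2
      refine (Finset.card_le_card this).trans (Finset.card_image_le.trans ?_)
      rw [Finset.card_erase_of_mem ha']
      omega
    | succ t ih => exact linear_step P h0 hs ht ih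
where
  linear_step {s t : ℕ} (P : Finset (ℤ × ℤ)) (h0 : (0 : ℤ × ℤ) ∉ P)
      (hs : ((P.image Prod.fst).erase 0).card ≤ s)
      (ht : ((P.filter fun p => p.1 = 0).image Prod.snd).card ≤ t + 1)
      (ih : ∀ P' : Finset (ℤ × ℤ), (0 : ℤ × ℤ) ∉ P' → ((P'.image Prod.fst).erase 0).card ≤ s →
        ((P'.filter fun p => p.1 = 0).image Prod.snd).card ≤ t → QuadRegular P') :
      QuadRegular P := by
    by_cases h : ((P.filter fun p => p.1 = 0).image Prod.snd).card ≤ t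
    · exact ih P h0 hs h
    have hne : ((P.filter fun p => p.1 = 0).image Prod.snd).Nonempty :=
      Finset.card_pos.1 (by omega)
    obtain ⟨b, hb⟩ := hne
    have hb' := hb
    obtain ⟨p₁, hp₁, rfl⟩ := Finset.mem_image.1 hb
    obtain ⟨hp₁, h10⟩ := Finset.mem_filter.1 hp₁
    refine quadRegular_of_derived hp₁ fun N => quadRegular_of_erase
      (ih _ (Finset.notMem_erase _ _) ?_ ?_)
    · refine (Finset.card_le_card ?_).trans hs
      intro a ha
      simp only [quadDerived, Finset.mem_erase, Finset.mem_image, Finset.mem_image₂, h10] at ha ⊢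
      obtain ⟨h0, _, ⟨-, p, hp, n, -, rfl⟩, rfl⟩ := ha
      exact ⟨h0, p, hp, by simp⟩
    · have : ((((quadDerived P p₁ N).erase 0).filter fun p => p.1 = 0).image Prod.snd) ⊆
          (((P.filter fun p => p.1 = 0).image Prod.snd).erase p₁.2).image
            (fun b => b - p₁.2) := by
        intro b hb
        simp only [quadDerived, Finset.mem_erase, Finset.mem_image, Finset.mem_image₂,
          Finset.mem_filter] at hb ⊢
        obtain ⟨_, ⟨⟨h1, p, hp, n, -, rfl⟩, h2⟩, rfl⟩ := hb
        have hp0 : p.1 = 0 := by simpa [h10] using h2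
        simp only [hp0, h10] at h1 ⊢
        refine ⟨p.2, ⟨fun h => h1 (by simp [h]), p, ⟨hp, hp0⟩, rfl⟩, by ring⟩
      refine (Finset.card_le_card this).trans (Finset.card_image_le.trans ?_)
      rw [Finset.card_erase_of_mem hb']
      omega

theorem quadRegular (P : Finset (ℤ × ℤ)) : QuadRegular P :=
  quadRegular_of_erase (quadRegular_of_card _ _ _ (Finset.notMem_erase _ _) le_rfl le_rfl)

/-- Finite colourings of long intervals contain monochromatic progressions of square step. -/
theorem exists_mono_square_step (κ : Type) [Finite κ] (J : ℕ) :
    ∃ J' : ℕ, ∀ c : ℕ → κ, ∃ x k : ℕ, 1 ≤ k ∧ k ≤ J' ∧ x + J * k ^ 2 ≤ J' ∧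
      ∀ i ≤ J, c (x + i * k ^ 2) = c x := by
  obtain ⟨N, hN⟩ := quadRegular ((Finset.range (J + 1)).image fun i : ℕ => ((i : ℤ), (0 : ℤ))) κ
  refine ⟨2 * N + J * N ^ 2, fun c => ?_⟩
  obtain ⟨x, n, hx, hn1, hn, h⟩ := hN fun z => c (z + N).toNat
  rw [abs_le] at hx
  obtain ⟨y, hy⟩ := Int.eq_ofNat_of_zero_le (show 0 ≤ x + N by linarith)
  refine ⟨y, n, hn1, by nlinarith, ?_, fun i hi => ?_⟩
  · have : y ≤ 2 * N := by omega
    have : n ^ 2 ≤ N ^ 2 := Nat.pow_le_pow_left hn 2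
    nlinarith
  · have := h _ (Finset.mem_image_of_mem _ (Finset.mem_range.2 (Nat.lt_succ_of_le hi)))
    simp only [quadEval, zero_mul, add_zero, hy] at this
    rw [show x + (i : ℤ) * (n : ℤ) ^ 2 + N = ((y + i * n ^ 2 : ℕ) : ℤ) by
      push_cast; linarith] at this
    simpa only [Int.toNat_natCast, Int.ofNat_eq_natCast] using this

end

section

open MeasureTheory ProbabilityTheory Filter Topology

section Basic
variable {X : Type} [mX : MeasurableSpace X]

/-- Bounded measurable real functions. -/
structure BddMeas (f : X → ℝ) : Prop where
  meas : Measurable f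
  bdd : ∃ C, ∀ x, |f x| ≤ C

namespace BddMeas
variable {f g : X → ℝ}

lemma const (c : ℝ) : BddMeas (fun _ : X => c) := ⟨measurable_const, |c|, fun _ => le_rfl⟩

lemma exists_pos (hf : BddMeas f) : ∃ C, 0 < C ∧ ∀ x, |f x| ≤ C := by
  obtain ⟨C, hC⟩ := hf.bdd
  exact ⟨max C 1, by positivity, fun x => (hC x).trans (le_max_left _ _)⟩

lemma add (hf : BddMeas f) (hg : BddMeas g) : BddMeas (fun x => f x + g x) := by
  obtain ⟨C, hC⟩ := hf.bdd
  obtain ⟨C', hC'⟩ := hg.bdd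
  exact ⟨hf.meas.add hg.meas, C + C', fun x => (abs_add_le _ _).trans (add_le_add (hC x) (hC' x))⟩

lemma sub (hf : BddMeas f) (hg : BddMeas g) : BddMeas (fun x => f x - g x) := by
  obtain ⟨C, hC⟩ := hf.bdd
  obtain ⟨C', hC'⟩ := hg.bdd
  exact ⟨hf.meas.sub hg.meas, C + C', fun x => (abs_sub _ _).trans (add_le_add (hC x) (hC' x))⟩

lemma mul (hf : BddMeas f) (hg : BddMeas g) : BddMeas (fun x => f x * g x) := by
  obtain ⟨C, hC⟩ := hf.bdd
  obtain ⟨C', hC'⟩ := hg.bdd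
  refine ⟨hf.meas.mul hg.meas, C * C', fun x => ?_⟩
  rw [abs_mul]
  exact mul_le_mul (hC x) (hC' x) (abs_nonneg _) ((abs_nonneg _).trans (hC x))

lemma const_mul (c : ℝ) (hf : BddMeas f) : BddMeas (fun x => c * f x) := (const c).mul hf

lemma pow (hf : BddMeas f) (n : ℕ) : BddMeas (fun x => f x ^ n) := by
  induction n with
  | zero => simpa using const 1
  | succ n ih => simpa only [pow_succ] using ih.mul hf

lemma abs (hf : BddMeas f) : BddMeas (fun x => |f x|) := by
  obtain ⟨C, hC⟩ := hf.bdd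
  exact ⟨hf.meas.abs, C, fun x => by simpa using hC x⟩

lemma sum {ι : Type*} {s : Finset ι} {f : ι → X → ℝ} (hf : ∀ i ∈ s, BddMeas (f i)) :
    BddMeas (fun x => ∑ i ∈ s, f i x) := by
  classical
  induction s using Finset.induction_on with
  | empty => simpa using const 0
  | insert a s ha ih =>
    simp only [Finset.sum_insert ha]
    exact (hf a (Finset.mem_insert_self _ _)).add
      (ih fun i hi => hf i (Finset.mem_insert_of_mem hi))

lemma prod {ι : Type*} {s : Finset ι} {f : ι → X → ℝ} (hf : ∀ i ∈ s, BddMeas (f i)) :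
    BddMeas (fun x => ∏ i ∈ s, f i x) := by
  classical
  induction s using Finset.induction_on with
  | empty => simpa using const 1
  | insert a s ha ih =>
    simp only [Finset.prod_insert ha]
    exact (hf a (Finset.mem_insert_self _ _)).mul
      (ih fun i hi => hf i (Finset.mem_insert_of_mem hi))

lemma comp {Y : Type} [MeasurableSpace Y] {t : Y → X} (hf : BddMeas f) (ht : Measurable t) :
    BddMeas (fun y => f (t y)) :=
  ⟨hf.meas.comp ht, hf.bdd.imp fun _ h _ => h _⟩

lemma integrable (hf : BddMeas f) (ν : Measure X) [IsFiniteMeasure ν] : Integrable f ν := by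
  obtain ⟨C, hC⟩ := hf.bdd
  exact Integrable.of_bound hf.meas.aestronglyMeasurable C (ae_of_all _ hC)

lemma indicator {s : Set X} (hs : MeasurableSet s) : BddMeas (s.indicator (1 : X → ℝ)) :=
  ⟨measurable_one.indicator hs, 1, fun x => by
    by_cases h : x ∈ s <;> simp [h]⟩

lemma abs_integral_le {ν : Measure X} [IsProbabilityMeasure ν] {C : ℝ} (hC : ∀ x, |f x| ≤ C) :
    |∫ x, f x ∂ν| ≤ C := by
  simpa using norm_integral_le_of_norm_le_const (μ := ν) (f := f) (ae_of_all _ hC)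

/-- The Cauchy–Schwarz inequality for bounded functions. -/
lemma sq_integral_mul_le (hf : BddMeas f) (hg : BddMeas g) (ν : Measure X) [IsFiniteMeasure ν] :
    (∫ x, f x * g x ∂ν) ^ 2 ≤ (∫ x, f x ^ 2 ∂ν) * ∫ x, g x ^ 2 ∂ν := by
  have h : ∀ t : ℝ, 0 ≤ (∫ x, g x ^ 2 ∂ν) * (t * t) + (2 * ∫ x, f x * g x ∂ν) * t
      + ∫ x, f x ^ 2 ∂ν := by
    intro t
    have : 0 ≤ ∫ x, (t * t) * g x ^ 2 + (2 * t) * (f x * g x) + f x ^ 2 ∂ν :=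
      integral_nonneg fun x => by
        show 0 ≤ _
        nlinarith [sq_nonneg (f x + t * g x)]
    rw [integral_add (((((hg.pow 2).const_mul _).add ((hf.mul hg).const_mul _))).integrable ν)
      ((hf.pow 2).integrable ν), integral_add (((hg.pow 2).const_mul _).integrable ν)
      (((hf.mul hg).const_mul _).integrable ν), integral_const_mul, integral_const_mul] at this
    linarith
  have := discrim_le_zero h
  simp only [discrim] at this
  linarith

lemma sq_integral_le (hf : BddMeas f) (ν : Measure X) [IsProbabilityMeasure ν] :
    (∫ x, f x ∂ν) ^ 2 ≤ ∫ x, f x ^ 2 ∂ν := by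
  simpa using sq_integral_mul_le hf (const 1) ν

end BddMeas

variable [AddAction ℤ X]

/-- Shift-invariant sub-σ-algebras (factors). -/
structure Factor (X : Type) [mX : MeasurableSpace X] [AddAction ℤ X] where
  alg : MeasurableSpace X
  le : alg ≤ mX
  inv : ∀ (n : ℤ) (s : Set X), MeasurableSet[alg] s → MeasurableSet[alg] ((n +ᵥ ·) ⁻¹' s)

variable [StandardBorelSpace X] {μ : Measure X} [IsProbabilityMeasure μ]

/-- Conditional expectation on a factor, by integration against the disintegration. -/
noncomputable def ce (μ : Measure X) [IsProbabilityMeasure μ] (D : Factor X) (f : X → ℝ)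
    (y : X) : ℝ :=
  ∫ x, f x ∂(condExpKernel μ D.alg y)

variable {D : Factor X} {f g : X → ℝ}

lemma ce_abs_le {C : ℝ} (hC : ∀ x, |f x| ≤ C) (y : X) : |ce μ D f y| ≤ C :=
  BddMeas.abs_integral_le hC

lemma ce_measurable (hf : BddMeas f) : Measurable[D.alg] (ce μ D f) :=
  (hf.meas.stronglyMeasurable.integral_condExpKernel (μ := μ) (m := D.alg)).measurable

lemma ce_bddMeas (hf : BddMeas f) : BddMeas (ce μ D f) :=
  ⟨(ce_measurable hf).mono D.le le_rfl, hf.bdd.imp fun _ h => ce_abs_le h⟩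

lemma ce_add (hf : BddMeas f) (hg : BddMeas g) (y : X) :
    ce μ D (fun x => f x + g x) y = ce μ D f y + ce μ D g y :=
  integral_add (hf.integrable _) (hg.integrable _)

lemma ce_sub (hf : BddMeas f) (hg : BddMeas g) (y : X) :
    ce μ D (fun x => f x - g x) y = ce μ D f y - ce μ D g y :=
  integral_sub (hf.integrable _) (hg.integrable _)

lemma ce_const_mul (c : ℝ) (y : X) : ce μ D (fun x => c * f x) y = c * ce μ D f y :=
  integral_const_mul _ _

lemma ce_sum {ι : Type*} {s : Finset ι} {f : ι → X → ℝ} (hf : ∀ i ∈ s, BddMeas (f i)) (y : X) :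
    ce μ D (fun x => ∑ i ∈ s, f i x) y = ∑ i ∈ s, ce μ D (f i) y :=
  integral_finsetSum _ fun i hi => (hf i hi).integrable _

lemma ce_mono (hf : BddMeas f) (hg : BddMeas g) (h : ∀ x, f x ≤ g x) (y : X) :
    ce μ D f y ≤ ce μ D g y :=
  integral_mono (hf.integrable _) (hg.integrable _) h

lemma ce_nonneg (h : ∀ x, 0 ≤ f x) (y : X) : 0 ≤ ce μ D f y := integral_nonneg h

lemma ce_ae_eq_condExp (hf : BddMeas f) : ce μ D f =ᵐ[μ] μ[f | D.alg] :=
  (condExp_ae_eq_integral_condExpKernel D.le (hf.integrable μ)).symm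

lemma integral_ce (hf : BddMeas f) : ∫ x, ce μ D f x ∂μ = ∫ x, f x ∂μ := by
  rw [integral_congr_ae (ce_ae_eq_condExp hf), integral_condExp D.le]

lemma ce_mul_right (hf : BddMeas f) (hg : BddMeas g) (hgD : Measurable[D.alg] g) :
    ce μ D (fun x => f x * g x) =ᵐ[μ] fun x => ce μ D f x * g x := by
  have h := condExp_mul_of_stronglyMeasurable_right (μ := μ) (m := D.alg) (f := f) (g := g)
    hgD.stronglyMeasurable ((hf.mul hg).integrable μ) (hf.integrable μ)
  filter_upwards [ce_ae_eq_condExp (μ := μ) (D := D) (hf.mul hg),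
    ce_ae_eq_condExp (μ := μ) (D := D) hf, h] with x h1 h2 h3
  rw [h1, h2]
  exact h3

lemma integral_ce_mul (hf : BddMeas f) (hg : BddMeas g) (hgD : Measurable[D.alg] g) :
    ∫ x, ce μ D f x * g x ∂μ = ∫ x, f x * g x ∂μ := by
  rw [← integral_congr_ae (ce_mul_right hf hg hgD), integral_ce (hf.mul hg)]

lemma ae_eq_ce (hf : BddMeas f) (hg : BddMeas g) (hgD : Measurable[D.alg] g)
    (h : ∀ s, MeasurableSet[D.alg] s → ∫ x in s, g x ∂μ = ∫ x in s, f x ∂μ) :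
    g =ᵐ[μ] ce μ D f :=
  (ae_eq_condExp_of_forall_setIntegral_eq D.le (hf.integrable μ)
    (fun _ _ _ => (hg.integrable μ).integrableOn) (fun s hs _ => h s hs)
    hgD.stronglyMeasurable.aestronglyMeasurable).trans (ce_ae_eq_condExp hf).symm

variable [MeasurableConstVAdd ℤ X]

lemma BddMeas.shift (hf : BddMeas f) (n : ℤ) : BddMeas (fun x => f (n +ᵥ x)) :=
  hf.comp (measurable_const_vadd n)

variable [VAddInvariantMeasure ℤ X μ]

lemma integral_shift (f : X → ℝ) (n : ℤ) : ∫ x, f (n +ᵥ x) ∂μ = ∫ x, f x ∂μ :=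
  (measurePreserving_vadd n μ).integral_comp (measurableEmbedding_const_vadd n) f

lemma Factor.measurable_shift (D : Factor X) (n : ℤ) :
    Measurable[D.alg, D.alg] (fun x : X => n +ᵥ x) := fun s hs => D.inv n s hs

lemma Factor.measurable_indicator (D : Factor X) {s : Set X} (hs : MeasurableSet[D.alg] s) :
    Measurable[D.alg] (s.indicator (1 : X → ℝ)) :=
  Measurable.indicator (m := D.alg) (@measurable_const ℝ X _ D.alg 1) hs

lemma ae_shift {p : X → Prop} (h : ∀ᵐ x ∂μ, p x) (n : ℤ) : ∀ᵐ x ∂μ, p (n +ᵥ x) :=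
  (measurePreserving_vadd n μ).quasiMeasurePreserving.ae h

lemma ce_shift (hf : BddMeas f) (n : ℤ) :
    ce μ D (fun x => f (n +ᵥ x)) =ᵐ[μ] fun x => ce μ D f (n +ᵥ x) := by
  refine (ae_eq_ce (hf.shift n) ((ce_bddMeas hf).shift n)
    ((ce_measurable hf).comp (D.measurable_shift n)) fun s hs => ?_).symm
  have hs' : MeasurableSet[D.alg] ((-n +ᵥ ·) ⁻¹' s) := D.inv _ _ hs
  have key : ∀ φ : X → ℝ, ∫ x in s, φ (n +ᵥ x) ∂μ = ∫ x in ((-n +ᵥ ·) ⁻¹' s), φ x ∂μ := by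
    intro φ
    rw [← integral_indicator (D.le _ hs), ← integral_indicator (D.le _ hs'),
      ← integral_shift (μ := μ) (Set.indicator ((-n +ᵥ ·) ⁻¹' s) _) n]
    congr 1
    ext x
    have : n +ᵥ x ∈ (fun x => -n +ᵥ x) ⁻¹' s ↔ x ∈ s := by
      rw [Set.mem_preimage, neg_vadd_vadd]
    by_cases hx : x ∈ s
    · rw [Set.indicator_of_mem hx, Set.indicator_of_mem (this.2 hx)]
    · rw [Set.indicator_of_notMem hx, Set.indicator_of_notMem (this.not.2 hx)]
  rw [key, key]
  have h2 := integral_ce_mul (μ := μ) (D := D) hf (BddMeas.indicator (D.le _ hs'))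
    (D.measurable_indicator hs')
  rw [← integral_indicator (D.le _ hs'), ← integral_indicator (D.le _ hs')]
  convert h2 using 2 <;> ext x <;> simp [Set.indicator]

end Basic

section AP
variable {X : Type} [mX : MeasurableSpace X] [AddAction ℤ X] [MeasurableConstVAdd ℤ X]
  [StandardBorelSpace X] {μ : Measure X} [IsProbabilityMeasure μ] [VAddInvariantMeasure ℤ X μ]
  {D : Factor X} {φ ψ : X → ℝ}

/-- Functions that are almost periodic relative to the factor `D`. -/
structure AlmostPeriodic (μ : Measure X) [IsProbabilityMeasure μ] (D : Factor X) (φ : X → ℝ) :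
    Prop where
  bddMeas : BddMeas φ
  approx : ∀ ε > 0, ∃ Γ : Set (X → ℝ), Γ.Finite ∧ (∀ g ∈ Γ, BddMeas g) ∧
    ∃ E, MeasurableSet[D.alg] E ∧ μ.real E ≤ ε ∧
      ∀ n : ℤ, ∀ᵐ y ∂μ, y ∉ E → n +ᵥ y ∉ E →
        ∃ g ∈ Γ, ce μ D (fun x => (φ (n +ᵥ x) - g x) ^ 2) y ≤ ε

namespace AlmostPeriodic

lemma comp₂ (hφ : AlmostPeriodic μ D φ) (hψ : AlmostPeriodic μ D ψ) {F : ℝ → ℝ → ℝ} {K : ℝ}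
    (hFc : Continuous (Function.uncurry F)) 
    (hF : ∀ a b a' b', |F a b - F a' b'| ≤ K * (|a - a'| + |b - b'|)) :
    AlmostPeriodic μ D (fun x => F (φ x) (ψ x)) := by
  have hF2 : ∀ a b a' b', (F a b - F a' b') ^ 2 ≤ 2 * K ^ 2 * (a - a') ^ 2
      + 2 * K ^ 2 * (b - b') ^ 2 := by
    intro a b a' b'
    have h1 := pow_le_pow_left₀ (abs_nonneg _) (hF a b a' b') 2
    rw [sq_abs] at h1
    have h2 : (|a - a'| + |b - b'|) ^ 2 ≤ 2 * ((a - a') ^ 2 + (b - b') ^ 2) := by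
      rw [← sq_abs (a - a'), ← sq_abs (b - b')]
      nlinarith [sq_nonneg (|a - a'| - |b - b'|)]
    calc _ ≤ _ := h1
      _ = K ^ 2 * (|a - a'| + |b - b'|) ^ 2 := by ring
      _ ≤ K ^ 2 * (2 * ((a - a') ^ 2 + (b - b') ^ 2)) := by gcongr
      _ = _ := by ring
  have hbm : ∀ {f g : X → ℝ}, BddMeas f → BddMeas g → BddMeas (fun x => F (f x) (g x)) := by
    intro f g hf hg
    refine ⟨hFc.measurable.comp (hf.meas.prodMk hg.meas), ?_⟩
    obtain ⟨C, hC0, hC⟩ := hf.exists_pos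
    obtain ⟨C', hC0', hC'⟩ := hg.exists_pos
    refine ⟨|F 0 0| + |K| * (C + C'), fun x => ?_⟩
    have h := hF (f x) (g x) 0 0
    simp only [sub_zero] at h
    have h3 : K * (|f x| + |g x|) ≤ |K| * (C + C') :=
      mul_le_mul (le_abs_self _) (add_le_add (hC x) (hC' x)) (by positivity) (abs_nonneg _)
    have := abs_sub_abs_le_abs_sub (F (f x) (g x)) (F 0 0)
    linarith
  refine ⟨hbm hφ.bddMeas hψ.bddMeas, fun ε hε => ?_⟩
  set ε' := ε / (4 * K ^ 2 + 2) with hε'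
  have hpos : 0 < ε' := by positivity
  have hmul : ε' * (4 * K ^ 2 + 2) = ε := by rw [hε']; field_simp
  obtain ⟨Γ, hΓ, hΓb, E, hE, hμE, h⟩ := hφ.approx ε' hpos
  obtain ⟨Γ', hΓ', hΓb', E', hE', hμE', h'⟩ := hψ.approx ε' hpos
  refine ⟨Set.image2 (fun g g' x => F (g x) (g' x)) Γ Γ', hΓ.image2 _ hΓ', ?_, E ∪ E',
    MeasurableSet.union (m := D.alg) hE hE', ?_, fun n => ?_⟩
  · rintro _ ⟨g, hg, g', hg', rfl⟩
    exact hbm (hΓb g hg) (hΓb' g' hg')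
  · refine (measureReal_union_le _ _).trans ?_
    nlinarith [sq_nonneg K]
  · filter_upwards [h n, h' n] with y hy hy' h1 h2
    simp only [Set.mem_union, not_or] at h1 h2
    obtain ⟨g, hg, hgy⟩ := hy h1.1 h2.1
    obtain ⟨g', hg', hgy'⟩ := hy' h1.2 h2.2
    refine ⟨_, ⟨g, hg, g', hg', rfl⟩, ?_⟩
    have b1 := ((hφ.bddMeas.shift n).sub (hΓb g hg)).pow 2
    have b2 := ((hψ.bddMeas.shift n).sub (hΓb' g' hg')).pow 2
    have := ce_mono (μ := μ) (D := D) (((hbm (hφ.bddMeas.shift n) (hψ.bddMeas.shift n)).sub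
      (hbm (hΓb g hg) (hΓb' g' hg'))).pow 2)
      ((b1.const_mul (2 * K ^ 2)).add (b2.const_mul (2 * K ^ 2)))
      (fun x => hF2 _ _ _ _) y
    rw [ce_add (b1.const_mul _) (b2.const_mul _), ce_const_mul, ce_const_mul] at this
    refine this.trans ?_
    have h3 := mul_le_mul_of_nonneg_left hgy (by positivity : 0 ≤ 2 * K ^ 2)
    have h4 := mul_le_mul_of_nonneg_left hgy' (by positivity : 0 ≤ 2 * K ^ 2)
    linarith

lemma const (c : ℝ) : AlmostPeriodic μ D (fun _ => c) := by
  refine ⟨BddMeas.const c, fun ε hε => ⟨{fun _ => c}, Set.finite_singleton _, ?_, ∅,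
    @MeasurableSet.empty _ D.alg, by simpa using hε.le, fun n => ae_of_all _ fun y _ _ =>
      ⟨_, rfl, by simpa [ce] using hε.le⟩⟩⟩
  rintro g rfl
  exact BddMeas.const c

lemma of_approx (hφ : BddMeas φ)
    (h : ∀ ε > 0, ∃ ψ, AlmostPeriodic μ D ψ ∧ ∫ x, (φ x - ψ x) ^ 2 ∂μ ≤ ε) :
    AlmostPeriodic μ D φ := by
  refine ⟨hφ, fun ε hε => ?_⟩
  obtain ⟨ψ, hψ, hint⟩ := h (ε ^ 2 / 8) (by positivity)
  obtain ⟨Γ, hΓ, hΓb, E, hE, hμE, hn⟩ := hψ.approx (ε / 4) (by positivity)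
  have hb := (hφ.sub hψ.bddMeas).pow 2
  set h : X → ℝ := ce μ D fun x => (φ x - ψ x) ^ 2 with hh
  have hmeas : MeasurableSet[D.alg] {y | ε / 4 ≤ h y} :=
    ce_measurable hb measurableSet_Ici
  refine ⟨Γ, hΓ, hΓb, E ∪ {y | ε / 4 ≤ h y}, MeasurableSet.union (m := D.alg) hE hmeas, ?_, fun n => ?_⟩
  · have h1 : ε / 4 * μ.real {y | ε / 4 ≤ h y} ≤ ∫ y, h y ∂μ :=
      mul_meas_ge_le_integral_of_nonneg
        (ae_of_all _ fun y => ce_nonneg (fun x => sq_nonneg _) y) ((ce_bddMeas hb).integrable μ) _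
    rw [hh, integral_ce hb, ← hh] at h1
    have h2 : μ.real {y | ε / 4 ≤ h y} ≤ ε / 2 := by
      have : ε / 4 * μ.real {y | ε / 4 ≤ h y} ≤ ε / 4 * (ε / 2) := by nlinarith
      exact le_of_mul_le_mul_left this (by positivity)
    refine (measureReal_union_le _ _).trans (by linarith)
  · filter_upwards [hn n, ce_shift (D := D) hb n] with y hy hy' h1 h2
    simp only [Set.mem_union, not_or, Set.mem_ofPred_eq, not_le] at h1 h2
    obtain ⟨g, hg, hgy⟩ := hy h1.1 h2.1
    refine ⟨g, hg, ?_⟩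
    have b2 := ((hψ.bddMeas.shift n).sub (hΓb g hg)).pow 2
    have := ce_mono (μ := μ) (D := D) (((hφ.shift n).sub (hΓb g hg)).pow 2)
      (((hb.shift n).const_mul 2).add (b2.const_mul 2))
      (fun x => by nlinarith [sq_nonneg (φ (n +ᵥ x) - ψ (n +ᵥ x) - (ψ (n +ᵥ x) - g x))]) y
    rw [ce_add ((hb.shift n).const_mul _) (b2.const_mul _), ce_const_mul, ce_const_mul, hy'] at this
    refine this.trans ?_
    have h5 := h2.2
    rw [hh] at h5
    linarith

lemma shift (hφ : AlmostPeriodic μ D φ) (k : ℤ) : AlmostPeriodic μ D (fun x => φ (k +ᵥ x)) := by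
  refine ⟨hφ.bddMeas.shift k, fun ε hε => ?_⟩
  obtain ⟨Γ, hΓ, hΓb, E, hE, hμE, h⟩ := hφ.approx (ε / 2) (by positivity)
  refine ⟨Γ, hΓ, hΓb, E ∪ ((k +ᵥ ·) ⁻¹' E), MeasurableSet.union (m := D.alg) hE (D.inv k _ hE), ?_, fun n => ?_⟩
  · have := (measurePreserving_vadd k μ).measureReal_preimage (D.le _ hE).nullMeasurableSet
    refine (measureReal_union_le _ _).trans ?_
    rw [this]
    linarith
  · filter_upwards [h (k + n)] with y hy h1 h2
    simp only [Set.mem_union, not_or, Set.mem_preimage] at h1 h2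
    obtain ⟨g, hg, hgy⟩ := hy h1.1 (by rw [add_vadd]; exact h2.2)
    refine ⟨g, hg, ?_⟩
    simp only [add_vadd] at hgy
    linarith

end AlmostPeriodic

lemma tendsto_integral_sq_sub {f : ℕ → X → ℝ} {g : X → ℝ} {C : ℝ} (hf : ∀ n, BddMeas (f n))
    (hg : BddMeas g) (hC : ∀ n x, |f n x| ≤ C) (h : ∀ x, Tendsto (fun n => f n x) atTop (𝓝 (g x))) :
    Tendsto (fun n => ∫ x, (g x - f n x) ^ 2 ∂μ) atTop (𝓝 0) := by
  obtain ⟨C', hC'⟩ := hg.bdd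
  have := tendsto_integral_of_dominated_convergence (μ := μ) (F := fun n x => (g x - f n x) ^ 2)
    (f := fun _ => 0) (fun _ => (C' + C) ^ 2)
    (fun n => ((hg.sub (hf n)).pow 2).meas.aestronglyMeasurable) (integrable_const _)
    (fun n => ae_of_all _ fun x => ?_) (ae_of_all _ fun x => ?_)
  · simpa using this
  · rw [Real.norm_eq_abs, abs_of_nonneg (sq_nonneg _), ← sq_abs]
    exact pow_le_pow_left₀ (abs_nonneg _)
      ((abs_sub _ _).trans (add_le_add (hC' x) (hC n x))) 2
  · simpa using ((h x).const_sub (g x)).pow 2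

lemma AlmostPeriodic.of_tendsto {f : ℕ → X → ℝ} {C : ℝ} (hf : ∀ n, AlmostPeriodic μ D (f n))
    (hφ : BddMeas φ) (hC : ∀ n x, |f n x| ≤ C) (h : ∀ x, Tendsto (fun n => f n x) atTop (𝓝 (φ x))) :
    AlmostPeriodic μ D φ := by
  refine .of_approx hφ fun ε hε => ?_
  obtain ⟨n, hn⟩ := ((tendsto_integral_sq_sub (μ := μ) (fun n => (hf n).bddMeas) hφ hC
    h).eventually_lt_const hε).exists
  exact ⟨f n, hf n, hn.le⟩

/-- The σ-algebra of sets whose indicators are almost periodic relative to `D`. -/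
noncomputable def apFactor (μ : Measure X) [IsProbabilityMeasure μ] [VAddInvariantMeasure ℤ X μ]
    (D : Factor X) : Factor X where
  alg :=
    { MeasurableSet' := fun s => MeasurableSet s ∧ AlmostPeriodic μ D (s.indicator 1)
      measurableSet_empty := ⟨MeasurableSet.empty, by simpa using AlmostPeriodic.const 0⟩
      measurableSet_compl := fun s hs => ⟨hs.1.compl, by
        have := hs.2.comp₂ hs.2 (F := fun a _ => 1 - a) (K := 1) (by fun_prop) fun a b a' b' => by
          rw [show 1 - a - (1 - a') = -(a - a') by ring, abs_neg]
          linarith [abs_nonneg (b - b')]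
        convert this using 1
        ext x
        by_cases h : x ∈ s <;> simp [h]⟩
      measurableSet_iUnion := fun s hs => ⟨MeasurableSet.iUnion fun i => (hs i).1, by
        have hfin : ∀ n, AlmostPeriodic μ D ((⋃ i ∈ Finset.range n, s i).indicator 1) := by
          intro n
          induction n with
          | zero => simpa using AlmostPeriodic.const 0
          | succ n ih =>
            have := ih.comp₂ (hs n).2 (F := fun a b => max a b) (K := 1) (by fun_prop)
              fun a b a' b' => by
                have := abs_max_sub_max_le_max a b a' b'
                have h2 : max |a - a'| |b - b'| ≤ |a - a'| + |b - b'| :=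
                  max_le (by linarith [abs_nonneg (b - b')]) (by linarith [abs_nonneg (a - a')])
                linarith
            convert this using 1
            ext x
            have hsplit : (⋃ i ∈ Finset.range (n + 1), s i)
                = (⋃ i ∈ Finset.range n, s i) ∪ s n := by
              simp only [Finset.mem_range]
              exact Set.biUnion_lt_succ s n
            rw [hsplit]
            by_cases h : x ∈ ⋃ i ∈ Finset.range n, s i <;> by_cases h' : x ∈ s n <;>
              simp only [Set.indicator, Set.mem_union, h, h', or_true, or_false,
                Pi.one_apply, if_true, if_false] <;> norm_num
        refine AlmostPeriodic.of_tendsto (C := 1) hfin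
          (BddMeas.indicator (MeasurableSet.iUnion fun i => (hs i).1)) ?_ fun x => ?_
        · intro n x
          by_cases h : x ∈ ⋃ i ∈ Finset.range n, s i
          · rw [Set.indicator_of_mem h]; simp
          · rw [Set.indicator_of_notMem h]; simp
        · refine tendsto_const_nhds.congr' ?_
          by_cases h : x ∈ ⋃ i, s i
          · obtain ⟨i, hi⟩ := Set.mem_iUnion.1 h
            filter_upwards [eventually_gt_atTop i] with n hn
            rw [Set.indicator_of_mem h, Set.indicator_of_mem]
            exact Set.mem_biUnion (Finset.mem_coe.2 (Finset.mem_range.2 hn)) hi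
          · filter_upwards with n
            rw [Set.indicator_of_notMem h, Set.indicator_of_notMem]
            exact fun h' => h (by
              obtain ⟨i, -, hi⟩ := Set.mem_iUnion₂.1 h'
              exact Set.mem_iUnion.2 ⟨i, hi⟩)⟩ }
  le := fun _ hs => hs.1
  inv := fun n s hs => ⟨measurable_const_vadd n hs.1, hs.2.shift n⟩

lemma AlmostPeriodic.measurable (hφ : AlmostPeriodic μ D φ) :
    Measurable[(apFactor μ D).alg] φ := by
  refine measurable_of_Ioi (mδ := (apFactor μ D).alg) fun t => ?_
  refine ⟨hφ.bddMeas.meas measurableSet_Ioi, ?_⟩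
  have h1 : ∀ k : ℕ, AlmostPeriodic μ D (fun x => min 1 (max 0 (k * (φ x - t)))) := by
    intro k
    refine hφ.comp₂ hφ (F := fun a _ => min 1 (max 0 (k * (a - t)))) (K := k) (by fun_prop)
      fun a b a' b' => ?_
    have e1 := abs_min_sub_min_le_max 1 (max 0 (k * (a - t))) 1 (max 0 (k * (a' - t)))
    have e2 := abs_max_sub_max_le_max 0 (k * (a - t)) 0 (k * (a' - t))
    simp only [sub_self, abs_zero, abs_nonneg, max_eq_right] at e1 e2
    refine (e1.trans e2).trans ?_
    rw [← mul_sub, sub_sub_sub_cancel_right, abs_mul, Nat.abs_cast]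
    exact mul_le_mul_of_nonneg_left (by linarith [abs_nonneg (b - b')]) (Nat.cast_nonneg k)
  refine .of_tendsto (C := 1) h1 (BddMeas.indicator (hφ.bddMeas.meas measurableSet_Ioi)) ?_ ?_
  · intro n x
    rw [abs_of_nonneg (le_min zero_le_one (le_max_left _ _))]
    exact min_le_left _ _
  · intro x
    refine tendsto_const_nhds.congr' ?_
    by_cases h : t < φ x
    · obtain ⟨k, hk⟩ := exists_nat_gt (1 / (φ x - t))
      have h0 : 0 < φ x - t := sub_pos.2 h
      filter_upwards [eventually_ge_atTop k] with n hn
      have : 1 ≤ n * (φ x - t) := by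
        rw [div_lt_iff₀ h0] at hk
        have : (k : ℝ) ≤ n := by exact_mod_cast hn
        nlinarith
      rw [Set.indicator_of_mem (show x ∈ φ ⁻¹' Set.Ioi t from h),
        max_eq_right (by linarith), min_eq_left this]
      rfl
    · filter_upwards with n
      rw [Set.indicator_of_notMem (show x ∉ φ ⁻¹' Set.Ioi t from h), max_eq_left, min_eq_right]
      · norm_num
      · exact mul_nonpos_of_nonneg_of_nonpos (Nat.cast_nonneg n) (by linarith)

end AP

section L2
variable {Z : Type} [MeasurableSpace Z] {f g : Z → ℝ}

lemma BddMeas.memLp (hf : BddMeas f) (ν : Measure Z) [IsFiniteMeasure ν] : MemLp f 2 ν := by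
  obtain ⟨C, hC⟩ := hf.bdd
  exact MemLp.of_bound hf.meas.aestronglyMeasurable C (ae_of_all _ hC)

/-- The class in `L²` of a bounded measurable function. -/
noncomputable def BddMeas.toL2 (hf : BddMeas f) (ν : Measure Z) [IsFiniteMeasure ν] : Lp ℝ 2 ν :=
  (hf.memLp ν).toLp f

lemma BddMeas.inner_toL2 (hf : BddMeas f) (hg : BddMeas g) (ν : Measure Z) [IsFiniteMeasure ν] :
    inner ℝ (hf.toL2 ν) (hg.toL2 ν) = ∫ z, f z * g z ∂ν := by
  rw [L2.inner_def]
  refine integral_congr_ae ?_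
  filter_upwards [(hf.memLp ν).coeFn_toLp, (hg.memLp ν).coeFn_toLp] with z h1 h2
  simp only [BddMeas.toL2, h1, h2]
  simp [mul_comm]

lemma L2_norm_sq {ν : Measure Z} (F : Lp ℝ 2 ν) : ‖F‖ ^ 2 = ∫ z, F z ^ 2 ∂ν := by
  rw [← real_inner_self_eq_norm_sq, L2.inner_def]
  simp [pow_two]

lemma BddMeas.norm_sq_sub_toL2 (hf : BddMeas f) {ν : Measure Z} [IsFiniteMeasure ν]
    (G : Lp ℝ 2 ν) : ‖G - hf.toL2 ν‖ ^ 2 = ∫ z, (G z - f z) ^ 2 ∂ν := by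
  rw [L2_norm_sq]
  refine integral_congr_ae ?_
  filter_upwards [Lp.coeFn_sub G (hf.toL2 ν), (hf.memLp ν).coeFn_toLp] with z h1 h2
  rw [h1, Pi.sub_apply]
  simp only [BddMeas.toL2, h2]

lemma exists_l2_limit {ν : Measure Z} [IsFiniteMeasure ν] {f : ℕ → Z → ℝ} {C : ℝ}
    (hf : ∀ n, BddMeas (f n)) (hC : ∀ n z, |f n z| ≤ C)
    (hcau : CauchySeq fun n => (hf n).toL2 ν) :
    ∃ g, BddMeas g ∧ (∀ z, |g z| ≤ C) ∧
      Tendsto (fun n => ∫ z, (g z - f n z) ^ 2 ∂ν) atTop (𝓝 0) := by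
  obtain ⟨G, hG⟩ := cauchySeq_tendsto_of_complete hcau
  rcases isEmpty_or_nonempty Z with h | ⟨⟨z₀⟩⟩
  · exact ⟨0, ⟨measurable_const, 0, fun z => h.elim z⟩, fun z => h.elim z, by
      simp [Measure.eq_zero_of_isEmpty ν]⟩
  have hC0 : 0 ≤ C := (abs_nonneg _).trans (hC 0 z₀)
  have hGm : AEMeasurable G ν := (Lp.aestronglyMeasurable G).aemeasurable
  have hbd : ∀ z, |max (-C) (min C (hGm.mk G z))| ≤ C := fun z =>
    abs_le.2 ⟨le_max_left _ _, max_le (by linarith) (min_le_left _ _)⟩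
  have hgb : BddMeas (fun z => max (-C) (min C (hGm.mk G z))) :=
    ⟨measurable_const.max (measurable_const.min hGm.measurable_mk), C, hbd⟩
  refine ⟨_, hgb, hbd, ?_⟩
  have h1 : Tendsto (fun n => ‖G - (hf n).toL2 ν‖ ^ 2) atTop (𝓝 0) := by
    have := ((tendsto_const_nhds (x := G)).sub hG).norm.pow 2
    simpa using this
  refine squeeze_zero (fun n => integral_nonneg fun z => sq_nonneg _) (fun n => ?_) h1
  rw [(hf n).norm_sq_sub_toL2]
  have hint : Integrable (fun z => (G z - f n z) ^ 2) ν :=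
    ((Lp.memLp G).sub ((hf n).memLp ν)).integrable_sq
  refine integral_mono_ae (((hgb.sub (hf n)).pow 2).integrable ν) hint ?_
  filter_upwards [hGm.ae_eq_mk] with z hz
  simp only [← hz]
  have h2 := abs_le.1 (hC n z)
  refine sq_le_sq.2 ?_
  rcases le_total (G z) (-C) with h3 | h3
  · rw [min_eq_right (by linarith), max_eq_left h3, abs_of_nonpos (by linarith),
      abs_of_nonpos (by linarith)]
    linarith
  rcases le_total C (G z) with h4 | h4
  · rw [min_eq_left h4, max_eq_right (by linarith), abs_of_nonneg (by linarith),
      abs_of_nonneg (by linarith)]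
    linarith
  · rw [min_eq_right h4, max_eq_right h3]

end L2

section Hilbert
variable {E : Type} [NormedAddCommGroup E] [InnerProductSpace ℝ E]

lemma norm_sum_range_add_sub_le {v : ℕ → E} {C : ℝ} (hC : ∀ n, ‖v n‖ ≤ C) (N p : ℕ) :
    ‖∑ n ∈ Finset.range N, v (n + p) - ∑ n ∈ Finset.range N, v n‖ ≤ 2 * C * p := by
  induction p with
  | zero => simp
  | succ p ih =>
    have h : ∑ n ∈ Finset.range N, v (n + (p + 1)) - ∑ n ∈ Finset.range N, v (n + p)
        = v (N + p) - v p := by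
      rw [← Finset.sum_sub_distrib]
      have := Finset.sum_range_sub (fun n => v (n + p)) N
      simpa [add_assoc, add_comm, add_left_comm] using this
    calc _ = ‖(v (N + p) - v p) + (∑ n ∈ Finset.range N, v (n + p) - ∑ n ∈ Finset.range N, v n)‖ := by
          rw [← h]; congr 1; abel
      _ ≤ (‖v (N + p)‖ + ‖v p‖) + _ := (norm_add_le _ _).trans (add_le_add (norm_sub_le _ _) ih)
      _ ≤ _ := by push_cast; linarith [hC (N + p), hC p]

/-- Averages of a stationary sequence in an inner product space form a Cauchy sequence. -/
lemma cauchySeq_average {v : ℕ → E} {C : ℝ} (hC : ∀ n, ‖v n‖ ≤ C)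
    (hst : ∀ n m, inner ℝ (v (n + 1)) (v (m + 1)) = inner ℝ (v n) (v m)) :
    CauchySeq fun N : ℕ => (N : ℝ)⁻¹ • ∑ n ∈ Finset.range N, v n := by
  set A : ℕ → E := fun N => (N : ℝ)⁻¹ • ∑ n ∈ Finset.range N, v n with hA
  have hC0 : 0 ≤ C := (norm_nonneg _).trans (hC 0)
  have hst' : ∀ p n m, inner ℝ (v (n + p)) (v (m + p)) = inner ℝ (v n) (v m) := by
    intro p n m
    induction p with
    | zero => rfl
    | succ p ih => exact (hst (n + p) (m + p)).trans ih
  have hinv : ∀ (w : ℕ → ℝ) (M p : ℕ), ‖∑ n ∈ Finset.range M, w n • v (n + p)‖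
      = ‖∑ n ∈ Finset.range M, w n • v n‖ := by
    intro w M p
    rw [← sq_eq_sq₀ (norm_nonneg _) (norm_nonneg _), ← real_inner_self_eq_norm_sq,
      ← real_inner_self_eq_norm_sq]
    simp only [sum_inner, inner_sum, inner_smul_left, inner_smul_right, hst']
  have hshift : ∀ (w : ℕ → ℝ) (M P : ℕ), (∀ n, 0 ≤ w n) → 0 < P →
      (∑ n ∈ Finset.range M, w n) * ‖A P‖ ≤ ‖∑ n ∈ Finset.range M, w n • v n‖
        + (∑ n ∈ Finset.range M, w n) * (2 * C * M / P) := by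
    intro w M P hw hP
    have hP' : (0 : ℝ) < P := Nat.cast_pos.2 hP
    have e1 : ‖∑ p ∈ Finset.range P, ∑ n ∈ Finset.range M, w n • v (n + p)‖
        ≤ P * ‖∑ n ∈ Finset.range M, w n • v n‖ := by
      refine (norm_sum_le _ _).trans ?_
      simp [hinv]
    have e2 : ‖(∑ n ∈ Finset.range M, w n) • ∑ p ∈ Finset.range P, v p
        - ∑ p ∈ Finset.range P, ∑ n ∈ Finset.range M, w n • v (n + p)‖
        ≤ (∑ n ∈ Finset.range M, w n) * (2 * C * M) := by
      rw [Finset.sum_comm, Finset.sum_smul, ← Finset.sum_sub_distrib, Finset.sum_mul]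
      refine (norm_sum_le _ _).trans (Finset.sum_le_sum fun n hn => ?_)
      rw [← Finset.smul_sum, ← smul_sub, norm_smul, Real.norm_of_nonneg (hw n), norm_sub_rev]
      refine mul_le_mul_of_nonneg_left ?_ (hw n)
      have := norm_sum_range_add_sub_le hC P n
      simp only [add_comm] at this ⊢
      refine this.trans ?_
      have : (n : ℝ) ≤ M := by exact_mod_cast (Finset.mem_range.1 hn).le
      gcongr
    have e3 : ‖(∑ n ∈ Finset.range M, w n) • ∑ p ∈ Finset.range P, v p‖
        = P * ((∑ n ∈ Finset.range M, w n) * ‖A P‖) := by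
      have : ∑ p ∈ Finset.range P, v p = (P : ℝ) • A P := by
        rw [hA]; simp only; rw [smul_smul, mul_inv_cancel₀ hP'.ne', one_smul]
      rw [this, norm_smul, norm_smul, Real.norm_of_nonneg (Finset.sum_nonneg fun n _ => hw n),
        Real.norm_of_nonneg hP'.le]
      ring
    have e4 := norm_sub_norm_le ((∑ n ∈ Finset.range M, w n) • ∑ p ∈ Finset.range P, v p)
      (∑ p ∈ Finset.range P, ∑ n ∈ Finset.range M, w n • v (n + p))
    rw [e3] at e4
    rw [mul_div_assoc', ← sub_le_iff_le_add', le_div_iff₀ hP']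
    nlinarith
  have hsumA : ∀ N : ℕ, ∀ M, N ≤ M → ∑ n ∈ Finset.range M,
      (if n < N then (N : ℝ)⁻¹ else 0) • v n = A N := by
    intro N M hNM
    rw [hA]
    simp only [Finset.smul_sum, ite_smul, zero_smul]
    rw [← Finset.sum_filter]
    congr 1
    ext n
    simp only [Finset.mem_filter, Finset.mem_range]
    omega
  have hsumw : ∀ N : ℕ, 0 < N → ∀ M, N ≤ M → ∑ n ∈ Finset.range M,
      (if n < N then (N : ℝ)⁻¹ else 0) = 1 := by
    intro N hN M hNM
    rw [← Finset.sum_filter]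
    have : (Finset.range M).filter (fun n => n < N) = Finset.range N := by
      ext n
      simp only [Finset.mem_filter, Finset.mem_range]
      omega
    rw [this]
    have : (N : ℝ) ≠ 0 := by positivity
    simp [this]
  set S := (fun N => ‖A N‖) '' Set.Ici 1 with hS
  have hSb : BddBelow S := ⟨0, by rintro _ ⟨N, -, rfl⟩; exact norm_nonneg _⟩
  set d := sInf S with hd
  have hd0 : 0 ≤ d := Real.sInf_nonneg (by rintro _ ⟨N, -, rfl⟩; exact norm_nonneg _)
  have hdle : ∀ N, 1 ≤ N → d ≤ ‖A N‖ := fun N hN => csInf_le hSb ⟨N, hN, rfl⟩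
  have hsmall : ∀ (K : ℝ) (ε : ℝ), 0 < ε → ∀ᶠ P : ℕ in atTop, K / P < ε := fun K ε hε =>
    (tendsto_const_div_atTop_nhds_zero_nat K).eventually_lt_const hε
  have hlim : Tendsto (fun N => ‖A N‖) atTop (𝓝 d) := by
    refine tendsto_order.2 ⟨fun a ha => ?_, fun a ha => ?_⟩
    · filter_upwards [eventually_ge_atTop 1] with N hN using ha.trans_le (hdle N hN)
    · obtain ⟨_, ⟨N, hN, rfl⟩, hNa⟩ := exists_lt_of_csInf_lt (Set.image_nonempty.2 ⟨1, le_rfl⟩) ha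
      filter_upwards [hsmall (2 * C * N) (a - ‖A N‖) (sub_pos.2 hNa), eventually_ge_atTop 1]
        with P hP hP1
      have := hshift (fun n => if n < N then (N : ℝ)⁻¹ else 0) N P (fun n => by positivity) hP1
      rw [hsumA N N le_rfl, hsumw N hN N le_rfl] at this
      linarith
  have hmid : ∀ N M, 1 ≤ N → 1 ≤ M → 2 * d ≤ ‖A N + A M‖ := by
    intro N M hN hM
    refine le_of_forall_pos_le_add fun ε hε => ?_
    obtain ⟨P, hP, hP1⟩ := ((hsmall (2 * C * (N + M : ℕ)) (ε / 2) (by positivity)).and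
      (eventually_ge_atTop 1)).exists
    have h := hshift (fun n => (if n < N then (N : ℝ)⁻¹ else 0) + if n < M then (M : ℝ)⁻¹ else 0)
      (N + M) P (fun n => by positivity) hP1
    simp only [add_smul, Finset.sum_add_distrib] at h
    rw [hsumA N _ (by omega), hsumA M _ (by omega), hsumw N hN _ (by omega),
      hsumw M hM _ (by omega)] at h
    linarith [hdle P hP1]
  rw [Metric.cauchySeq_iff]
  intro ε hε
  have hev : ∀ᶠ N in atTop, ‖A N‖ ^ 2 < d ^ 2 + ε ^ 2 / 4 :=
    (hlim.pow 2).eventually_lt_const (by nlinarith [pow_pos hε 2])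
  obtain ⟨N₀, hN₀⟩ := eventually_atTop.1 (hev.and (eventually_ge_atTop 1))
  refine ⟨N₀, fun m hm n hn => ?_⟩
  have h1 := hN₀ m hm
  have h2 := hN₀ n hn
  have h3 := hmid m n h1.2 h2.2
  have h4 := parallelogram_law_with_norm ℝ (A m) (A n)
  rw [dist_eq_norm]
  refine lt_of_pow_lt_pow_left₀ 2 hε.le ?_
  nlinarith [pow_le_pow_left₀ (by positivity) h3 2]

end Hilbert

section Dichotomy
variable {X : Type} [mX : MeasurableSpace X] [AddAction ℤ X] [MeasurableConstVAdd ℤ X]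
  [StandardBorelSpace X] {μ : Measure X} [IsProbabilityMeasure μ] [VAddInvariantMeasure ℤ X μ]
  {D : Factor X} {f g φ : X → ℝ}

/-- In a conditional expectation, factor-measurable coefficients may be frozen. -/
lemma ce_sq_add_sum_mul {ι : Type} {s : Finset ι} {a b : ι → X → ℝ} (hφ : BddMeas φ)
    (ha : ∀ i ∈ s, BddMeas (a i)) (hb : ∀ i ∈ s, BddMeas (b i))
    (hbD : ∀ i ∈ s, Measurable[D.alg] (b i)) :
    ∀ᵐ y ∂μ, ce μ D (fun x => (φ x + ∑ i ∈ s, a i x * b i x) ^ 2) y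
      = ce μ D (fun x => (φ x + ∑ i ∈ s, a i x * b i y) ^ 2) y := by
  have h1 : ∀ i ∈ s, ∀ᵐ y ∂μ, ce μ D (fun x => (2 * φ x * a i x) * b i x) y
      = ce μ D (fun x => 2 * φ x * a i x) y * b i y := fun i hi =>
    ce_mul_right ((hφ.const_mul 2).mul (ha i hi)) (hb i hi) (hbD i hi)
  have h2 : ∀ p ∈ s ×ˢ s, ∀ᵐ y ∂μ, ce μ D (fun x => (a p.1 x * a p.2 x) * (b p.1 x * b p.2 x)) y
      = ce μ D (fun x => a p.1 x * a p.2 x) y * (b p.1 y * b p.2 y) := fun p hp => by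
    obtain ⟨hp1, hp2⟩ := Finset.mem_product.1 hp
    exact ce_mul_right ((ha _ hp1).mul (ha _ hp2)) ((hb _ hp1).mul (hb _ hp2))
      ((hbD _ hp1).mul (hbD _ hp2))
  rw [← Finset.eventually_all] at h1 h2
  filter_upwards [h1, h2] with y hy1 hy2
  have key : ∀ c : ι → X → ℝ, (∀ i ∈ s, BddMeas (c i)) →
      ce μ D (fun x => (φ x + ∑ i ∈ s, a i x * c i x) ^ 2) y
      = ce μ D (fun x => φ x ^ 2) y + ∑ i ∈ s, ce μ D (fun x => (2 * φ x * a i x) * c i x) y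
        + ∑ p ∈ s ×ˢ s, ce μ D (fun x => (a p.1 x * a p.2 x) * (c p.1 x * c p.2 x)) y := by
    intro c hc
    have e1 : ∀ i ∈ s, BddMeas (fun x => (2 * φ x * a i x) * c i x) := fun i hi =>
      ((hφ.const_mul 2).mul (ha i hi)).mul (hc i hi)
    have e2 : ∀ p ∈ s ×ˢ s, BddMeas (fun x => (a p.1 x * a p.2 x) * (c p.1 x * c p.2 x)) :=
      fun p hp => ((ha _ (Finset.mem_product.1 hp).1).mul (ha _ (Finset.mem_product.1 hp).2)).mul
        ((hc _ (Finset.mem_product.1 hp).1).mul (hc _ (Finset.mem_product.1 hp).2))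
    rw [← ce_sum e1, ← ce_sum e2, ← ce_add (hφ.pow 2) (BddMeas.sum e1),
      ← ce_add ((hφ.pow 2).add (BddMeas.sum e1)) (BddMeas.sum e2)]
    congr 1
    ext x
    rw [add_sq, sq (∑ i ∈ s, _), Finset.sum_mul_sum, Finset.mul_sum, ← Finset.sum_product']
    congr 1
    · congr 1
      exact Finset.sum_congr rfl fun i _ => by ring
    · exact Finset.sum_congr rfl fun i _ => by ring
  rw [key b hb, key (fun i _ => b i y) fun i _ => BddMeas.const _]
  congr 1
  · congr 1
    refine Finset.sum_congr rfl fun i hi => ?_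
    rw [hy1 i hi]
    exact (integral_mul_const _ _).symm
  · refine Finset.sum_congr rfl fun p hp => ?_
    rw [hy2 p hp]
    exact (integral_mul_const _ _).symm

/-- The relatively independent square of the disintegration over a factor. -/
noncomputable def fiberSq (μ : Measure X) [IsProbabilityMeasure μ] (D : Factor X) :
    Kernel X (X × X) :=
  let κ := (condExpKernel μ D.alg).comap id (measurable_id'' D.le)
  κ ×ₖ κ

lemma fiberSq_apply (y : X) :
    fiberSq μ D y = (condExpKernel μ D.alg y).prod (condExpKernel μ D.alg y) := by
  rw [fiberSq, Kernel.prod_apply]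
  rfl

instance : IsMarkovKernel (fiberSq μ D) := by
  unfold fiberSq
  infer_instance

instance : IsProbabilityMeasure (μ.bind (fiberSq μ D)) :=
  inferInstance

lemma integral_fiberSq {F : X × X → ℝ} (hF : BddMeas F) :
    ∫ y, ∫ z, F z ∂(fiberSq μ D y) ∂μ = ∫ z, F z ∂(μ.bind (fiberSq μ D)) := by
  have h := Kernel.integral_comp (η := fiberSq μ D) (κ := Kernel.const Unit μ) (a := ()) (f := F)
  rw [← Measure.comp_eq_comp_const_apply] at h
  exact (h (hF.integrable _)).symm

lemma fiberSq_bddMeas {F : X × X → ℝ} (hF : BddMeas F) :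
    BddMeas (fun y => ∫ z, F z ∂(fiberSq μ D y)) :=
  ⟨(hF.meas.stronglyMeasurable.integral_kernel (κ := fiberSq μ D)).measurable,
    hF.bdd.imp fun _ h _ => BddMeas.abs_integral_le h⟩

lemma fiberSq_measurable {F : X × X → ℝ} (hF : BddMeas F) :
    Measurable[D.alg] (fun y => ∫ z, F z ∂(fiberSq μ D y)) := by
  simp only [fiberSq_apply]
  have := (hF.meas.stronglyMeasurable.integral_kernel
    (κ := condExpKernel μ D.alg ×ₖ condExpKernel μ D.alg)).measurable
  simpa only [Kernel.prod_apply] using this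

/-- The tensor square of a shift of `g`. -/
def pairShift (g : X → ℝ) (n : ℕ) (z : X × X) : ℝ := g ((n : ℤ) +ᵥ z.1) * g ((n : ℤ) +ᵥ z.2)

/-- The averaged tensor squares of the shifts of `g`. -/
noncomputable def avgKer (g : X → ℝ) (N : ℕ) (z : X × X) : ℝ :=
  (N : ℝ)⁻¹ * ∑ n ∈ Finset.range N, pairShift g n z

/-- The averaged rank-one operators attached to the shifts of `g`. -/
noncomputable def avgOp (μ : Measure X) [IsProbabilityMeasure μ] (D : Factor X) (g f : X → ℝ)
    (N : ℕ) (x : X) : ℝ :=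
  (N : ℝ)⁻¹ * ∑ n ∈ Finset.range N,
    g ((n : ℤ) +ᵥ x) * ce μ D (fun x => g ((n : ℤ) +ᵥ x) * f x) x

lemma pairShift_bddMeas (hg : BddMeas g) (n : ℕ) : BddMeas (pairShift g n) :=
  ((hg.shift n).comp measurable_fst).mul ((hg.shift n).comp measurable_snd)

lemma avgKer_bddMeas (hg : BddMeas g) (N : ℕ) : BddMeas (avgKer g N) :=
  (BddMeas.sum fun n _ => pairShift_bddMeas hg n).const_mul _

lemma avgOp_bddMeas (hg : BddMeas g) (hf : BddMeas f) (N : ℕ) : BddMeas (avgOp μ D g f N) :=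
  BddMeas.const_mul _ (BddMeas.sum fun (n : ℕ) _ =>
    (hg.shift (n : ℤ)).mul (ce_bddMeas ((hg.shift (n : ℤ)).mul hf)))

lemma abs_avg_le {u : ℕ → ℝ} {C : ℝ} (hC : ∀ n, |u n| ≤ C) (N : ℕ) :
    |(N : ℝ)⁻¹ * ∑ n ∈ Finset.range N, u n| ≤ C := by
  have hC0 : 0 ≤ C := (abs_nonneg _).trans (hC 0)
  rcases N.eq_zero_or_pos with rfl | hN
  · simpa using hC0
  have hN' : (0 : ℝ) < N := Nat.cast_pos.2 hN
  rw [abs_mul, abs_of_pos (inv_pos.2 hN'), inv_mul_le_iff₀ hN']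
  refine (Finset.abs_sum_le_sum_abs _ _).trans ?_
  simpa using Finset.sum_le_card_nsmul (Finset.range N) (fun n => |u n|) C fun n _ => hC n

lemma integral_fiberSq_mul (a b : X → ℝ) (y : X) :
    ∫ z, a z.1 * b z.2 ∂(fiberSq μ D y) = ce μ D a y * ce μ D b y := by
  rw [fiberSq_apply, integral_prod_mul]
  rfl

lemma exists_kernel_limit (hg : BddMeas g) : ∃ K : X × X → ℝ, BddMeas K ∧
    Tendsto (fun N => ∫ z, (K z - avgKer g N z) ^ 2 ∂(μ.bind (fiberSq μ D))) atTop (𝓝 0) := by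
  obtain ⟨C, hC0, hC⟩ := hg.exists_pos
  have hP := pairShift_bddMeas hg
  have hPC : ∀ n z, |pairShift g n z| ≤ C * C := fun n z => by
    rw [pairShift, abs_mul]
    exact mul_le_mul (hC _) (hC _) (abs_nonneg _) hC0.le
  have hin : ∀ n m, ∫ z, pairShift g n z * pairShift g m z ∂(μ.bind (fiberSq μ D))
      = ∫ y, ce μ D (fun x => g ((n : ℤ) +ᵥ x) * g ((m : ℤ) +ᵥ x)) y ^ 2 ∂μ := by
    intro n m
    rw [← integral_fiberSq ((hP n).mul (hP m))]
    congr 1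
    ext y
    rw [sq, ← integral_fiberSq_mul]
    congr 1
    ext z
    simp only [pairShift]
    ring
  have hst : ∀ n m, ∫ z, pairShift g (n + 1) z * pairShift g (m + 1) z ∂(μ.bind (fiberSq μ D))
      = ∫ z, pairShift g n z * pairShift g m z ∂(μ.bind (fiberSq μ D)) := by
    intro n m
    rw [hin, hin, ← integral_shift (μ := μ) (fun y => ce μ D (fun x => g ((n : ℤ) +ᵥ x) * g ((m : ℤ) +ᵥ x)) y ^ 2) 1]
    refine integral_congr_ae ?_
    filter_upwards [ce_shift (μ := μ) (D := D) ((hg.shift n).mul (hg.shift m)) 1] with y hy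
    rw [← hy]
    simp only [Nat.cast_add, Nat.cast_one, add_vadd]
  have hcau := cauchySeq_average (v := fun n => (hP n).toL2 (μ.bind (fiberSq μ D))) (C := C * C)
    (fun n => by
      have h : ‖(hP n).toL2 (μ.bind (fiberSq μ D))‖ ^ 2 ≤ (C * C) ^ 2 := by
        rw [← real_inner_self_eq_norm_sq, BddMeas.inner_toL2]
        refine (le_abs_self _).trans (BddMeas.abs_integral_le fun z => ?_)
        rw [abs_mul, sq]
        exact mul_le_mul (hPC _ _) (hPC _ _) (abs_nonneg _) (by positivity)
      exact le_of_sq_le_sq h (by positivity))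
    (fun n m => by rw [BddMeas.inner_toL2, BddMeas.inner_toL2, hst])
  obtain ⟨K, hK, -, h⟩ := exists_l2_limit (ν := μ.bind (fiberSq μ D)) (avgKer_bddMeas hg)
    (fun n z => abs_avg_le (fun m => hPC m z) n) (by
      convert hcau using 2 with N
      have : ∀ s : Finset ℕ, (BddMeas.sum (s := s) fun n _ => hP n).toL2 (μ.bind (fiberSq μ D))
          = ∑ n ∈ s, (hP n).toL2 (μ.bind (fiberSq μ D)) := by
        intro s
        induction s using Finset.cons_induction with
        | empty => simp only [Finset.sum_empty, BddMeas.toL2]; exact MemLp.toLp_zero _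
        | cons a s ha ih =>
          rw [Finset.sum_cons, ← ih]
          simp only [BddMeas.toL2, Finset.sum_cons]
          exact MemLp.toLp_add _ _
      rw [← this]
      exact MemLp.toLp_const_smul (N : ℝ)⁻¹
        ((BddMeas.sum (s := Finset.range N) fun n _ => hP n).memLp (μ.bind (fiberSq μ D))))
  exact ⟨K, hK, h⟩

/-- Fibrewise Hilbert--Schmidt bound. -/
lemma ce_sq_sum_le (hg : BddMeas g) (hf : BddMeas f) (w : ℕ → ℝ) (P : ℕ) :
    ∀ᵐ y ∂μ, ce μ D (fun x => (∑ n ∈ Finset.range P,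
        (w n * g ((n : ℤ) +ᵥ x)) * ce μ D (fun x => g ((n : ℤ) +ᵥ x) * f x) x) ^ 2) y
      ≤ (∫ z, (∑ n ∈ Finset.range P, w n * pairShift g n z) ^ 2 ∂(fiberSq μ D y))
        * ce μ D (fun x => f x ^ 2) y := by
  have h := ce_sq_add_sum_mul (μ := μ) (D := D) (s := Finset.range P) (φ := fun _ => 0)
    (a := fun n x => w n * g ((n : ℤ) +ᵥ x))
    (b := fun n => ce μ D (fun x => g ((n : ℤ) +ᵥ x) * f x)) (BddMeas.const 0)
    (fun n _ => (hg.shift n).const_mul _) (fun n _ => ce_bddMeas ((hg.shift n).mul hf))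
    (fun n _ => ce_measurable ((hg.shift n).mul hf))
  filter_upwards [h] with y hy
  simp only [zero_add] at hy
  rw [hy]
  have hG : BddMeas (fun z : X × X => (∑ n ∈ Finset.range P, w n * pairShift g n z)) :=
    BddMeas.sum fun n _ => (pairShift_bddMeas hg n).const_mul _
  rw [fiberSq_apply, integral_prod _ ((hG.pow 2).integrable _), ← integral_mul_const]
  have hm : BddMeas (fun x => ∫ x', (∑ n ∈ Finset.range P, w n * pairShift g n (x, x')) ^ 2
      ∂(condExpKernel μ D.alg y)) := by
    refine ⟨((hG.pow 2).meas.stronglyMeasurable.integral_prod_right').measurable, ?_⟩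
    obtain ⟨C, hC⟩ := (hG.pow 2).bdd
    exact ⟨C, fun x => BddMeas.abs_integral_le fun x' => hC (x, x')⟩
  have hl : BddMeas (fun x => (∑ n ∈ Finset.range P, w n * g ((n : ℤ) +ᵥ x)
      * ce μ D (fun x => g ((n : ℤ) +ᵥ x) * f x) y) ^ 2) :=
    (BddMeas.sum fun (n : ℕ) _ => ((hg.shift (n : ℤ)).const_mul _).mul (BddMeas.const _)).pow 2
  refine integral_mono (hl.integrable _) ((hm.mul (BddMeas.const _)).integrable _) fun x => ?_
  have e : ∑ n ∈ Finset.range P, w n * g ((n : ℤ) +ᵥ x) * ce μ D (fun x => g ((n : ℤ) +ᵥ x) * f x) y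
      = ∫ x', (∑ n ∈ Finset.range P, w n * pairShift g n (x, x')) * f x'
        ∂(condExpKernel μ D.alg y) := by
    simp only [ce, ← integral_const_mul]
    rw [← integral_finsetSum _ fun (n : ℕ) _ =>
      ((((hg.shift (n : ℤ)).mul hf).const_mul (w n * g ((n : ℤ) +ᵥ x))).integrable _)]
    congr 1
    ext x'
    rw [Finset.sum_mul]
    exact Finset.sum_congr rfl fun n _ => by simp only [pairShift]; ring
  simp only
  rw [e]
  exact BddMeas.sq_integral_mul_le (hG.comp measurable_prodMk_left) hf _

lemma avg_eq_sum {u : ℕ → ℝ} {N P : ℕ} (h : N ≤ P) : (N : ℝ)⁻¹ * ∑ n ∈ Finset.range N, u n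
    = ∑ n ∈ Finset.range P, (if n < N then (N : ℝ)⁻¹ else 0) * u n := by
  simp only [ite_mul, zero_mul]
  rw [← Finset.sum_filter, Finset.mul_sum]
  refine Finset.sum_congr ?_ fun _ _ => rfl
  ext n
  simp only [Finset.mem_filter, Finset.mem_range]
  omega

/-- Squared fibrewise distance of the averaged kernel to its limit. -/
noncomputable def kerDist (μ : Measure X) [IsProbabilityMeasure μ] (D : Factor X)
    (K : X × X → ℝ) (g : X → ℝ) (N : ℕ) (y : X) : ℝ :=
  ∫ z, (K z - avgKer g N z) ^ 2 ∂(fiberSq μ D y)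

lemma kerDist_nonneg (K : X × X → ℝ) (N : ℕ) (y : X) : 0 ≤ kerDist μ D K g N y :=
  integral_nonneg fun _ => sq_nonneg _

lemma ce_sq_avgOp_sub_le (hg : BddMeas g) (hf : BddMeas f) {C : ℝ} (hC : ∀ x, |f x| ≤ C)
    {K : X × X → ℝ} (hK : BddMeas K) (N M : ℕ) :
    ∀ᵐ y ∂μ, ce μ D (fun x => (avgOp μ D g f N x - avgOp μ D g f M x) ^ 2) y
      ≤ 2 * C ^ 2 * (kerDist μ D K g N y + kerDist μ D K g M y) := by
  filter_upwards [ce_sq_sum_le (μ := μ) (D := D) hg hf (fun n => (if n < N then (N : ℝ)⁻¹ else 0)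
    - (if n < M then (M : ℝ)⁻¹ else 0)) (max N M)] with y hy
  have e1 : ∀ x, avgOp μ D g f N x - avgOp μ D g f M x = ∑ n ∈ Finset.range (max N M),
      (((if n < N then (N : ℝ)⁻¹ else 0) - (if n < M then (M : ℝ)⁻¹ else 0)) * g ((n : ℤ) +ᵥ x))
        * ce μ D (fun x => g ((n : ℤ) +ᵥ x) * f x) x := fun x => by
    rw [avgOp, avgOp, avg_eq_sum (le_max_left N M), avg_eq_sum (le_max_right N M),
      ← Finset.sum_sub_distrib]
    exact Finset.sum_congr rfl fun n _ => by ring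
  have e2 : ∀ z, ∑ n ∈ Finset.range (max N M),
      ((if n < N then (N : ℝ)⁻¹ else 0) - (if n < M then (M : ℝ)⁻¹ else 0)) * pairShift g n z
      = avgKer g N z - avgKer g M z := fun z => by
    rw [avgKer, avgKer, avg_eq_sum (le_max_left N M), avg_eq_sum (le_max_right N M),
      ← Finset.sum_sub_distrib]
    exact Finset.sum_congr rfl fun n _ => by ring
  simp only [e1]
  simp only [e2] at hy
  refine hy.trans ?_
  have hN := avgKer_bddMeas hg N
  have hM := avgKer_bddMeas hg M
  have h1 : ∫ z, (avgKer g N z - avgKer g M z) ^ 2 ∂(fiberSq μ D y)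
      ≤ 2 * (kerDist μ D K g N y + kerDist μ D K g M y) := by
    rw [kerDist, kerDist, ← integral_add (((hK.sub hN).pow 2).integrable _)
      (((hK.sub hM).pow 2).integrable _), ← integral_const_mul]
    refine integral_mono (((hN.sub hM).pow 2).integrable _)
      ((((hK.sub hN).pow 2).add ((hK.sub hM).pow 2)).const_mul 2 |>.integrable _) fun z => ?_
    simp only
    nlinarith [sq_nonneg (K z - avgKer g N z + (K z - avgKer g M z))]
  have h2 : ce μ D (fun x => f x ^ 2) y ≤ C ^ 2 := (le_abs_self _).trans (ce_abs_le (fun x => by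
    rw [abs_of_nonneg (sq_nonneg _), ← sq_abs]
    exact pow_le_pow_left₀ (abs_nonneg _) (hC x) 2) y)
  calc _ ≤ 2 * (kerDist μ D K g N y + kerDist μ D K g M y) * C ^ 2 :=
        mul_le_mul h1 h2 (ce_nonneg (fun x => sq_nonneg _) y)
          (by linarith [kerDist_nonneg (μ := μ) (D := D) (g := g) K N y, kerDist_nonneg (μ := μ) (D := D) (g := g) K M y])
    _ = _ := by ring

end Dichotomy

section Dichotomy
variable {X : Type} [mX : MeasurableSpace X] [AddAction ℤ X] [MeasurableConstVAdd ℤ X]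
  [StandardBorelSpace X] {μ : Measure X} [IsProbabilityMeasure μ] [VAddInvariantMeasure ℤ X μ]
  {D : Factor X} {f g φ : X → ℝ}

lemma kerDist_bddMeas {K : X × X → ℝ} (hK : BddMeas K) (hg : BddMeas g) (N : ℕ) :
    BddMeas (kerDist μ D K g N) := fiberSq_bddMeas ((hK.sub (avgKer_bddMeas hg N)).pow 2)

lemma kerDist_measurable {K : X × X → ℝ} (hK : BddMeas K) (hg : BddMeas g) (N : ℕ) :
    Measurable[D.alg] (kerDist μ D K g N) :=
  fiberSq_measurable ((hK.sub (avgKer_bddMeas hg N)).pow 2)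

lemma exists_kerDist_tendsto (D : Factor X) (hg : BddMeas g) : ∃ K : X × X → ℝ, BddMeas K ∧
    Tendsto (fun N => ∫ y, kerDist μ D K g N y ∂μ) atTop (𝓝 0) := by
  obtain ⟨K, hK, h⟩ := exists_kernel_limit (μ := μ) (D := D) hg
  refine ⟨K, hK, h.congr fun N => ?_⟩
  exact (integral_fiberSq ((hK.sub (avgKer_bddMeas hg N)).pow 2)).symm

lemma abs_avgOp_le {C C' : ℝ} (hC : ∀ x, |g x| ≤ C) (hC' : ∀ x, |f x| ≤ C') (N : ℕ) (x : X) :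
    |avgOp μ D g f N x| ≤ C * (C * C') := by
  have hC0 : 0 ≤ C := (abs_nonneg _).trans (hC x)
  refine abs_avg_le (fun n => ?_) N
  rw [abs_mul]
  refine mul_le_mul (hC _) (ce_abs_le (fun x => ?_) x) (abs_nonneg _) hC0
  rw [abs_mul]
  exact mul_le_mul (hC _) (hC' _) (abs_nonneg _) hC0

lemma exists_avgOp_limit (hg : BddMeas g) (hf : BddMeas f) {K : X × X → ℝ} (hK : BddMeas K)
    (hlim : Tendsto (fun N => ∫ y, kerDist μ D K g N y ∂μ) atTop (𝓝 0)) :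
    ∃ φ : X → ℝ, BddMeas φ ∧
      Tendsto (fun N => ∫ x, (φ x - avgOp μ D g f N x) ^ 2 ∂μ) atTop (𝓝 0) := by
  obtain ⟨C, hC0, hC⟩ := hg.exists_pos
  obtain ⟨C', hC0', hC'⟩ := hf.exists_pos
  have hS := avgOp_bddMeas (μ := μ) (D := D) hg hf
  obtain ⟨φ, hφ, -, h⟩ := exists_l2_limit (ν := μ) hS (abs_avgOp_le hC hC') (by
    rw [Metric.cauchySeq_iff]
    intro ε hε
    have hev := hlim.eventually_lt_const (show (0 : ℝ) < ε ^ 2 / (4 * C' ^ 2) by positivity)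
    obtain ⟨N₀, hN₀⟩ := eventually_atTop.1 hev
    refine ⟨N₀, fun N hN M hM => ?_⟩
    rw [dist_eq_norm]
    refine lt_of_pow_lt_pow_left₀ 2 hε.le ?_
    have h1 : ‖(hS N).toL2 μ - (hS M).toL2 μ‖ ^ 2
        = ∫ x, (avgOp μ D g f N x - avgOp μ D g f M x) ^ 2 ∂μ := by
      rw [(hS M).norm_sq_sub_toL2]
      refine integral_congr_ae ?_
      filter_upwards [((hS N).memLp μ).coeFn_toLp] with x hx
      simp only [BddMeas.toL2, hx]
    rw [h1, ← integral_ce (D := D) (((hS N).sub (hS M)).pow 2)]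
    have hb : BddMeas fun y => 2 * C' ^ 2 * (kerDist μ D K g N y + kerDist μ D K g M y) :=
      ((kerDist_bddMeas hK hg N).add (kerDist_bddMeas hK hg M)).const_mul _
    refine (integral_mono_ae ((ce_bddMeas (((hS N).sub (hS M)).pow 2)).integrable _)
      (hb.integrable _) (ce_sq_avgOp_sub_le hg hf hC' hK N M)).trans_lt ?_
    rw [integral_const_mul, integral_add ((kerDist_bddMeas hK hg N).integrable _)
      ((kerDist_bddMeas hK hg M).integrable _)]
    have h2 := hN₀ N hN
    have h3 := hN₀ M hM
    rw [lt_div_iff₀ (by positivity)] at h2 h3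
    linarith)
  exact ⟨φ, hφ, h⟩

lemma abs_sum_shift_sub_le {u : ℤ → ℝ} {B : ℝ} (hB : ∀ n, |u n| ≤ B) (m : ℤ) (N : ℕ) :
    |∑ n ∈ Finset.range N, u (n + m) - ∑ n ∈ Finset.range N, u n| ≤ 2 * B * |(m : ℝ)| := by
  obtain ⟨p, rfl | rfl⟩ := m.eq_nat_or_neg
  · have := norm_sum_range_add_sub_le (v := fun n : ℕ => u n) (fun n => hB n) N p
    simpa using this
  · have := norm_sum_range_add_sub_le (v := fun n : ℕ => u (n + -p)) (fun n => hB _) N p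
    rw [norm_sub_rev] at this
    simpa using this

lemma avgOp_shift_sub_le (hg : BddMeas g) (hf : BddMeas f) {C C' : ℝ} (hC : ∀ x, |g x| ≤ C)
    (hC' : ∀ x, |f x| ≤ C') (m : ℤ) (N : ℕ) :
    ∀ᵐ x ∂μ, |avgOp μ D g f N (m +ᵥ x) - avgOp μ D g (fun x => f (m +ᵥ x)) N x|
      ≤ (N : ℝ)⁻¹ * (2 * (C * (C * C')) * |(m : ℝ)|) := by
  have h : ∀ᵐ x ∂μ, ∀ n : ℕ, ce μ D (fun x => g ((n : ℤ) +ᵥ (m +ᵥ x)) * f (m +ᵥ x)) x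
      = ce μ D (fun x => g ((n : ℤ) +ᵥ x) * f x) (m +ᵥ x) :=
    ae_all_iff.2 fun n => ce_shift ((hg.shift n).mul hf) m
  filter_upwards [h] with x hx
  have hC0 : 0 ≤ C := (abs_nonneg _).trans (hC x)
  have := abs_sum_shift_sub_le (u := fun k => g (k +ᵥ x) *
    ce μ D (fun x => g (k +ᵥ x) * f (m +ᵥ x)) x) (B := C * (C * C')) (fun n => by
      rw [abs_mul]
      refine mul_le_mul (hC _) (ce_abs_le (fun x => ?_) x) (abs_nonneg _) hC0
      rw [abs_mul]
      exact mul_le_mul (hC _) (hC' _) (abs_nonneg _) hC0) m N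
  simp only [add_vadd] at this
  simp only [hx] at this
  rw [avgOp, avgOp, ← mul_sub, abs_mul, abs_of_nonneg (by positivity)]
  exact mul_le_mul_of_nonneg_left this (by positivity)

/-- Fibrewise approximation, uniform over translates, of the limit function. -/
lemma ce_sq_shift_sub_avgOp_le (hg : BddMeas g) (hf : BddMeas f) {C : ℝ} (hC : ∀ x, |f x| ≤ C)
    {K : X × X → ℝ} (hK : BddMeas K)
    (hlim : Tendsto (fun N => ∫ y, kerDist μ D K g N y ∂μ) atTop (𝓝 0)) (hφ : BddMeas φ)
    (hφlim : Tendsto (fun N => ∫ x, (φ x - avgOp μ D g f N x) ^ 2 ∂μ) atTop (𝓝 0))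
    (m : ℤ) (M : ℕ) :
    ∀ᵐ y ∂μ, ce μ D (fun x => (φ (m +ᵥ x) - avgOp μ D g (fun x => f (m +ᵥ x)) M x) ^ 2) y
      ≤ 4 * C ^ 2 * kerDist μ D K g M y := by
  obtain ⟨Cg, hCg0, hCg⟩ := hg.exists_pos
  have hSm := avgOp_bddMeas (μ := μ) (D := D) hg (hf.shift m)
  have hS := avgOp_bddMeas (μ := μ) (D := D) hg hf
  have hφm := hφ.shift m
  set A := ce μ D (fun x => (φ (m +ᵥ x) - avgOp μ D g (fun x => f (m +ᵥ x)) M x) ^ 2) with hA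
  have hAb : BddMeas A := ce_bddMeas ((hφm.sub (hSm M)).pow 2)
  set P := fun N => ce μ D (fun x => (φ (m +ᵥ x) - avgOp μ D g (fun x => f (m +ᵥ x)) N x) ^ 2)
    with hP
  have hPb : ∀ N, BddMeas (P N) := fun N => ce_bddMeas ((hφm.sub (hSm N)).pow 2)
  have hkd := kerDist_bddMeas (μ := μ) (D := D) hK hg
  have hbound : ∀ N, ∀ᵐ y ∂μ, max (A y - 4 * C ^ 2 * kerDist μ D K g M y) 0
      ≤ 2 * P N y + 4 * C ^ 2 * kerDist μ D K g N y := by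
    intro N
    filter_upwards [ce_sq_avgOp_sub_le (μ := μ) (D := D) hg (hf.shift m) (fun x => hC (m +ᵥ x))
      hK N M] with y hy
    have h0 : 0 ≤ P N y := ce_nonneg (fun x => sq_nonneg _) y
    have h1 : 0 ≤ kerDist μ D K g N y := kerDist_nonneg K N y
    refine max_le ?_ (by positivity)
    have h2 : A y ≤ 2 * P N y + 2 * ce μ D (fun x => (avgOp μ D g (fun x => f (m +ᵥ x)) N x
        - avgOp μ D g (fun x => f (m +ᵥ x)) M x) ^ 2) y := by
      simp only [hP, hA]
      rw [← ce_const_mul, ← ce_const_mul,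
        ← ce_add (((hφm.sub (hSm N)).pow 2).const_mul 2) ((((hSm N).sub (hSm M)).pow 2).const_mul 2)]
      refine ce_mono ((hφm.sub (hSm M)).pow 2) ((((hφm.sub (hSm N)).pow 2).const_mul 2).add
        ((((hSm N).sub (hSm M)).pow 2).const_mul 2)) (fun x => ?_) y
      set a := φ (m +ᵥ x)
      set b := avgOp μ D g (fun x => f (m +ᵥ x)) N x
      set c := avgOp μ D g (fun x => f (m +ᵥ x)) M x
      nlinarith [sq_nonneg ((a - b) - (b - c))]
    linarith
  have hPlim : Tendsto (fun N => ∫ y, P N y ∂μ) atTop (𝓝 0) := by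
    have hub : ∀ N : ℕ, ∫ y, P N y ∂μ ≤ 2 * ∫ x, (φ x - avgOp μ D g f N x) ^ 2 ∂μ
        + 2 * ((N : ℝ)⁻¹ * (2 * (Cg * (Cg * C)) * |(m : ℝ)|)) ^ 2 := by
      intro N
      rw [hP]
      simp only
      rw [integral_ce ((hφm.sub (hSm N)).pow 2),
        ← integral_shift (μ := μ) (fun x => (φ x - avgOp μ D g f N x) ^ 2) m]
      have hb : BddMeas fun x => (2 : ℝ) * (φ (m +ᵥ x) - avgOp μ D g f N (m +ᵥ x)) ^ 2
        + 2 * ((N : ℝ)⁻¹ * (2 * (Cg * (Cg * C)) * |(m : ℝ)|)) ^ 2 :=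
        (((hφm.sub ((hS N).shift m)).pow 2).const_mul 2).add (BddMeas.const _)
      refine (integral_mono_ae (((hφm.sub (hSm N)).pow 2).integrable _) (hb.integrable _) ?_).trans
        (le_of_eq ?_)
      · filter_upwards [avgOp_shift_sub_le (μ := μ) (D := D) hg hf hCg hC m N] with x hx
        have h3 := sq_le_sq' (abs_le.1 hx).1 (abs_le.1 hx).2
        set a := φ (m +ᵥ x)
        set b := avgOp μ D g f N (m +ᵥ x)
        set c := avgOp μ D g (fun x => f (m +ᵥ x)) N x
        nlinarith [sq_nonneg ((a - b) - (b - c))]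
      · rw [integral_add ((((hφm.sub ((hS N).shift m)).pow 2).const_mul 2).integrable _)
          (integrable_const _), integral_const_mul]
        simp
    have hz : Tendsto (fun N : ℕ => 2 * ∫ x, (φ x - avgOp μ D g f N x) ^ 2 ∂μ
        + 2 * ((N : ℝ)⁻¹ * (2 * (Cg * (Cg * C)) * |(m : ℝ)|)) ^ 2) atTop (𝓝 0) := by
      have e1 := (tendsto_inv_atTop_nhds_zero_nat (𝕜 := ℝ)).mul_const
        (2 * (Cg * (Cg * C)) * |(m : ℝ)|)
      have e2 := (hφlim.const_mul 2).add ((e1.pow 2).const_mul 2)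
      simpa using e2
    exact squeeze_zero (fun N => integral_nonneg fun y => ce_nonneg (fun x => sq_nonneg _) y) hub hz
  have hQb : BddMeas fun y => max (A y - 4 * C ^ 2 * kerDist μ D K g M y) 0 := by
    have hb := hAb.sub ((hkd M).const_mul (4 * C ^ 2))
    refine ⟨hb.meas.max measurable_const, hb.bdd.imp fun B hB y => ?_⟩
    rw [abs_of_nonneg (le_max_right _ _)]
    exact max_le ((le_abs_self _).trans (hB y)) ((abs_nonneg _).trans (hB y))
  have hzero : ∫ y, max (A y - 4 * C ^ 2 * kerDist μ D K g M y) 0 ∂μ = 0 := by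
    refine le_antisymm ?_ (integral_nonneg fun y => le_max_right _ _)
    have hl := (hPlim.const_mul 2).add (hlim.const_mul (4 * C ^ 2))
    rw [mul_zero, mul_zero, add_zero] at hl
    refine ge_of_tendsto' hl fun N => ?_
    rw [← integral_const_mul, ← integral_const_mul, ← integral_add (((hPb N).const_mul 2).integrable _)
      (((hkd N).const_mul _).integrable _)]
    exact integral_mono_ae (hQb.integrable _)
      ((((hPb N).const_mul 2).add ((hkd N).const_mul (4 * C ^ 2))).integrable _) (hbound N)
  have hzero := (integral_eq_zero_iff_of_nonneg (fun y => le_max_right _ _)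
    (hQb.integrable μ)).1 hzero
  filter_upwards [hzero] with y hy
  have : A y - 4 * C ^ 2 * kerDist μ D K g M y ≤ 0 := by
    have h := le_max_left (A y - 4 * C ^ 2 * kerDist μ D K g M y) 0
    rw [show max (A y - 4 * C ^ 2 * kerDist μ D K g M y) 0 = 0 from hy] at h
    exact h
  linarith

lemma almostPeriodic_of_avgOp_limit (hg : BddMeas g) (hf : BddMeas f)
    {K : X × X → ℝ} (hK : BddMeas K)
    (hlim : Tendsto (fun N => ∫ y, kerDist μ D K g N y ∂μ) atTop (𝓝 0)) (hφ : BddMeas φ)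
    (hφlim : Tendsto (fun N => ∫ x, (φ x - avgOp μ D g f N x) ^ 2 ∂μ) atTop (𝓝 0)) :
    AlmostPeriodic μ D φ := by
  refine ⟨hφ, fun ε hε => ?_⟩
  obtain ⟨C, hC0, hC⟩ := hf.exists_pos
  obtain ⟨Cg, hCg0, hCg⟩ := hg.exists_pos
  set ε' := ε / (16 * C ^ 2) with hε'
  have hε'0 : 0 < ε' := by positivity
  obtain ⟨M, hM, hM1⟩ := ((hlim.eventually_lt_const (show 0 < ε' * ε by positivity)).and
    (eventually_ge_atTop 1)).exists
  have hMpos : (0 : ℝ) < M := by exact_mod_cast hM1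
  set η := Real.sqrt ε / (2 * Cg) with hη
  have hη0 : 0 < η := by positivity
  set L : ℤ := ⌈Cg * C / η⌉ + 1 with hL
  set G : (Fin M → Set.Icc (-L) L) → X → ℝ := fun t x => (0 : ℝ) + ∑ n : Fin M,
    ((M : ℝ)⁻¹ * g (((n : ℕ) : ℤ) +ᵥ x)) * (η * ((t n : ℤ) : ℝ)) with hG
  have hGb : ∀ t, BddMeas (G t) := fun t => (BddMeas.const 0).add
    (BddMeas.sum fun (n : Fin M) _ => ((hg.shift ((n : ℕ) : ℤ)).const_mul _).mul (BddMeas.const _))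
  have hkd := kerDist_bddMeas (μ := μ) (D := D) hK hg M
  refine ⟨Set.range G, Set.finite_range G, ?_, {y | ε' ≤ kerDist μ D K g M y}, ?_, ?_, ?_⟩
  · rintro _ ⟨t, rfl⟩
    exact hGb t
  · exact (kerDist_measurable hK hg M) measurableSet_Ici
  · have := mul_meas_ge_le_integral_of_nonneg (μ := μ)
      (ae_of_all _ fun y => kerDist_nonneg (μ := μ) (D := D) (g := g) K M y)
      (hkd.integrable μ) ε'
    exact (mul_le_mul_iff_right₀ hε'0).1 (this.trans hM.le)
  · intro m
    have hfz := ce_sq_add_sum_mul (μ := μ) (D := D) (s := (Finset.univ : Finset (Fin M)))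
      (φ := fun x => φ (m +ᵥ x)) (a := fun n x => -(M : ℝ)⁻¹ * g (((n : ℕ) : ℤ) +ᵥ x))
      (b := fun n => ce μ D (fun x => g (((n : ℕ) : ℤ) +ᵥ x) * f (m +ᵥ x))) (hφ.shift m)
      (fun n _ => (hg.shift _).const_mul _)
      (fun n _ => ce_bddMeas ((hg.shift _).mul (hf.shift m)))
      (fun n _ => ce_measurable ((hg.shift _).mul (hf.shift m)))
    filter_upwards [hfz, ce_sq_shift_sub_avgOp_le hg hf hC hK hlim hφ hφlim m M]
      with y hy1 hy2 hyE _
    have hyE' : kerDist μ D K g M y < ε' := not_le.1 hyE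
    set b : Fin M → ℝ := fun n => ce μ D (fun x => g (((n : ℕ) : ℤ) +ᵥ x) * f (m +ᵥ x)) y with hb
    have hbC : ∀ n, |b n| ≤ Cg * C := fun n => ce_abs_le (fun x => by
      rw [abs_mul]
      exact mul_le_mul (hCg _) (hC _) (abs_nonneg _) hCg0.le) y
    have hbt : ∀ n, ⌊b n / η⌋ ∈ Set.Icc (-L) L := by
      intro n
      have h := abs_le.1 (hbC n)
      have hc := Int.le_ceil (Cg * C / η)
      constructor
      · rw [Int.le_floor, hL]
        push_cast
        have : -(Cg * C / η) ≤ b n / η := by rw [← neg_div]; gcongr; exact h.1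
        linarith
      · have h1 : (⌊b n / η⌋ : ℝ) ≤ b n / η := Int.floor_le _
        have h2 : b n / η ≤ Cg * C / η := by gcongr; exact h.2
        have : (⌊b n / η⌋ : ℝ) ≤ (L : ℝ) := by rw [hL]; push_cast; linarith
        exact_mod_cast this
    refine ⟨G fun n => ⟨_, hbt n⟩, ⟨_, rfl⟩, ?_⟩
    have hbη : ∀ n, |b n - η * (⌊b n / η⌋ : ℝ)| ≤ η := by
      intro n
      have h1 := Int.floor_le (b n / η)
      have h2 := Int.lt_floor_add_one (b n / η)
      rw [le_div_iff₀ hη0] at h1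
      rw [div_lt_iff₀ hη0] at h2
      rw [abs_le]
      constructor <;> nlinarith
    have e1 : ∀ x, avgOp μ D g (fun x => f (m +ᵥ x)) M x = -∑ n : Fin M,
        (-(M : ℝ)⁻¹ * g (((n : ℕ) : ℤ) +ᵥ x)) *
          ce μ D (fun x => g (((n : ℕ) : ℤ) +ᵥ x) * f (m +ᵥ x)) x := by
      intro x
      rw [avgOp, ← Fin.sum_univ_eq_sum_range (fun n => g ((n : ℤ) +ᵥ x) *
        ce μ D (fun x => g ((n : ℤ) +ᵥ x) * f (m +ᵥ x)) x), Finset.mul_sum,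
        ← Finset.sum_neg_distrib]
      exact Finset.sum_congr rfl fun n _ => by ring
    simp only [e1, sub_neg_eq_add] at hy2
    rw [hy1] at hy2
    have hfb : BddMeas fun x => (φ (m +ᵥ x) + ∑ n : Fin M,
        (-(M : ℝ)⁻¹ * g (((n : ℕ) : ℤ) +ᵥ x)) * b n) ^ 2 :=
      ((hφ.shift m).add (BddMeas.sum fun (n : Fin M) _ => ((hg.shift ((n : ℕ) : ℤ)).const_mul _).mul
        (BddMeas.const _))).pow 2
    have h3 : ce μ D (fun x => (φ (m +ᵥ x) - G (fun n => ⟨_, hbt n⟩) x) ^ 2) y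
        ≤ ce μ D (fun x => 2 * (φ (m +ᵥ x) + ∑ n : Fin M,
        (-(M : ℝ)⁻¹ * g (((n : ℕ) : ℤ) +ᵥ x)) * b n) ^ 2 + 2 * (Cg * η) ^ 2) y := by
      refine ce_mono (((hφ.shift m).sub (hGb _)).pow 2) ((hfb.const_mul 2).add (BddMeas.const _))
        (fun x => ?_) y
      set p := φ (m +ᵥ x) + ∑ n : Fin M, (-(M : ℝ)⁻¹ * g (((n : ℕ) : ℤ) +ᵥ x)) * b n with hp
      set r := ∑ n : Fin M, (M : ℝ)⁻¹ * (g (((n : ℕ) : ℤ) +ᵥ x) *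
        (b n - η * (⌊b n / η⌋ : ℝ))) with hr
      have e2 : φ (m +ᵥ x) - G (fun n => ⟨_, hbt n⟩) x = p + r := by
        rw [hp, hr, hG, add_assoc, ← Finset.sum_add_distrib]
        simp only
        rw [zero_add, sub_eq_add_neg, ← Finset.sum_neg_distrib]
        congr 1
        exact Finset.sum_congr rfl fun n _ => by ring
      have e3 : |r| ≤ Cg * η := by
        refine (Finset.abs_sum_le_sum_abs _ _).trans ?_
        have : ∀ n ∈ (Finset.univ : Finset (Fin M)), |(M : ℝ)⁻¹ * (g (((n : ℕ) : ℤ) +ᵥ x) *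
          (b n - η * (⌊b n / η⌋ : ℝ)))| ≤ (M : ℝ)⁻¹ * (Cg * η) := fun n _ => by
          rw [abs_mul, abs_of_pos (inv_pos.2 hMpos), abs_mul]
          exact mul_le_mul_of_nonneg_left (mul_le_mul (hCg _) (hbη n) (abs_nonneg _) hCg0.le)
            (inv_pos.2 hMpos).le
        refine (Finset.sum_le_sum this).trans (le_of_eq ?_)
        simp only [Finset.sum_const, Finset.card_univ, Fintype.card_fin, nsmul_eq_mul]
        field_simp
      rw [e2]
      have e4 := sq_le_sq' (abs_le.1 e3).1 (abs_le.1 e3).2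
      nlinarith [sq_nonneg (p - r)]
    refine h3.trans ?_
    rw [ce_add (hfb.const_mul 2) (BddMeas.const _), ce_const_mul]
    have h4 : ce μ D (fun _ => 2 * (Cg * η) ^ 2) y = ε / 2 := by
      have : (Cg * η) ^ 2 = ε / 4 := by
        rw [hη, show Cg * (√ε / (2 * Cg)) = √ε / 2 by field_simp, div_pow, Real.sq_sqrt hε.le]
        norm_num
      rw [this, ce]
      simp
      ring
    rw [h4]
    have h5 : 4 * C ^ 2 * kerDist μ D K g M y ≤ ε / 4 := by
      calc _ ≤ 4 * C ^ 2 * ε' := by gcongr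
        _ = ε / 4 := by rw [hε']; field_simp; norm_num
    linarith

/-- Functions orthogonal to the relatively almost periodic factor are relatively weakly mixing. -/
theorem tendsto_avg_integral_ce_sq (hf : BddMeas f) (hg : BddMeas g)
    (h0 : ce μ (apFactor μ D) f =ᵐ[μ] 0) :
    Tendsto (fun N : ℕ => (N : ℝ)⁻¹ * ∑ n ∈ Finset.range N,
      ∫ y, ce μ D (fun x => g ((n : ℤ) +ᵥ x) * f x) y ^ 2 ∂μ) atTop (𝓝 0) := by
  obtain ⟨K, hK, hlim⟩ := exists_kerDist_tendsto (μ := μ) D hg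
  obtain ⟨φ, hφ, hφlim⟩ := exists_avgOp_limit hg hf hK hlim
  have hap := almostPeriodic_of_avgOp_limit hg hf hK hlim hφ hφlim
  have hφf : ∫ x, φ x * f x ∂μ = 0 := by
    have h := integral_ce_mul (μ := μ) (D := apFactor μ D) hf hφ hap.measurable
    simp only [mul_comm (φ _)]
    rw [← h, integral_eq_zero_of_ae]
    filter_upwards [h0] with x hx
    simp [hx]
  have e1 : ∀ N : ℕ, (N : ℝ)⁻¹ * ∑ n ∈ Finset.range N,
      ∫ y, ce μ D (fun x => g ((n : ℤ) +ᵥ x) * f x) y ^ 2 ∂μ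
      = -∫ x, (φ x - avgOp μ D g f N x) * f x ∂μ := by
    intro N
    have hS := avgOp_bddMeas (μ := μ) (D := D) hg hf N
    simp only [sub_mul]
    rw [integral_sub ((hφ.mul hf).integrable _) ((hS.mul hf).integrable _), hφf, zero_sub, neg_neg]
    simp only [avgOp, mul_assoc, Finset.sum_mul]
    rw [integral_const_mul, integral_finsetSum _ fun (n : ℕ) _ =>
      ((hg.shift (n : ℤ)).mul ((ce_bddMeas ((hg.shift (n : ℤ)).mul hf)).mul hf)).integrable _]
    congr 1
    refine Finset.sum_congr rfl fun n _ => ?_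
    have hgf := (hg.shift (n : ℤ)).mul hf
    rw [show (fun x => g ((n : ℤ) +ᵥ x) * (ce μ D (fun x => g ((n : ℤ) +ᵥ x) * f x) x * f x))
      = fun x => (g ((n : ℤ) +ᵥ x) * f x) * ce μ D (fun x => g ((n : ℤ) +ᵥ x) * f x) x from
      funext fun x => by ring, ← integral_ce_mul hgf (ce_bddMeas hgf) (ce_measurable hgf)]
    simp only [sq]
  simp only [e1]
  rw [← neg_zero]
  refine Tendsto.neg ?_
  refine squeeze_zero_norm (a := fun N => Real.sqrt ((∫ x, (φ x - avgOp μ D g f N x) ^ 2 ∂μ)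
    * ∫ x, f x ^ 2 ∂μ)) (fun N => Real.abs_le_sqrt
      (BddMeas.sq_integral_mul_le (hφ.sub (avgOp_bddMeas hg hf N)) hf μ)) ?_
  have := (hφlim.mul_const (∫ x, f x ^ 2 ∂μ)).sqrt
  simpa using this

end Dichotomy

section VdC
variable {X : Type} [mX : MeasurableSpace X] {μ : Measure X} [IsProbabilityMeasure μ]

/-- Cesàro averages tend to zero in `L²`. -/
def AvgZero (μ : Measure X) (u : ℕ → X → ℝ) : Prop :=
  Tendsto (fun N : ℕ => ∫ x, ((N : ℝ)⁻¹ * ∑ n ∈ Finset.range N, u n x) ^ 2 ∂μ) atTop (𝓝 0)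

lemma sum_natDist_le {a : ℕ → ℝ} (ha : ∀ h, 0 ≤ a h) (H : ℕ) :
    ∑ h ∈ Finset.range H, ∑ k ∈ Finset.range H, a ((max h k) - (min h k))
      ≤ 2 * H * ∑ h ∈ Finset.range H, a h := by
  have h1 : ∀ h ∈ Finset.range H, ∑ k ∈ Finset.range H, a ((max h k) - (min h k))
      ≤ 2 * ∑ h ∈ Finset.range H, a h := by
    intro h hh
    have hh' := Finset.mem_range.1 hh
    have e1 : ∑ k ∈ (Finset.range H).filter (· ≤ h), a ((max h k) - (min h k))
        ≤ ∑ h ∈ Finset.range H, a h := by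
      rw [← Finset.sum_image (f := a) (g := fun k => max h k - min h k)
        (s := (Finset.range H).filter (· ≤ h))]
      · refine Finset.sum_le_sum_of_subset_of_nonneg (fun x hx => ?_) fun i _ _ => ha i
        simp only [Finset.mem_image, Finset.mem_filter, Finset.mem_range] at hx ⊢
        omega
      · intro x hx y hy hxy
        simp only [Finset.coe_filter, Finset.mem_range, Set.mem_ofPred_eq] at hx hy hxy
        omega
    have e2 : ∑ k ∈ (Finset.range H).filter (fun k => ¬ k ≤ h), a ((max h k) - (min h k))
        ≤ ∑ h ∈ Finset.range H, a h := by
      rw [← Finset.sum_image (f := a) (g := fun k => max h k - min h k)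
        (s := (Finset.range H).filter (fun k => ¬ k ≤ h))]
      · refine Finset.sum_le_sum_of_subset_of_nonneg (fun x hx => ?_) fun i _ _ => ha i
        simp only [Finset.mem_image, Finset.mem_filter, Finset.mem_range] at hx ⊢
        omega
      · intro x hx y hy hxy
        simp only [Finset.coe_filter, Finset.mem_range, Set.mem_ofPred_eq] at hx hy hxy
        omega
    rw [← Finset.sum_filter_add_sum_filter_not (Finset.range H) (· ≤ h)]
    linarith
  refine (Finset.sum_le_sum h1).trans ?_
  rw [Finset.sum_const, Finset.card_range, nsmul_eq_mul]
  linarith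

/-- The van der Corput inequality, in limiting form. -/
lemma avgZero_of_vdC {u : ℕ → X → ℝ} {C : ℝ} (hu : ∀ n, BddMeas (u n)) (hC : ∀ n x, |u n x| ≤ C)
    {a : ℕ → ℝ} (ha : ∀ h, 0 ≤ a h)
    (hcor : ∀ h, ∀ ε > 0, ∀ᶠ N : ℕ in atTop,
      (N : ℝ)⁻¹ * ∑ n ∈ Finset.range N, ∫ x, u n x * u (n + h) x ∂μ ≤ a h + ε)
    (hlim : Tendsto (fun H : ℕ => (H : ℝ)⁻¹ * ∑ h ∈ Finset.range H, a h) atTop (𝓝 0)) :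
    AvgZero μ u := by
  obtain ⟨x₀⟩ : Nonempty X := μ.nonempty_of_neZero
  have hC0 : 0 ≤ C := (abs_nonneg _).trans (hC 0 x₀)
  rw [AvgZero, Metric.tendsto_atTop]
  intro ε hε
  suffices h : ∀ᶠ N : ℕ in atTop,
      ∫ x, ((N : ℝ)⁻¹ * ∑ n ∈ Finset.range N, u n x) ^ 2 ∂μ < ε by
    obtain ⟨N₀, h⟩ := eventually_atTop.1 h
    refine ⟨N₀, fun N hN => ?_⟩
    rw [Real.dist_eq, sub_zero, abs_of_nonneg (integral_nonneg fun x => sq_nonneg _)]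
    exact h N hN
  obtain ⟨H, hH, hH1⟩ := ((hlim.eventually_lt_const (show 0 < ε / 16 by positivity)).and
    (eventually_ge_atTop 1)).exists
  have hHpos : (0 : ℝ) < H := by exact_mod_cast hH1
  have hsmall : ∀ K : ℝ, ∀ ε > 0, ∀ᶠ N : ℕ in atTop, (N : ℝ)⁻¹ * K < ε := fun K ε hε => by
    have := (tendsto_inv_atTop_nhds_zero_nat (𝕜 := ℝ)).mul_const K
    rw [zero_mul] at this
    exact this.eventually_lt_const hε
  have hall : ∀ᶠ N : ℕ in atTop, ∀ h ∈ Finset.range H,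
      (N : ℝ)⁻¹ * ∑ n ∈ Finset.range N, ∫ x, u n x * u (n + h) x ∂μ ≤ a h + ε / 16 :=
    (Finset.eventually_all _).2 fun h _ => hcor h _ (by positivity)
  filter_upwards [hall, hsmall (2 * (C * C) * H) (ε / 16) (by positivity),
    hsmall (2 * C * H) (Real.sqrt (ε / 16)) (by positivity), eventually_ge_atTop 1]
    with N hN1 hN2 hN3 hN4
  have hNpos : (0 : ℝ) < N := by exact_mod_cast hN4
  -- smoothing
  set V : X → ℝ := fun x => (N : ℝ)⁻¹ * ∑ n ∈ Finset.range N, (H : ℝ)⁻¹ *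
    ∑ h ∈ Finset.range H, u (n + h) x with hV
  have hUb : BddMeas fun x => (N : ℝ)⁻¹ * ∑ n ∈ Finset.range N, u n x :=
    (BddMeas.sum fun n _ => hu n).const_mul _
  have hWb : ∀ n, BddMeas fun x => ∑ h ∈ Finset.range H, u (n + h) x :=
    fun n => BddMeas.sum fun h _ => hu _
  have hVb : BddMeas V := (BddMeas.sum fun n _ => (hWb n).const_mul _).const_mul _
  have e1 : ∀ x, |(N : ℝ)⁻¹ * ∑ n ∈ Finset.range N, u n x - V x| ≤ Real.sqrt (ε / 16) := by
    intro x
    have : (N : ℝ)⁻¹ * ∑ n ∈ Finset.range N, u n x - V x = (H : ℝ)⁻¹ * ∑ h ∈ Finset.range H,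
        (N : ℝ)⁻¹ * (∑ n ∈ Finset.range N, u n x - ∑ n ∈ Finset.range N, u (n + h) x) := by
      simp only [mul_sub, Finset.sum_sub_distrib, Finset.sum_const, Finset.card_range, nsmul_eq_mul]
      rw [hV]
      congr 1
      · field_simp
      · simp only [Finset.mul_sum]
        rw [Finset.sum_comm]
        exact Finset.sum_congr rfl fun _ _ => Finset.sum_congr rfl fun _ _ => by ring
    rw [this, abs_mul, abs_of_pos (inv_pos.2 hHpos), inv_mul_le_iff₀ hHpos]
    refine (Finset.abs_sum_le_sum_abs _ _).trans ?_
    have : ∀ h ∈ Finset.range H, |(N : ℝ)⁻¹ * (∑ n ∈ Finset.range N, u n x -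
        ∑ n ∈ Finset.range N, u (n + h) x)| ≤ Real.sqrt (ε / 16) := by
      intro h hh
      have h1 := norm_sum_range_add_sub_le (v := fun n => u n x) (fun n => hC n x) N h
      rw [abs_mul, abs_of_pos (inv_pos.2 hNpos), abs_sub_comm]
      refine le_trans ?_ hN3.le
      refine mul_le_mul_of_nonneg_left (h1.trans ?_) (inv_pos.2 hNpos).le
      have : (h : ℝ) ≤ H := by exact_mod_cast (Finset.mem_range.1 hh).le
      gcongr
    refine (Finset.sum_le_sum this).trans ?_
    simp
  have e2 : ∫ x, V x ^ 2 ∂μ ≤ (H : ℝ)⁻¹ ^ 2 * ∑ h ∈ Finset.range H, ∑ k ∈ Finset.range H,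
      (N : ℝ)⁻¹ * ∑ n ∈ Finset.range N, ∫ x, u (n + h) x * u (n + k) x ∂μ := by
    have hcs : ∀ x, V x ^ 2 ≤ (N : ℝ)⁻¹ * ∑ n ∈ Finset.range N,
        ((H : ℝ)⁻¹ * ∑ h ∈ Finset.range H, u (n + h) x) ^ 2 := by
      intro x
      rw [hV]
      simp only
      rw [mul_pow, sq (N : ℝ)⁻¹, mul_assoc]
      refine mul_le_mul_of_nonneg_left ?_ (inv_pos.2 hNpos).le
      rw [inv_mul_le_iff₀ hNpos]
      have := sq_sum_le_card_mul_sum_sq (s := Finset.range N)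
        (f := fun n => (H : ℝ)⁻¹ * ∑ h ∈ Finset.range H, u (n + h) x)
      simpa using this
    have hb : BddMeas fun x => (N : ℝ)⁻¹ * ∑ n ∈ Finset.range N,
        ((H : ℝ)⁻¹ * ∑ h ∈ Finset.range H, u (n + h) x) ^ 2 :=
      (BddMeas.sum fun n _ => ((hWb n).const_mul _).pow 2).const_mul _
    refine (integral_mono ((hVb.pow 2).integrable μ) (hb.integrable μ) hcs).trans (le_of_eq ?_)
    rw [integral_const_mul, integral_finsetSum _ fun n _ =>
      (((hWb n).const_mul (H : ℝ)⁻¹).pow 2).integrable μ]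
    have : ∀ n, ∫ x, ((H : ℝ)⁻¹ * ∑ h ∈ Finset.range H, u (n + h) x) ^ 2 ∂μ
        = (H : ℝ)⁻¹ ^ 2 * ∑ h ∈ Finset.range H, ∑ k ∈ Finset.range H,
          ∫ x, u (n + h) x * u (n + k) x ∂μ := by
      intro n
      simp only [mul_pow]
      rw [integral_const_mul]
      simp only [sq (∑ h ∈ Finset.range H, u (n + h) _), Finset.sum_mul_sum]
      rw [integral_finsetSum _ fun h _ =>
        (BddMeas.sum fun k _ => (hu (n + h)).mul (hu (n + k))).integrable μ]
      congr 1
      exact Finset.sum_congr rfl fun h _ =>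
        integral_finsetSum _ fun k _ => ((hu (n + h)).mul (hu (n + k))).integrable μ
    rw [Finset.sum_congr rfl fun n _ => this n]
    simp only [Finset.mul_sum]
    rw [Finset.sum_comm]
    refine Finset.sum_congr rfl fun h _ => ?_
    rw [Finset.sum_comm]
    exact Finset.sum_congr rfl fun k _ => Finset.sum_congr rfl fun n _ => by ring
  have e3 : ∀ h ∈ Finset.range H, ∀ k ∈ Finset.range H,
      (N : ℝ)⁻¹ * ∑ n ∈ Finset.range N, ∫ x, u (n + h) x * u (n + k) x ∂μ
        ≤ a (max h k - min h k) + ε / 8 := by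
    have key : ∀ h k, h ≤ k → k ∈ Finset.range H →
        (N : ℝ)⁻¹ * ∑ n ∈ Finset.range N, ∫ x, u (n + h) x * u (n + k) x ∂μ
        ≤ a (k - h) + ε / 8 := by
      intro h k hhk hk
      have hk' := Finset.mem_range.1 hk
      have h1 := hN1 (k - h) (Finset.mem_range.2 (by omega))
      have h2 := norm_sum_range_add_sub_le (v := fun n => ∫ x, u n x * u (n + (k - h)) x ∂μ)
        (C := C * C) (fun n => BddMeas.abs_integral_le fun x => by
          rw [abs_mul]; exact mul_le_mul (hC _ _) (hC _ _) (abs_nonneg _) hC0) N h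
      have h3 : ∀ n, n + h + (k - h) = n + k := fun n => by omega
      simp only [h3] at h2
      have h4 := (le_abs_self _).trans h2
      have h5 : (h : ℝ) ≤ H := by exact_mod_cast (hhk.trans_lt hk').le
      have h6 : (N : ℝ)⁻¹ * (∑ n ∈ Finset.range N, ∫ x, u (n + h) x * u (n + k) x ∂μ
          - ∑ n ∈ Finset.range N, ∫ x, u n x * u (n + (k - h)) x ∂μ) ≤ ε / 16 := by
        refine le_trans ?_ hN2.le
        refine mul_le_mul_of_nonneg_left (h4.trans ?_) (inv_pos.2 hNpos).le
        gcongr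
      rw [mul_sub] at h6
      linarith
    intro h hh k hk
    rcases le_total h k with hhk | hhk
    · rw [max_eq_right hhk, min_eq_left hhk]
      exact key h k hhk hk
    · rw [max_eq_left hhk, min_eq_right hhk]
      have := key k h hhk hh
      simp only [mul_comm (u (_ + k) _)] at this
      exact this
  have e4 : ∫ x, V x ^ 2 ∂μ ≤ ε / 4 := by
    refine e2.trans ?_
    have h1 := Finset.sum_le_sum fun h hh => Finset.sum_le_sum (e3 h hh)
    simp only [Finset.sum_add_distrib, Finset.sum_const, Finset.card_range, nsmul_eq_mul] at h1
    have h2 := sum_natDist_le ha H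
    rw [inv_mul_lt_iff₀ hHpos] at hH
    rw [inv_pow, inv_mul_le_iff₀ (by positivity)]
    nlinarith
  have e5 : ∫ x, ((N : ℝ)⁻¹ * ∑ n ∈ Finset.range N, u n x) ^ 2 ∂μ
      ≤ 2 * ∫ x, V x ^ 2 ∂μ + 2 * (ε / 16) := by
    have hb : BddMeas fun x => (2 : ℝ) * V x ^ 2 + 2 * (ε / 16) :=
      ((hVb.pow 2).const_mul 2).add (BddMeas.const _)
    refine (integral_mono ((hUb.pow 2).integrable μ) (hb.integrable μ) fun x => ?_).trans
      (le_of_eq ?_)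
    · have h1 := sq_le_sq' (abs_le.1 (e1 x)).1 (abs_le.1 (e1 x)).2
      rw [Real.sq_sqrt (by positivity)] at h1
      simp only
      set U := (N : ℝ)⁻¹ * ∑ n ∈ Finset.range N, u n x
      nlinarith [sq_nonneg (U - V x - V x)]
    · rw [integral_add (((hVb.pow 2).const_mul 2).integrable μ) (integrable_const _),
        integral_const_mul]
      simp
  linarith

lemma avgZero_of_vdC_eventually {u : ℕ → X → ℝ} {C : ℝ} (hu : ∀ n, BddMeas (u n))
    (hC : ∀ n x, |u n x| ≤ C)
    (hcor : ∀ᶠ h in atTop, Tendsto (fun N : ℕ =>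
      (N : ℝ)⁻¹ * ∑ n ∈ Finset.range N, ∫ x, u n x * u (n + h) x ∂μ) atTop (𝓝 0)) :
    AvgZero μ u := by
  obtain ⟨x₀⟩ : Nonempty X := μ.nonempty_of_neZero
  have hC0 : 0 ≤ C := (abs_nonneg _).trans (hC 0 x₀)
  obtain ⟨h₀, hh₀⟩ := eventually_atTop.1 hcor
  refine avgZero_of_vdC hu hC (a := fun h => if h < h₀ then C * C else 0)
    (fun h => by positivity) (fun h ε hε => ?_) ?_
  · by_cases hh : h < h₀
    · simp only [hh, if_true]
      filter_upwards with N
      have := abs_avg_le (u := fun n => ∫ x, u n x * u (n + h) x ∂μ) (C := C * C)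
        (fun n => BddMeas.abs_integral_le fun x => by
          rw [abs_mul]; exact mul_le_mul (hC _ _) (hC _ _) (abs_nonneg _) hC0) N
      linarith [le_abs_self ((N : ℝ)⁻¹ * ∑ n ∈ Finset.range N, ∫ x, u n x * u (n + h) x ∂μ)]
    · simp only [hh, if_false, zero_add]
      exact ((hh₀ h (not_lt.1 hh)).eventually_lt_const hε).mono fun _ h => h.le
  · refine squeeze_zero (g := fun H : ℕ => (H : ℝ)⁻¹ * (h₀ * (C * C))) (fun H => mul_nonneg (by positivity)
      (Finset.sum_nonneg fun h _ => by positivity)) (fun H => ?_) ?_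
    · refine mul_le_mul_of_nonneg_left ?_ (by positivity)
      rw [← Finset.sum_filter, Finset.sum_const, nsmul_eq_mul]
      refine mul_le_mul_of_nonneg_right ?_ (by positivity)
      have : ((Finset.range H).filter (· < h₀)) ⊆ Finset.range h₀ := fun x hx => by
        simp only [Finset.mem_filter, Finset.mem_range] at hx ⊢
        exact hx.2
      have := Finset.card_le_card this
      rw [Finset.card_range] at this
      exact_mod_cast this
    · simpa using (tendsto_inv_atTop_nhds_zero_nat (𝕜 := ℝ)).mul_const (h₀ * (C * C))

lemma AvgZero.tendsto_integral_mul {u : ℕ → X → ℝ} (hu : ∀ n, BddMeas (u n)) (h : AvgZero μ u)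
    {g : X → ℝ} (hg : BddMeas g) :
    Tendsto (fun N : ℕ => (N : ℝ)⁻¹ * ∑ n ∈ Finset.range N, ∫ x, g x * u n x ∂μ) atTop (𝓝 0) := by
  refine squeeze_zero_norm (a := fun N : ℕ => Real.sqrt ((∫ x, g x ^ 2 ∂μ) *
    ∫ x, ((N : ℝ)⁻¹ * ∑ n ∈ Finset.range N, u n x) ^ 2 ∂μ)) (fun N => ?_) ?_
  · have e : (N : ℝ)⁻¹ * ∑ n ∈ Finset.range N, ∫ x, g x * u n x ∂μ
        = ∫ x, g x * ((N : ℝ)⁻¹ * ∑ n ∈ Finset.range N, u n x) ∂μ := by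
      rw [← integral_finsetSum _ fun n _ => (hg.mul (hu n)).integrable μ, ← integral_const_mul]
      congr 1
      ext x
      rw [← Finset.mul_sum]
      ring
    rw [e]
    exact Real.abs_le_sqrt (BddMeas.sq_integral_mul_le hg
      ((BddMeas.sum fun n _ => hu n).const_mul _) μ)
  · have := (Tendsto.const_mul (∫ x, g x ^ 2 ∂μ) h).sqrt
    simpa using this

end VdC

section Linear
variable {X : Type} [mX : MeasurableSpace X] [AddAction ℤ X] [MeasurableConstVAdd ℤ X]
  [StandardBorelSpace X] {μ : Measure X} [IsProbabilityMeasure μ] [VAddInvariantMeasure ℤ X μ]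
  {D : Factor X} {f g : X → ℝ}

lemma tendsto_avg_mul {u : ℕ → ℝ} (hu : ∀ n, 0 ≤ u n)
    (h : Tendsto (fun N : ℕ => (N : ℝ)⁻¹ * ∑ n ∈ Finset.range N, u n) atTop (𝓝 0))
    {c : ℕ} (hc : c ≠ 0) :
    Tendsto (fun N : ℕ => (N : ℝ)⁻¹ * ∑ n ∈ Finset.range N, u (c * n)) atTop (𝓝 0) := by
  have hcN : Tendsto (fun N : ℕ => c * N) atTop atTop :=
    tendsto_id.const_mul_atTop' (Nat.pos_of_ne_zero hc)
  have h2 := (h.comp hcN).const_mul (c : ℝ)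
  rw [mul_zero] at h2
  refine squeeze_zero (fun N => mul_nonneg (by positivity) (Finset.sum_nonneg fun n _ => hu _))
    (fun N => ?_) h2
  have hle : ∑ n ∈ Finset.range N, u (c * n) ≤ ∑ n ∈ Finset.range (c * N), u n := by
    rw [← Finset.sum_image (f := u) (s := Finset.range N) (g := fun n => c * n)
      (fun a _ b _ hab => Nat.eq_of_mul_eq_mul_left (Nat.pos_of_ne_zero hc) hab)]
    refine Finset.sum_le_sum_of_subset_of_nonneg (fun x hx => ?_) fun _ _ _ => hu _
    obtain ⟨n, hn, rfl⟩ := Finset.mem_image.1 hx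
    exact Finset.mem_range.2
      (Nat.mul_lt_mul_of_pos_left (Finset.mem_range.1 hn) (Nat.pos_of_ne_zero hc))
  simp only [Function.comp, Nat.cast_mul, mul_inv]
  rw [← mul_assoc, ← mul_assoc, mul_inv_cancel₀ (by exact_mod_cast hc), one_mul]
  exact mul_le_mul_of_nonneg_left hle (by positivity)

lemma tendsto_avg_sqrt {u : ℕ → ℝ} (hu : ∀ n, 0 ≤ u n)
    (h : Tendsto (fun N : ℕ => (N : ℝ)⁻¹ * ∑ n ∈ Finset.range N, u n) atTop (𝓝 0)) :
    Tendsto (fun N : ℕ => (N : ℝ)⁻¹ * ∑ n ∈ Finset.range N, Real.sqrt (u n)) atTop (𝓝 0) := by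
  have h2 := h.sqrt
  rw [Real.sqrt_zero] at h2
  refine squeeze_zero (fun N => mul_nonneg (by positivity) (Finset.sum_nonneg fun n _ =>
    Real.sqrt_nonneg _)) (fun N => ?_) h2
  refine Real.le_sqrt_of_sq_le ?_
  have h3 := sq_sum_le_card_mul_sum_sq (s := Finset.range N) (f := fun n => Real.sqrt (u n))
  simp only [Real.sq_sqrt (hu _), Finset.card_range] at h3
  rcases Nat.eq_zero_or_pos N with rfl | hN
  · simp
  have hN' : (0 : ℝ) < N := by exact_mod_cast hN
  rw [mul_pow, sq (N : ℝ)⁻¹, mul_assoc]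
  refine mul_le_mul_of_nonneg_left ?_ (inv_pos.2 hN').le
  rwa [inv_mul_le_iff₀ hN']

lemma integral_ce_sq_neg (hf : BddMeas f) (n : ℤ) :
    ∫ y, ce μ D (fun x => f (-n +ᵥ x) * f x) y ^ 2 ∂μ
      = ∫ y, ce μ D (fun x => f (n +ᵥ x) * f x) y ^ 2 ∂μ := by
  rw [← integral_shift _ n]
  refine integral_congr_ae ?_
  filter_upwards [ce_shift (μ := μ) (D := D) ((hf.shift (-n)).mul hf) n] with x hx
  rw [← hx]
  simp only [neg_vadd_vadd, mul_comm]

lemma tendsto_avg_integral_ce_sq_mul (hf : BddMeas f) (h0 : ce μ (apFactor μ D) f =ᵐ[μ] 0)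
    {c : ℤ} (hc : c ≠ 0) :
    Tendsto (fun N : ℕ => (N : ℝ)⁻¹ * ∑ n ∈ Finset.range N,
      ∫ y, ce μ D (fun x => f x * f ((c * n : ℤ) +ᵥ x)) y ^ 2 ∂μ) atTop (𝓝 0) := by
  have h := tendsto_avg_mul (fun n => integral_nonneg fun y => sq_nonneg _)
    (tendsto_avg_integral_ce_sq (μ := μ) hf hf h0) (Int.natAbs_ne_zero.2 hc)
  refine h.congr fun N => ?_
  congr 1
  refine Finset.sum_congr rfl fun n _ => ?_
  have e : ∀ m : ℤ, (fun x => f x * f (m +ᵥ x)) = fun x => f (m +ᵥ x) * f x :=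
    fun m => funext fun x => mul_comm _ _
  rw [e]
  rcases Int.natAbs_eq c with hc' | hc'
  · rw [Nat.cast_mul, ← hc']
  · rw [← integral_ce_sq_neg hf, Nat.cast_mul, ← neg_mul, ← hc']

/-- The product `∏ᵢ fᵢ (pᵢ + x)`. -/
def patt {ι : Type} [Fintype ι] (f : ι → X → ℝ) (p : ι → ℤ) (x : X) : ℝ := ∏ i, f i (p i +ᵥ x)

section Patt
variable {ι : Type} [Fintype ι] {f : ι → X → ℝ} {p : ι → ℤ}

lemma patt_bddMeas (hf : ∀ i, BddMeas (f i)) : BddMeas (patt f p) :=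
  BddMeas.prod fun i _ => (hf i).shift _

lemma exists_bound (hf : ∀ i, BddMeas (f i)) : ∃ C, 1 ≤ C ∧ ∀ i x, |f i x| ≤ C := by
  choose C hC using fun i => (hf i).bdd
  have h0 : 0 ≤ ∑ i, |C i| := Finset.sum_nonneg fun i _ => abs_nonneg (C i)
  refine ⟨1 + ∑ i, |C i|, by linarith, fun i x => (hC i x).trans ?_⟩
  have := Finset.single_le_sum (f := fun i => |C i|) (fun i _ => abs_nonneg (C i))
    (Finset.mem_univ i)
  linarith [le_abs_self (C i)]

lemma abs_patt_le {C : ℝ} (hC : ∀ i x, |f i x| ≤ C) (x : X) :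
    |patt f p x| ≤ C ^ Fintype.card ι := by
  rw [patt, Finset.abs_prod]
  refine (Finset.prod_le_prod (fun i _ => abs_nonneg _) fun i _ => hC i _).trans (le_of_eq ?_)
  simp

variable [DecidableEq ι]

lemma patt_update (j : ι) (φ : X → ℝ) (x : X) :
    patt (Function.update f j φ) p x
      = φ (p j +ᵥ x) * ∏ i : {i // i ≠ j}, f i (p i +ᵥ x) := by
  rw [patt, Fintype.prod_eq_mul_prod_subtype_ne _ j, Function.update_self]
  congr 1
  exact Finset.prod_congr rfl fun i _ => by rw [Function.update_of_ne i.2]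

lemma patt_eq_update_add (j : ι) (φ : X → ℝ) (x : X) :
    patt f p x = patt (Function.update f j φ) p x
      + patt (Function.update f j fun x => f j x - φ x) p x := by
  rw [patt_update, patt_update, patt, Fintype.prod_eq_mul_prod_subtype_ne _ j]
  ring

lemma update_bddMeas (hf : ∀ i, BddMeas (f i)) (j : ι) {φ : X → ℝ} (hφ : BddMeas φ) (i : ι) :
    BddMeas (Function.update f j φ i) := by
  rcases eq_or_ne i j with rfl | h
  · rwa [Function.update_self]
  · rw [Function.update_of_ne h]
    exact hf i

lemma abs_integral_patt_update_le {C : ℝ} (h1 : 1 ≤ C) (hf : ∀ i, BddMeas (f i))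
    (hC : ∀ i x, |f i x| ≤ C)
    (j : ι) {φ : X → ℝ} (hφ : BddMeas φ) :
    |∫ x, patt (Function.update f j φ) p x ∂μ|
      ≤ C ^ Fintype.card ι * Real.sqrt (∫ x, φ x ^ 2 ∂μ) := by
  have hb : BddMeas fun x => ∏ i : {i // i ≠ j}, f i (p i +ᵥ x) :=
    BddMeas.prod fun i _ => (hf i).shift _
  have h := BddMeas.sq_integral_mul_le (hφ.shift (p j)) hb μ
  rw [integral_shift (μ := μ) (fun x => φ x ^ 2)] at h
  have hle : ∫ x, (∏ i : {i // i ≠ j}, f i (p i +ᵥ x)) ^ 2 ∂μ ≤ (C ^ Fintype.card ι) ^ 2 := by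
    refine (le_abs_self _).trans (BddMeas.abs_integral_le fun x => ?_)
    rw [abs_pow]
    refine pow_le_pow_left₀ (abs_nonneg _) ?_ 2
    rw [Finset.abs_prod]
    refine (Finset.prod_le_prod (fun i _ => abs_nonneg _) fun i _ => hC i.1 _).trans ?_
    rw [Finset.prod_const, Finset.card_univ]
    exact pow_le_pow_right₀ h1 <| Fintype.card_subtype_le _
  simp only [patt_update]
  refine (Real.abs_le_sqrt (h.trans (mul_le_mul_of_nonneg_left hle
    (integral_nonneg fun x => sq_nonneg _)))).trans (le_of_eq ?_)
  rw [mul_comm, Real.sqrt_mul (by positivity), Real.sqrt_sq (by positivity)]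

end Patt

/-- The trivial factor. -/
def trivialFactor (X : Type) [mX : MeasurableSpace X] [AddAction ℤ X] : Factor X where
  alg := ⊥
  le := bot_le
  inv n s hs := by
    rcases MeasurableSpace.measurableSet_bot_iff.1 hs with rfl | rfl <;> simp

/-- The tower of relatively almost periodic extensions. -/
noncomputable def tower (μ : Measure X) [IsProbabilityMeasure μ] [VAddInvariantMeasure ℤ X μ] :
    ℕ → Factor X
  | 0 => trivialFactor X
  | r + 1 => apFactor μ (tower μ r)

/-- Weak convergence to zero of linear averages with `r + 1` terms. -/
def LinWeak (μ : Measure X) [IsProbabilityMeasure μ] [VAddInvariantMeasure ℤ X μ] (r : ℕ) : Prop :=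
  ∀ (ι : Type) [Fintype ι] (c : ι → ℤ) (f : ι → X → ℝ) (j : ι), Fintype.card ι = r + 1 →
    Function.Injective c → (∀ i, BddMeas (f i)) → ce μ (tower μ r) (f j) =ᵐ[μ] 0 →
    Tendsto (fun N : ℕ => (N : ℝ)⁻¹ * ∑ n ∈ Finset.range N,
      ∫ x, patt f (fun i => c i * n) x ∂μ) atTop (𝓝 0)

/-- Norm convergence to zero of linear averages with `r` terms. -/
def LinNorm (μ : Measure X) [IsProbabilityMeasure μ] [VAddInvariantMeasure ℤ X μ] (r : ℕ) : Prop :=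
  ∀ (ι : Type) [Fintype ι] (c : ι → ℤ) (f : ι → X → ℝ) (j : ι), Fintype.card ι = r →
    Function.Injective c → (∀ i, c i ≠ 0) → (∀ i, BddMeas (f i)) →
    ce μ (tower μ r) (f j) =ᵐ[μ] 0 → AvgZero μ fun n => patt f fun i => c i * n

lemma linWeak_zero : LinWeak μ 0 := by
  intro ι _ c f j hcard _ hf h0
  have h1 : ∀ i, i = j := fun i => (Fintype.card_le_one_iff.1 hcard.le) i j
  have h2 : ∀ n : ℕ, ∫ x, patt f (fun i => c i * n) x ∂μ = 0 := by
    intro n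
    have : ∀ x, patt f (fun i => c i * n) x = f j ((c j * n : ℤ) +ᵥ x) := fun x => by
      rw [patt, Fintype.prod_eq_single j fun i hi => (hi (h1 i)).elim]
    simp only [this]
    rw [integral_shift, ← integral_ce (D := tower μ 0) (hf j), integral_congr_ae h0]
    simp
  simp [h2]

lemma LinNorm.linWeak {r : ℕ} (hr : 1 ≤ r) (h : LinNorm μ r) : LinWeak μ r := by
  classical
  intro ι _ c f j hcard hc hf h0
  obtain ⟨i₀, hi₀⟩ : ∃ i₀, j ≠ i₀ := by
    by_contra! hne
    have := Fintype.card_le_one_iff.2 fun a b => (hne a).symm.trans (hne b)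
    omega
  have hcard' : Fintype.card {i // i ≠ i₀} = r := by
    have := Fintype.card_subtype_compl (fun i => i = i₀)
    simp only [Fintype.card_unique, hcard] at this
    exact this
  have hinj : Function.Injective fun i : {i // i ≠ i₀} => c i - c i₀ :=
    fun a b hab => Subtype.ext (hc (sub_left_inj.1 hab))
  have key := h {i // i ≠ i₀} (fun i => c i - c i₀) (fun i => f i) ⟨j, hi₀⟩ hcard' hinj
    (fun i => sub_ne_zero.2 fun e => i.2 (hc e)) (fun i => hf i) h0
  have hpt : ∀ (n : ℕ) (x : X), f i₀ x * patt (fun i : {i // i ≠ i₀} => f i)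
      (fun i => (c i - c i₀) * n) x = patt f (fun i => c i * n) (-(c i₀ * n) +ᵥ x) := by
    intro n x
    rw [patt, patt, Fintype.prod_eq_mul_prod_subtype_ne _ i₀, vadd_vadd, add_neg_cancel, zero_vadd]
    congr 1
    refine Finset.prod_congr rfl fun i _ => ?_
    rw [vadd_vadd, sub_mul, sub_eq_add_neg]
  have hu : ∀ n : ℕ, BddMeas (patt (fun i : {i // i ≠ i₀} => f i)
      fun i => (c i - c i₀) * n) := fun n => patt_bddMeas fun i => hf i
  have key2 := key.tendsto_integral_mul hu (hf i₀)
  refine key2.congr fun N => ?_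
  congr 1
  refine Finset.sum_congr rfl fun n _ => ?_
  simp only [hpt]
  exact integral_shift (μ := μ) (patt f fun i => c i * n) _

lemma tendsto_avg_zero_split {u v w : ℕ → ℝ} {a : ℝ} (h : ∀ n, u n = v n + w n)
    (hv : ∀ n, |v n| ≤ a)
    (hw : Tendsto (fun N : ℕ => (N : ℝ)⁻¹ * ∑ n ∈ Finset.range N, w n) atTop (𝓝 0)) {ε : ℝ}
    (hε : 0 < ε) : ∀ᶠ N : ℕ in atTop, (N : ℝ)⁻¹ * ∑ n ∈ Finset.range N, u n ≤ a + ε := by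
  filter_upwards [hw.eventually_lt_const hε] with N hN
  simp only [h, Finset.sum_add_distrib, mul_add]
  have := (le_abs_self _).trans (abs_avg_le hv N)
  linarith

lemma patt_mul_patt {ι : Type} [Fintype ι] {f : ι → X → ℝ} {p q : ι → ℤ} (x : X) :
    patt f p x * patt f q x = patt (fun i x => f i x * f i ((q i - p i) +ᵥ x)) p x := by
  simp only [patt, ← Finset.prod_mul_distrib, vadd_vadd, sub_add_cancel]

lemma ce_sub_ce (hf : BddMeas f) : ce μ D (fun x => f x - ce μ D f x) =ᵐ[μ] 0 := by
  filter_upwards [ae_eq_ce (μ := μ) (ce_bddMeas (μ := μ) (D := D) hf) (ce_bddMeas hf) (ce_measurable hf)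
    fun s _ => rfl] with x hx
  rw [ce_sub hf (ce_bddMeas hf), ← hx]
  simp

lemma LinWeak.linNorm {r : ℕ} (h : LinWeak μ r) : LinNorm μ (r + 1) := by
  classical
  intro ι _ c f j hcard hc hc0 hf h0
  obtain ⟨C, hC1, hC⟩ := exists_bound hf
  have hF : ∀ (h : ℕ) (i : ι), BddMeas fun x => f i x * f i ((c i * h : ℤ) +ᵥ x) :=
    fun h i => (hf i).mul ((hf i).shift _)
  have hFC : ∀ (h : ℕ) (i : ι) x, |f i x * f i ((c i * h : ℤ) +ᵥ x)| ≤ C * C := fun h i x => by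
    rw [abs_mul]
    exact mul_le_mul (hC _ _) (hC _ _) (abs_nonneg _) (by linarith)
  have hCC : 1 ≤ C * C := by nlinarith
  refine avgZero_of_vdC (fun n => patt_bddMeas hf) (fun n x => abs_patt_le hC x)
    (a := fun h => (C * C) ^ Fintype.card ι * Real.sqrt (∫ y, ce μ (tower μ r)
      (fun x => f j x * f j ((c j * h : ℤ) +ᵥ x)) y ^ 2 ∂μ)) (fun h => by positivity)
    (fun k ε hε => ?_) ?_
  · set F : ι → X → ℝ := fun i x => f i x * f i ((c i * k : ℤ) +ᵥ x) with hFdef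
    set φ := ce μ (tower μ r) (F j)
    have hφ : BddMeas φ := ce_bddMeas (hF k j)
    refine tendsto_avg_zero_split
      (v := fun n => ∫ x, patt (Function.update F j φ) (fun i => c i * n) x ∂μ)
      (w := fun n => ∫ x, patt (Function.update F j fun x => F j x - φ x) (fun i => c i * n) x ∂μ)
      (fun n => ?_) (fun n => ?_) ?_ hε
    · rw [← integral_add ((patt_bddMeas (update_bddMeas (hF k) j hφ)).integrable μ)
        ((patt_bddMeas (update_bddMeas (hF k) j ((hF k j).sub hφ))).integrable μ)]
      congr 1
      ext x
      rw [patt_mul_patt, ← patt_eq_update_add]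
      simp only [Nat.cast_add, mul_add, add_sub_cancel_left]
    · exact abs_integral_patt_update_le hCC (hF k) (hFC k) j hφ
    · refine h ι c _ j hcard hc (update_bddMeas (hF k) j ((hF k j).sub hφ)) ?_
      rw [Function.update_self]
      exact ce_sub_ce (hF k j)
  · have := (tendsto_avg_sqrt (fun n => integral_nonneg fun y => sq_nonneg _)
      (tendsto_avg_integral_ce_sq_mul (μ := μ) (D := tower μ r) (hf j) h0 (hc0 j))).const_mul
        ((C * C) ^ Fintype.card ι)
    rw [mul_zero] at this
    refine this.congr fun H => ?_
    rw [Finset.mul_sum, Finset.mul_sum, Finset.mul_sum]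
    exact Finset.sum_congr rfl fun n _ => by ring

theorem linWeak (r : ℕ) : LinWeak μ r := by
  induction r with
  | zero => exact linWeak_zero
  | succ r ih => exact ih.linNorm.linWeak (by omega)

end Linear

section Quadratic
variable {X : Type} [mX : MeasurableSpace X] [AddAction ℤ X] [MeasurableConstVAdd ℤ X]
  [StandardBorelSpace X] {μ : Measure X} [IsProbabilityMeasure μ] [VAddInvariantMeasure ℤ X μ]

section Double
variable {ι : Type} {c : ℤ} {s : ι → ℤ}

lemma injective_double (hs : Function.Injective s) {d : ℤ} (hd : ∀ i j, s i ≠ s j + d) :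
    Function.Injective (Sum.elim s fun i => s i + d) := by
  rintro (i | i) (j | j) hij
  · exact congrArg _ (hs hij)
  · exact (hd _ _ hij).elim
  · exact (hd _ _ hij.symm).elim
  · exact congrArg _ (hs (add_right_cancel hij))

lemma eventually_separated [Finite ι] (hc : c ≠ 0) :
    ∀ᶠ h : ℕ in atTop, ∀ i j, s i ≠ s j + 2 * c * h := by
  rw [eventually_all]
  intro i
  rw [eventually_all]
  intro j
  filter_upwards [eventually_gt_atTop (s i - s j).natAbs] with h hh heq
  have h1 : s i - s j = 2 * c * h := by rw [heq]; ring
  rw [h1, Int.natAbs_mul, Int.natAbs_mul, Int.natAbs_natCast] at hh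
  have h2 : 1 ≤ c.natAbs := Int.natAbs_pos.2 hc
  have h3 : (2 : ℤ).natAbs = 2 := rfl
  rw [h3] at hh
  nlinarith

end Double

lemma patt_sum {ι : Type} [Fintype ι] (f g : ι → X → ℝ) (p q : ι → ℤ) (x : X) :
    patt (Sum.elim f g) (Sum.elim p q) x = patt f p x * patt g q x := by
  simp [patt, Fintype.prod_sum_type]

lemma patt_shift {ι : Type} [Fintype ι] (f : ι → X → ℝ) (p : ι → ℤ) (m : ℤ) (x : X) :
    patt f p (m +ᵥ x) = patt f (fun i => p i + m) x := by
  simp [patt, vadd_vadd]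

lemma patt_const_shift {ι : Type} [Fintype ι] (f : ι → X → ℝ) (p q : ι → ℤ) (x : X) :
    patt (fun i y => f i (q i +ᵥ y)) p x = patt f (fun i => q i + p i) x := by
  simp [patt, vadd_vadd]

lemma avgZero_quadratic {ι : Type} [Fintype ι] {c : ℤ} (hc : c ≠ 0) {s : ι → ℤ}
    (hs : Function.Injective s) {f : ι → X → ℝ} (hf : ∀ i, BddMeas (f i)) {r : ℕ}
    (hr : 2 * Fintype.card ι = r + 1) (j : ι) (h0 : ce μ (tower μ r) (f j) =ᵐ[μ] 0) :
    AvgZero μ fun n => patt f fun i => c * n ^ 2 + s i * n := by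
  obtain ⟨C, -, hC⟩ := exists_bound hf
  refine avgZero_of_vdC_eventually (fun n => patt_bddMeas hf) (fun n x => abs_patt_le hC x) ?_
  filter_upwards [eventually_separated (s := s) hc] with h hh
  set F : ι ⊕ ι → X → ℝ := Sum.elim f fun i x => f i ((c * h ^ 2 + s i * h : ℤ) +ᵥ x) with hF
  have hFb : ∀ i, BddMeas (F i) := by
    rintro (i | i)
    · exact hf i
    · exact (hf i).shift _
  have key := linWeak (μ := μ) r (ι ⊕ ι) (Sum.elim s fun i => s i + 2 * c * h) F (Sum.inl j)
    (by rw [Fintype.card_sum]; omega) (injective_double hs hh) hFb h0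
  refine key.congr fun N => ?_
  congr 1
  refine Finset.sum_congr rfl fun n _ => ?_
  rw [← integral_shift (μ := μ) (patt F _) (c * n ^ 2)]
  congr 1
  ext x
  rw [patt_shift]
  have e : (fun i => (Sum.elim s (fun i => s i + 2 * c * h) : ι ⊕ ι → ℤ) i * (n : ℤ) + c * n ^ 2)
      = Sum.elim (fun i => s i * n + c * n ^ 2)
        (fun i => (s i + 2 * c * h) * n + c * n ^ 2) := by
    ext (i | i) <;> rfl
  rw [e, hF, patt_sum, patt_const_shift]
  congr 3 <;> ext i <;> push_cast <;> ring

lemma avgZero_linear_quadratic {ι : Type} [Fintype ι] {c : ℤ} (hc : c ≠ 0) {s : ι → ℤ}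
    (hs : Function.Injective s) {f : ι → X → ℝ} (hf : ∀ i, BddMeas (f i)) {r : ℕ}
    (hr : 4 * Fintype.card ι = r + 1) (j : ι) (h0 : ce μ (tower μ r) (f j) =ᵐ[μ] 0)
    {g : X → ℝ} (hg : BddMeas g) (ℓ : ℤ) :
    AvgZero μ fun n x => g ((ℓ * n : ℤ) +ᵥ x) * patt f (fun i => c * n ^ 2 + s i * n) x := by
  obtain ⟨C, -, hC⟩ := exists_bound hf
  obtain ⟨C', hC'0, hC'⟩ := hg.exists_pos
  refine avgZero_of_vdC_eventually (fun n => (hg.shift _).mul (patt_bddMeas hf)) (C :=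
    C' * C ^ Fintype.card ι)
    (fun n x => by
      rw [abs_mul]
      exact mul_le_mul (hC' _) (abs_patt_le hC x) (abs_nonneg _) hC'0.le) ?_
  filter_upwards [eventually_separated (s := s) hc] with h hh
  set F : ι ⊕ ι → X → ℝ := Sum.elim f fun i x => f i ((c * h ^ 2 + s i * h : ℤ) +ᵥ x) with hF
  have hFb : ∀ i, BddMeas (F i) := by
    rintro (i | i)
    · exact hf i
    · exact (hf i).shift _
  have hinj : Function.Injective
      (fun i => (Sum.elim s fun i => s i + 2 * c * h : ι ⊕ ι → ℤ) i - ℓ) :=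
    fun i j hij => injective_double hs hh (sub_left_inj.1 hij)
  have key := avgZero_quadratic (μ := μ) hc hinj hFb (r := r) (by rw [Fintype.card_sum]; omega)
    (Sum.inl j) h0
  have hG : BddMeas fun x => g x * g ((ℓ * h : ℤ) +ᵥ x) := hg.mul (hg.shift _)
  have hub : ∀ n : ℕ, BddMeas (patt F fun i => c * n ^ 2 +
    ((Sum.elim s fun i => s i + 2 * c * h : ι ⊕ ι → ℤ) i - ℓ) * n) := fun n => patt_bddMeas hFb
  have key2 := key.tendsto_integral_mul hub hG
  refine key2.congr fun N => ?_
  congr 1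
  refine Finset.sum_congr rfl fun n _ => ?_
  rw [← integral_shift (μ := μ) _ (ℓ * n)]
  congr 1
  ext x
  rw [patt_shift]
  have e : (fun i => c * (n : ℤ) ^ 2 +
        ((Sum.elim s fun i => s i + 2 * c * h : ι ⊕ ι → ℤ) i - ℓ) * n + ℓ * n)
      = Sum.elim (fun i => c * (n : ℤ) ^ 2 + s i * n)
        (fun i => c * (n : ℤ) ^ 2 + (s i + 2 * c * h) * n) := by
    ext (i | i) <;> simp <;> ring
  have e2 : (fun i => c * ((n + h : ℕ) : ℤ) ^ 2 + s i * ((n + h : ℕ) : ℤ))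
      = fun i => c * h ^ 2 + s i * h + (c * (n : ℤ) ^ 2 + (s i + 2 * c * h) * n) := by
    ext i
    push_cast
    ring
  have e3 : (ℓ * ((n + h : ℕ) : ℤ)) = ℓ * h + ℓ * n := by push_cast; ring
  rw [e, hF, patt_sum, patt_const_shift, e2, e3, vadd_vadd]
  ring

/-- The tower of height seven is characteristic for the averages `f₁(an² + x) f₂(bn² + x)`. -/
theorem avgZero_square_pair {a b : ℤ} (hb : b ≠ 0) (hab : a ≠ b) {f₁ f₂ : X → ℝ}
    (h₁ : BddMeas f₁) (h₂ : BddMeas f₂) (h0 : ce μ (tower μ 7) f₂ =ᵐ[μ] 0) :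
    AvgZero μ fun n x => f₁ ((a * n ^ 2 : ℤ) +ᵥ x) * f₂ ((b * n ^ 2 : ℤ) +ᵥ x) := by
  obtain ⟨C, hC0, hC⟩ := h₁.exists_pos
  obtain ⟨C', hC'0, hC'⟩ := h₂.exists_pos
  refine avgZero_of_vdC_eventually (fun n => (h₁.shift _).mul (h₂.shift _)) (C := C * C')
    (fun n x => by
      rw [abs_mul]
      exact mul_le_mul (hC _) (hC' _) (abs_nonneg _) hC0.le) ?_
  filter_upwards [eventually_ge_atTop 1] with h hh
  set F : Bool → X → ℝ := fun i => if i then f₂ else fun x => f₂ ((b * h ^ 2 : ℤ) +ᵥ x) with hF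
  have hFb : ∀ i, BddMeas (F i) := by
    rintro (_ | _)
    · exact h₂.shift _
    · exact h₂
  have hinj : Function.Injective (fun i : Bool => if i then (0 : ℤ) else 2 * b * h) := by
    have : 2 * b * h ≠ 0 := mul_ne_zero (mul_ne_zero two_ne_zero hb) (by exact_mod_cast by omega)
    rintro (_ | _) (_ | _) hij <;> simp_all
  have key := avgZero_linear_quadratic (μ := μ) (sub_ne_zero.2 hab.symm) hinj hFb (r := 7)
    (by simp) true h0 (h₁.shift (a * h ^ 2)) (2 * a * h)
  have hub : ∀ n : ℕ, BddMeas fun x => f₁ ((a * h ^ 2 : ℤ) +ᵥ (2 * a * h * n : ℤ) +ᵥ x) *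
      patt F (fun i => (b - a) * n ^ 2 + (if i then (0 : ℤ) else 2 * b * h) * n) x :=
    fun n => (((h₁.shift _)).shift _).mul (patt_bddMeas hFb)
  have key2 := key.tendsto_integral_mul hub h₁
  refine key2.congr fun N => ?_
  congr 1
  refine Finset.sum_congr rfl fun n _ => ?_
  rw [← integral_shift (μ := μ) _ (a * n ^ 2)]
  congr 1
  ext x
  have e1 : (a * h ^ 2 + (2 * a * h * n + a * n ^ 2) : ℤ) = a * ((n + h : ℕ) : ℤ) ^ 2 := by
    push_cast; ring
  have e2 : (b * h ^ 2 + ((b - a) * n ^ 2 + 2 * b * h * n + a * n ^ 2) : ℤ)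
      = b * ((n + h : ℕ) : ℤ) ^ 2 := by push_cast; ring
  have e3 : ((b - a) * n ^ 2 + 0 * n + a * n ^ 2 : ℤ) = b * n ^ 2 := by ring
  simp only [patt, Fintype.prod_bool, hF, vadd_vadd, if_true, Bool.false_eq_true,
    if_false, e1, e2, e3]
  ring

end Quadratic

section Recurrence
variable {X : Type} [mX : MeasurableSpace X] [AddAction ℤ X] [MeasurableConstVAdd ℤ X]
  [StandardBorelSpace X] {μ : Measure X} [IsProbabilityMeasure μ] [VAddInvariantMeasure ℤ X μ]
  {D : Factor X}

/-- The points all of whose first translates along multiples of `d` lie in `A`. -/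
def progSet (A : Set X) (J : ℕ) (d : ℤ) : Set X := {x | ∀ j : ℕ, j ≤ J → (j * d) +ᵥ x ∈ A}

lemma progSet_measurable {A : Set X} (hA : MeasurableSet A) (J : ℕ) (d : ℤ) :
    MeasurableSet (progSet A J d) := by
  have : progSet A J d = ⋂ j : ℕ, ⋂ _ : j ≤ J, (((j * d : ℤ) +ᵥ ·) ⁻¹' A) := by
    ext x
    simp [progSet]
  rw [this]
  exact MeasurableSet.iInter fun j => MeasurableSet.iInter fun _ =>
    (measurable_const_vadd _) hA

/-- Multiple recurrence along square steps for the sets of a factor, uniformly in dilations. -/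
def SquareRecurrent (μ : Measure X) (D : Factor X) : Prop :=
  ∀ A : Set X, MeasurableSet[D.alg] A → 0 < μ.real A → ∀ J : ℕ, ∃ M : ℕ, ∃ c > 0, ∀ k : ℕ, 1 ≤ k →
    ∃ m : ℕ, 1 ≤ m ∧ m ≤ M ∧ c ≤ μ.real (progSet A J ((k * m : ℕ) ^ 2 : ℤ))

lemma squareRecurrent_trivialFactor : SquareRecurrent μ (trivialFactor X) := by
  intro A hA hpos J
  rcases MeasurableSpace.measurableSet_bot_iff.1 hA with rfl | rfl
  · simp at hpos
  · exact ⟨1, 1, one_pos, fun k _ => ⟨1, le_rfl, le_rfl, by simp [progSet]⟩⟩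

lemma measureReal_superlevel_pos {f : X → ℝ} (hf : BddMeas f) (h1 : ∀ x, f x ≤ 1) {a : ℝ}
    (ha : a ≤ ∫ x, f x ∂μ) : a / 2 ≤ μ.real {x | a / 2 ≤ f x} ∨ a ≤ 0 := by
  by_cases h0 : a ≤ 0
  · exact Or.inr h0
  refine Or.inl ?_
  have hm : MeasurableSet {x | a / 2 ≤ f x} := measurableSet_le measurable_const hf.meas
  have hb := BddMeas.indicator (X := X) hm
  have h2 : ∫ x, f x ∂μ ≤ ∫ x, ({x | a / 2 ≤ f x}.indicator (1 : X → ℝ) x + a / 2) ∂μ := by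
    refine integral_mono (hf.integrable μ) ((hb.add (BddMeas.const _)).integrable μ) fun x => ?_
    by_cases hx : a / 2 ≤ f x
    · have : {x | a / 2 ≤ f x}.indicator (1 : X → ℝ) x = 1 := Set.indicator_of_mem (s := {x | a / 2 ≤ f x}) hx _
      simp only [this]
      linarith [h1 x]
    · have : {x | a / 2 ≤ f x}.indicator (1 : X → ℝ) x = 0 := Set.indicator_of_notMem (s := {x | a / 2 ≤ f x}) hx _
      simp only [this]
      linarith
  rw [integral_add (hb.integrable μ) (integrable_const _), integral_indicator_one hm] at h2
  simp at h2
  linarith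

/-- Comparison of translates of an indicator with a common approximant. -/
lemma ce_inter_ge {A : Set X} (hA : MeasurableSet A) {J : ℕ} {p : ℕ → ℤ} {g : X → ℝ}
    (hg : BddMeas g) {ε : ℝ} {y : X}
    (h : ∀ i ≤ J, ce μ D (fun x => (A.indicator (1 : X → ℝ) (p i +ᵥ x) - g x) ^ 2) y ≤ ε) :
    ce μ D (fun x => A.indicator (1 : X → ℝ) (p 0 +ᵥ x)) y - ((J : ℝ) + (1 : ℝ)) * ((4 : ℝ) * ε)
      ≤ ce μ D ({x | ∀ i ≤ J, p i +ᵥ x ∈ A}.indicator 1) y := by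
  have hb : BddMeas (A.indicator (1 : X → ℝ)) := BddMeas.indicator hA
  have hmeas : MeasurableSet {x | ∀ i ≤ J, p i +ᵥ x ∈ A} := by
    have : {x | ∀ i ≤ J, p i +ᵥ x ∈ A} = ⋂ j : ℕ, ⋂ _ : j ≤ J, ((p j +ᵥ ·) ⁻¹' A) := by
      ext x
      simp
    rw [this]
    exact MeasurableSet.iInter fun j => MeasurableSet.iInter fun _ =>
      (measurable_const_vadd _) hA
  have hd : ∀ i, BddMeas fun x => (A.indicator (1 : X → ℝ) (p i +ᵥ x) - g x) ^ 2 :=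
    fun i => ((hb.shift _).sub hg).pow 2
  have hS : BddMeas fun x => ∑ i ∈ Finset.range (J + 1),
      ((2 : ℝ) * (A.indicator (1 : X → ℝ) (p i +ᵥ x) - g x) ^ 2
        + (2 : ℝ) * (A.indicator (1 : X → ℝ) (p 0 +ᵥ x) - g x) ^ 2) :=
    BddMeas.sum fun i _ => ((hd i).const_mul 2).add ((hd 0).const_mul 2)
  have key := ce_mono (μ := μ) (D := D) (hb.shift (p 0))
    ((BddMeas.indicator (X := X) hmeas).add hS) (fun x => ?_) y
  · rw [ce_add (BddMeas.indicator hmeas) hS, ce_sum fun i _ =>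
      ((hd i).const_mul 2).add ((hd 0).const_mul 2)] at key
    have hle : ∀ i ∈ Finset.range (J + 1), ce μ D (fun x =>
        (2 : ℝ) * (A.indicator (1 : X → ℝ) (p i +ᵥ x) - g x) ^ 2
        + (2 : ℝ) * (A.indicator (1 : X → ℝ) (p 0 +ᵥ x) - g x) ^ 2) y ≤ 4 * ε := by
      intro i hi
      rw [ce_add ((hd i).const_mul 2) ((hd 0).const_mul 2), ce_const_mul, ce_const_mul]
      linarith [h i (Nat.lt_succ_iff.1 (Finset.mem_range.1 hi)), h 0 (Nat.zero_le _)]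
    have := Finset.sum_le_sum hle
    rw [Finset.sum_const, Finset.card_range, nsmul_eq_mul] at this
    push_cast at this
    linarith
  · have hpos : ∀ i ∈ Finset.range (J + 1), 0 ≤
        (2 : ℝ) * (A.indicator (1 : X → ℝ) (p i +ᵥ x) - g x) ^ 2
        + (2 : ℝ) * (A.indicator (1 : X → ℝ) (p 0 +ᵥ x) - g x) ^ 2 := fun i _ => by positivity
    by_cases hx : ∀ i ≤ J, p i +ᵥ x ∈ A
    · have h1 : {x | ∀ i ≤ J, p i +ᵥ x ∈ A}.indicator (1 : X → ℝ) x = 1 :=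
        Set.indicator_of_mem (s := {x | ∀ i ≤ J, p i +ᵥ x ∈ A}) hx _
      rw [h1]
      have h2 : A.indicator (1 : X → ℝ) (p 0 +ᵥ x) ≤ 1 :=
        Set.indicator_le' (fun _ _ => le_rfl) (fun _ _ => zero_le_one) _
      linarith [Finset.sum_nonneg hpos]
    · rw [Set.indicator_of_notMem (s := {x | ∀ i ≤ J, p i +ᵥ x ∈ A}) hx, zero_add]
      push Not at hx
      obtain ⟨i, hi, hiA⟩ := hx
      refine le_trans ?_ (Finset.single_le_sum hpos (Finset.mem_range.2 (Nat.lt_succ_of_le hi)))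
      rw [Set.indicator_of_notMem hiA]
      by_cases h0 : p 0 +ᵥ x ∈ A
      · rw [Set.indicator_of_mem h0]
        simp only [Pi.one_apply]
        nlinarith [sq_nonneg (2 * g x - 1)]
      · rw [Set.indicator_of_notMem h0]
        positivity

theorem SquareRecurrent.apFactor (hD : SquareRecurrent μ D) :
    SquareRecurrent μ (apFactor μ D) := by
  classical
  intro A hA hpos J
  obtain ⟨hAm, hAP⟩ : MeasurableSet A ∧ AlmostPeriodic μ D (A.indicator 1) := hA
  set a := μ.real A with ha
  have hb : BddMeas (A.indicator (1 : X → ℝ)) := BddMeas.indicator hAm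
  set h := ce μ D (A.indicator 1) with hh
  have hhb : BddMeas h := ce_bddMeas hb
  have hint : ∫ x, h x ∂μ = a := by rw [integral_ce hb, integral_indicator_one hAm]
  have hh1 : ∀ x, h x ≤ 1 := fun x => (le_abs_self _).trans (ce_abs_le (fun x => by
    by_cases hx : x ∈ A <;> simp [hx]) x)
  set ε := a / (16 * (J + 1)) with hε
  have hεpos : 0 < ε := by positivity
  have hεa : ε ≤ a / 4 := by
    rw [hε]
    gcongr
    nlinarith [(Nat.cast_nonneg J : (0 : ℝ) ≤ J)]
  obtain ⟨Γ, hΓfin, hΓ, E, hE, hEε, happ⟩ := hAP.approx ε hεpos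
  set A₀ : Set X := {x | a / 2 ≤ h x} \ E with hA₀
  have hA₁m : MeasurableSet[D.alg] {x | a / 2 ≤ h x} :=
    @measurableSet_le _ _ _ _ _ D.alg _ _ _ _ _ (@measurable_const _ _ _ D.alg _)
      (ce_measurable hb)
  have hA₀m : MeasurableSet[D.alg] A₀ := hA₁m.diff hE
  have hA₀pos : 0 < μ.real A₀ := by
    have h1 := (measureReal_superlevel_pos (μ := μ) hhb hh1 hint.ge).resolve_right
      (not_le.2 hpos)
    have h2 := le_measureReal_sdiff (μ := μ) (s₁ := {x | a / 2 ≤ h x}) (s₂ := E)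
    linarith
  have : Finite Γ := hΓfin
  obtain ⟨J', hJ'⟩ := exists_mono_square_step (Option Γ) J
  obtain ⟨M, c, hc, hrec⟩ := hD A₀ hA₀m hA₀pos J'
  refine ⟨J' * M, a / 4 * c / ((J' + 1) * (J' + 1)), by positivity, fun k hk => ?_⟩
  obtain ⟨m, hm1, hmM, hm⟩ := hrec k hk
  set d : ℤ := ((k * m : ℕ) ^ 2 : ℤ) with hd
  set S : ℕ → ℕ → Set X := fun u v => {x | ∀ i ≤ J, (((u + i * v ^ 2 : ℕ) : ℤ) * d) +ᵥ x ∈ A}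
    with hS
  have hSm : ∀ u v, MeasurableSet (S u v) := by
    intro u v
    have : S u v = ⋂ i : ℕ, ⋂ _ : i ≤ J, (((((u + i * v ^ 2 : ℕ) : ℤ) * d) +ᵥ ·) ⁻¹' A) := by
      ext x
      simp [hS]
    rw [this]
    exact MeasurableSet.iInter fun j => MeasurableSet.iInter fun _ =>
      (measurable_const_vadd _) hAm
  have hpt : ∀ᵐ y ∂μ, y ∈ progSet A₀ J' d → ∃ u ∈ Finset.range (J' + 1),
      ∃ v ∈ Finset.Icc 1 J', a / 4 ≤ ce μ D ((S u v).indicator 1) y := by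
    have h1 : ∀ᵐ y ∂μ, ∀ n : ℤ, y ∉ E → n +ᵥ y ∉ E → ∃ g ∈ Γ,
        ce μ D (fun x => (A.indicator 1 (n +ᵥ x) - g x) ^ 2) y ≤ ε := ae_all_iff.2 happ
    have h2 : ∀ᵐ y ∂μ, ∀ n : ℤ, ce μ D (fun x => A.indicator 1 (n +ᵥ x)) y = h (n +ᵥ y) :=
      ae_all_iff.2 fun n => ce_shift hb n
    filter_upwards [h1, h2] with y hy1 hy2 hy
    have hcol : ∀ i : ℕ, ∃ g : Option Γ, i ≤ J' → ∃ g' : Γ, g = some g' ∧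
        ce μ D (fun x => (A.indicator 1 ((i * d : ℤ) +ᵥ x) - (g' : X → ℝ) x) ^ 2) y ≤ ε := by
      intro i
      by_cases hi : i ≤ J'
      · have hy0 := hy 0 (Nat.zero_le _)
        rw [Nat.cast_zero, zero_mul, zero_vadd] at hy0
        obtain ⟨g, hg, hgε⟩ := hy1 (i * d) hy0.2 (hy i hi).2
        exact ⟨some ⟨g, hg⟩, fun _ => ⟨_, rfl, hgε⟩⟩
      · exact ⟨none, fun h => (hi h).elim⟩
    choose col hcol using hcol
    obtain ⟨u, v, hv1, hvJ, huv, hmono⟩ := hJ' col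
    have hle : ∀ i ≤ J, u + i * v ^ 2 ≤ J' := fun i hi =>
      (Nat.add_le_add_left (Nat.mul_le_mul_right _ hi) u).trans huv
    refine ⟨u, Finset.mem_range.2 (by have := hle 0 (Nat.zero_le _); omega), v,
      Finset.mem_Icc.2 ⟨hv1, hvJ⟩, ?_⟩
    obtain ⟨g, hg, -⟩ := hcol u (by have := hle 0 (Nat.zero_le _); omega)
    have key := ce_inter_ge (μ := μ) (D := D) hAm (J := J)
      (p := fun i => ((u + i * v ^ 2 : ℕ) : ℤ) * d) (hΓ g g.2) (ε := ε) (y := y) fun i hi => by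
        obtain ⟨g', hg', hle'⟩ := hcol _ (hle i hi)
        rw [hmono i hi, hg] at hg'
        rwa [Option.some.inj hg']
    refine le_trans ?_ key
    have hu := (hy u (by have := hle 0 (Nat.zero_le _); omega)).1
    have e : (((u + 0 * v ^ 2 : ℕ) : ℤ) * d) = u * d := by simp
    simp only [e]
    rw [hy2]
    have hu' : a / 2 ≤ h ((u * d : ℤ) +ᵥ y) := hu
    have : ((J : ℝ) + 1) * (4 * ε) = a / 4 := by
      rw [hε]
      field_simp
      norm_num
    linarith
  have hB := progSet_measurable (D.le _ hA₀m) J' d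
  have hsum : a / 4 * c ≤ ∑ u ∈ Finset.range (J' + 1), ∑ v ∈ Finset.Icc 1 J', μ.real (S u v) := by
    have hSb : ∀ u v, BddMeas ((S u v).indicator (1 : X → ℝ)) := fun u v =>
      BddMeas.indicator (hSm u v)
    have hnn : ∀ u v y, 0 ≤ ce μ D ((S u v).indicator 1) y := fun u v y =>
      ce_nonneg (fun x => Set.indicator_nonneg (fun _ _ => zero_le_one) _) y
    have h1 : ∫ y, a / 4 * (progSet A₀ J' d).indicator (1 : X → ℝ) y ∂μ
        ≤ ∫ y, ∑ u ∈ Finset.range (J' + 1), ∑ v ∈ Finset.Icc 1 J',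
          ce μ D ((S u v).indicator 1) y ∂μ := by
      refine integral_mono_ae (((BddMeas.indicator hB).const_mul _).integrable μ)
        ((BddMeas.sum fun u _ => BddMeas.sum fun v _ => ce_bddMeas (hSb u v)).integrable μ) ?_
      filter_upwards [hpt] with y hy
      by_cases hyB : y ∈ progSet A₀ J' d
      · obtain ⟨u, hu, v, hv, huv⟩ := hy hyB
        rw [Set.indicator_of_mem hyB, Pi.one_apply, mul_one]
        refine huv.trans ((Finset.single_le_sum (f := fun v => ce μ D ((S u v).indicator 1) y)
          (fun v _ => hnn u v y) hv).trans (Finset.single_le_sum (f := fun u =>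
            ∑ v ∈ Finset.Icc 1 J', ce μ D ((S u v).indicator 1) y)
          (fun u _ => Finset.sum_nonneg fun v _ => hnn u v y) hu))
      · rw [Set.indicator_of_notMem hyB, mul_zero]
        exact Finset.sum_nonneg fun u _ => Finset.sum_nonneg fun v _ => hnn u v y
    rw [integral_const_mul, integral_indicator_one hB, integral_finsetSum _ fun u _ =>
      (BddMeas.sum fun v _ => ce_bddMeas (hSb u v)).integrable μ] at h1
    refine (mul_le_mul_of_nonneg_left hm (by positivity)).trans (h1.trans (le_of_eq ?_))
    refine Finset.sum_congr rfl fun u _ => ?_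
    rw [integral_finsetSum _ fun v _ => (ce_bddMeas (hSb u v)).integrable μ]
    refine Finset.sum_congr rfl fun v _ => ?_
    rw [integral_ce (hSb u v), integral_indicator_one (hSm u v)]
  obtain ⟨u, v, hv, huv⟩ : ∃ u, ∃ v ∈ Finset.Icc 1 J',
      a / 4 * c / ((J' + 1) * (J' + 1)) ≤ μ.real (S u v) := by
    by_contra! hlt
    have h1 : ∑ u ∈ Finset.range (J' + 1), ∑ v ∈ Finset.Icc 1 J', μ.real (S u v)
        ≤ ∑ u ∈ Finset.range (J' + 1), ∑ v ∈ Finset.Icc 1 J',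
          a / 4 * c / ((J' + 1) * (J' + 1)) :=
      Finset.sum_le_sum fun u _ => Finset.sum_le_sum fun v hv => (hlt u v hv).le
    simp only [Finset.sum_const, Finset.card_range, Nat.card_Icc, nsmul_eq_mul] at h1
    have h2 : ((J' + 1 : ℕ) : ℝ) * (((J' + 1 - 1 : ℕ) : ℝ) *
        (a / 4 * c / ((J' + 1) * (J' + 1)))) < a / 4 * c := by
      rw [Nat.add_sub_cancel]
      push_cast
      rw [show ((J' : ℝ) + 1) * (J' * (a / 4 * c / ((J' + 1) * (J' + 1))))
        = (a / 4 * c) * (J' / (J' + 1)) by field_simp]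
      have : (J' : ℝ) / (J' + 1) < 1 := by rw [div_lt_one (by positivity)]; linarith
      nlinarith [mul_pos (div_pos hpos (by norm_num : (0 : ℝ) < 4)) hc]
    linarith
  obtain ⟨hv1, hvJ⟩ := Finset.mem_Icc.1 hv
  refine ⟨v * m, Nat.mul_pos hv1 hm1, Nat.mul_le_mul hvJ hmM, huv.trans (le_of_eq ?_)⟩
  have hpre : S u v = ((u * d : ℤ) +ᵥ ·) ⁻¹' (progSet A J ((k * (v * m) : ℕ) ^ 2 : ℤ)) := by
    ext x
    simp only [hS, progSet, Set.mem_preimage, Set.mem_ofPred_eq, vadd_vadd]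
    refine forall₂_congr fun i _ => ?_
    have : ((u + i * v ^ 2 : ℕ) : ℤ) * d = i * ((k * (v * m) : ℕ) ^ 2 : ℤ) + u * d := by
      rw [hd]; push_cast; ring
    rw [this]
  rw [hpre, measureReal_def, measureReal_def, measure_preimage_vadd_of_nullMeasurableSet]
  exact (progSet_measurable hAm _ _).nullMeasurableSet

theorem squareRecurrent_tower (r : ℕ) : SquareRecurrent μ (tower μ r) := by
  induction r with
  | zero => exact squareRecurrent_trivialFactor
  | succ r ih => exact ih.apFactor

end Recurrence

section Positivity
variable {X : Type} [mX : MeasurableSpace X] [AddAction ℤ X] [MeasurableConstVAdd ℤ X]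
  [StandardBorelSpace X] {μ : Measure X} [IsProbabilityMeasure μ] [VAddInvariantMeasure ℤ X μ]
  {D : Factor X}

lemma integral_mul_eq_zero {e g : X → ℝ} (he : BddMeas e) (hg : BddMeas g)
    (hgD : Measurable[D.alg] g) (h0 : ce μ D e =ᵐ[μ] 0) : ∫ x, e x * g x ∂μ = 0 := by
  rw [← integral_ce_mul he hg hgD]
  refine integral_eq_zero_of_ae ?_
  filter_upwards [h0] with x hx
  simp [hx]

/-- The average of `f(x) f(16n² + x) f(25n² + x)` is controlled by the tower of height seven. -/
lemma tendsto_avg_pattern_sub {f : X → ℝ} (hf : BddMeas f) :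
    Tendsto (fun N : ℕ => (N : ℝ)⁻¹ * ∑ n ∈ Finset.range N,
      ((∫ x, f x * (f ((16 * n ^ 2 : ℤ) +ᵥ x) * f ((25 * n ^ 2 : ℤ) +ᵥ x)) ∂μ) -
        ∫ x, ce μ (tower μ 7) f x * (ce μ (tower μ 7) f ((16 * n ^ 2 : ℤ) +ᵥ x) *
          ce μ (tower μ 7) f ((25 * n ^ 2 : ℤ) +ᵥ x)) ∂μ)) atTop (𝓝 0) := by
  set g := ce μ (tower μ 7) f with hgdef
  have hg : BddMeas g := ce_bddMeas hf
  have hgD : Measurable[(tower μ 7).alg] g := ce_measurable hf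
  have he : BddMeas fun x => f x - g x := hf.sub hg
  have he0 : ce μ (tower μ 7) (fun x => f x - g x) =ᵐ[μ] 0 := ce_sub_ce hf
  have h1 := (avgZero_square_pair (μ := μ) (a := 16) (b := 25) (by norm_num) (by norm_num) hf he
    he0).tendsto_integral_mul (fun n => (hf.shift _).mul (he.shift _)) hf
  have h2 := (avgZero_square_pair (μ := μ) (a := 25) (b := 16) (by norm_num) (by norm_num) hg he
    he0).tendsto_integral_mul (fun n => (hg.shift _).mul (he.shift _)) hf
  have h := h1.add h2
  rw [add_zero] at h
  refine h.congr fun N => ?_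
  rw [← mul_add, ← Finset.sum_add_distrib]
  congr 1
  refine Finset.sum_congr rfl fun n _ => ?_
  set p : ℤ := 16 * n ^ 2
  set q : ℤ := 25 * n ^ 2
  have h3 : ∫ x, (f x - g x) * (g (p +ᵥ x) * g (q +ᵥ x)) ∂μ = 0 :=
    integral_mul_eq_zero he ((hg.shift p).mul (hg.shift q))
      (Measurable.mul (hgD.comp ((tower μ 7).measurable_shift p))
        (hgD.comp ((tower μ 7).measurable_shift q))) he0
  rw [← integral_sub ((hf.mul ((hf.shift p).mul (hf.shift q))).integrable μ)
    ((hg.mul ((hg.shift p).mul (hg.shift q))).integrable μ),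
    ← integral_add ((hf.mul ((hf.shift p).mul (he.shift q))).integrable μ)
    ((hf.mul ((hg.shift q).mul (he.shift p))).integrable μ), ← add_zero (∫ x, _ ∂μ), ← h3,
    ← integral_add (((hf.mul ((hf.shift p).mul (he.shift q))).add
    (hf.mul ((hg.shift q).mul (he.shift p)))).integrable μ)
    ((he.mul ((hg.shift p).mul (hg.shift q))).integrable μ)]
  congr 1
  ext x
  ring

theorem exists_square_pattern_recurrence {A : Set X} (hA : MeasurableSet A) (hpos : 0 < μ.real A) :
    ∃ n : ℕ, 1 ≤ n ∧ 0 < μ.real {x | x ∈ A ∧ (16 * n ^ 2 : ℤ) +ᵥ x ∈ A ∧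
      (25 * n ^ 2 : ℤ) +ᵥ x ∈ A} := by
  by_contra! hno
  set f : X → ℝ := A.indicator 1 with hfdef
  have hf : BddMeas f := BddMeas.indicator hA
  set g := ce μ (tower μ 7) f with hgdef
  have hg : BddMeas g := ce_bddMeas hf
  have hf0 : ∀ x, 0 ≤ f x := fun x => Set.indicator_nonneg (fun _ _ => zero_le_one) _
  have hf1 : ∀ x, |f x| ≤ 1 := fun x => by by_cases hx : x ∈ A <;> simp [hfdef, hx]
  have hg0 : ∀ x, 0 ≤ g x := fun x => ce_nonneg hf0 x
  have hg1 : ∀ x, g x ≤ 1 := fun x => (le_abs_self _).trans (ce_abs_le hf1 x)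
  have hzero : ∀ n : ℕ, 1 ≤ n →
      ∫ x, f x * (f ((16 * n ^ 2 : ℤ) +ᵥ x) * f ((25 * n ^ 2 : ℤ) +ᵥ x)) ∂μ = 0 := by
    intro n hn
    set S := {x | x ∈ A ∧ (16 * n ^ 2 : ℤ) +ᵥ x ∈ A ∧ (25 * n ^ 2 : ℤ) +ᵥ x ∈ A} with hS
    have hSm : MeasurableSet S := hA.inter
      (((measurable_const_vadd (16 * n ^ 2 : ℤ)) hA).inter
        ((measurable_const_vadd (25 * n ^ 2 : ℤ)) hA))
    have : (fun x => f x * (f ((16 * n ^ 2 : ℤ) +ᵥ x) * f ((25 * n ^ 2 : ℤ) +ᵥ x)))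
        = S.indicator 1 := by
      ext x
      by_cases h1 : x ∈ A <;> by_cases h2 : (16 * n ^ 2 : ℤ) +ᵥ x ∈ A <;>
        by_cases h3 : (25 * n ^ 2 : ℤ) +ᵥ x ∈ A <;> simp [hfdef, hS, Set.indicator, h1, h2, h3]
    rw [this, integral_indicator_one hSm]
    exact le_antisymm (hno n hn) measureReal_nonneg
  set q : ℕ → ℝ := fun n => ∫ x, g x * (g ((16 * n ^ 2 : ℤ) +ᵥ x) * g ((25 * n ^ 2 : ℤ) +ᵥ x)) ∂μ
    with hq
  have hq0 : ∀ n, 0 ≤ q n := fun n => integral_nonneg fun x =>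
    mul_nonneg (hg0 _) (mul_nonneg (hg0 _) (hg0 _))
  have hqavg : Tendsto (fun N : ℕ => (N : ℝ)⁻¹ * ∑ n ∈ Finset.range N, q n) atTop (𝓝 0) := by
    have h1 := (tendsto_avg_pattern_sub (μ := μ) hf).neg
    rw [neg_zero] at h1
    have h2 := (tendsto_inv_atTop_nhds_zero_nat (𝕜 := ℝ)).mul_const
      (∫ x, f x * (f ((16 * (0 : ℕ) ^ 2 : ℤ) +ᵥ x) * f ((25 * (0 : ℕ) ^ 2 : ℤ) +ᵥ x)) ∂μ)
    rw [zero_mul] at h2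
    have h3 := h1.add h2
    rw [add_zero] at h3
    refine h3.congr' ?_
    filter_upwards [eventually_ge_atTop 1] with N hN
    rw [Finset.sum_sub_distrib, mul_sub]
    have h4 : ∑ n ∈ Finset.range N, ∫ x, f x * (f ((16 * n ^ 2 : ℤ) +ᵥ x) *
        f ((25 * n ^ 2 : ℤ) +ᵥ x)) ∂μ = ∫ x, f x * (f ((16 * (0 : ℕ) ^ 2 : ℤ) +ᵥ x) *
        f ((25 * (0 : ℕ) ^ 2 : ℤ) +ᵥ x)) ∂μ := by
      rw [Finset.sum_eq_single_of_mem 0 (Finset.mem_range.2 hN)]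
      intro n _ hn
      exact hzero n (Nat.one_le_iff_ne_zero.2 hn)
    rw [h4]
    ring
  set a := μ.real A with ha
  have hint : ∫ x, g x ∂μ = a := by rw [integral_ce hf, integral_indicator_one hA]
  have hpos' := (measureReal_superlevel_pos (μ := μ) hg hg1 hint.ge).resolve_right
    (not_le.2 hpos)
  have hm : MeasurableSet[(tower μ 7).alg] {x | a / 2 ≤ g x} :=
    @measurableSet_le _ _ _ _ _ (tower μ 7).alg _ _ _ _ _
      (@measurable_const _ _ _ (tower μ 7).alg _) (ce_measurable hf)
  obtain ⟨M, c, hc, hM⟩ := squareRecurrent_tower (μ := μ) 7 _ hm (by linarith) 25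
  have hlow : ∀ k : ℕ, 1 ≤ k → (a / 2) ^ 3 * c ≤ ∑ m ∈ Finset.Icc 1 M, q (m * k) := by
    intro k hk
    obtain ⟨m, hm1, hmM, hmc⟩ := hM k hk
    refine le_trans ?_ (Finset.single_le_sum (f := fun m => q (m * k)) (fun m _ => hq0 _)
      (Finset.mem_Icc.2 ⟨hm1, hmM⟩))
    set P := progSet {x | a / 2 ≤ g x} 25 ((k * m : ℕ) ^ 2 : ℤ) with hP
    have hPm : MeasurableSet P := progSet_measurable ((tower μ 7).le _ hm) _ _
    have h1 : ∫ x, (a / 2) ^ 3 * P.indicator (1 : X → ℝ) x ∂μ ≤ q (m * k) := by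
      refine integral_mono (((BddMeas.indicator hPm).const_mul _).integrable μ)
        ((hg.mul ((hg.shift _).mul (hg.shift _))).integrable μ) fun x => ?_
      by_cases hx : x ∈ P
      · have e : ∀ j : ℕ, ((j : ℤ) * ((m * k : ℕ) : ℤ) ^ 2) = j * ((k * m : ℕ) ^ 2 : ℤ) := by
          intro j; push_cast; ring
        have h0 := hx 0 (by norm_num)
        have h16 := hx 16 (by norm_num)
        have h25 := hx 25 (by norm_num)
        rw [← e] at h16 h25
        simp only [Nat.cast_zero, zero_mul, zero_vadd, Set.mem_ofPred_eq] at h0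
        simp only [Set.mem_ofPred_eq] at h16 h25
        simp only [Set.indicator_of_mem hx, Pi.one_apply, mul_one]
        calc (a / 2) ^ 3 = a / 2 * (a / 2 * (a / 2)) := by ring
          _ ≤ _ := mul_le_mul h0 (mul_le_mul h16 h25 (by positivity) (hg0 _)) (by positivity)
            (hg0 _)
      · simp only [Set.indicator_of_notMem hx, mul_zero]
        exact mul_nonneg (hg0 _) (mul_nonneg (hg0 _) (hg0 _))
    rw [integral_const_mul, integral_indicator_one hPm] at h1
    exact (mul_le_mul_of_nonneg_left hmc (by positivity)).trans h1
  have hsum : Tendsto (fun N : ℕ => ∑ m ∈ Finset.Icc 1 M, (N : ℝ)⁻¹ * ∑ n ∈ Finset.range N,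
      q (m * n)) atTop (𝓝 0) := by
    have := tendsto_finsetSum (Finset.Icc 1 M) fun m hm => tendsto_avg_mul hq0 hqavg
      (c := m) (by have := (Finset.mem_Icc.1 hm).1; omega)
    simpa using this
  have hev := hsum.eventually_lt_const (show 0 < (a / 2) ^ 3 * c / 2 by positivity)
  obtain ⟨N, hN, hN2⟩ := (hev.and (eventually_ge_atTop 2)).exists
  have hNpos : (0 : ℝ) < N := by exact_mod_cast (by omega : 0 < N)
  rw [← Finset.mul_sum, Finset.sum_comm, inv_mul_lt_iff₀ hNpos] at hN
  have h5 : ∑ n ∈ Finset.range N, (if n = 0 then (0 : ℝ) else (a / 2) ^ 3 * c)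
      ≤ ∑ n ∈ Finset.range N, ∑ m ∈ Finset.Icc 1 M, q (m * n) := by
    refine Finset.sum_le_sum fun n _ => ?_
    split_ifs with h
    · exact Finset.sum_nonneg fun m _ => hq0 _
    · exact hlow n (Nat.one_le_iff_ne_zero.2 h)
  have h6 : ∑ n ∈ Finset.range N, (if n = 0 then (0 : ℝ) else (a / 2) ^ 3 * c)
      = (N - 1) * ((a / 2) ^ 3 * c) := by
    obtain ⟨N, rfl⟩ : ∃ N', N = N' + 1 := ⟨N - 1, by omega⟩
    rw [Finset.sum_range_succ']
    simp
  have h7 : (2 : ℝ) ≤ N := by exact_mod_cast hN2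
  have h8 : 0 < (a / 2) ^ 3 * c := by positivity
  nlinarith

end Positivity

section Correspondence

/-- The shift action of `ℤ` on two-sided binary sequences. -/
instance shiftAction : AddAction ℤ (ℤ → Bool) where
  vadd n ω := fun k => ω (k + n)
  zero_vadd ω := funext fun k => congrArg ω (add_zero k)
  add_vadd m n ω := funext fun k => congrArg ω (by ring)

lemma shift_apply (n : ℤ) (ω : ℤ → Bool) (k : ℤ) : (n +ᵥ ω) k = ω (k + n) := rfl

lemma continuous_shift (n : ℤ) : Continuous fun ω : ℤ → Bool => n +ᵥ ω :=
  continuous_pi fun k => continuous_apply (k + n)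

instance : MeasurableConstVAdd ℤ (ℤ → Bool) where
  measurable_const_vadd n := (continuous_shift n).measurable

/-- The indicator sequence of a finite set of naturals. -/
def indicatorSeq (A : Finset ℕ) : ℤ → Bool := fun k => decide (∃ a ∈ A, (a : ℤ) = k)

/-- The uniform measure on the first `L + 1` shifts of the indicator sequence of `A`. -/
noncomputable def empirical (A : Finset ℕ) (L : ℕ) : Measure (ℤ → Bool) :=
  ((L + 1 : ℕ) : ENNReal)⁻¹ • ∑ x ∈ Finset.range (L + 1), Measure.dirac ((x : ℤ) +ᵥ indicatorSeq A)

instance (A : Finset ℕ) (L : ℕ) : IsProbabilityMeasure (empirical A L) where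
  measure_univ := by
    simp only [empirical, Measure.smul_apply, Measure.finsetSum_apply, measure_univ,
      Finset.sum_const, Finset.card_range, smul_eq_mul, nsmul_eq_mul, mul_one]
    exact ENNReal.inv_mul_cancel (by simp) (by simp)

lemma integral_empirical (A : Finset ℕ) (L : ℕ) {f : (ℤ → Bool) → ℝ}  :
    ∫ ω, f ω ∂(empirical A L)
      = ((L + 1 : ℕ) : ℝ)⁻¹ * ∑ x ∈ Finset.range (L + 1), f ((x : ℤ) +ᵥ indicatorSeq A) := by
  rw [empirical, integral_smul_measure, integral_finsetSum_measure]
  · simp only [integral_dirac, smul_eq_mul, ENNReal.toReal_inv, ENNReal.toReal_natCast]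
  · intro i _
    exact integrable_dirac (by simp)

lemma real_empirical (A : Finset ℕ) (L : ℕ) {S : Set (ℤ → Bool)} (hS : MeasurableSet S) :
    (empirical A L).real S
      = ((L + 1 : ℕ) : ℝ)⁻¹ * ∑ x ∈ Finset.range (L + 1),
        S.indicator (1 : (ℤ → Bool) → ℝ) ((x : ℤ) +ᵥ indicatorSeq A) := by
  rw [← integral_empirical, integral_indicator_one hS]

lemma isClopen_coord (k : ℤ) : IsClopen {ω : ℤ → Bool | ω k = true} :=
  (isClopen_discrete {true}).preimage (continuous_apply k)

theorem square_pattern_in_dense_set {δ : ℝ} (hδ : 0 < δ) :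
    ∃ L : ℕ, ∀ A ⊆ Finset.range (L + 1), δ * (L + 1 : ℕ) ≤ A.card →
      ∃ x n : ℕ, 1 ≤ n ∧ x ∈ A ∧ x + 16 * n ^ 2 ∈ A ∧ x + 25 * n ^ 2 ∈ A := by
  by_contra! hcon
  choose A hAsub hAcard hA using hcon
  let P : ℕ → ProbabilityMeasure (ℤ → Bool) := fun L => ⟨empirical (A L) L, inferInstance⟩
  let U : Ultrafilter ℕ := hyperfilter ℕ
  have hU : (U : Filter ℕ) ≤ atTop := Nat.hyperfilter_le_atTop
  obtain ⟨Q, -, hQ⟩ := isCompact_univ.ultrafilter_le_nhds (U.map P) (by simp)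
  have hQ : Tendsto P U (𝓝 Q) := hQ
  let μ : Measure (ℤ → Bool) := Q
  have hclopen : ∀ S : Set (ℤ → Bool), IsClopen S →
      Tendsto (fun L => (empirical (A L) L).real S) U (𝓝 (μ.real S)) := fun S hS => by
    have := ProbabilityMeasure.tendsto_measure_of_null_frontier_of_tendsto hQ
      (E := S) (by simp [hS.frontier_eq])
    exact (NNReal.tendsto_coe).2 this
  have hgen : Measure.map (fun ω => (1 : ℤ) +ᵥ ω) μ = μ := by
    have hmeas : Measurable fun ω : ℤ → Bool => (1 : ℤ) +ᵥ ω := (continuous_shift 1).measurable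
    have : IsProbabilityMeasure (Measure.map (fun ω => (1 : ℤ) +ᵥ ω) μ) :=
      Measure.isProbabilityMeasure_map hmeas.aemeasurable
    refine ext_of_forall_integral_eq_of_IsFiniteMeasure fun f => ?_
    rw [integral_map hmeas.aemeasurable f.continuous.measurable.aestronglyMeasurable]
    have hw := ProbabilityMeasure.tendsto_iff_forall_integral_tendsto.1 hQ
    have h1 := hw (f.compContinuous ⟨_, continuous_shift 1⟩)
    have h2 := hw f
    have h3 : Tendsto (fun L => ∫ ω, f.compContinuous ⟨_, continuous_shift 1⟩ ω ∂(P L : Measure _)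
        - ∫ ω, f ω ∂(P L : Measure _)) U (𝓝 0) := by
      refine (squeeze_zero_norm (a := fun L : ℕ => 2 * ‖f‖ * ((L : ℝ) + 1)⁻¹) (fun L => ?_)
        ?_).mono_left hU
      · change ‖∫ ω, f ((1 : ℤ) +ᵥ ω) ∂(empirical (A L) L) - ∫ ω, f ω ∂(empirical (A L) L)‖ ≤ _
        rw [integral_empirical,
          integral_empirical, ← mul_sub, ← Finset.sum_sub_distrib]
        have e : ∀ x ∈ Finset.range (L + 1), f ((1 : ℤ) +ᵥ (x : ℤ) +ᵥ indicatorSeq (A L))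
            - f ((x : ℤ) +ᵥ indicatorSeq (A L))
            = f (((x + 1 : ℕ) : ℤ) +ᵥ indicatorSeq (A L)) - f ((x : ℤ) +ᵥ indicatorSeq (A L)) :=
          fun x _ => by rw [vadd_vadd]; push_cast; rw [add_comm]
        rw [Finset.sum_congr rfl e,
          Finset.sum_range_sub (fun x : ℕ => f ((x : ℤ) +ᵥ indicatorSeq (A L))), norm_mul, norm_inv,
          Real.norm_natCast, mul_comm]
        push_cast
        refine mul_le_mul_of_nonneg_right ?_ (by positivity)
        refine (norm_sub_le _ _).trans ?_
        rw [two_mul]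
        exact add_le_add (f.norm_coe_le_norm _) (f.norm_coe_le_norm _)
      · have := (tendsto_inv_atTop_zero.comp (tendsto_natCast_atTop_atTop.atTop_add
          (tendsto_const_nhds (x := (1 : ℝ))))).const_mul (2 * ‖f‖)
        simpa using this
    have h4 := tendsto_nhds_unique h3 (h1.sub h2)
    exact (sub_eq_zero.1 h4.symm)
  have hinv : ∀ n : ℤ, Measure.map (fun ω => n +ᵥ ω) μ = μ := by
    have hm : ∀ n : ℤ, Measurable fun ω : ℤ → Bool => n +ᵥ ω := fun n =>
      (continuous_shift n).measurable
    have hadd : ∀ m n : ℤ, Measure.map (fun ω => (m + n) +ᵥ ω) μ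
        = Measure.map (fun ω => m +ᵥ ω) (Measure.map (fun ω => n +ᵥ ω) μ) := fun m n => by
      rw [Measure.map_map (hm m) (hm n)]
      simp only [add_vadd, Function.comp_def]
    have h0 : Measure.map (fun ω => (0 : ℤ) +ᵥ ω) μ = μ := by
      simp only [zero_vadd]; exact Measure.map_id
    have hneg : Measure.map (fun ω => (-1 : ℤ) +ᵥ ω) μ = μ := by
      conv_lhs => rw [← hgen]
      rw [← hadd]; exact h0
    intro n
    induction n with
    | zero => exact h0
    | succ n ih => rw [add_comm, hadd, ih, hgen]
    | pred n ih => rw [sub_eq_add_neg, add_comm, hadd, ih, hneg]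
  have : VAddInvariantMeasure ℤ (ℤ → Bool) μ := ⟨fun n S hS => by
    conv_rhs => rw [← hinv n]
    exact (Measure.map_apply (continuous_shift n).measurable hS).symm⟩
  have hS0 : IsClopen {ω : ℤ → Bool | ω 0 = true} := isClopen_coord 0
  have hS0m := hS0.isOpen.measurableSet
  have hpos : 0 < μ.real {ω : ℤ → Bool | ω 0 = true} := by
    refine hδ.trans_le (ge_of_tendsto (hclopen _ hS0) (Eventually.of_forall fun L => ?_))
    rw [real_empirical _ _ hS0m, le_inv_mul_iff₀ (by positivity), mul_comm]
    refine (hAcard L).trans ?_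
    have : ∀ x : ℕ, Set.indicator {ω : ℤ → Bool | ω 0 = true} (1 : (ℤ → Bool) → ℝ)
        ((x : ℤ) +ᵥ indicatorSeq (A L)) = if x ∈ A L then 1 else 0 := fun x => by
      simp [Set.indicator_apply, shift_apply, indicatorSeq]
    simp only [this]
    rw [Finset.sum_boole]
    exact_mod_cast Finset.card_le_card fun x hx =>
      Finset.mem_filter.2 ⟨hAsub L hx, hx⟩
  obtain ⟨n, hn, hn2⟩ := exists_square_pattern_recurrence hS0m hpos
  have hS : IsClopen {ω : ℤ → Bool | ω ∈ {ω : ℤ → Bool | ω 0 = true} ∧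
      (16 * n ^ 2 : ℤ) +ᵥ ω ∈ {ω : ℤ → Bool | ω 0 = true} ∧
      (25 * n ^ 2 : ℤ) +ᵥ ω ∈ {ω : ℤ → Bool | ω 0 = true}} :=
    hS0.inter ((hS0.preimage (continuous_shift _)).inter (hS0.preimage (continuous_shift _)))
  obtain ⟨L, hL⟩ := ((hclopen _ hS).eventually_const_lt hn2).exists
  rw [real_empirical _ _ hS.isOpen.measurableSet] at hL
  have hL2 := pos_of_mul_pos_right hL (by positivity)
  obtain ⟨x, hx, hx2⟩ := Finset.exists_ne_zero_of_sum_ne_zero hL2.ne'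
  have hx3 := Set.mem_of_indicator_ne_zero hx2
  simp only [Set.mem_ofPred_eq, shift_apply, indicatorSeq, decide_eq_true_eq] at hx3
  obtain ⟨⟨a, ha, ha'⟩, ⟨b, hb, hb'⟩, c, hc, hc'⟩ := hx3
  refine hA L x n hn ?_ ?_ ?_
  · convert ha; omega
  · convert hb; zify; rw [hb']; ring
  · convert hc; zify; rw [hc']; ring

end Correspondence

end

section

open Filter Topology
open scoped BigOperators

section Box
variable {V W : Type*} [Fintype V] [DecidableEq V] [Fintype W] [DecidableEq W]

/-- The box of integer vectors with `0 ≤ a v < R v`. -/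
noncomputable def bx (R : V → ℕ) : Finset (V → ℤ) := Fintype.piFinset fun v => Finset.Ico (0 : ℤ) (R v)

lemma mem_bx {R : V → ℕ} {a : V → ℤ} : a ∈ bx R ↔ ∀ v, 0 ≤ a v ∧ a v < R v := by
  simp [bx, Fintype.mem_piFinset]

lemma bx_nonempty {R : V → ℕ} (hR : ∀ v, 1 ≤ R v) : (bx R).Nonempty :=
  ⟨0, mem_bx.2 fun v => ⟨le_rfl, by have := hR v; simp; omega⟩⟩

lemma Ico_nonempty {n : ℕ} (h : 1 ≤ n) : (Finset.Ico (0 : ℤ) n).Nonempty :=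
  ⟨0, by simp; omega⟩

lemma expect_bx_comp {R : V → ℕ} (hR : ∀ v, 1 ≤ R v) {i : W → V} (hi : i.Injective)
    (G : (W → ℤ) → ℝ) : 𝔼 a ∈ bx R, G (a ∘ i) = 𝔼 b ∈ bx (R ∘ i), G b := by
  have hW : (bx (R ∘ i)).Nonempty := bx_nonempty fun w => hR (i w)
  have hV : (bx R).Nonempty := bx_nonempty hR
  have h1 : 𝔼 a ∈ bx R, G (a ∘ i) = 𝔼 p ∈ bx R ×ˢ bx (R ∘ i), G (p.1 ∘ i) := by
    rw [Finset.expect_product]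
    exact Finset.expect_congr rfl fun a _ => (Finset.expect_const hW _).symm
  have h2 : 𝔼 b ∈ bx (R ∘ i), G b = 𝔼 p ∈ bx R ×ˢ bx (R ∘ i), G p.2 := by
    rw [Finset.expect_product]
    exact (Finset.expect_const hV _).symm
  rw [h1, h2]
  have hmem : ∀ p ∈ bx R ×ˢ bx (R ∘ i),
      ((Function.extend i p.2 p.1, p.1 ∘ i) : (V → ℤ) × (W → ℤ)) ∈ bx R ×ˢ bx (R ∘ i) := by
    intro p hp
    rw [Finset.mem_product, mem_bx, mem_bx] at hp ⊢
    refine ⟨fun v => ?_, fun w => hp.1 (i w)⟩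
    by_cases hv : ∃ w, i w = v
    · obtain ⟨w, rfl⟩ := hv
      simpa [hi.extend_apply] using hp.2 w
    · simpa [Function.extend_apply' _ _ _ hv] using hp.1 v
  have hinv : ∀ p : (V → ℤ) × (W → ℤ),
      (Function.extend i (p.1 ∘ i) (Function.extend i p.2 p.1), Function.extend i p.2 p.1 ∘ i)
        = p := by
    intro p
    refine Prod.ext (funext fun v => ?_) (funext fun w => by simp [hi.extend_apply])
    by_cases hv : ∃ w, i w = v
    · obtain ⟨w, rfl⟩ := hv
      simp [hi.extend_apply]
    · simp [Function.extend_apply' _ _ _ hv]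
  exact Finset.expect_nbij' (fun p => (Function.extend i p.2 p.1, p.1 ∘ i))
    (fun p => (Function.extend i p.2 p.1, p.1 ∘ i)) hmem hmem (fun p _ => hinv p)
    (fun p _ => hinv p) fun p _ => rfl

lemma expect_bx_update {R : V → ℕ} (hR : ∀ v, 1 ≤ R v) (v : V) (G : (V → ℤ) → ℝ) :
    𝔼 a ∈ bx R, G a = 𝔼 a ∈ bx R, 𝔼 n ∈ Finset.Ico (0 : ℤ) (R v), G (Function.update a v n) := by
  have hI := Ico_nonempty (hR v)
  have h1 : 𝔼 a ∈ bx R, G a = 𝔼 p ∈ bx R ×ˢ Finset.Ico (0 : ℤ) (R v), G p.1 := by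
    rw [Finset.expect_product]
    exact Finset.expect_congr rfl fun a _ => (Finset.expect_const hI _).symm
  rw [h1, ← Finset.expect_product']
  have hmem : ∀ p ∈ bx R ×ˢ Finset.Ico (0 : ℤ) (R v),
      ((Function.update p.1 v p.2, p.1 v) : (V → ℤ) × ℤ) ∈ bx R ×ˢ Finset.Ico (0 : ℤ) (R v) := by
    intro p hp
    rw [Finset.mem_product, mem_bx, Finset.mem_Ico] at hp ⊢
    refine ⟨fun w => ?_, hp.1 v⟩
    rcases eq_or_ne w v with rfl | h
    · simpa using hp.2
    · simpa [Function.update_of_ne h] using hp.1 w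
  have hinv : ∀ p : (V → ℤ) × ℤ,
      (Function.update (Function.update p.1 v p.2) v (p.1 v), Function.update p.1 v p.2 v) = p := by
    intro p; simp
  exact Finset.expect_nbij' (fun p => (Function.update p.1 v p.2, p.1 v))
    (fun p => (Function.update p.1 v p.2, p.1 v)) hmem hmem (fun p _ => hinv p)
    (fun p _ => hinv p) fun p _ => by simp

lemma expect_bx_sum {R : V ⊕ W → ℕ} (G : (V ⊕ W → ℤ) → ℝ) :
    𝔼 a ∈ bx R, G a = 𝔼 b ∈ bx (R ∘ Sum.inl), 𝔼 c ∈ bx (R ∘ Sum.inr), G (Sum.elim b c) := by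
  rw [← Finset.expect_product']
  refine Finset.expect_nbij' (fun a => (a ∘ Sum.inl, a ∘ Sum.inr)) (fun p => Sum.elim p.1 p.2)
    ?_ ?_ ?_ ?_ ?_
  · intro a ha
    rw [mem_bx] at ha
    simp only [Finset.mem_product, mem_bx]
    exact ⟨fun v => ha _, fun v => ha _⟩
  · intro p hp
    simp only [Finset.mem_product, mem_bx] at hp
    exact mem_bx.2 (Sum.rec hp.1 hp.2)
  · intro a _; simp
  · intro p _; simp
  · intro a _; simp

end Box

section Poly
variable {V W : Type*}

/-- A function on integer vectors that is given by a polynomial. -/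
def IsPoly (p : (V → ℤ) → ℤ) : Prop := ∃ P : MvPolynomial V ℤ, ∀ a, MvPolynomial.eval a P = p a

namespace IsPoly
variable {p q : (V → ℤ) → ℤ}

lemma const (c : ℤ) : IsPoly fun _ : V → ℤ => c := ⟨MvPolynomial.C c, by simp⟩
lemma coord (v : V) : IsPoly fun a : V → ℤ => a v := ⟨MvPolynomial.X v, by simp⟩
lemma add (hp : IsPoly p) (hq : IsPoly q) : IsPoly fun a => p a + q a := by
  obtain ⟨P, hP⟩ := hp; obtain ⟨Q, hQ⟩ := hq
  exact ⟨P + Q, by simp [hP, hQ]⟩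
lemma sub (hp : IsPoly p) (hq : IsPoly q) : IsPoly fun a => p a - q a := by
  obtain ⟨P, hP⟩ := hp; obtain ⟨Q, hQ⟩ := hq
  exact ⟨P - Q, by simp [hP, hQ]⟩
lemma mul (hp : IsPoly p) (hq : IsPoly q) : IsPoly fun a => p a * q a := by
  obtain ⟨P, hP⟩ := hp; obtain ⟨Q, hQ⟩ := hq
  exact ⟨P * Q, by simp [hP, hQ]⟩
lemma neg (hp : IsPoly p) : IsPoly fun a => -p a := by
  obtain ⟨P, hP⟩ := hp
  exact ⟨-P, by simp [hP]⟩
lemma pow (hp : IsPoly p) (n : ℕ) : IsPoly fun a => p a ^ n := by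
  obtain ⟨P, hP⟩ := hp
  exact ⟨P ^ n, by simp [hP]⟩
lemma sum {ι : Type*} {s : Finset ι} {p : ι → (V → ℤ) → ℤ} (hp : ∀ i ∈ s, IsPoly (p i)) :
    IsPoly fun a => ∑ i ∈ s, p i a := by
  classical
  induction s using Finset.induction_on with
  | empty => simpa using const 0
  | insert i s hi ih =>
    simp only [Finset.sum_insert hi]
    exact (hp i (by simp)).add (ih fun k hk => hp k (by simp [hk]))
lemma prod {ι : Type*} {s : Finset ι} {p : ι → (V → ℤ) → ℤ} (hp : ∀ i ∈ s, IsPoly (p i)) :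
    IsPoly fun a => ∏ i ∈ s, p i a := by
  classical
  induction s using Finset.induction_on with
  | empty => simpa using const 1
  | insert i s hi ih =>
    simp only [Finset.prod_insert hi]
    exact (hp i (by simp)).mul (ih fun k hk => hp k (by simp [hk]))
lemma comp (hp : IsPoly p) (i : V → W) : IsPoly fun a : W → ℤ => p (a ∘ i) := by
  obtain ⟨P, hP⟩ := hp
  exact ⟨MvPolynomial.rename i P, fun a => by rw [MvPolynomial.eval_rename, hP]⟩

lemma bound (hp : IsPoly p) : ∃ C d : ℕ, ∀ (L : ℕ), 1 ≤ L → ∀ a : V → ℤ, (∀ v, |a v| ≤ L) →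
    |p a| ≤ C * L ^ d := by
  obtain ⟨P, hP⟩ := hp
  induction P using MvPolynomial.induction_on generalizing p with
  | C c =>
    refine ⟨c.natAbs, 0, fun L _ a _ => ?_⟩
    rw [← hP]; simp
  | add P Q h1 h2 =>
    obtain ⟨C1, d1, h1⟩ := h1 (fun a => rfl)
    obtain ⟨C2, d2, h2⟩ := h2 (fun a => rfl)
    refine ⟨C1 + C2, d1 + d2, fun L hL a ha => ?_⟩
    rw [← hP, map_add]
    have hL' : (1 : ℤ) ≤ L := by exact_mod_cast hL
    calc _ ≤ _ := abs_add_le _ _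
      _ ≤ (C1 : ℤ) * L ^ d1 + C2 * L ^ d2 := add_le_add (h1 L hL a ha) (h2 L hL a ha)
      _ ≤ (C1 : ℤ) * L ^ (d1 + d2) + C2 * L ^ (d1 + d2) := by
        gcongr <;> first | exact hL' | omega
      _ = _ := by push_cast; ring
  | mul_X P v h =>
    obtain ⟨C1, d1, h1⟩ := h (fun a => rfl)
    refine ⟨C1, d1 + 1, fun L hL a ha => ?_⟩
    rw [← hP, map_mul, abs_mul, MvPolynomial.eval_X, pow_succ, ← mul_assoc]
    exact mul_le_mul (h1 L hL a ha) (ha v) (abs_nonneg _) (by positivity)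

lemma zeros [Fintype V] [DecidableEq V] (hp : IsPoly p) (h0 : p ≠ 0) : ∃ C : ℝ, 0 ≤ C ∧
    ∀ (M : ℕ) (R : V → ℕ), 1 ≤ M → (∀ v, M ≤ R v) →
      𝔼 a ∈ bx R, (if p a = 0 then (1 : ℝ) else 0) ≤ C / M := by
  obtain ⟨P, hP⟩ := hp
  let e := Fintype.equivFin V
  set Q := MvPolynomial.rename e P with hQ
  have hQ0 : Q ≠ 0 := fun h => h0 (funext fun a => by
    have : P = 0 := MvPolynomial.rename_injective e e.injective (by simpa using h)
    rw [← hP, this]; simp)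
  refine ⟨∑ i, (Q.degreeOf i : ℝ), by positivity, fun M R hM hMR => ?_⟩
  have hR : ∀ v, 1 ≤ R v := fun v => hM.trans (hMR v)
  have hRe : (R ∘ e.symm) ∘ e = R := by ext; simp
  have h1 : 𝔼 a ∈ bx R, (if p a = 0 then (1 : ℝ) else 0)
      = 𝔼 b ∈ bx (R ∘ e.symm), (if MvPolynomial.eval b Q = 0 then (1 : ℝ) else 0) := by
    have := expect_bx_comp (R := R ∘ e.symm) (fun v => hR _) e.injective
      (fun a => if p a = 0 then (1 : ℝ) else 0)
    rw [hRe] at this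
    rw [← this]
    refine Finset.expect_congr rfl fun b _ => ?_
    rw [hQ, MvPolynomial.eval_rename, hP]
  have h2 := MvPolynomial.schwartz_zippel_sum_degreeOf hQ0
    (fun i => Finset.Ico (0 : ℤ) ((R ∘ e.symm) i))
  have h3 := (NNRat.cast_le (K := ℝ)).2 h2
  rw [h1, Finset.expect_eq_sum_div_card, Finset.sum_boole]
  have hcard : ((bx (R ∘ e.symm)).card : ℝ)
      = ∏ i, ((Finset.Ico (0 : ℤ) ((R ∘ e.symm) i)).card : ℝ) := by
    rw [bx, Fintype.card_piFinset]; push_cast; rfl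
  rw [hcard]
  push_cast at h3
  refine h3.trans ?_
  rw [Finset.sum_div]
  refine Finset.sum_le_sum fun i _ => ?_
  have : (M : ℝ) ≤ ((Finset.Ico (0 : ℤ) ((R ∘ e.symm) i)).card : ℝ) := by
    simp only [Int.card_Ico, sub_zero, Int.toNat_natCast]
    exact_mod_cast hMR _
  have hM' : (0 : ℝ) < M := by exact_mod_cast hM
  gcongr

end IsPoly
end Poly

/-- A sequence of pseudorandom weights on cyclic groups, with three well separated scales. -/
structure Sys (k₀ : ℕ) where
  N : ℕ → ℕ
  N_ne : ∀ j, NeZero (N j)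
  W : ℕ → ℕ
  W_pos : ∀ j, 1 ≤ W j
  ν : ∀ j, ZMod (N j) → ℝ
  L : Fin 3 → ℕ → ℕ
  B : ℕ → ℝ
  one_le_B : ∀ j, 1 ≤ B j
  nonneg : ∀ j x, 0 ≤ ν j x
  le_B : ∀ j x, ν j x ≤ B j
  L_pos : ∀ r j, 1 ≤ L r j
  L_mono : ∀ j, L 0 j ≤ L 1 j ∧ L 1 j ≤ L 2 j
  B_L : ∀ k : ℕ, Tendsto (fun j => B j ^ k / L 0 j) atTop (𝓝 0)
  L01 : ∀ k : ℕ, Tendsto (fun j => (L 0 j : ℝ) ^ k / L 1 j) atTop (𝓝 0)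
  L12 : ∀ k : ℕ, Tendsto (fun j => (L 1 j : ℝ) ^ k / L 2 j) atTop (𝓝 0)
  LN : ∀ k : ℕ, ∀ᶠ j in atTop, ((W j : ℤ) * L 2 j ^ k) ^ 2 ≤ N j
  linear_forms : ∀ κ : ℝ, 0 < κ → ∀ᶠ j in atTop, ∀ H : Finset ℤ, H.card ≤ k₀ →
    (∀ h ∈ H, h ^ 2 ≤ N j) → |𝔼 x : ZMod (N j), ∏ h ∈ H, ν j (x + (h : ZMod (N j))) - 1| ≤ κ

namespace Sys
variable {k₀ : ℕ} (S : Sys k₀)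

instance (j : ℕ) : NeZero (S.N j) := S.N_ne j

/-- The cyclic group at stage `j`. -/
abbrev Z (j : ℕ) := ZMod (S.N j)

/-- Translation of `x` by the `W`-dilate of `k`. -/
def pt (j : ℕ) (x : S.Z j) (k : ℤ) : S.Z j := x + (((S.W j : ℤ) * k : ℤ) : S.Z j)

lemma pt_pt (j : ℕ) (x : S.Z j) (k l : ℤ) : S.pt j (S.pt j x k) l = S.pt j x (k + l) := by
  simp only [pt]; push_cast; ring

lemma pt_zero (j : ℕ) (x : S.Z j) : S.pt j x 0 = x := by simp [pt]

lemma expect_pt (j : ℕ) (k : ℤ) (G : S.Z j → ℝ) : 𝔼 x, G (S.pt j x k) = 𝔼 x, G x :=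
  Fintype.expect_equiv (Equiv.addRight _) _ _ fun _ => rfl

variable {V W : Type*} [Fintype V] [DecidableEq V] [Fintype W] [DecidableEq W]
variable (ρ : V → Fin 3)

/-- Ranges of the variables at stage `j`. -/
def R (j : ℕ) : V → ℕ := fun v => S.L (ρ v) j

lemma R_pos (j : ℕ) (v : V) : 1 ≤ S.R ρ j v := S.L_pos _ _

/-- Average over the parameters and over the base point. -/
noncomputable def E (j : ℕ) (G : S.Z j → (V → ℤ) → ℝ) : ℝ := 𝔼 a ∈ bx (S.R ρ j), 𝔼 x, G x a

lemma L0_le (r : Fin 3) (j : ℕ) : S.L 0 j ≤ S.L r j := by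
  have := S.L_mono j
  fin_cases r
  · exact le_rfl
  · exact this.1
  · exact this.1.trans this.2

lemma le_L2 (r : Fin 3) (j : ℕ) : S.L r j ≤ S.L 2 j := by
  have := S.L_mono j
  fin_cases r
  · exact this.1.trans this.2
  · exact this.2
  · exact le_rfl

lemma eventually_le_L (C : ℕ) (r : Fin 3) : ∀ᶠ j in atTop, C ≤ S.L r j := by
  have h := (S.B_L 0).eventually_lt_const (show (0 : ℝ) < ((C : ℝ) + 1)⁻¹ by positivity)
  filter_upwards [h] with j hj
  have hL : (0 : ℝ) < S.L 0 j := by exact_mod_cast S.L_pos 0 j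
  rw [pow_zero, one_div, inv_lt_inv₀ hL (by positivity)] at hj
  have : C + 1 < S.L 0 j := by exact_mod_cast hj
  have := S.L0_le r j
  omega

lemma eventually_small {p : (V → ℤ) → ℤ} (hp : IsPoly p) :
    ∀ᶠ j in atTop, ∀ a ∈ bx (S.R ρ j), ((S.W j : ℤ) * p a) ^ 2 ≤ S.N j := by
  obtain ⟨C, d, h⟩ := hp.bound
  filter_upwards [S.LN (d + 1), S.eventually_le_L C 2] with j h1 h2 a ha
  refine le_trans ?_ h1
  rw [mem_bx] at ha
  have h3 := h (S.L 2 j) (S.L_pos 2 j) a fun v => by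
    have h4 := ha v
    have h5 : S.R ρ j v ≤ S.L 2 j := S.le_L2 _ _
    rw [abs_of_nonneg h4.1]
    omega
  refine sq_le_sq.2 ?_
  rw [abs_mul, abs_mul]
  refine mul_le_mul_of_nonneg_left ?_ (abs_nonneg _)
  refine (h3.trans ?_).trans (le_abs_self _)
  rw [pow_succ, mul_comm]
  exact mul_le_mul_of_nonneg_left (by exact_mod_cast h2) (by positivity)

lemma prod_le_B {ι : Type*} (s : Finset ι) (j : ℕ) (y : ι → S.Z j) :
    ∏ i ∈ s, S.ν j (y i) ≤ S.B j ^ s.card := by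
  rw [← Finset.prod_const]
  exact Finset.prod_le_prod (fun i _ => S.nonneg _ _) fun i _ => S.le_B _ _

theorem tendsto_prod_weights {A : Finset ((V → ℤ) → ℤ)} (hA : ∀ p ∈ A, IsPoly p)
    (hk : A.card ≤ k₀) :
    Tendsto (fun j => S.E ρ j fun x a => ∏ p ∈ A, S.ν j (S.pt j x (p a))) atTop (𝓝 1) := by
  classical
  have hz : ∀ pq : ((V → ℤ) → ℤ) × ((V → ℤ) → ℤ), ∃ C : ℝ, 0 ≤ C ∧ (pq ∈ A.offDiag →
      ∀ j, 𝔼 a ∈ bx (S.R ρ j), (if pq.1 a - pq.2 a = 0 then (1 : ℝ) else 0) ≤ C / S.L 0 j) := by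
    intro pq
    by_cases h : pq ∈ A.offDiag
    · rw [Finset.mem_offDiag] at h
      obtain ⟨C, hC, h1⟩ := ((hA _ h.1).sub (hA _ h.2.1)).zeros
        (fun h0 => h.2.2 (funext fun a => sub_eq_zero.1 (congrFun h0 a)))
      exact ⟨C, hC, fun _ j => h1 _ _ (S.L_pos 0 j) fun v => S.L0_le _ _⟩
    · exact ⟨0, le_rfl, fun h' => absurd h' h⟩
  choose C hC hz using hz
  set D := ∑ pq ∈ A.offDiag, C pq with hD
  have hsmall : ∀ᶠ j in atTop, ∀ p ∈ A, ∀ a ∈ bx (S.R ρ j), ((S.W j : ℤ) * p a) ^ 2 ≤ S.N j :=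
    (eventually_all_finset A).2 fun p hp => S.eventually_small ρ (hA p hp)
  rw [Metric.tendsto_nhds]
  intro ε hε
  have hB : Tendsto (fun j => (S.B j ^ A.card / S.L 0 j + S.B j ^ 0 / S.L 0 j) * D) atTop (𝓝 0) := by
    simpa using ((S.B_L A.card).add (S.B_L 0)).mul_const D
  filter_upwards [hsmall, S.linear_forms (ε / 2) (by positivity),
    hB.eventually_lt_const (show 0 < ε / 2 by positivity)] with j hs hlf hBj
  have hne := bx_nonempty (S.R_pos ρ j)
  have hL : (0 : ℝ) < S.L 0 j := by exact_mod_cast S.L_pos 0 j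
  have hB1 : (1 : ℝ) ≤ S.B j ^ A.card := one_le_pow₀ (S.one_le_B j)
  have key : ∀ a ∈ bx (S.R ρ j), |𝔼 x, ∏ p ∈ A, S.ν j (S.pt j x (p a)) - 1| ≤
      ε / 2 + (S.B j ^ A.card + 1) *
        ∑ pq ∈ A.offDiag, (if pq.1 a - pq.2 a = 0 then (1 : ℝ) else 0) := by
    intro a ha
    by_cases hdeg : ∃ pq ∈ A.offDiag, pq.1 a - pq.2 a = 0
    · obtain ⟨pq, h1, h2⟩ := hdeg
      have h3 : (1 : ℝ) ≤ ∑ pq ∈ A.offDiag, (if pq.1 a - pq.2 a = 0 then (1 : ℝ) else 0) := by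
        refine le_trans ?_ (Finset.single_le_sum (f := fun pq : ((V → ℤ) → ℤ) × ((V → ℤ) → ℤ) =>
          if pq.1 a - pq.2 a = 0 then (1 : ℝ) else 0) (fun i _ => by positivity) h1)
        simp [h2]
      have h4 : 𝔼 x, ∏ p ∈ A, S.ν j (S.pt j x (p a)) ≤ S.B j ^ A.card :=
        Finset.expect_le Finset.univ_nonempty fun x _ => S.prod_le_B _ _ _
      have h5 : 0 ≤ 𝔼 x, ∏ p ∈ A, S.ν j (S.pt j x (p a)) :=
        Finset.expect_nonneg fun x _ => Finset.prod_nonneg fun p _ => S.nonneg _ _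
      rw [abs_le]
      constructor <;> nlinarith
    · push Not at hdeg
      have hsum : ∑ pq ∈ A.offDiag, (if pq.1 a - pq.2 a = 0 then (1 : ℝ) else 0) = 0 :=
        Finset.sum_eq_zero fun pq h => if_neg (hdeg pq h)
      rw [hsum, mul_zero, add_zero]
      have hinj : Set.InjOn (fun p : (V → ℤ) → ℤ => (S.W j : ℤ) * p a) A := by
        intro p hp q hq hpq
        by_contra hne
        have hW : (S.W j : ℤ) ≠ 0 := by have := S.W_pos j; omega
        exact hdeg (p, q) (Finset.mem_offDiag.2 ⟨hp, hq, hne⟩)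
          (sub_eq_zero.2 (mul_left_cancel₀ hW hpq))
      have := hlf (A.image fun p => (S.W j : ℤ) * p a) (Finset.card_image_le.trans hk)
        (by
          intro h hh
          obtain ⟨p, hp, rfl⟩ := Finset.mem_image.1 hh
          exact hs p hp a ha)
      simp only [Finset.prod_image hinj] at this
      exact this
  rw [Real.dist_eq]
  calc |S.E ρ j (fun x a => ∏ p ∈ A, S.ν j (S.pt j x (p a))) - 1|
      = |𝔼 a ∈ bx (S.R ρ j), (𝔼 x, ∏ p ∈ A, S.ν j (S.pt j x (p a)) - 1)| := by
        rw [Finset.expect_sub_distrib, Finset.expect_const hne]; rfl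
    _ ≤ 𝔼 a ∈ bx (S.R ρ j), |𝔼 x, ∏ p ∈ A, S.ν j (S.pt j x (p a)) - 1| :=
        Finset.abs_expect_le _ _
    _ ≤ _ := Finset.expect_le_expect key
    _ = ε / 2 + (S.B j ^ A.card + 1) * ∑ pq ∈ A.offDiag,
          𝔼 a ∈ bx (S.R ρ j), (if pq.1 a - pq.2 a = 0 then (1 : ℝ) else 0) := by
        rw [Finset.expect_add_distrib, Finset.expect_const hne, ← Finset.mul_expect,
          Finset.expect_sum_comm]
    _ ≤ ε / 2 + (S.B j ^ A.card + 1) * ∑ pq ∈ A.offDiag, C pq / S.L 0 j := by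
        gcongr with pq hpq
        exact hz pq hpq j
    _ = ε / 2 + (S.B j ^ A.card / S.L 0 j + S.B j ^ 0 / S.L 0 j) * D := by
        rw [hD, ← Finset.sum_div]; ring
    _ < ε := by linarith

end Sys

section Indep
variable {V α : Type*} [DecidableEq V]

/-- The function `G` does not depend on the coordinate `v`. -/
def Indep (v : V) (G : (V → ℤ) → α) : Prop := ∀ a n, G (Function.update a v n) = G a

lemma Indep.comp_equiv {v : V} {G : (V → ℤ) → α} (σ : V ≃ V) (h : Indep (σ.symm v) G) :
    Indep v fun a => G (a ∘ σ) := fun a n => by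
  have : Function.update a v n ∘ σ = Function.update (a ∘ σ) (σ.symm v) n := by
    rw [Function.update_comp_equiv]
  change G (Function.update a v n ∘ σ) = G (a ∘ σ)
  rw [this]; exact h _ _

lemma Indep.comp_swap {v v' : V} {G : (V → ℤ) → α} (h : Indep v' G) (a : V → ℤ) :
    G (a ∘ Equiv.swap v v') = G (Function.update a v (a v')) := by
  rw [← h (Function.update a v (a v')) (a v)]
  congr 1
  ext w
  by_cases h1 : w = v'
  · subst h1; simp
  · rw [Function.update_of_ne h1]
    by_cases h2 : w = v
    · subst h2; simp
    · simp [Equiv.swap_apply_of_ne_of_ne h2 h1, h2]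

lemma Indep.comp_swap_eq {v v' : V} {G : (V → ℤ) → α} (h : Indep v G) (h' : Indep v' G)
    (a : V → ℤ) : G (a ∘ Equiv.swap v v') = G a := by
  rw [h'.comp_swap, h]

end Indep

lemma expect_cs {ι : Type*} (s : Finset ι) (c w y : ι → ℝ) (h : ∀ i ∈ s, |c i| ≤ w i) :
    (𝔼 i ∈ s, c i * y i) ^ 2 ≤ (𝔼 i ∈ s, w i) * 𝔼 i ∈ s, w i * y i ^ 2 := by
  have hw : ∀ i ∈ s, 0 ≤ w i := fun i hi => (abs_nonneg _).trans (h i hi)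
  have h1 : |𝔼 i ∈ s, c i * y i| ≤ 𝔼 i ∈ s, √(w i) * (√(w i) * |y i|) := by
    refine (Finset.abs_expect_le _ _).trans (Finset.expect_le_expect fun i hi => ?_)
    rw [abs_mul, ← mul_assoc, Real.mul_self_sqrt (hw i hi)]
    exact mul_le_mul_of_nonneg_right (h i hi) (abs_nonneg _)
  calc _ = |𝔼 i ∈ s, c i * y i| ^ 2 := (sq_abs _).symm
    _ ≤ (𝔼 i ∈ s, √(w i) * (√(w i) * |y i|)) ^ 2 := pow_le_pow_left₀ (abs_nonneg _) h1 2
    _ ≤ (𝔼 i ∈ s, √(w i) ^ 2) * 𝔼 i ∈ s, (√(w i) * |y i|) ^ 2 :=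
        Finset.expect_mul_sq_le_sq_mul_sq _ _ _
    _ = _ := by
      congr 1
      · exact Finset.expect_congr rfl fun i hi => Real.sq_sqrt (hw i hi)
      · exact Finset.expect_congr rfl fun i hi => by rw [mul_pow, Real.sq_sqrt (hw i hi), sq_abs]

namespace Sys
variable {k₀ : ℕ} (S : Sys k₀)
variable {V : Type*} [Fintype V] [DecidableEq V] (ρ : V → Fin 3)

lemma E_cs' (j : ℕ) (c w y : S.Z j → (V → ℤ) → ℝ) (h : ∀ x a, |c x a| ≤ w x a) :
    (S.E ρ j fun x a => c x a * y x a) ^ 2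
      ≤ S.E ρ j w * S.E ρ j fun x a => w x a * y x a ^ 2 := by
  have := expect_cs (bx (S.R ρ j) ×ˢ (Finset.univ : Finset (S.Z j)))
    (fun p => c p.2 p.1) (fun p => w p.2 p.1) (fun p => y p.2 p.1) fun p _ => h _ _
  simp only [Finset.expect_product] at this
  exact this

lemma E_congr {j : ℕ} {F G : S.Z j → (V → ℤ) → ℝ} (h : ∀ x a, F x a = G x a) :
    S.E ρ j F = S.E ρ j G := by
  congr 1; ext x a; exact h x a

lemma E_update (j : ℕ) (v : V) (G : S.Z j → (V → ℤ) → ℝ) :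
    S.E ρ j G = S.E ρ j fun x a =>
      𝔼 n ∈ Finset.Ico (0 : ℤ) (S.R ρ j v), G x (Function.update a v n) := by
  rw [E, expect_bx_update (S.R_pos ρ j) v, E]
  exact Finset.expect_congr rfl fun a _ => Finset.expect_comm _ _ _

/-- Cauchy–Schwarz in a single variable `v`, with `v'` as the fresh copy of `v`. -/
theorem E_cs {v v' : V} (hvv : v ≠ v') (hρ : ρ v = ρ v') (j : ℕ) {c w d : S.Z j → (V → ℤ) → ℝ}
    (hcw : ∀ x a, |c x a| ≤ w x a) (hc : ∀ x, Indep v (c x)) (hw : ∀ x, Indep v (w x))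
    (hw' : ∀ x, Indep v' (w x)) (hd' : ∀ x, Indep v' (d x)) :
    (S.E ρ j fun x a => c x a * d x a) ^ 2
      ≤ S.E ρ j w * S.E ρ j fun x a => w x a * (d x a * d x (a ∘ Equiv.swap v v')) := by
  have hR : S.R ρ j v = S.R ρ j v' := by simp [R, hρ]
  have h1 : (S.E ρ j fun x a => c x a * d x a)
      = S.E ρ j fun x a => c x a *
        𝔼 n ∈ Finset.Ico (0 : ℤ) (S.R ρ j v), d x (Function.update a v n) := by
    rw [S.E_update ρ j v]
    refine S.E_congr ρ fun x a => ?_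
    simp only [hc x a]
    rw [Finset.mul_expect]
  have h2 : (S.E ρ j fun x a => w x a * (d x a * d x (a ∘ Equiv.swap v v')))
      = S.E ρ j fun x a => w x a *
        (𝔼 n ∈ Finset.Ico (0 : ℤ) (S.R ρ j v), d x (Function.update a v n)) ^ 2 := by
    rw [S.E_update ρ j v, S.E_update ρ j v']
    refine S.E_congr ρ fun x a => ?_
    rw [sq, Finset.expect_mul_expect, Finset.mul_expect, ← hR]
    refine Finset.expect_congr rfl fun m _ => ?_
    rw [Finset.mul_expect]
    refine Finset.expect_congr rfl fun n _ => ?_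
    rw [hw x, hw' x, (hd' x).comp_swap, Function.update_of_ne hvv.symm, Function.update_self,
      Function.update_idem, Function.update_comm hvv.symm, hd' x, Function.update_comm hvv.symm,
      hd' x, mul_comm (d x _)]
  rw [h1, h2]
  exact S.E_cs' ρ j _ _ _ hcw

end Sys

section Dbl
variable {U : Type*} [DecidableEq U]

/-- A polynomial form in the variables of `U` and their copies. -/
abbrev Form (U : Type*) := (Bool × U → ℤ) → ℤ

/-- Exchange of the variable `u` with its copy. -/
def sw (u : U) : Bool × U ≃ Bool × U := Equiv.swap (false, u) (true, u)

/-- The form `p` with `u` exchanged with its copy. -/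
def Form.sw (u : U) (p : Form U) : Form U := fun a => p (a ∘ PolyPattern.sw u)

lemma Form.sw_sw (u : U) (p : Form U) : (p.sw u).sw u = p := by
  funext a
  simp only [Form.sw]
  congr 1
  ext w
  simp [PolyPattern.sw]

lemma Form.sw_injective (u : U) : Function.Injective (Form.sw u) :=
  Function.LeftInverse.injective (Form.sw_sw u)

lemma Form.isPoly_sw {u : U} {p : Form U} (h : IsPoly p) : IsPoly (p.sw u) := h.comp _

lemma Form.indep_sw {u : U} {w : Bool × U} {p : Form U}
    (h : Indep (PolyPattern.sw u w) p) : Indep w (p.sw u) :=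
  Indep.comp_equiv _ (by simpa [PolyPattern.sw] using h)

lemma sw_of_ne {u u' : U} (h : u' ≠ u) (b : Bool) : sw u (b, u') = (b, u') :=
  Equiv.swap_apply_of_ne_of_ne (by simp [h]) (by simp [h])

lemma Form.indep_sw_of_ne {u u' : U} (h : u' ≠ u) {b : Bool} {p : Form U} :
    Indep (b, u') (p.sw u) ↔ Indep (b, u') p := by
  constructor
  · intro h'
    have := Form.indep_sw (u := u) (w := (b, u')) (p := p.sw u) (by rwa [sw_of_ne h])
    rwa [Form.sw_sw] at this
  · intro h'
    exact Form.indep_sw (by rwa [sw_of_ne h])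

lemma Form.indep_false_sw {u : U} {p : Form U} (h : Indep (true, u) p) :
    Indep (false, u) (p.sw u) := Form.indep_sw (by simpa [PolyPattern.sw] using h)

lemma Form.indep_true_sw {u : U} {p : Form U} (h : Indep (false, u) p) :
    Indep (true, u) (p.sw u) := Form.indep_sw (by simpa [PolyPattern.sw] using h)

lemma Form.sw_eq {u : U} {p : Form U} (h : Indep (false, u) p) (h' : Indep (true, u) p) :
    p.sw u = p := funext fun a => h.comp_swap_eq h' a

open scoped Classical in
/-- The forms of `A` together with their copies with `u` replaced by its copy. -/
noncomputable def dbl (u : U) (A : Finset (Form U)) : Finset (Form U) := A ∪ A.image (Form.sw u)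

/-- Doubling of a list of variables. -/
noncomputable def dblL (us : List U) (A : Finset (Form U)) : Finset (Form U) :=
  us.foldl (fun B u => dbl u B) A

lemma mem_dbl {u : U} {A : Finset (Form U)} {p : Form U} :
    p ∈ dbl u A ↔ p ∈ A ∨ ∃ q ∈ A, q.sw u = p := by simp [dbl]

lemma card_dbl (u : U) (A : Finset (Form U)) : (dbl u A).card ≤ 2 * A.card := by
  classical
  refine (Finset.card_union_le _ _).trans ?_
  have : (A.image (Form.sw u)).card ≤ A.card := Finset.card_image_le
  omega

open scoped Classical in
lemma prod_dbl {u : U} {A : Finset (Form U)} (hA : ∀ p ∈ A, Indep (true, u) p)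
    (F : Form U → ℝ) :
    ∏ p ∈ dbl u A, F p = (∏ p ∈ A with Indep (false, u) p, F p) *
      ((∏ p ∈ A with ¬ Indep (false, u) p, F p) *
        ∏ p ∈ A with ¬ Indep (false, u) p, F (Form.sw u p)) := by
  have h1 : dbl u A = A ∪ (A.filter fun p => ¬ Indep (false, u) p).image (Form.sw u) := by
    ext p
    simp only [mem_dbl, Finset.mem_union, Finset.mem_image, Finset.mem_filter]
    constructor
    · rintro (h | ⟨q, hq, rfl⟩)
      · exact Or.inl h
      · by_cases hi : Indep (false, u) q
        · left; rwa [Form.sw_eq hi (hA q hq)]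
        · exact Or.inr ⟨q, ⟨hq, hi⟩, rfl⟩
    · rintro (h | ⟨q, hq, rfl⟩)
      · exact Or.inl h
      · exact Or.inr ⟨q, hq.1, rfl⟩
  have hdisj : Disjoint A ((A.filter fun p => ¬ Indep (false, u) p).image (Form.sw u)) := by
    rw [Finset.disjoint_left]
    rintro p hp hp'
    obtain ⟨q, hq, rfl⟩ := Finset.mem_image.1 hp'
    have := Form.indep_false_sw (hA _ hp)
    rw [Form.sw_sw] at this
    exact (Finset.mem_filter.1 hq).2 this
  rw [h1, Finset.prod_union hdisj, Finset.prod_image fun p _ q _ h => Form.sw_injective u h,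
    ← Finset.prod_filter_mul_prod_filter_not A (fun p => Indep (false, u) p), mul_assoc]

lemma prod_dbl_of_dep {u : U} {A : Finset (Form U)} (hA : ∀ p ∈ A, Indep (true, u) p)
    (hA' : ∀ p ∈ A, ¬ Indep (false, u) p) (F : Form U → ℝ) :
    ∏ p ∈ dbl u A, F p = (∏ p ∈ A, F p) * ∏ p ∈ A, F (Form.sw u p) := by
  classical
  rw [prod_dbl hA, Finset.filter_false_of_mem hA', Finset.filter_true_of_mem hA',
    Finset.prod_empty, one_mul]

end Dbl

namespace Sys
variable {k₀ : ℕ} (S : Sys k₀)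
variable {U : Type*} [Fintype U] [DecidableEq U] (ρ : U → Fin 3)

/-- A family of functions on all the cyclic groups. -/
abbrev Fn := ∀ j, S.Z j → ℝ

lemma sq_tendsto {u m v : ℕ → ℝ} (h : ∀ j, u j ^ 2 ≤ m j * v j) (hm : Tendsto m atTop (𝓝 1))
    (hv : Tendsto v atTop (𝓝 0)) : Tendsto u atTop (𝓝 0) := by
  have h1 : Tendsto (fun j => u j ^ 2) atTop (𝓝 0) :=
    squeeze_zero (fun j => sq_nonneg _) h (by simpa using hm.mul hv)
  have h2 := h1.sqrt
  simp only [Real.sqrt_sq_eq_abs, Real.sqrt_zero] at h2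
  exact (tendsto_zero_iff_abs_tendsto_zero _).2 h2

/-- The weighted generalised von Neumann theorem: successive applications of Cauchy–Schwarz in the
variables `us` replace the average of a product by the average over all copies of the target
forms, weighted by all copies of the other forms. -/
theorem tendsto_of_dblL (b : S.Fn) (us : List U) (hus : us.Nodup) :
    ∀ (Tg Wt : Finset (Form U)) (f : Form U → S.Fn)
      (H : U → ∀ j, S.Z j → (Bool × U → ℤ) → ℝ),
    Wt.card * 2 ^ us.length ≤ k₀ →
    (∀ p ∈ Wt, IsPoly p) →
    (∀ p ∈ Tg, ∀ u ∈ us, Indep (true, u) p ∧ ¬ Indep (false, u) p) →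
    (∀ p ∈ Wt, ∀ u ∈ us, Indep (true, u) p) →
    (∀ p ∈ Wt, ∀ j x, |f p j x| ≤ S.ν j x) →
    (∀ p ∈ Wt, f p = S.ν ∨ ∃ u ∈ us, Indep (false, u) p) →
    (∀ u ∈ us, ∀ j x a, |H u j x a| ≤ 1) →
    (∀ u ∈ us, ∀ j x, Indep (false, u) (H u j x)) →
    (∀ u ∈ us, ∀ u' ∈ us, ∀ j x, Indep (true, u') (H u j x)) →
    Tendsto (fun j => S.E (ρ ∘ Prod.snd) j fun x a =>
      (∏ p ∈ dblL us Tg, b j (S.pt j x (p a))) * ∏ p ∈ dblL us Wt, S.ν j (S.pt j x (p a)))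
      atTop (𝓝 0) →
    Tendsto (fun j => S.E (ρ ∘ Prod.snd) j fun x a =>
      (∏ p ∈ Tg, b j (S.pt j x (p a))) * (∏ p ∈ Wt, f p j (S.pt j x (p a))) *
        (us.map fun u => H u j x a).prod) atTop (𝓝 0) := by
  classical
  induction us with
  | nil =>
    intro Tg Wt f H _ _ _ _ _ hf _ _ _ hlim
    refine hlim.congr fun j => S.E_congr _ fun x a => ?_
    simp only [List.map_nil, List.prod_nil, mul_one]
    congr 1
    refine Finset.prod_congr rfl fun p hp => ?_
    rcases hf p hp with h | ⟨u, hu, -⟩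
    · rw [h]
    · simp at hu
  | cons v us ih =>
    intro Tg Wt f H hcard hpoly hTg hWt hfν hf hH1 hHi hHt hlim
    have hv : v ∉ us := (List.nodup_cons.1 hus).1
    have hmem : v ∈ v :: us := by simp
    let f' : Form U → S.Fn := fun p =>
      if Indep (false, v) p then (if Indep (true, v) p then S.ν else f (p.sw v)) else f p
    let H' : U → ∀ j, S.Z j → (Bool × U → ℤ) → ℝ := fun u j x a =>
      H u j x a * H u j x (a ∘ sw v)
    have hsub : ∀ u ∈ us, u ∈ v :: us := fun u hu => List.mem_cons_of_mem _ hu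
    have hne : ∀ u ∈ us, u ≠ v := fun u hu h => hv (h ▸ hu)
    have key := ih (List.nodup_cons.1 hus).2 (dbl v Tg) (dbl v Wt) f' H' ?_ ?_ ?_ ?_ ?_ ?_ ?_ ?_ ?_
      hlim
    · refine sq_tendsto (m := fun j => S.E (ρ ∘ Prod.snd) j fun x a =>
        ∏ p ∈ Wt with Indep (false, v) p, S.ν j (S.pt j x (p a))) (fun j => ?_) ?_ key
      · have hcs := S.E_cs (ρ ∘ Prod.snd) (v := (false, v)) (v' := (true, v)) (by simp) rfl j
          (c := fun x a => (∏ p ∈ Wt with Indep (false, v) p, f p j (S.pt j x (p a))) * H v j x a)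
          (w := fun x a => ∏ p ∈ Wt with Indep (false, v) p, S.ν j (S.pt j x (p a)))
          (d := fun x a => (∏ p ∈ Tg, b j (S.pt j x (p a))) *
            (∏ p ∈ Wt with ¬ Indep (false, v) p, f p j (S.pt j x (p a))) *
            (us.map fun u => H u j x a).prod) ?_ ?_ ?_ ?_ ?_
        · refine le_trans (le_of_eq ?_) (hcs.trans (le_of_eq ?_))
          · congr 1
            refine S.E_congr _ fun x a => ?_
            rw [← Finset.prod_filter_mul_prod_filter_not Wt (fun p => Indep (false, v) p)]
            simp only [List.map_cons, List.prod_cons]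
            ring
          · congr 1
            refine S.E_congr _ fun x a => ?_
            rw [prod_dbl_of_dep (fun p hp => (hTg p hp v hmem).1) fun p hp => (hTg p hp v hmem).2,
              prod_dbl fun p hp => hWt p hp v hmem]
            have e1 : ∏ p ∈ Wt with Indep (false, v) p, f' p j (S.pt j x (p a))
                = ∏ p ∈ Wt with Indep (false, v) p, S.ν j (S.pt j x (p a)) := by
              refine Finset.prod_congr rfl fun p hp => ?_
              rw [Finset.mem_filter] at hp
              simp only [f', if_pos hp.2, if_pos (hWt p hp.1 v hmem)]
            have e2 : ∏ p ∈ Wt with ¬ Indep (false, v) p, f' p j (S.pt j x (p a))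
                = ∏ p ∈ Wt with ¬ Indep (false, v) p, f p j (S.pt j x (p a)) := by
              refine Finset.prod_congr rfl fun p hp => ?_
              rw [Finset.mem_filter] at hp
              simp only [f', if_neg hp.2]
            have e3 : ∏ p ∈ Wt with ¬ Indep (false, v) p, f' (Form.sw v p) j (S.pt j x (Form.sw v p a))
                = ∏ p ∈ Wt with ¬ Indep (false, v) p, f p j (S.pt j x (p (a ∘ sw v))) := by
              refine Finset.prod_congr rfl fun p hp => ?_
              rw [Finset.mem_filter] at hp
              have h1 : Indep (false, v) (Form.sw v p) := Form.indep_false_sw (hWt p hp.1 v hmem)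
              have h2 : ¬ Indep (true, v) (Form.sw v p) := fun h => hp.2 (by
                have := Form.sw_sw v p ▸ Form.indep_sw (u := v) (w := (false, v)) (p := Form.sw v p)
                  (by simpa [sw] using h)
                exact this)
              simp only [f', if_pos h1, if_neg h2, Form.sw_sw]
              rfl
            have e4 : (us.map fun u => H' u j x a).prod = (us.map fun u => H u j x a).prod *
                (us.map fun u => H u j x (a ∘ sw v)).prod := List.prod_map_mul
            rw [e1, e2, e3, e4]
            simp only [Form.sw]
            change _ * (_ * (((∏ p ∈ Tg, b j (S.pt j x (p (a ∘ sw v)))) *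
              ∏ p ∈ Wt with ¬ Indep (false, v) p, f p j (S.pt j x (p (a ∘ sw v)))) *
              (us.map fun u => H u j x (a ∘ sw v)).prod)) = _
            ring
        · intro x a
          rw [abs_mul, Finset.abs_prod]
          refine (mul_le_of_le_one_right (by positivity) (hH1 v hmem j x a)).trans ?_
          exact Finset.prod_le_prod (fun _ _ => abs_nonneg _) fun p hp =>
            hfν p (Finset.mem_filter.1 hp).1 _ _
        · intro x a n
          simp only [hHi v hmem j x a n]
          congr 1
          exact Finset.prod_congr rfl fun p hp => by rw [(Finset.mem_filter.1 hp).2 a n]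
        · intro x a n
          exact Finset.prod_congr rfl fun p hp => by rw [(Finset.mem_filter.1 hp).2 a n]
        · intro x a n
          exact Finset.prod_congr rfl fun p hp => by
            rw [hWt p (Finset.mem_filter.1 hp).1 v hmem a n]
        · intro x a n
          simp only
          congr 1
          · congr 1
            · exact Finset.prod_congr rfl fun p hp => by rw [(hTg p hp v hmem).1 a n]
            · exact Finset.prod_congr rfl fun p hp => by
                rw [hWt p (Finset.mem_filter.1 hp).1 v hmem a n]
          · congr 1
            exact List.map_congr_left fun u hu => hHt u (hsub u hu) v hmem j x a n
      · refine S.tendsto_prod_weights _ (fun p hp => hpoly p (Finset.mem_filter.1 hp).1) ?_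
        refine (Finset.card_filter_le _ _).trans (le_trans ?_ hcard)
        exact Nat.le_mul_of_pos_right _ (by positivity)
    · refine le_trans (Nat.mul_le_mul_right _ (card_dbl v Wt)) (le_trans (le_of_eq ?_) hcard)
      rw [List.length_cons, pow_succ]; ring
    · intro p hp
      rcases mem_dbl.1 hp with h | ⟨q, hq, rfl⟩
      · exact hpoly p h
      · exact Form.isPoly_sw (hpoly q hq)
    · intro p hp u hu
      rcases mem_dbl.1 hp with h | ⟨q, hq, rfl⟩
      · exact hTg p h u (hsub u hu)
      · rw [Form.indep_sw_of_ne (hne u hu), Form.indep_sw_of_ne (hne u hu)]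
        exact hTg q hq u (hsub u hu)
    · intro p hp u hu
      rcases mem_dbl.1 hp with h | ⟨q, hq, rfl⟩
      · exact hWt p h u (hsub u hu)
      · rw [Form.indep_sw_of_ne (hne u hu)]
        exact hWt q hq u (hsub u hu)
    · intro p hp j x
      have hνν : ∀ j x, |S.ν j x| ≤ S.ν j x := fun j x => (abs_of_nonneg (S.nonneg j x)).le
      simp only [f']
      rcases mem_dbl.1 hp with h | ⟨q, hq, rfl⟩
      · split_ifs with h1 h2
        · exact hνν j x
        · exact absurd (hWt p h v hmem) h2
        · exact hfν p h j x
      · rw [Form.sw_sw]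
        split_ifs with h1 h2
        · exact hνν j x
        · exact hfν q hq j x
        · exact absurd (Form.indep_false_sw (hWt q hq v hmem)) h1
    · intro p hp
      simp only [f']
      rcases mem_dbl.1 hp with h | ⟨q, hq, rfl⟩
      · split_ifs with h1 h2
        · exact Or.inl rfl
        · exact absurd (hWt p h v hmem) h2
        · rcases hf p h with h3 | ⟨u, hu, h3⟩
          · exact Or.inl h3
          · rcases List.mem_cons.1 hu with rfl | hu
            · exact absurd h3 h1
            · exact Or.inr ⟨u, hu, h3⟩
      · rw [Form.sw_sw]
        split_ifs with h1 h2
        · exact Or.inl rfl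
        · rcases hf q hq with h3 | ⟨u, hu, h3⟩
          · exact Or.inl h3
          · rcases List.mem_cons.1 hu with rfl | hu
            · exact absurd (Form.indep_true_sw h3) h2
            · exact Or.inr ⟨u, hu, (Form.indep_sw_of_ne (hne u hu)).2 h3⟩
        · exact absurd (Form.indep_false_sw (hWt q hq v hmem)) h1
    · intro u hu j x a
      rw [abs_mul]
      exact mul_le_one₀ (hH1 u (hsub u hu) j x a) (abs_nonneg _) (hH1 u (hsub u hu) j x _)
    · intro u hu j x a n
      have h1 := hHi u (hsub u hu) j x
      have h2 : Indep (false, u) fun a => H u j x (a ∘ sw v) := Indep.comp_equiv (sw v) (by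
        rw [show (sw v).symm = sw v from Equiv.symm_swap _ _, sw_of_ne (hne u hu)]; exact h1)
      change H u j x _ * H u j x (_ ∘ sw v) = H u j x a * H u j x (a ∘ sw v)
      rw [h1 a n]
      exact congrArg _ (h2 a n)
    · intro u hu u' hu' j x a n
      have h1 := hHt u (hsub u hu) u' (hsub u' hu') j x
      have h2 : Indep (true, u') fun a => H u j x (a ∘ sw v) := Indep.comp_equiv (sw v) (by
        rw [show (sw v).symm = sw v from Equiv.symm_swap _ _, sw_of_ne (hne u' hu')]; exact h1)
      change H u j x _ * H u j x (_ ∘ sw v) = H u j x a * H u j x (a ∘ sw v)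
      rw [h1 a n]
      exact congrArg _ (h2 a n)

end Sys

lemma Indep.eq_of_eq_off {V α : Type*} [DecidableEq V] {G : (V → ℤ) → α} {T : Finset V}
    (h : ∀ u ∈ T, Indep u G) {a b : V → ℤ} (hab : ∀ u ∉ T, a u = b u) : G a = G b := by
  induction T using Finset.induction_on generalizing a with
  | empty => congr 1; ext u; exact hab u (by simp)
  | insert v T hv ih =>
    rw [← h v (by simp) a (b v)]
    refine ih (fun u hu => h u (by simp [hu])) fun u hu => ?_
    by_cases huv : u = v
    · subst huv; simp
    · rw [Function.update_of_ne huv]; exact hab u (by simp [hu, huv])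

lemma abs_expect_shift_sub_le {R : ℕ} (hR : 1 ≤ R) (s : ℤ) {g : ℤ → ℝ} {M : ℝ}
    (hg : ∀ n, |g n| ≤ M) :
    |𝔼 n ∈ Finset.Ico (0 : ℤ) R, g (n + s) - 𝔼 n ∈ Finset.Ico (0 : ℤ) R, g n|
      ≤ 2 * |(s : ℝ)| * M / R := by
  classical
  have hM : 0 ≤ M := (abs_nonneg _).trans (hg 0)
  have h1 : ∑ n ∈ Finset.Ico (0 : ℤ) R, g (n + s) = ∑ n ∈ Finset.Ico s (R + s), g n := by
    rw [Finset.sum_Ico_add' g 0 (R : ℤ) s, zero_add]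
  have hcard : ∀ a b : ℤ, a - b = s ∨ b - a = s →
      ((Finset.Ico a (R + a) \ Finset.Ico b (R + b)).card : ℝ) ≤ |(s : ℝ)| := by
    intro a b hab
    have : Finset.Ico a (R + a) \ Finset.Ico b (R + b) ⊆
        if a ≤ b then Finset.Ico a b else Finset.Ico (R + b) (R + a) := by
      intro n
      simp only [Finset.mem_sdiff, Finset.mem_Ico]
      split_ifs <;> simp only [Finset.mem_Ico] <;> omega
    have h2 := Finset.card_le_card this
    have h3 : (if a ≤ b then Finset.Ico a b else Finset.Ico ((R : ℤ) + b) (R + a)).card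
        = s.natAbs := by
      split_ifs <;> simp only [Int.card_Ico] <;> omega
    rw [h3] at h2
    rw [← Int.cast_abs, Int.abs_eq_natAbs]
    exact_mod_cast h2
  have hsum : ∀ T : Finset ℤ, |∑ n ∈ T, g n| ≤ T.card * M := fun T =>
    (Finset.abs_sum_le_sum_abs _ _).trans
      ((Finset.sum_le_sum fun n _ => hg n).trans (by simp))
  have h4 : |∑ n ∈ Finset.Ico s (R + s), g n - ∑ n ∈ Finset.Ico (0 : ℤ) R, g n|
      ≤ 2 * |(s : ℝ)| * M := by
    rw [← Finset.sum_sdiff_sub_sum_sdiff]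
    refine (abs_sub _ _).trans ?_
    have e1 := hcard s 0 (by simp)
    have e2 := hcard 0 s (by simp)
    rw [add_zero] at e1 e2
    have := hsum (Finset.Ico s (R + s) \ Finset.Ico (0 : ℤ) R)
    have := hsum (Finset.Ico (0 : ℤ) R \ Finset.Ico s (R + s))
    nlinarith
  have hRr : (0 : ℝ) < R := by exact_mod_cast hR
  rw [Finset.expect_eq_sum_div_card, Finset.expect_eq_sum_div_card, h1, ← sub_div, abs_div]
  simp only [Int.card_Ico, sub_zero, Int.toNat_natCast]
  rw [abs_of_pos hRr]
  exact div_le_div_of_nonneg_right h4 hRr.le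

namespace Sys
variable {k₀ : ℕ} (S : Sys k₀)
variable {V : Type*} [Fintype V] [DecidableEq V] (ρ : V → Fin 3)

lemma E_add (j : ℕ) (F G : S.Z j → (V → ℤ) → ℝ) :
    (S.E ρ j fun x a => F x a + G x a) = S.E ρ j F + S.E ρ j G := by
  simp only [E, Finset.expect_add_distrib]

lemma E_sub (j : ℕ) (F G : S.Z j → (V → ℤ) → ℝ) :
    (S.E ρ j fun x a => F x a - G x a) = S.E ρ j F - S.E ρ j G := by
  simp only [E, Finset.expect_sub_distrib]

lemma E_const_mul (j : ℕ) (c : ℝ) (G : S.Z j → (V → ℤ) → ℝ) :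
    (S.E ρ j fun x a => c * G x a) = c * S.E ρ j G := by
  simp only [E, Finset.mul_expect]

lemma E_const (j : ℕ) (c : ℝ) : (S.E ρ j fun _ _ => c) = c := by
  simp only [E, Finset.expect_const Finset.univ_nonempty,
    Finset.expect_const (bx_nonempty (S.R_pos ρ j))]

lemma E_mono_box {j : ℕ} {F G : S.Z j → (V → ℤ) → ℝ}
    (h : ∀ x, ∀ a ∈ bx (S.R ρ j), F x a ≤ G x a) : S.E ρ j F ≤ S.E ρ j G :=
  Finset.expect_le_expect fun a ha => Finset.expect_le_expect fun x _ => h x a ha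

lemma E_mono {j : ℕ} {F G : S.Z j → (V → ℤ) → ℝ} (h : ∀ x a, F x a ≤ G x a) :
    S.E ρ j F ≤ S.E ρ j G := S.E_mono_box ρ fun x a _ => h x a

lemma abs_E_le (j : ℕ) (F : S.Z j → (V → ℤ) → ℝ) :
    |S.E ρ j F| ≤ S.E ρ j fun x a => |F x a| :=
  (Finset.abs_expect_le _ _).trans (Finset.expect_le_expect fun _ _ => Finset.abs_expect_le _ _)

/-- Invariance of the average under translation of the base point. -/
lemma E_pt (j : ℕ) (q : (V → ℤ) → ℤ) (G : S.Z j → (V → ℤ) → ℝ) :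
    (S.E ρ j fun x a => G (S.pt j x (q a)) a) = S.E ρ j G :=
  Finset.expect_congr rfl fun a _ => S.expect_pt j (q a) fun x => G x a

lemma pow_B_le (K : ℕ) : ∀ᶠ j in atTop, S.B j ^ K ≤ S.L 0 j := by
  filter_upwards [(S.B_L K).eventually_lt_const one_pos] with j hj
  have hL : (0 : ℝ) < S.L 0 j := by exact_mod_cast S.L_pos 0 j
  exact ((div_lt_one hL).1 hj).le

lemma tendsto_of_bound {u : ℕ → ℝ} {ρ : V → Fin 3} {v : V} (hv : ρ v ≠ 0) {s : (V → ℤ) → ℤ}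
    (hs : IsPoly s) (hsv : ∀ u, ρ v ≤ ρ u → Indep u s) {C : ℝ} (hC : 0 ≤ C) (K : ℕ)
    (h : ∀ j m, (∀ a ∈ bx (S.R ρ j), |(s a : ℝ)| ≤ m) →
      |u j| ≤ C * (m * S.B j ^ K / S.L (ρ v) j)) :
    Tendsto u atTop (𝓝 0) := by
  obtain ⟨D, d, hD⟩ := hs.bound
  obtain ⟨r, hr, hrv⟩ : ∃ r : Fin 3, (∀ u, ρ u < ρ v → ∀ j, S.L (ρ u) j ≤ S.L r j) ∧
      ∀ k : ℕ, Tendsto (fun j => (S.L r j : ℝ) ^ k / S.L (ρ v) j) atTop (𝓝 0) := by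
    obtain h | h : ρ v = 1 ∨ ρ v = 2 := by
      generalize ρ v = i at hv; fin_cases i <;> simp_all
    · refine ⟨0, fun u hu j => ?_, fun k => h ▸ S.L01 k⟩
      have : ρ u = 0 := by rw [h] at hu; generalize ρ u = i at hu; fin_cases i <;> simp_all
      rw [this]
    · refine ⟨1, fun u hu j => ?_, fun k => h ▸ S.L12 k⟩
      have : ρ u = 0 ∨ ρ u = 1 := by
        rw [h] at hu; generalize ρ u = i at hu; fin_cases i <;> simp_all
      rcases this with h | h <;> rw [h]
      exact (S.L_mono j).1
  refine squeeze_zero_norm' (a := fun j => C * D * ((S.L r j : ℝ) ^ (d + 1) / S.L (ρ v) j)) ?_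
    (by simpa using (hrv (d + 1)).const_mul (C * D))
  filter_upwards [S.pow_B_le K] with j hj
  have hL : (0 : ℝ) < S.L (ρ v) j := by exact_mod_cast S.L_pos _ j
  refine (h j (D * (S.L r j : ℝ) ^ d) fun a ha => ?_).trans ?_
  · rw [mem_bx] at ha
    have h1 : s a = s fun u => if ρ u < ρ v then a u else 0 :=
      Indep.eq_of_eq_off (T := Finset.univ.filter fun u => ρ v ≤ ρ u)
        (fun u hu => hsv u (by simpa using hu)) fun u hu => by
          rw [if_pos (by simpa using hu)]
    rw [h1]
    have h2 := hD (S.L r j) (S.L_pos r j) (fun u => if ρ u < ρ v then a u else 0) fun u => by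
      split_ifs with hu
      · have h3 := ha u
        have h4 := hr u hu j
        simp only [R] at h3
        rw [abs_of_nonneg h3.1]
        omega
      · simp
    rw [← Int.cast_abs]
    exact_mod_cast h2
  · rw [mul_assoc C]
    refine mul_le_mul_of_nonneg_left ?_ hC
    rw [pow_succ, mul_div_assoc', ← mul_assoc]
    refine div_le_div_of_nonneg_right ?_ hL.le
    refine mul_le_mul_of_nonneg_left (hj.trans ?_) (by positivity)
    exact_mod_cast S.L0_le r j

/-- Translating a variable by a polynomial in variables of smaller scale changes the average
negligibly. -/
theorem tendsto_shift {v : V} (hv : ρ v ≠ 0) {s : (V → ℤ) → ℤ} (hs : IsPoly s)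
    (hsv : ∀ u, ρ v ≤ ρ u → Indep u s) {G : ∀ j, S.Z j → (V → ℤ) → ℝ} {C : ℝ} (K : ℕ)
    (hG : ∀ j x a, |G j x a| ≤ C * S.B j ^ K) :
    Tendsto (fun j => S.E ρ j (fun x a => G j x (Function.update a v (a v + s a)))
      - S.E ρ j (G j)) atTop (𝓝 0) := by
  have hC : 0 ≤ C := by
    have h1 := (abs_nonneg _).trans (hG 0 0 0)
    have := S.one_le_B 0
    exact nonneg_of_mul_nonneg_left h1 (by positivity)
  refine S.tendsto_of_bound hv hs hsv (C := 2 * C) (by positivity) K fun j m hm => ?_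
  have hL : (0 : ℝ) < S.L (ρ v) j := by exact_mod_cast S.L_pos _ j
  have hB := S.one_le_B j
  rw [S.E_update ρ j v, S.E_update ρ j v (G j), ← S.E_sub]
  refine (S.abs_E_le ρ j _).trans ?_
  rw [← S.E_const ρ j (2 * C * _)]
  refine S.E_mono_box ρ fun x a ha => ?_
  have h1 : ∀ n, s (Function.update a v n) = s a := fun n => hsv v le_rfl a n
  simp only [h1, Function.update_self, Function.update_idem]
  refine (abs_expect_shift_sub_le (S.R_pos ρ j v) (s a)
    (g := fun n => G j x (Function.update a v n)) fun n => hG j x _).trans ?_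
  have h2 := hm a ha
  change 2 * |(s a : ℝ)| * (C * S.B j ^ K) / S.L (ρ v) j ≤ _
  rw [mul_div_assoc', div_le_div_iff_of_pos_right hL]
  have : |(s a : ℝ)| * (C * S.B j ^ K) ≤ m * (C * S.B j ^ K) :=
    mul_le_mul_of_nonneg_right h2 (by positivity)
  linarith

/-- Simultaneous translation of the variables in `T`. -/
def shift (T : Finset V) (s : V → (V → ℤ) → ℤ) (a : V → ℤ) : V → ℤ :=
  fun v => if v ∈ T then a v + s v a else a v

theorem tendsto_shift_set (T : Finset V) (hT : ∀ v ∈ T, ρ v ≠ 0) {s : V → (V → ℤ) → ℤ}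
    (hs : ∀ v ∈ T, IsPoly (s v)) (hsv : ∀ v ∈ T, ∀ u, ρ u ≠ 0 → Indep u (s v))
    {G : ∀ j, S.Z j → (V → ℤ) → ℝ} {C : ℝ} (K : ℕ) (hG : ∀ j x a, |G j x a| ≤ C * S.B j ^ K) :
    Tendsto (fun j => S.E ρ j (fun x a => G j x (shift T s a)) - S.E ρ j (G j))
      atTop (𝓝 0) := by
  induction T using Finset.induction_on with
  | empty =>
    have h : ∀ a, shift ∅ s a = a := fun a => by ext u; simp [shift]
    simp only [h, sub_self, tendsto_const_nhds_iff]
  | insert v T hv ih =>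
    have h1 := ih (fun u hu => hT u (by simp [hu])) (fun u hu => hs u (by simp [hu]))
      fun u hu => hsv u (by simp [hu])
    have hle : ∀ u, ρ v ≤ ρ u → ρ u ≠ 0 := fun u hu h0 =>
      hT v (by simp) (by rw [h0] at hu; exact Fin.le_zero_iff.1 hu)
    have h2 := S.tendsto_shift ρ (hT v (by simp)) (hs v (by simp))
      (fun u hu => hsv v (by simp) u (hle u hu)) (G := fun j x a => G j x (shift T s a)) K
      fun j x a => hG j x _
    have h3 := h2.add h1
    rw [add_zero] at h3
    refine h3.congr fun j => ?_
    rw [sub_add_sub_cancel]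
    congr 1
    refine S.E_congr ρ fun x a => ?_
    congr 1
    ext u
    by_cases huv : u = v
    · subst huv; simp [shift, hv]
    · by_cases hu : u ∈ T
      · simp [shift, huv, hu, hsv u (by simp [hu]) v (hT v (by simp)) a _]
      · simp [shift, huv, hu]

/-- A product of weights all of which depend on a variable not involved in `c` can be removed. -/
theorem tendsto_strip {v v' : V} (hvv : v ≠ v') (hρ : ρ v = ρ v')
    {A Q : Finset ((V → ℤ) → ℤ)} (hA : ∀ p ∈ A, IsPoly p) (hQ : ∀ p ∈ Q, IsPoly p)
    (hcard : A.card + 2 * Q.card ≤ k₀) (hAv : ∀ p ∈ A, Indep v p) (hAv' : ∀ p ∈ A, Indep v' p)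
    (hQv : ∀ p ∈ Q, ¬ Indep v p) (hQv' : ∀ p ∈ Q, Indep v' p)
    {c : ∀ j, S.Z j → (V → ℤ) → ℝ}
    (hc : ∀ j x a, |c j x a| ≤ ∏ p ∈ A, S.ν j (S.pt j x (p a))) (hcv : ∀ j x, Indep v (c j x)) :
    Tendsto (fun j => S.E ρ j fun x a => c j x a * (∏ p ∈ Q, S.ν j (S.pt j x (p a)) - 1))
      atTop (𝓝 0) := by
  classical
  set σ : ((V → ℤ) → ℤ) → ((V → ℤ) → ℤ) := fun p a => p (a ∘ Equiv.swap v v') with hσ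
  have hσσ : ∀ p, σ (σ p) = p := fun p => by
    funext a; simp only [hσ]; congr 1; ext w; simp
  have hσi : Function.Injective σ := Function.LeftInverse.injective hσσ
  have hσv : ∀ p, Indep v' p → Indep v (σ p) := fun p h =>
    Indep.comp_equiv _ (by simpa using h)
  have hσv' : ∀ p, Indep v (σ p) → Indep v' p := fun p h => by
    rw [← hσσ p]; exact Indep.comp_equiv _ (by simpa using h)
  have hσv2 : ∀ p, Indep v' (σ p) → Indep v p := fun p h => by
    rw [← hσσ p]; exact hσv _ h
  have d1 : Disjoint A Q := Finset.disjoint_left.2 fun p h1 h2 => hQv p h2 (hAv p h1)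
  have d2 : Disjoint A (Q.image σ) := Finset.disjoint_left.2 fun p h1 h2 => by
    obtain ⟨q, hq, rfl⟩ := Finset.mem_image.1 h2
    exact hQv q hq (hσv2 q (hAv' _ h1))
  have d3 : Disjoint (A ∪ Q) (Q.image σ) := by
    rw [Finset.disjoint_union_left]
    refine ⟨d2, Finset.disjoint_left.2 fun p h1 h2 => ?_⟩
    obtain ⟨q, hq, rfl⟩ := Finset.mem_image.1 h2
    exact hQv _ h1 (hσv q (hQv' q hq))
  have hQi : ∀ p ∈ Q.image σ, IsPoly p := fun p hp => by
    obtain ⟨q, hq, rfl⟩ := Finset.mem_image.1 hp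
    exact (hQ q hq).comp _
  have cQ : (Q.image σ).card ≤ Q.card := Finset.card_image_le
  have w1 := S.tendsto_prod_weights ρ hA (by omega)
  have w2 := S.tendsto_prod_weights ρ (A := A ∪ Q)
    (fun p hp => (Finset.mem_union.1 hp).elim (hA p) (hQ p))
    ((Finset.card_union_le _ _).trans (by omega))
  have w3 := S.tendsto_prod_weights ρ (A := A ∪ Q.image σ)
    (fun p hp => (Finset.mem_union.1 hp).elim (hA p) (hQi p))
    ((Finset.card_union_le _ _).trans (by omega))
  have w4 := S.tendsto_prod_weights ρ (A := A ∪ Q ∪ Q.image σ)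
    (fun p hp => (Finset.mem_union.1 hp).elim
      (fun h => (Finset.mem_union.1 h).elim (hA p) (hQ p)) (hQi p))
    ((Finset.card_union_le _ _).trans (by have := Finset.card_union_le A Q; omega))
  have hlim := ((w4.sub w2).sub w3).add w1
  rw [show (1 : ℝ) - 1 - 1 + 1 = 0 by norm_num] at hlim
  refine sq_tendsto (fun j => ?_) w1 hlim
  have hcs := S.E_cs ρ hvv hρ j (c := c j)
    (w := fun x a => ∏ p ∈ A, S.ν j (S.pt j x (p a)))
    (d := fun x a => ∏ p ∈ Q, S.ν j (S.pt j x (p a)) - 1) (hc j) (hcv j)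
    (fun x a n => Finset.prod_congr rfl fun p hp => by rw [hAv p hp])
    (fun x a n => Finset.prod_congr rfl fun p hp => by rw [hAv' p hp])
    (fun x a n => by
      simp only
      congr 1
      exact Finset.prod_congr rfl fun p hp => by rw [hQv' p hp])
  refine hcs.trans (le_of_eq ?_)
  congr 1
  rw [← S.E_sub, ← S.E_sub, ← S.E_add]
  refine S.E_congr ρ fun x a => ?_
  rw [Finset.prod_union d3, Finset.prod_union d1, Finset.prod_union d2,
    Finset.prod_image fun p _ q _ h => hσi h]
  simp only [hσ]
  ring

end Sys

section Flip
variable {U : Type*} [DecidableEq U]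

/-- Exchange of all the variables in `D` with their copies. -/
def flip (D : Finset U) (w : Bool × U) : Bool × U := (xor w.1 (decide (w.2 ∈ D)), w.2)

lemma flip_comp_sw {u : U} {D : Finset U} (h : u ∉ D) : flip D ∘ sw u = flip (insert u D) := by
  ext ⟨b, v⟩
  · by_cases hv : v = u
    · subst hv
      cases b <;> simp [sw, flip, h]
    · simp [sw_of_ne hv, flip, hv]
  · by_cases hv : v = u
    · subst hv
      cases b <;> simp [sw, flip]
    · simp [sw_of_ne hv, flip]

lemma prod_dblL (us : List U) (hus : us.Nodup) (F : Form U → ℝ) : ∀ A : Finset (Form U),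
    (∀ p ∈ A, ∀ u ∈ us, Indep (true, u) p ∧ ¬ Indep (false, u) p) →
    ∏ p ∈ dblL us A, F p = ∏ D ∈ us.toFinset.powerset, ∏ p ∈ A, F fun a => p (a ∘ flip D) := by
  induction us with
  | nil =>
    intro A _
    have : flip (∅ : Finset U) = id := by ext ⟨b, v⟩ <;> simp [flip]
    simp [dblL, this]
  | cons v us ih =>
    intro A hA
    have hv : v ∉ us := (List.nodup_cons.1 hus).1
    change ∏ p ∈ dblL us (dbl v A), F p = _
    rw [ih (List.nodup_cons.1 hus).2, List.toFinset_cons,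
      Finset.prod_powerset_insert (by simpa using hv), ← Finset.prod_mul_distrib]
    · refine Finset.prod_congr rfl fun D hD => ?_
      rw [prod_dbl_of_dep (fun p hp => (hA p hp v (by simp)).1)
        fun p hp => (hA p hp v (by simp)).2]
      congr 1
      refine Finset.prod_congr rfl fun p _ => ?_
      rw [← flip_comp_sw fun h => hv (by simpa using Finset.mem_powerset.1 hD h)]
      rfl
    · intro p hp u hu
      have hne : u ≠ v := fun h => hv (h ▸ hu)
      rcases mem_dbl.1 hp with h | ⟨q, hq, rfl⟩
      · exact hA p h u (List.mem_cons_of_mem _ hu)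
      · rw [Form.indep_sw_of_ne hne, Form.indep_sw_of_ne hne]
        exact hA q hq u (List.mem_cons_of_mem _ hu)

lemma dblL_induction {P : Form U → Prop} (us : List U)
    (hP : ∀ u ∈ us, ∀ p, P p → P (p.sw u)) : ∀ A : Finset (Form U), (∀ p ∈ A, P p) →
    ∀ p ∈ dblL us A, P p := by
  induction us with
  | nil => intro A hA; exact hA
  | cons v us ih =>
    intro A hA
    refine ih (fun u hu => hP u (List.mem_cons_of_mem _ hu)) (dbl v A) fun p hp => ?_
    rcases mem_dbl.1 hp with h | ⟨q, hq, rfl⟩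
    · exact hA p h
    · exact hP v (by simp) q (hA q hq)

lemma card_dblL (us : List U) : ∀ A : Finset (Form U),
    (dblL us A).card ≤ A.card * 2 ^ us.length := by
  induction us with
  | nil => intro A; simp [dblL]
  | cons v us ih =>
    intro A
    refine (ih (dbl v A)).trans ?_
    rw [List.length_cons, pow_succ, mul_comm _ 2, ← mul_assoc, mul_comm A.card 2]
    exact Nat.mul_le_mul_right _ (card_dbl v A)

end Flip

namespace Sys
variable {k₀ : ℕ} (S : Sys k₀)

lemma E_comp {V V' : Type*} [Fintype V] [DecidableEq V] [Fintype V'] [DecidableEq V']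
    (ρ : V → Fin 3) {i : V' → V} (hi : i.Injective) (j : ℕ) (G : S.Z j → (V' → ℤ) → ℝ) :
    (S.E ρ j fun x a => G x (a ∘ i)) = S.E (ρ ∘ i) j G :=
  expect_bx_comp (S.R_pos ρ j) hi fun b => 𝔼 x, G x b

/-- The box average with directions `c`. -/
noncomputable def Box {Θ I : Type*} [Fintype Θ] [DecidableEq Θ] [Fintype I] [DecidableEq I]
    (c : I → (Θ → ℤ) → ℤ) (G : Finset I → ∀ j, (Θ → ℤ) → S.Z j → ℝ) (j : ℕ) : ℝ :=
  S.E (Sum.elim (fun _ : Θ => 0) fun _ : Bool × I => 1) j fun x a => ∏ D : Finset I,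
    G D j (a ∘ Sum.inl)
      (S.pt j x (∑ i ∈ D, c i (a ∘ Sum.inl) * (a (.inr (false, i)) - a (.inr (true, i)))))

/-- The average over quadratic configurations. -/
noncomputable def T (A B : ℤ) (f₀ f₁ e : S.Fn) (j : ℕ) : ℝ :=
  S.E (fun _ : Unit => 2) j fun x a =>
    f₀ j x * f₁ j (S.pt j x (A * a () ^ 2)) * e j (S.pt j x (B * a () ^ 2))

/-- Nonzero vertices of the discrete cube. -/
abbrev Vert := {d : Bool × Bool × Bool // d ≠ (false, false, false)}

/-- Variables used in the linearisation. -/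
abbrev PVar := Fin 4 ⊕ Vert

/-- Scales of the variables. -/
def prk : PVar → Fin 3 := Sum.elim ![0, 0, 0, 2] fun _ => 1

section Lin
variable (A B : ℤ) (a : Bool × PVar → ℤ)

/-- The sum of the variables that are never doubled by hand. -/
def st : ℤ := a (false, .inl 3) + ∑ i, a (false, .inr i)

/-- The perturbed quadratic variable. -/
def nn (α β γ : Bool) : ℤ := st a + a (α, .inl 0) + a (β, .inl 1) + a (γ, .inl 2)

/-- The linear difference form. -/
def ell (β γ : Bool) : ℤ := A * (a (true, .inl 0) - a (false, .inl 0)) *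
  (2 * (st a + a (β, .inl 1) + a (γ, .inl 2)) + a (false, .inl 0) + a (true, .inl 0))

/-- The bilinear difference form. -/
def blf : ℤ := 2 * A * (a (true, .inl 0) - a (false, .inl 0)) *
  (a (true, .inl 1) - a (false, .inl 1))

/-- The form attached to a vertex. -/
def evt (d : Bool × Bool × Bool) : ℤ :=
  B * nn a d.1 d.2.1 d.2.2 ^ 2 - A * nn a false d.2.1 d.2.2 ^ 2 - ell A a false d.2.2

/-- The forms carrying the weights. -/
def wtf : Bool ⊕ Bool ⊕ Bool × Bool → ℤ
  | .inl δ => if δ then blf A a else 0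
  | .inr (.inl γ) => - ell A a false γ
  | .inr (.inr (β, γ)) => - A * nn a false β γ ^ 2 - ell A a false γ

/-- Directions of the box average. -/
def dir (d : Bool × Bool × Bool) (θ : Bool × Fin 3 → ℤ) : ℤ :=
  2 * (B * (θ (d.1, 0) - θ (false, 0)) +
    (B - A) * (θ (d.2.1, 1) - θ (false, 1) + (θ (d.2.2, 2) - θ (false, 2))))

/-- The embedding of the parameters of the box average into all the variables. -/
def par (w : Bool × Fin 3) : Bool × PVar := (w.1, .inl w.2.castSucc)

/-- The form subtracted from all the others. -/
def base : ℤ := evt A B a (false, false, false) + ∑ i : Vert, dir A B i.1 (a ∘ par) * a (false, .inr i)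

/-- All the forms except for the target. -/
def phi : Vert ⊕ (Bool ⊕ Bool ⊕ Bool × Bool) → ℤ
  | .inl i => evt A B a i.1 - base A B a
  | .inr k => wtf A a k - base A B a

lemma evt_sub (d : Bool × Bool × Bool) : ∃ r : ℤ, evt A B a d - evt A B a (false, false, false)
    = dir A B d (a ∘ par) * st a + r ∧ r = 
      B * (a (d.1, .inl 0) + a (d.2.1, .inl 1) + a (d.2.2, .inl 2)) ^ 2
      - A * (a (false, .inl 0) + a (d.2.1, .inl 1) + a (d.2.2, .inl 2)) ^ 2
      - A * (a (true, .inl 0) - a (false, .inl 0)) * 2 * (a (d.2.2, .inl 2) - a (false, .inl 2))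
      - (B - A) * (a (false, .inl 0) + a (false, .inl 1) + a (false, .inl 2)) ^ 2 := by
  refine ⟨_, ?_, rfl⟩
  simp only [evt, nn, ell, dir, par, Function.comp_apply]
  have h0 : (Fin.castSucc (0 : Fin 3)) = (0 : Fin 4) := rfl
  have h1 : (Fin.castSucc (1 : Fin 3)) = (1 : Fin 4) := rfl
  have h2 : (Fin.castSucc (2 : Fin 3)) = (2 : Fin 4) := rfl
  rw [h0, h1, h2]
  ring

/-- A numerical assignment used for showing that forms are distinct. -/
def val (n : ℤ) : Bool × PVar → ℤ
  | (b, .inl i) => if b then ![8, 3, 10, 0] i else ![7, 0, 0, n] i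
  | (_, .inr _) => 0

lemma evt_isPoly (d : Bool × Bool × Bool) : IsPoly fun a => evt A B a d := by
  have hst : IsPoly fun a : Bool × PVar → ℤ => st a :=
    (IsPoly.coord _).add (IsPoly.sum fun i _ => IsPoly.coord _)
  have hn : ∀ α β γ, IsPoly fun a : Bool × PVar → ℤ => nn a α β γ := fun α β γ =>
    ((hst.add (IsPoly.coord _)).add (IsPoly.coord _)).add (IsPoly.coord _)
  have hl : ∀ β γ, IsPoly fun a : Bool × PVar → ℤ => ell A a β γ := fun β γ =>
    ((IsPoly.const A).mul ((IsPoly.coord _).sub (IsPoly.coord _))).mul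
      (((((IsPoly.const 2).mul ((hst.add (IsPoly.coord _)).add (IsPoly.coord _))).add
        (IsPoly.coord _)).add (IsPoly.coord _)))
  exact (((IsPoly.const B).mul ((hn _ _ _).pow 2)).sub
    ((IsPoly.const A).mul ((hn _ _ _).pow 2))).sub (hl _ _)

lemma dir_isPoly (d : Bool × Bool × Bool) : IsPoly fun θ => dir A B d θ :=
  (IsPoly.const 2).mul (((IsPoly.const B).mul ((IsPoly.coord _).sub (IsPoly.coord _))).add
    ((IsPoly.const (B - A)).mul (((IsPoly.coord _).sub (IsPoly.coord _)).add
      ((IsPoly.coord _).sub (IsPoly.coord _)))))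

lemma base_isPoly : IsPoly fun a => base A B a :=
  (evt_isPoly A B _).add (IsPoly.sum fun i _ => ((dir_isPoly A B i.1).comp par).mul (IsPoly.coord _))

lemma blf_isPoly : IsPoly fun a => blf A a :=
  (((IsPoly.const 2).mul (IsPoly.const A)).mul ((IsPoly.coord _).sub (IsPoly.coord _))).mul
    ((IsPoly.coord _).sub (IsPoly.coord _))

lemma phi_isPoly (k) : IsPoly fun a => phi A B a k := by
  rcases k with i | k
  · exact (evt_isPoly A B _).sub (base_isPoly A B)
  · have hst : IsPoly fun a : Bool × PVar → ℤ => st a :=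
      (IsPoly.coord _).add (IsPoly.sum fun i _ => IsPoly.coord _)
    have hn : ∀ α β γ, IsPoly fun a : Bool × PVar → ℤ => nn a α β γ := fun α β γ =>
      ((hst.add (IsPoly.coord _)).add (IsPoly.coord _)).add (IsPoly.coord _)
    have hl : ∀ β γ, IsPoly fun a : Bool × PVar → ℤ => ell A a β γ := fun β γ =>
      ((IsPoly.const A).mul ((IsPoly.coord _).sub (IsPoly.coord _))).mul
        (((((IsPoly.const 2).mul ((hst.add (IsPoly.coord _)).add (IsPoly.coord _))).add
          (IsPoly.coord _)).add (IsPoly.coord _)))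
    refine IsPoly.sub ?_ (base_isPoly A B)
    rcases k with (_ | _) | γ | ⟨β, γ⟩
    · exact IsPoly.const 0
    · exact blf_isPoly A
    · exact (hl _ _).neg
    · exact ((IsPoly.const (-A)).mul ((hn _ _ _).pow 2)).sub (hl _ _)

lemma st_update {w : Bool × PVar} (h : w.1 = true) (n : ℤ) :
    st (Function.update a w n) = st a := by
  obtain ⟨b, u⟩ := w
  obtain rfl : b = true := h
  simp [st]

lemma phi_update_true {u : PVar} (h : ∀ i, u = .inl i → i = 3) (n : ℤ)
    (k) : phi A B (Function.update a (true, u) n) k = phi A B a k := by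
  have hu : ∀ (b : Bool) (i : Fin 3), ((b, .inl i.castSucc) : Bool × PVar) ≠ (true, u) := by
    rintro b i hi
    have := h _ (congrArg Prod.snd hi).symm
    exact absurd this (by fin_cases i <;> decide)
  have h0 : ∀ b, Function.update a (true, u) n (b, .inl 0) = a (b, .inl 0) := fun b =>
    Function.update_of_ne (hu b 0) _ _
  have h1 : ∀ b, Function.update a (true, u) n (b, .inl 1) = a (b, .inl 1) := fun b =>
    Function.update_of_ne (hu b 1) _ _
  have h2 : ∀ b, Function.update a (true, u) n (b, .inl 2) = a (b, .inl 2) := fun b =>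
    Function.update_of_ne (hu b 2) _ _
  have h3 : Function.update a (true, u) n ∘ par = a ∘ par := by
    ext ⟨b, i⟩; exact Function.update_of_ne (hu b i) _ _
  have h4 : ∀ v, Function.update a (true, u) n (false, v) = a (false, v) := fun v =>
    Function.update_of_ne (by simp) _ _
  have h5 : st (Function.update a (true, u) n) = st a := st_update a rfl n
  have hb : base A B (Function.update a (true, u) n) = base A B a := by
    simp only [base, evt, nn, ell, h0, h1, h2, h3, h4, h5]
  rcases k with i | (δ | γ | ⟨β, γ⟩) <;>
    simp only [phi, evt, wtf, nn, ell, blf, hb, h0, h1, h2, h5]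

lemma update_inr_par (i : Vert) (b : Bool) (n : ℤ) :
    Function.update a (b, .inr i) n ∘ par = a ∘ par := by
  ext ⟨b', j⟩; exact Function.update_of_ne (by simp [par]) _ _

lemma phi_update_vert (i : Vert) (n : ℤ) :
    phi A B (Function.update a (false, .inr i) n) (.inl i) = phi A B a (.inl i) := by
  set a' := Function.update a (false, .inr i) n with ha'
  have hs : ∀ F : Vert → ℤ, ∑ j, F j * a' (false, .inr j) = ∑ j, F j * a (false, .inr j)
      + F i * (n - a (false, .inr i)) := by
    intro F
    rw [← sub_eq_iff_eq_add', ← Finset.sum_sub_distrib, Finset.sum_eq_single i]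
    · rw [ha', Function.update_self]; ring
    · intro j _ hj
      rw [ha', Function.update_of_ne (by simpa using hj), sub_self]
    · simp
  have h5 : st a' = st a + (n - a (false, .inr i)) := by
    have := hs fun _ => 1
    simp only [one_mul] at this
    rw [st, this, st, ha', Function.update_of_ne (by simp)]; ring
  obtain ⟨r, hr, hr'⟩ := evt_sub A B a i.1
  obtain ⟨r2, hr2, hr2'⟩ := evt_sub A B a' i.1
  have h0 : ∀ b k, a' (b, .inl k) = a (b, .inl k) := fun b k => Function.update_of_ne (by simp) _ _
  simp only [h0] at hr2'
  rw [← hr'] at hr2'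
  subst hr2'
  have h3 : a' ∘ par = a ∘ par := update_inr_par a i false n
  simp only [phi, base]
  rw [← sub_sub, ← sub_sub, hr, hr2, hs fun j => dir A B j.1 (a' ∘ par), h3, h5]
  ring

/-- The target form. -/
def trg : ℤ := evt A B a (false, false, false) - base A B a

lemma trg_eq : trg A B a = - ∑ i : Vert, dir A B i.1 (a ∘ par) * a (false, .inr i) := by
  simp only [trg, base]; ring

end Lin

end Sys

namespace Sys
variable {k₀ : ℕ} (S : Sys k₀)

section Swap
variable (A B : ℤ) (a : Bool × PVar → ℤ) (i : Fin 3)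

lemma swap_inl (b : Bool) (k : Fin 4) :
    (a ∘ Equiv.swap (false, .inl i.castSucc) (true, .inl i.castSucc)) (b, .inl k)
      = a (if k = i.castSucc then !b else b, .inl k) := by
  rw [Function.comp_apply]
  congr 1
  split_ifs with h
  · subst h; cases b <;> simp
  · exact Equiv.swap_apply_of_ne_of_ne (by simp [h]) (by simp [h])

lemma swap_inr (b : Bool) (k : Vert) :
    (a ∘ Equiv.swap (false, .inl i.castSucc) (true, .inl i.castSucc)) (b, .inr k)
      = a (b, .inr k) := by
  rw [Function.comp_apply, Equiv.swap_apply_of_ne_of_ne (by simp) (by simp)]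

lemma st_swap : st (a ∘ Equiv.swap (false, .inl i.castSucc) (true, .inl i.castSucc)) = st a := by
  simp only [st, swap_inr, swap_inl]
  rw [if_neg (by fin_cases i <;> decide)]

lemma nn_swap (α β γ : Bool) :
    nn (a ∘ Equiv.swap (false, .inl i.castSucc) (true, .inl i.castSucc)) α β γ
      = nn a (if i = 0 then !α else α) (if i = 1 then !β else β) (if i = 2 then !γ else γ) := by
  simp only [nn, st_swap, swap_inl]
  fin_cases i <;> rfl

lemma ell_swap (hi : i ≠ 0) (β γ : Bool) :
    ell A (a ∘ Equiv.swap (false, .inl i.castSucc) (true, .inl i.castSucc)) β γ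
      = ell A a (if i = 1 then !β else β) (if i = 2 then !γ else γ) := by
  simp only [ell, st_swap, swap_inl]
  fin_cases i
  · exact absurd rfl hi
  · rfl
  · rfl

end Swap

lemma tendsto_of_E_pt {V : Type*} [Fintype V] [DecidableEq V] {ρ : V → Fin 3}
    (q : (V → ℤ) → ℤ) {F G : ∀ j, S.Z j → (V → ℤ) → ℝ}
    (h : ∀ j x a, F j (S.pt j x (q a)) a = G j x a)
    (hG : Tendsto (fun j => S.E ρ j (G j)) atTop (𝓝 0)) :
    Tendsto (fun j => S.E ρ j (F j)) atTop (𝓝 0) := by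
  refine hG.congr fun j => ?_
  rw [← S.E_pt ρ j q (F j)]
  exact (S.E_congr ρ fun x a => (h j x a)).symm

/-- All the forms produced by three applications of Cauchy–Schwarz. -/
noncomputable def linProd (A B : ℤ) (e : S.Fn) (j : ℕ) (x : S.Z j) (a : Bool × PVar → ℤ) : ℝ :=
  (∏ d : Bool × Bool × Bool, e j (S.pt j x (evt A B a d))) *
    ∏ k : Bool ⊕ Bool ⊕ Bool × Bool, S.ν j (S.pt j x (wtf A a k))

variable {f₀ f₁ e : S.Fn}

theorem tendsto_T_of_linProd (hk : 2 ≤ k₀) {A B : ℤ} (hA : A ≠ 0)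
    (h₀ : ∀ j x, |f₀ j x| ≤ S.ν j x) (h₁ : ∀ j x, |f₁ j x| ≤ S.ν j x)
    (he : ∀ j x, |e j x| ≤ S.ν j x)
    (hlim : Tendsto (fun j => S.E (prk ∘ Prod.snd) j (S.linProd A B e j)) atTop (𝓝 0)) :
    Tendsto (S.T A B f₀ f₁ e) atTop (𝓝 0) := by
  classical
  set ρ : Bool × PVar → Fin 3 := prk ∘ Prod.snd with hρ
  have hup : ∀ (a : Bool × PVar → ℤ) (u v : Bool × PVar) (n : ℤ), v ≠ u →
      Function.update a u n v = a v := fun a u v n h => Function.update_of_ne h _ _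
  have hst : ∀ (a : Bool × PVar → ℤ) b (i : Fin 3) n,
      st (Function.update a (b, .inl i.castSucc) n) = st a := by
    intro a b i n
    simp only [st]
    rw [hup _ _ _ _ (by fin_cases i <;> simp)]
    congr 1
    exact Finset.sum_congr rfl fun _ _ => hup _ _ _ _ (by simp)
  have hν : ∀ (p : (Bool × PVar → ℤ) → ℤ), IsPoly p →
      Tendsto (fun j => S.E ρ j fun x a => S.ν j (S.pt j x (p a))) atTop (𝓝 1) := by
    intro p hp
    have := S.tendsto_prod_weights ρ (A := {p}) (by simpa using hp) (by simp; omega)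
    simpa using this
  have hν0 : Tendsto (fun j => S.E ρ j fun x _ => S.ν j x) atTop (𝓝 1) := by
    simpa only [pt_zero] using hν (fun _ => 0) (IsPoly.const 0)
  -- third application
  have h3 : Tendsto (fun j => S.E ρ j fun x a => (f₁ j x * f₁ j (S.pt j x (blf A a))) *
      (S.ν j (S.pt j x (- ell A a false false)) * (∏ β : Bool,
        S.ν j (S.pt j x (- A * nn a false β false ^ 2 - ell A a false false))) *
        ∏ α : Bool, ∏ β : Bool, e j (S.pt j x (evt A B a (α, β, false))))) atTop (𝓝 0) := by
    have hw : Tendsto (fun j => S.E ρ j fun x a => S.ν j x * S.ν j (S.pt j x (blf A a)))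
        atTop (𝓝 1) := by
      have hne : (fun _ : Bool × PVar → ℤ => (0 : ℤ)) ≠ fun a => blf A a := fun h => by
        have := congrFun h (val 0)
        simp [blf, val, hA] at this
      have := S.tendsto_prod_weights ρ (A := {fun _ => 0, fun a => blf A a})
        (by simpa using ⟨IsPoly.const 0, blf_isPoly A⟩) (by rw [Finset.card_pair hne]; exact hk)
      simpa only [Finset.prod_pair hne, pt_zero] using this
    refine sq_tendsto (fun j => ?_) hw hlim
    have hcs := S.E_cs ρ (v := (false, .inl (Fin.castSucc 2))) (v' := (true, .inl (Fin.castSucc 2)))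
      (by simp) rfl j
      (c := fun x a => f₁ j x * f₁ j (S.pt j x (blf A a)))
      (w := fun x a => S.ν j x * S.ν j (S.pt j x (blf A a)))
      (d := fun x a => S.ν j (S.pt j x (- ell A a false false)) * (∏ β : Bool,
        S.ν j (S.pt j x (- A * nn a false β false ^ 2 - ell A a false false))) *
        ∏ α : Bool, ∏ β : Bool, e j (S.pt j x (evt A B a (α, β, false)))) ?_ ?_ ?_ ?_ ?_
    · refine hcs.trans (le_of_eq ?_)
      congr 1
      refine S.E_congr ρ fun x a => ?_
      simp only [linProd, Fintype.prod_sum_type, Fintype.prod_prod_type, Fintype.prod_bool, wtf, evt,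
        nn_swap, ell_swap _ _ 2 (by decide)]
      simp [pt_zero, -mul_eq_mul_left_iff, -mul_eq_mul_right_iff]
      ring
    · intro x a
      rw [abs_mul]
      exact mul_le_mul (h₁ _ _) (h₁ _ _) (abs_nonneg _) (S.nonneg _ _)
    · intro x a n
      simp [blf]
    · intro x a n
      simp [blf]
    · intro x a n
      simp [blf]
    · intro x a n
      simp only [evt, nn, ell, hst]
      simp
  -- second application
  have h2 : Tendsto (fun j => S.E ρ j fun x a => f₁ j x *
      (S.ν j (S.pt j x (- A * nn a false false false ^ 2)) * f₁ j (S.pt j x (ell A a false false)) *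
        ∏ α : Bool, e j (S.pt j x (B * nn a α false false ^ 2 - A * nn a false false false ^ 2))))
      atTop (𝓝 0) := by
    refine sq_tendsto (fun j => ?_) hν0 (S.tendsto_of_E_pt (F := fun j x a => S.ν j x * ∏ β : Bool,
      (S.ν j (S.pt j x (- A * nn a false β false ^ 2)) * f₁ j (S.pt j x (ell A a β false)) *
        ∏ α : Bool, e j (S.pt j x (B * nn a α β false ^ 2 - A * nn a false β false ^ 2))))
        (fun a => - ell A a false false) (fun j x a => ?_) h3)
    · have hcs := S.E_cs ρ (v := (false, .inl (Fin.castSucc 1)))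
        (v' := (true, .inl (Fin.castSucc 1))) (by simp) rfl j
        (c := fun x a => f₁ j x) (w := fun x a => S.ν j x)
        (d := fun x a =>
          S.ν j (S.pt j x (- A * nn a false false false ^ 2)) * f₁ j (S.pt j x (ell A a false false)) *
          ∏ α : Bool, e j (S.pt j x (B * nn a α false false ^ 2 - A * nn a false false false ^ 2)))
        (fun x a => h₁ _ _) (fun x a n => rfl) (fun x a n => rfl) (fun x a n => rfl) ?_
      · refine hcs.trans (le_of_eq ?_)
        congr 1
        refine S.E_congr ρ fun x a => ?_
        simp only [Fintype.prod_bool, nn_swap, ell_swap _ _ 1 (by decide)]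
        simp [pt_zero, -mul_eq_mul_left_iff, -mul_eq_mul_right_iff]
        ring
      · intro x a n
        simp only [nn, ell, hst]
        simp
    · have e1 : - ell A a false false + ell A a true false = blf A a := by
        simp only [ell, blf]; ring
      simp only [Fintype.prod_bool, pt_pt, e1, neg_add_cancel, pt_zero, evt]
      have e2 : ∀ y, - ell A a false false + y = y - ell A a false false := fun y => by ring
      simp only [e2]
      ring
  -- first application
  have h1 : Tendsto (fun j => S.E ρ j fun x a => f₀ j x *
      (f₁ j (S.pt j x (A * nn a false false false ^ 2)) *
        e j (S.pt j x (B * nn a false false false ^ 2)))) atTop (𝓝 0) := by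
    refine sq_tendsto (fun j => ?_) hν0 (S.tendsto_of_E_pt (F := fun j x a => S.ν j x * ∏ α : Bool,
      (f₁ j (S.pt j x (A * nn a α false false ^ 2)) *
        e j (S.pt j x (B * nn a α false false ^ 2))))
        (fun a => - A * nn a false false false ^ 2) (fun j x a => ?_) h2)
    · have hcs := S.E_cs ρ (v := (false, .inl (Fin.castSucc 0)))
        (v' := (true, .inl (Fin.castSucc 0))) (by simp) rfl j
        (c := fun x a => f₀ j x) (w := fun x a => S.ν j x)
        (d := fun x a =>
          f₁ j (S.pt j x (A * nn a false false false ^ 2)) *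
            e j (S.pt j x (B * nn a false false false ^ 2)))
        (fun x a => h₀ _ _) (fun x a n => rfl) (fun x a n => rfl) (fun x a n => rfl) ?_
      · refine hcs.trans (le_of_eq ?_)
        congr 1
        refine S.E_congr ρ fun x a => ?_
        simp only [Fintype.prod_bool, nn_swap]
        simp [pt_zero, -mul_eq_mul_left_iff, -mul_eq_mul_right_iff]
        ring
      · intro x a n
        simp only [nn, hst]
        simp
    · have e1 : -A * nn a false false false ^ 2 + A * nn a true false false ^ 2
          = ell A a false false := by simp only [ell, nn]; ring
      have e2 : -A * nn a false false false ^ 2 + A * nn a false false false ^ 2 = 0 := by ring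
      have e3 : ∀ y, -A * nn a false false false ^ 2 + y = y - A * nn a false false false ^ 2 :=
        fun y => by ring
      simp only [Fintype.prod_bool, pt_pt, e1, e2, pt_zero]
      simp only [e3]
      ring
  -- introduction of the extra variables
  have hsh := S.tendsto_shift ρ (v := (false, .inl 3)) (by decide)
    (s := fun a => ∑ i, a (false, .inr i) + a (false, .inl 0) + a (false, .inl 1) +
      a (false, .inl 2))
    ((((IsPoly.sum fun i _ => IsPoly.coord _).add (IsPoly.coord _)).add (IsPoly.coord _)).add
      (IsPoly.coord _)) (fun u hu a n => ?_)
    (G := fun j x a => f₀ j x * f₁ j (S.pt j x (A * a (false, .inl 3) ^ 2)) *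
      e j (S.pt j x (B * a (false, .inl 3) ^ 2))) (C := 1) 3 fun j x a => ?_
  · have h4 := h1.sub hsh
    rw [sub_zero] at h4
    refine h4.congr fun j => ?_
    have e1 : (S.E ρ j fun x a => f₀ j x * (f₁ j (S.pt j x (A * nn a false false false ^ 2)) *
        e j (S.pt j x (B * nn a false false false ^ 2)))) = S.E ρ j fun x a =>
        (fun x (a : Bool × PVar → ℤ) => f₀ j x * f₁ j (S.pt j x (A * a (false, .inl 3) ^ 2)) *
      e j (S.pt j x (B * a (false, .inl 3) ^ 2))) x (Function.update a (false, .inl 3)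
        (a (false, .inl 3) + (∑ i, a (false, .inr i) + a (false, .inl 0) + a (false, .inl 1) +
      a (false, .inl 2)))) := by
      refine S.E_congr ρ fun x a => ?_
      simp only [Function.update_self, nn, st, mul_assoc, add_assoc]
    rw [e1, sub_sub_cancel]
    exact S.E_comp ρ (i := fun _ : Unit => (false, .inl 3)) (fun _ _ _ => rfl) j fun x a =>
      f₀ j x * f₁ j (S.pt j x (A * a () ^ 2)) * e j (S.pt j x (B * a () ^ 2))
  · have hu' : ∀ v : Bool × PVar, ρ v ≠ 2 → v ≠ u := by
      rintro v hv rfl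
      apply hv
      have h5 : (2 : Fin 3) ≤ ρ v := hu
      exact le_antisymm (Fin.le_last _) h5
    have ht : ∀ i : Vert, Function.update a u n (false, .inr i) = a (false, .inr i) := fun i =>
      hup _ _ _ _ (hu' _ (by simp [hρ, prk]))
    simp only [ht]
    rw [hup _ _ _ _ (hu' (false, .inl 0) (by decide)), hup _ _ _ _ (hu' (false, .inl 1) (by decide)),
      hup _ _ _ _ (hu' (false, .inl 2) (by decide))]
  · rw [abs_mul, abs_mul, one_mul, pow_succ (S.B j) 2, pow_two (S.B j)]
    have hb : ∀ {f : S.Fn}, (∀ j x, |f j x| ≤ S.ν j x) → ∀ y, |f j y| ≤ S.B j := fun hf y =>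
      (hf j y).trans (S.le_B j y)
    have hB := (zero_le_one.trans (S.one_le_B j))
    exact mul_le_mul (mul_le_mul (hb h₀ _) (hb h₁ _) (abs_nonneg _) hB) (hb he _) (abs_nonneg _)
      (mul_nonneg hB hB)

end Sys

namespace Sys
variable {k₀ : ℕ} (S : Sys k₀)

/-- The variables doubled by the generalised von Neumann theorem. -/
noncomputable def vs : List PVar := (Finset.univ : Finset Vert).toList.map Sum.inr

lemma mem_vs {u : PVar} : u ∈ vs ↔ ∃ i : Vert, Sum.inr i = u := by simp [vs]

lemma vs_nodup : vs.Nodup := (Finset.nodup_toList _).map Sum.inr_injective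

lemma length_vs : vs.length = 7 := by
  simp only [vs, List.length_map, Finset.length_toList]
  decide

lemma prod_powerset_vs (F : Finset PVar → ℝ) :
    ∏ D ∈ vs.toFinset.powerset, F D = ∏ D : Finset Vert, F (D.map Function.Embedding.inr) := by
  refine (Finset.prod_nbij (fun D : Finset Vert => D.map (Function.Embedding.inr : Vert ↪ PVar)) (fun D _ => ?_)
    (fun D _ D' _ h => Finset.map_injective (Function.Embedding.inr : Vert ↪ PVar) h) (fun D hD => ?_) fun _ _ => rfl).symm
  · rw [Finset.mem_powerset]
    intro u hu
    obtain ⟨i, -, rfl⟩ := Finset.mem_map.1 hu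
    exact List.mem_toFinset.2 (mem_vs.2 ⟨i, rfl⟩)
  · have h1 : D ⊆ (Finset.univ : Finset Vert).map Function.Embedding.inr := fun u hu => by
      obtain ⟨i, rfl⟩ := mem_vs.1 (List.mem_toFinset.1 (Finset.mem_powerset.1 hD hu))
      exact Finset.mem_map.2 ⟨i, Finset.mem_univ _, rfl⟩
    obtain ⟨E, -, rfl⟩ := Finset.subset_map_iff.1 h1
    exact ⟨E, by simp, rfl⟩

section Trg
variable (A B : ℤ)

lemma trg_isPoly : IsPoly fun a => trg A B a := (evt_isPoly A B _).sub (base_isPoly A B)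

lemma trg_update_of_ne (a : Bool × PVar → ℤ) {w : Bool × PVar} (h : ∀ i, (false, .inr i) ≠ w)
    (h' : ∀ v, par v ≠ w) (n : ℤ) : trg A B (Function.update a w n) = trg A B a := by
  have h3 : Function.update a w n ∘ par = a ∘ par := by
    ext v; exact Function.update_of_ne (h' v) _ _
  simp only [trg_eq, h3]
  congr 1
  exact Finset.sum_congr rfl fun i _ => by rw [Function.update_of_ne (h i)]

lemma trg_dep {i : Vert} (h : dir A B i.1 (val 0 ∘ par) ≠ 0) :
    ¬ Indep (false, .inr i) fun a => trg A B a := fun hi => by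
  have h1 := hi (val 0) 1
  simp only [trg_eq, update_inr_par, neg_inj] at h1
  rw [← sub_eq_zero, ← Finset.sum_sub_distrib, Finset.sum_eq_single i] at h1
  · rw [Function.update_self] at h1
    apply h
    simpa [val] using h1
  · intro k _ hk
    rw [Function.update_of_ne (by simpa using hk), sub_self]
  · simp

lemma trg_flip (a : Bool × PVar → ℤ) (D : Finset Vert) :
    trg A B (a ∘ flip (D.map Function.Embedding.inr)) + ∑ i : Vert, dir A B i.1 (a ∘ par) *
      a (false, .inr i) = ∑ i ∈ D, dir A B i.1 (a ∘ par) *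
        (a (false, .inr i) - a (true, .inr i)) := by
  have h1 : (a ∘ flip (D.map Function.Embedding.inr)) ∘ par = a ∘ par := by
    ext ⟨b, i⟩; simp [flip, par]
  rw [trg_eq, h1, neg_add_eq_sub, ← Finset.sum_sub_distrib, ← Finset.sum_subset D.subset_univ]
  · refine Finset.sum_congr rfl fun i hi => ?_
    simp [flip, hi]
    ring
  · intro i _ hi
    simp [flip, hi]

end Trg

/-- The embedding of the variables of the box average. -/
def boxEmb : (Bool × Fin 3) ⊕ Bool × Vert → Bool × PVar :=
  Sum.elim par fun w => (w.1, .inr w.2)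

lemma boxEmb_injective : Function.Injective boxEmb := by
  rintro (⟨b, i⟩ | ⟨b, i⟩) (⟨b', i'⟩ | ⟨b', i'⟩) h <;> simp_all [boxEmb, par]

lemma prk_boxEmb : (prk ∘ Prod.snd) ∘ boxEmb
    = Sum.elim (fun _ : Bool × Fin 3 => (0 : Fin 3)) fun _ : Bool × Vert => 1 := by
  ext w
  rcases w with ⟨b, i⟩ | ⟨b, i⟩
  · fin_cases i <;> rfl
  · rfl

variable {f₀ f₁ e : S.Fn}

/-- A quadratic average is controlled by a box average. -/
theorem tendsto_T_of_Box (hk : 2 ^ 13 ≤ k₀) {A B : ℤ} (hA : A ≠ 0)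
    (hinj : Function.Injective fun k => phi A B (val 0) k)
    (hdep : ∀ k, phi A B (val 0) k ≠ phi A B (val 1) k)
    (hdir : ∀ i : Vert, dir A B i.1 (val 0 ∘ par) ≠ 0)
    (h₀ : ∀ j x, |f₀ j x| ≤ S.ν j x) (h₁ : ∀ j x, |f₁ j x| ≤ S.ν j x)
    (he : ∀ j x, |e j x| ≤ S.ν j x)
    (hlim : Tendsto (S.Box (fun i : Vert => dir A B i.1) fun _ j _ => e j) atTop (𝓝 0)) :
    Tendsto (S.T A B f₀ f₁ e) atTop (𝓝 0) := by
  classical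
  have hν : ∀ j x, |S.ν j x| ≤ S.ν j x := fun j x => (abs_of_nonneg (S.nonneg j x)).le
  set φ : Vert ⊕ (Bool ⊕ Bool ⊕ Bool × Bool) → Form PVar := fun k a => phi A B a k with hφ
  have hφi : Function.Injective φ := fun k k' h => hinj (congrFun h (val 0))
  have hval : Function.update (val 0) (false, .inl 3) 1 = val 1 := by
    ext ⟨b, u⟩
    rcases u with i | i
    · by_cases hi : i = 3
      · subst hi; cases b <;> simp [val]
      · rw [Function.update_of_ne (by simp [hi])]
        fin_cases i <;> first | rfl | exact absurd rfl hi
    · rw [Function.update_of_ne (by simp)]; rfl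
  set t : Form PVar := fun a => trg A B a with ht
  set Wt : Finset (Form PVar) := Finset.univ.image φ with hWt
  have hWmem : ∀ p ∈ Wt, ∃ k, φ k = p := fun p hp => by simpa [hWt] using hp
  let f : Form PVar → S.Fn := fun p => if ∃ i, φ (.inl i) = p then e else S.ν
  refine S.tendsto_T_of_linProd (by omega) hA h₀ h₁ he ?_
  refine S.tendsto_of_E_pt (fun a => - base A B a) (fun j x a => rfl) ?_
  have hT := S.tendsto_of_dblL prk e vs vs_nodup {t} Wt f (fun _ _ _ _ => 1) ?_ ?_ ?_ ?_ ?_ ?_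
    (fun _ _ _ _ _ => by simp) (fun _ _ _ _ _ _ => rfl) (fun _ _ _ _ _ _ _ _ => rfl) ?_
  · refine hT.congr fun j => S.E_congr _ fun x a => ?_
    simp only [List.map_const', List.prod_replicate, one_pow, mul_one, Finset.prod_singleton, hWt]
    rw [Finset.prod_image fun _ _ _ _ h => hφi h, Fintype.prod_sum_type]
    have e1 : ∀ i, f (φ (.inl i)) = e := fun i => if_pos ⟨i, rfl⟩
    have e2 : ∀ k, f (φ (.inr k)) = S.ν := fun k =>
      if_neg (by rintro ⟨i, hi⟩; exact absurd (hφi hi) (by simp))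
    simp only [e1, e2, linProd, pt_pt]
    rw [← Finset.mul_prod_erase Finset.univ _ (Finset.mem_univ (false, false, false)),
      ← mul_assoc]
    have e3 : ∀ y, -base A B a + y = y - base A B a := fun y => by ring
    simp only [e3]
    congr 2
  · have : Wt.card ≤ 15 := Finset.card_image_le.trans (by decide)
    rw [length_vs]; omega
  · intro p hp
    obtain ⟨k, rfl⟩ := hWmem p hp
    exact phi_isPoly A B k
  · intro p hp u hu
    rw [Finset.mem_singleton] at hp
    subst hp
    obtain ⟨i, rfl⟩ := mem_vs.1 hu
    exact ⟨fun a n => trg_update_of_ne A B a (by simp) (by simp [par]) n, trg_dep A B (hdir i)⟩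
  · intro p hp u hu a n
    obtain ⟨k, rfl⟩ := hWmem p hp
    obtain ⟨i, rfl⟩ := mem_vs.1 hu
    exact phi_update_true A B a (by simp) n k
  · intro p hp j x
    simp only [f]
    split_ifs
    · exact he j x
    · exact hν j x
  · intro p hp
    by_cases h : ∃ i, φ (.inl i) = p
    · obtain ⟨i, rfl⟩ := h
      exact Or.inr ⟨.inr i, mem_vs.2 ⟨i, rfl⟩, fun a n => phi_update_vert A B a i n⟩
    · exact Or.inl (if_neg h)
  · have h3 : ∀ u ∈ vs, (.inl 3 : PVar) ≠ u := by
      rintro u hu rfl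
      obtain ⟨i, hi⟩ := mem_vs.1 hu
      exact absurd hi (by simp)
    have hstrip := S.tendsto_strip (prk ∘ Prod.snd) (v := (false, .inl 3)) (v' := (true, .inl 3))
      (by simp) rfl (A := dblL vs {t}) (Q := dblL vs Wt)
      (dblL_induction vs (fun _ _ p => Form.isPoly_sw) _ (by simpa using trg_isPoly A B))
      (dblL_induction vs (fun _ _ p => Form.isPoly_sw) _ fun p hp => by
        obtain ⟨k, rfl⟩ := hWmem p hp
        exact phi_isPoly A B k) ?_
      (dblL_induction vs (fun u hu p h => (Form.indep_sw_of_ne (h3 u hu)).2 h) _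
        (by
          simp only [Finset.mem_singleton, forall_eq]
          exact fun a n => trg_update_of_ne A B a (by simp)
            (by rintro ⟨b, i⟩; fin_cases i <;> simp [par]) n))
      (dblL_induction vs (fun u hu p h => (Form.indep_sw_of_ne (h3 u hu)).2 h) _
        (by
          simp only [Finset.mem_singleton, forall_eq]
          exact fun a n => trg_update_of_ne A B a (by simp)
            (by rintro ⟨b, i⟩; fin_cases i <;> simp [par]) n))
      (dblL_induction (P := fun p => ¬ Indep (false, .inl 3) p) vs
        (fun u hu p h => mt (Form.indep_sw_of_ne (h3 u hu)).1 h) _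
        fun p hp hi => by
          obtain ⟨k, rfl⟩ := hWmem p hp
          have := hi (val 0) 1
          rw [hval] at this
          exact hdep k this.symm)
      (dblL_induction vs (fun u hu p h => (Form.indep_sw_of_ne (h3 u hu)).2 h) _
        fun p hp a n => by
          obtain ⟨k, rfl⟩ := hWmem p hp
          exact phi_update_true A B a (by simp) n k)
      (c := fun j x a => ∏ p ∈ dblL vs {t}, e j (S.pt j x (p a)))
      (fun j x a => by
        rw [Finset.abs_prod]
        exact Finset.prod_le_prod (fun _ _ => abs_nonneg _) fun _ _ => he _ _) ?_
    · have hbox : Tendsto (fun j => S.E (prk ∘ Prod.snd) j fun x a =>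
          ∏ p ∈ dblL vs {t}, e j (S.pt j x (p a))) atTop (𝓝 0) := by
        refine S.tendsto_of_E_pt
          (fun a => ∑ i : Vert, dir A B i.1 (a ∘ par) * a (false, .inr i))
          (fun j x a => rfl) (hlim.congr fun j => ?_)
        rw [Box, ← prk_boxEmb, ← S.E_comp _ boxEmb_injective]
        refine S.E_congr _ fun x a => ?_
        rw [prod_dblL vs vs_nodup, prod_powerset_vs]
        · refine Finset.prod_congr rfl fun D _ => ?_
          rw [Finset.prod_singleton, pt_pt, add_comm, ht, trg_flip]
          rfl
        · intro p hp u hu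
          rw [Finset.mem_singleton] at hp
          subst hp
          obtain ⟨i, rfl⟩ := mem_vs.1 hu
          exact ⟨fun a n => trg_update_of_ne A B a (by simp) (by simp [par]) n,
            trg_dep A B (hdir i)⟩
      have := hstrip.add hbox
      rw [add_zero] at this
      refine this.congr fun j => ?_
      rw [← S.E_add]
      exact S.E_congr _ fun x a => by ring
    · have h4 := card_dblL vs {t}
      have h5 := card_dblL vs Wt
      have : Wt.card ≤ 15 := Finset.card_image_le.trans (by decide)
      rw [length_vs] at h4 h5
      rw [Finset.card_singleton] at h4
      omega
    · intro j x a n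
      refine Finset.prod_congr rfl fun p hp => ?_
      rw [dblL_induction (P := fun p => Indep (false, .inl 3) p) vs
        (fun u hu p h => (Form.indep_sw_of_ne (h3 u hu)).2 h) {t} _ p hp a n]
      simp only [Finset.mem_singleton, forall_eq]
      exact fun a n => trg_update_of_ne A B a (by simp)
        (by rintro ⟨b, i⟩; fin_cases i <;> simp [par]) n

/-- The pairs of coefficients that occur. -/
lemma nondegenerate_coeffs {A B : ℤ}
    (h : (A, B) ∈ ({(16, 25), (9, -16), (25, 16)} : Finset (ℤ × ℤ))) :
    A ≠ 0 ∧ (Function.Injective fun k => phi A B (val 0) k) ∧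
      (∀ k, phi A B (val 0) k ≠ phi A B (val 1) k) ∧
      ∀ i : Vert, dir A B i.1 (val 0 ∘ par) ≠ 0 := by
  simp only [Finset.mem_insert, Finset.mem_singleton, Prod.mk.injEq] at h
  have hinj : (Finset.univ.image (phi A B (val 0))).card =
      (Finset.univ : Finset (Vert ⊕ (Bool ⊕ Bool ⊕ Bool × Bool))).card := by
    rcases h with ⟨rfl, rfl⟩ | ⟨rfl, rfl⟩ | ⟨rfl, rfl⟩ <;> decide +kernel
  refine ⟨?_, fun k k' hk => Finset.card_image_iff.1 hinj (by simp) (by simp) hk, ?_⟩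
  · rcases h with ⟨rfl, -⟩ | ⟨rfl, -⟩ | ⟨rfl, -⟩ <;> decide
  · rcases h with ⟨rfl, rfl⟩ | ⟨rfl, rfl⟩ | ⟨rfl, rfl⟩ <;> exact ⟨by decide +kernel, by decide +kernel⟩

end Sys

lemma prod_expect_bx {K V : Type*} [Fintype K] [DecidableEq K] [Fintype V] [DecidableEq V]
    {R : K × V → ℕ} (F : K → (V → ℤ) → ℝ) :
    𝔼 a ∈ bx R, ∏ k, F k (fun v => a (k, v)) = ∏ k, 𝔼 b ∈ bx fun v => R (k, v), F k b := by
  have h : (bx R).card = ∏ k, (bx fun v => R (k, v)).card := by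
    simp only [bx, Fintype.card_piFinset, Fintype.prod_prod_type]
  simp only [Finset.expect_eq_sum_div_card, Finset.prod_div_distrib]
  rw [h, Finset.prod_univ_sum]
  push_cast
  congr 1
  refine Finset.sum_nbij' (fun a k v => a (k, v)) (fun b w => b w.1 w.2) ?_ ?_ ?_ ?_ ?_
  · intro a ha
    rw [Fintype.mem_piFinset]
    exact fun k => mem_bx.2 fun v => mem_bx.1 ha _
  · intro b hb
    exact mem_bx.2 fun w => mem_bx.1 (Fintype.mem_piFinset.1 hb w.1) w.2
  · exact fun _ _ => rfl
  · exact fun _ _ => rfl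
  · exact fun _ _ => rfl

namespace Sys
variable {k₀ : ℕ} (S : Sys k₀)

section Lim
variable {V : Type*} [Fintype V] [DecidableEq V] (ρ : V → Fin 3)

lemma E_sum {ι : Type*} (j : ℕ) (s : Finset ι) (F : ι → S.Z j → (V → ℤ) → ℝ) :
    (S.E ρ j fun x a => ∑ i ∈ s, F i x a) = ∑ i ∈ s, S.E ρ j (F i) := by
  simp only [E, Finset.expect_sum_comm]

lemma tendsto_prod_sub_one {A Q : Finset ((V → ℤ) → ℤ)} (hA : ∀ p ∈ A, IsPoly p)
    (hQ : ∀ p ∈ Q, IsPoly p) (hdis : Disjoint A Q) (hne : A.Nonempty)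
    (hcard : A.card + Q.card ≤ k₀) :
    Tendsto (fun j => S.E ρ j fun x a => (∏ p ∈ A, (S.ν j (S.pt j x (p a)) - 1)) *
      ∏ p ∈ Q, S.ν j (S.pt j x (p a))) atTop (𝓝 0) := by
  classical
  have h : Tendsto (fun j => ∑ t ∈ A.powerset, (-1 : ℝ) ^ (A \ t).card *
      S.E ρ j fun x a => ∏ p ∈ t ∪ Q, S.ν j (S.pt j x (p a))) atTop
      (𝓝 (∑ t ∈ A.powerset, (-1 : ℝ) ^ (A \ t).card * 1)) := by
    refine tendsto_finsetSum _ fun t ht => (S.tendsto_prod_weights ρ (fun p hp => ?_) ?_).const_mul _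
    · rcases Finset.mem_union.1 hp with hp | hp
      · exact hA p (Finset.mem_powerset.1 ht hp)
      · exact hQ p hp
    · exact (Finset.card_union_le _ _).trans
        (le_trans (by gcongr; exact Finset.mem_powerset.1 ht) hcard)
  have h0 : ∑ t ∈ A.powerset, (-1 : ℝ) ^ (A \ t).card * 1 = 0 := by
    have := Finset.prod_add (fun _ => (1 : ℝ)) (fun _ => -1) A
    simp only [add_neg_cancel, Finset.prod_const] at this
    rw [zero_pow (Finset.card_ne_zero.2 hne)] at this
    simp only [mul_one]
    exact (this.trans (Finset.sum_congr rfl fun t _ => by rw [one_pow, one_mul])).symm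
  rw [h0] at h
  refine h.congr fun j => ?_
  simp only [← S.E_const_mul, ← S.E_sum]
  refine S.E_congr _ fun x a => ?_
  simp only [sub_eq_add_neg, Finset.prod_add, Finset.sum_mul, Finset.prod_const]
  refine Finset.sum_congr rfl fun t ht => ?_
  rw [Finset.prod_union (hdis.mono_left (Finset.mem_powerset.1 ht))]
  ring

end Lim

section Cube
variable {Θ I K : Type*} [Fintype Θ] [DecidableEq Θ] [Fintype I] [DecidableEq I]
  [Fintype K] [DecidableEq K] (c : K → I → (Θ → ℤ) → ℤ)

/-- The variables used to estimate cube averages. -/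
abbrev CVar (Θ I K : Type*) := (Θ ⊕ I) ⊕ (K × Bool × I)

/-- Scales of the variables used to estimate cube averages. -/
def crk : CVar Θ I K → Fin 3 := Sum.elim (fun _ => 0) fun _ => 1

/-- The parameters among all the variables. -/
def cth (a : Bool × CVar Θ I K → ℤ) (t : Θ) : ℤ := a (false, .inl (.inl t))

/-- The cube variables among all the variables. -/
def cemb : Θ ⊕ (K × Bool × I) → Bool × CVar Θ I K :=
  Sum.elim (fun t => (false, .inl (.inl t))) fun w => (false, .inr w)

/-- The translation of the base point. -/
def cq (D : Finset I) (a : Bool × CVar Θ I K → ℤ) : ℤ :=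
  ∑ i ∈ D, a (false, .inl (.inr i)) * ∏ k, c k i (cth a)

/-- The form attached to a vertex of one of the cubes. -/
def cfrm (p : K × Finset I) (a : Bool × CVar Θ I K → ℤ) : ℤ := cq c p.2ᶜ a +
  ∑ i ∈ p.2, c p.1 i (cth a) * (a (false, .inr (p.1, false, i)) - a (false, .inr (p.1, true, i)))

/-- The translation of the cube variables. -/
def csh (v : Bool × CVar Θ I K) (a : Bool × CVar Θ I K → ℤ) : ℤ :=
  match v with
  | (_, .inr (k, _, i)) => a (false, .inl (.inr i)) * ∏ k' ∈ Finset.univ.erase k, c k' i (cth a)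
  | _ => 0

/-- The cube variables that are translated. -/
def cT : Finset (Bool × CVar Θ I K) :=
  Finset.univ.image fun w : K × I => (false, .inr (w.1, true, w.2))

lemma mem_cT {v : Bool × CVar Θ I K} : v ∈ cT ↔ ∃ k i, (false, .inr (k, true, i)) = v := by
  simp [cT]

lemma cth_update {a : Bool × CVar Θ I K → ℤ} {v : Bool × CVar Θ I K} (n : ℤ)
    (h : ∀ t, v ≠ (false, .inl (.inl t))) : cth (Function.update a v n) = cth a := by
  ext t
  exact Function.update_of_ne (h t).symm _ _

lemma cth_shift (a : Bool × CVar Θ I K → ℤ) : cth (shift cT (csh c) a) = cth a := by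
  ext t
  simp [cth, shift, mem_cT]

lemma cfrm_shift (p : K × Finset I) (a : Bool × CVar Θ I K → ℤ) :
    cq c Finset.univ a + ∑ i ∈ p.2, c p.1 i (cth a) * (shift cT (csh c) a (false, .inr (p.1, false, i))
      - shift cT (csh c) a (false, .inr (p.1, true, i))) = cfrm c p a := by
  have h1 : ∀ i, shift cT (csh c) a (false, .inr (p.1, false, i)) = a (false, .inr (p.1, false, i)) :=
    fun i => by simp [shift, mem_cT]
  have h2 : ∀ i, shift cT (csh c) a (false, .inr (p.1, true, i)) = a (false, .inr (p.1, true, i)) +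
      a (false, .inl (.inr i)) * ∏ k' ∈ Finset.univ.erase p.1, c k' i (cth a) :=
    fun i => by simp [shift, mem_cT, csh]
  have h3 : cq c Finset.univ a = cq c p.2ᶜ a + cq c p.2 a :=
    (Finset.sum_compl_add_sum p.2 _).symm
  rw [h3, cfrm, add_assoc, add_right_inj, cq, ← Finset.sum_add_distrib]
  refine Finset.sum_congr rfl fun i _ => ?_
  rw [h1, h2, ← Finset.mul_prod_erase Finset.univ (fun k => c k i (cth a)) (Finset.mem_univ p.1)]
  ring

variable {c}

lemma cth_isPoly {p : (Θ → ℤ) → ℤ} (hp : IsPoly p) :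
    IsPoly fun a : Bool × CVar Θ I K → ℤ => p (cth a) := hp.comp _

lemma cq_isPoly (hc : ∀ k i, IsPoly (c k i)) (D : Finset I) : IsPoly (cq c D) :=
  IsPoly.sum fun _ _ => (IsPoly.coord _).mul (IsPoly.prod fun _ _ => cth_isPoly (hc _ _))

lemma cfrm_isPoly (hc : ∀ k i, IsPoly (c k i)) (p : K × Finset I) : IsPoly (cfrm c p) :=
  (cq_isPoly hc _).add
    (IsPoly.sum fun _ _ => (cth_isPoly (hc _ _)).mul ((IsPoly.coord _).sub (IsPoly.coord _)))

lemma cq_indep_true (D : Finset I) (u : CVar Θ I K) : Indep (true, u) (cq c D) := fun a n => by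
  simp only [cq, cth_update n (v := (true, u)) (a := a) (by simp)]
  exact Finset.sum_congr rfl fun i _ => by rw [Function.update_of_ne (by simp)]

lemma cfrm_indep_true (p : K × Finset I) (u : CVar Θ I K) : Indep (true, u) (cfrm c p) :=
  fun a n => by
    simp only [cfrm, cq_indep_true p.2ᶜ u a n, cth_update n (v := (true, u)) (a := a) (by simp)]
    congr 1

lemma cfrm_indep {p : K × Finset I} {i : I} (hi : i ∈ p.2) :
    Indep (false, .inl (.inr i)) (cfrm c p) := fun a n => by
  simp only [cfrm, cq, cth_update n (v := (false, .inl (.inr i))) (a := a) (by simp)]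
  congr 1
  · refine Finset.sum_congr rfl fun i' hi' => ?_
    rw [Function.update_of_ne]
    simp only [ne_eq, Prod.mk.injEq, Sum.inl.injEq, Sum.inr.injEq, true_and]
    rintro rfl
    exact Finset.mem_compl.1 hi' hi

/-- The form attached to a vertex of one of the cubes, before the translation. -/
def clin (c : K → I → (Θ → ℤ) → ℤ) (p : K × Finset I) (a : Θ ⊕ (K × Bool × I) → ℤ) : ℤ :=
  ∑ i ∈ p.2, c p.1 i (a ∘ Sum.inl) * (a (.inr (p.1, false, i)) - a (.inr (p.1, true, i)))

lemma clin_isPoly (hc : ∀ k i, IsPoly (c k i)) (p : K × Finset I) : IsPoly (clin c p) :=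
  IsPoly.sum fun _ _ => ((hc _ _).comp _).mul ((IsPoly.coord _).sub (IsPoly.coord _))

lemma clin_injOn {θ₀ : Θ → ℤ} (h0 : ∀ k i, c k i θ₀ ≠ 0) :
    Set.InjOn (clin c) {p : K × Finset I | p.2.Nonempty} := by
  have key : ∀ p p' : K × Finset I, clin c p = clin c p' → ∀ i ∈ p.2, p.1 = p'.1 ∧ i ∈ p'.2 := by
    intro p p' h i hi
    by_contra hn
    let a : Θ ⊕ (K × Bool × I) → ℤ := Sum.elim θ₀ fun w => if w = (p.1, false, i) then 1 else 0
    have hθ : a ∘ Sum.inl = θ₀ := rfl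
    have h1 := congrFun h a
    simp only [clin, hθ] at h1
    rw [Finset.sum_eq_single_of_mem i hi (fun i' _ hi' => by simp [a, hi']),
      Finset.sum_eq_zero (fun i' hi' => ?_)] at h1
    · exact h0 p.1 i (by simpa [a] using h1)
    · by_cases h2 : p'.1 = p.1
      · have : i' ≠ i := by
          rintro rfl
          exact hn ⟨h2.symm, hi'⟩
        simp [a, this]
      · simp [a, h2]
  intro p hp p' hp' h
  obtain ⟨i, hi⟩ := hp
  exact Prod.ext (key p p' h i hi).1 (Finset.Subset.antisymm (fun i hi => (key p p' h i hi).2)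
    fun i hi => (key p' p h.symm i hi).2)

lemma cfrm_injOn {θ₀ : Θ → ℤ} (h0 : ∀ k i, c k i θ₀ ≠ 0) :
    Set.InjOn (cfrm c) {p : K × Finset I | p.2.Nonempty} := fun p hp p' hp' h =>
  clin_injOn h0 hp hp' <| funext fun a => by
    let a' : Bool × CVar Θ I K → ℤ :=
      Sum.elim (Sum.elim (a ∘ Sum.inl) 0) (a ∘ Sum.inr) ∘ Prod.snd
    have hq : ∀ D, cq c D a' = 0 := fun D => Finset.sum_eq_zero fun i _ => by simp [a']
    have h1 : ∀ p, cfrm c p a' = clin c p a := fun p => by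
      rw [cfrm, hq, zero_add]
      rfl
    rw [← h1, ← h1, h]

lemma cq_dep {θ₀ : Θ → ℤ} (h0 : ∀ k i, c k i θ₀ ≠ 0) (i : I) :
    ¬ Indep (false, .inl (.inr i)) (cq (K := K) c Finset.univ) := fun h => by
  have h1 := h (Sum.elim (Sum.elim θ₀ 0) (fun _ => 0) ∘ Prod.snd) 1
  have hq : cq c Finset.univ (Sum.elim (Sum.elim θ₀ 0) (fun _ : K × Bool × I => 0) ∘ Prod.snd) = 0 :=
    Finset.sum_eq_zero fun i _ => by simp
  rw [hq, cq, Finset.sum_eq_single_of_mem i (Finset.mem_univ i)] at h1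
  · rw [Function.update_self, one_mul, cth_update _ (by simp)] at h1
    exact Finset.prod_ne_zero_iff.2 (fun k _ => h0 k i) h1
  · intro i' _ hi'
    rw [Function.update_of_ne (by simpa using hi')]
    simp

end Cube

end Sys

section Dbl
variable {U : Type*} [Fintype U] [DecidableEq U]

lemma Form.exists_indep_sw {us : List U} (u : U) {p : Form U}
    (h : ∃ u ∈ us, ∀ b, Indep (b, u) p) : ∃ u' ∈ us, ∀ b, Indep (b, u') (p.sw u) := by
  obtain ⟨u', hu, h⟩ := h
  refine ⟨u', hu, fun b => Form.indep_sw ?_⟩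
  by_cases h' : u' = u
  · subst h'
    cases b
    · simpa [PolyPattern.sw] using h true
    · simpa [PolyPattern.sw] using h false
  · rw [sw_of_ne h']
    exact h b

lemma subset_dblL (us : List U) : ∀ A : Finset (Form U), A ⊆ dblL us A := by
  induction us with
  | nil => exact fun A => subset_rfl
  | cons u us ih => exact fun A p hp => ih _ (mem_dbl.2 (Or.inl hp))

end Dbl

namespace Sys
variable {k₀ : ℕ} (S : Sys k₀)
variable {Θ I K : Type*} [Fintype Θ] [DecidableEq Θ] [Fintype I] [DecidableEq I]
  [Fintype K] [DecidableEq K] {c : K → I → (Θ → ℤ) → ℤ}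

lemma abs_sub_one_le (j : ℕ) (x : S.Z j) : |S.ν j x - 1| ≤ S.B j := by
  rw [abs_le]
  constructor <;> linarith [S.nonneg j x, S.le_B j x, S.one_le_B j]

/-- The weight is indistinguishable from one by products of cube averages. -/
theorem tendsto_cube (hc : ∀ k i, IsPoly (c k i)) {θ₀ : Θ → ℤ} (h0 : ∀ k i, c k i θ₀ ≠ 0)
    {Sp : Finset (K × Finset I)} (hSp : ∀ p ∈ Sp, p.2.Nonempty)
    (hk : (Sp.card + 1) * 2 ^ Fintype.card I ≤ k₀) {e : S.Fn} (he : ∀ j x, |e j x| ≤ S.ν j x)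
    (G : K × Finset I → ∀ j, (Θ → ℤ) → S.Z j → ℝ)
    (hGe : ∀ p ∈ Sp, ∀ j θ x, G p j θ x = e j x)
    (hG : ∀ p ∉ Sp, p.2.Nonempty → ∀ j θ x, |G p j θ x| ≤ 1) :
    Tendsto (fun j => S.E (Sum.elim (fun _ : Θ => 0) fun _ : K × Bool × I => 1) j fun x a =>
      (S.ν j x - 1) * ∏ p : K × Finset I with p.2.Nonempty, G p j (a ∘ Sum.inl)
        (S.pt j x (∑ i ∈ p.2, c p.1 i (a ∘ Sum.inl) *
          (a (.inr (p.1, false, i)) - a (.inr (p.1, true, i)))))) atTop (𝓝 0) := by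
  classical
  set P : Finset (K × Finset I) := Finset.univ.filter fun p => p.2.Nonempty with hP
  have hmP : ∀ p ∈ P, p.2.Nonempty := fun p hp => (Finset.mem_filter.1 hp).2
  let F : ∀ j, S.Z j → (Bool × CVar Θ I K → ℤ) → ℝ := fun j x a =>
    (S.ν j x - 1) * ∏ p ∈ P, G p j (cth a) (S.pt j x (∑ i ∈ p.2, c p.1 i (cth a) *
      (a (false, .inr (p.1, false, i)) - a (false, .inr (p.1, true, i)))))
  have hGB : ∀ p ∈ P, ∀ j θ x, |G p j θ x| ≤ S.B j := fun p hp j θ x => by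
    by_cases h : p ∈ Sp
    · rw [hGe p h]
      exact (he j x).trans (S.le_B j x)
    · exact (hG p h (hmP p hp) j θ x).trans (S.one_le_B j)
  have hshift := S.tendsto_shift_set ((crk : CVar Θ I K → Fin 3) ∘ Prod.snd) cT (s := csh c)
    (G := F) (C := 1) ?_ ?_ ?_ (P.card + 1) ?_
  · have hmain : Tendsto (fun j => S.E ((crk : CVar Θ I K → Fin 3) ∘ Prod.snd) j
        fun x a => F j x (shift cT (csh c) a)) atTop (𝓝 0) := by
      refine S.tendsto_of_E_pt (cq c Finset.univ) (fun j x a => rfl) ?_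
      let us : List (CVar Θ I K) := (Finset.univ : Finset I).toList.map fun i => .inl (.inr i)
      have hinj : Function.Injective fun i : I => (.inl (.inr i) : CVar Θ I K) :=
        fun i i' h => by simpa using h
      have hus : us.Nodup := (Finset.nodup_toList _).map hinj
      have hlen : us.length = Fintype.card I := by simp [us]
      have hmus : ∀ u, u ∈ us ↔ ∃ i, .inl (.inr i) = u := fun u => by simp [us]
      let ch : K × Finset I → Finset I := fun p =>
        if h : p.2.Nonempty then {h.choose} else ∅
      have hch : ∀ p i, i ∈ ch p → i ∈ p.2 := fun p i h => by
        simp only [ch] at h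
        split_ifs at h with h1
        · rw [Finset.mem_singleton.1 h]; exact h1.choose_spec
        · simp at h
      let g : K × Finset I → ∀ j, S.Z j → (Bool × CVar Θ I K → ℤ) → ℝ := fun p j x a =>
        G p j (cth a) (S.pt j x (cfrm c p a))
      let H : CVar Θ I K → ∀ j, S.Z j → (Bool × CVar Θ I K → ℤ) → ℝ := fun u j x a =>
        match u with
        | .inl (.inr i) => ∏ p ∈ P \ Sp with i ∈ ch p, g p j x a
        | _ => 1
      have hinjW : Set.InjOn (cfrm c) (Sp : Set (K × Finset I)) :=
        (cfrm_injOn h0).mono fun p hp => hSp p hp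
      have hWcard : (Sp.image (cfrm c)).card * 2 ^ us.length ≤ Sp.card * 2 ^ Fintype.card I := by
        rw [hlen]
        exact Nat.mul_le_mul_right _ Finset.card_image_le
      have hmW : ∀ p ∈ Sp.image (cfrm c), ∃ q ∈ Sp, cfrm c q = p := fun p hp =>
        Finset.mem_image.1 hp
      have hT := S.tendsto_of_dblL crk (fun j x => S.ν j x - 1) us hus {cq c Finset.univ}
        (Sp.image (cfrm c)) (fun _ => e) H (by rw [add_mul] at hk; omega) ?_ ?_ ?_ ?_ ?_ ?_ ?_ ?_ ?_
      · refine hT.congr fun j => S.E_congr _ fun x a => ?_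
        simp only [F, cth_shift, pt_pt, cfrm_shift, Finset.prod_singleton]
        rw [Finset.prod_image hinjW, ← List.prod_toFinset _ hus, mul_assoc]
        congr 1
        have h1 : us.toFinset = Finset.univ.image fun i : I => (.inl (.inr i) : CVar Θ I K) := by
          ext u; simp [hmus]
        rw [h1, Finset.prod_image fun _ _ _ _ h => hinj h]
        have h2 : Sp ⊆ P := fun p hp => by simp [hP, hSp p hp]
        rw [← Finset.prod_sdiff h2, mul_comm]
        congr 1
        · simp only [H, Finset.prod_filter]
          rw [Finset.prod_comm]
          refine Finset.prod_congr rfl fun p hp => ?_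
          have h3 : p.2.Nonempty := hmP p (Finset.mem_sdiff.1 hp).1
          have h4 : ch p = {h3.choose} := dif_pos h3
          simp only [h4, Finset.mem_singleton, Finset.prod_ite_eq', Finset.mem_univ, if_true]
          rfl
        · exact Finset.prod_congr rfl fun p hp => (hGe p hp _ _ _).symm
      · intro p hp
        obtain ⟨q, -, rfl⟩ := hmW p hp
        exact cfrm_isPoly hc q
      · intro p hp u hu
        rw [Finset.mem_singleton] at hp
        obtain ⟨i, rfl⟩ := (hmus u).1 hu
        subst hp
        exact ⟨cq_indep_true _ _, cq_dep h0 i⟩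
      · intro p hp u hu
        obtain ⟨q, -, rfl⟩ := hmW p hp
        exact cfrm_indep_true q u
      · exact fun _ _ => he
      · intro p hp
        obtain ⟨q, hq, rfl⟩ := hmW p hp
        obtain ⟨i, hi⟩ := hSp q hq
        exact Or.inr ⟨_, (hmus _).2 ⟨i, rfl⟩, cfrm_indep hi⟩
      · intro u hu j x a
        obtain ⟨i, rfl⟩ := (hmus u).1 hu
        simp only [H, Finset.abs_prod]
        refine Finset.prod_le_one (fun _ _ => abs_nonneg _) fun p hp => ?_
        have hp := Finset.mem_sdiff.1 (Finset.mem_filter.1 hp).1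
        exact hG p hp.2 (hmP p hp.1) _ _ _
      · intro u hu j x a n
        obtain ⟨i, rfl⟩ := (hmus u).1 hu
        refine Finset.prod_congr rfl fun p hp => ?_
        simp only [g]
        rw [cth_update n (by simp), cfrm_indep (hch p i (Finset.mem_filter.1 hp).2) a n]
      · intro u hu u' hu' j x a n
        obtain ⟨i, rfl⟩ := (hmus u).1 hu
        refine Finset.prod_congr rfl fun p hp => ?_
        simp only [g]
        rw [cth_update n (by simp), cfrm_indep_true p u' a n]
      · refine S.tendsto_prod_sub_one _ (dblL_induction us (fun _ _ p => Form.isPoly_sw) _ ?_)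
          (dblL_induction us (fun _ _ p => Form.isPoly_sw) _ ?_) ?_ ?_ ?_
        · simpa using cq_isPoly hc Finset.univ
        · intro p hp
          obtain ⟨q, -, rfl⟩ := hmW p hp
          exact cfrm_isPoly hc q
        · rw [Finset.disjoint_left]
          intro p hp hp'
          refine dblL_induction (P := fun p => ¬ ∃ u ∈ us, ∀ b, Indep (b, u) p) us
            (fun u _ p h h' => h ((Form.sw_sw u p) ▸ Form.exists_indep_sw u h')) _ ?_ p hp
            (dblL_induction (P := fun p => ∃ u ∈ us, ∀ b, Indep (b, u) p) us
              (fun u _ p h => Form.exists_indep_sw u h) _ ?_ p hp')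
          · intro p hp
            rw [Finset.mem_singleton] at hp
            subst hp
            rintro ⟨u, hu, h⟩
            obtain ⟨i, rfl⟩ := (hmus u).1 hu
            exact cq_dep h0 i (h false)
          · intro p hp
            obtain ⟨q, hq, rfl⟩ := hmW p hp
            obtain ⟨i, hi⟩ := hSp q hq
            exact ⟨_, (hmus _).2 ⟨i, rfl⟩, Bool.rec (cfrm_indep hi) (cfrm_indep_true _ _)⟩
        · exact (Finset.singleton_nonempty _).mono (subset_dblL us _)
        · have h1 := card_dblL us {cq c Finset.univ}
          have h2 := card_dblL us (Sp.image (cfrm c))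
          rw [Finset.card_singleton, hlen] at h1
          rw [add_mul] at hk
          omega
    have h := hmain.sub hshift
    rw [sub_zero] at h
    refine h.congr fun j => ?_
    rw [sub_sub_cancel]
    have hi : Function.Injective (cemb : Θ ⊕ (K × Bool × I) → Bool × CVar Θ I K) := by
      rintro (t | w) (t' | w') h <;> simpa [cemb] using h
    have hr : ((crk : CVar Θ I K → Fin 3) ∘ Prod.snd) ∘ cemb =
        Sum.elim (fun _ : Θ => (0 : Fin 3)) fun _ : K × Bool × I => 1 := by
      ext (t | w) <;> rfl
    rw [← hr, ← S.E_comp _ hi]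
    rfl
  · intro v hv
    obtain ⟨k, i, rfl⟩ := mem_cT.1 hv
    simp [crk]
  · intro v hv
    obtain ⟨k, i, rfl⟩ := mem_cT.1 hv
    exact (IsPoly.coord _).mul (IsPoly.prod fun _ _ => cth_isPoly (hc _ _))
  · intro v hv u hu a n
    obtain ⟨k, i, rfl⟩ := mem_cT.1 hv
    have h1 : ∀ w, u ≠ (false, .inl w) := by
      rintro w rfl
      exact hu rfl
    simp only [csh]
    rw [cth_update n (fun t => h1 _), Function.update_of_ne (h1 _).symm]
  · intro j x a
    rw [abs_mul, Finset.abs_prod, one_mul, pow_succ']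
    refine mul_le_mul (S.abs_sub_one_le j x) ?_ (Finset.prod_nonneg fun _ _ => abs_nonneg _)
      (zero_le_one.trans (S.one_le_B j))
    rw [← Finset.prod_const]
    exact Finset.prod_le_prod (fun _ _ => abs_nonneg _) fun p hp => hGB p hp _ _ _

end Sys

namespace Sys
variable {k₀ : ℕ} (S : Sys k₀)
variable {Θ I K : Type*} [Fintype Θ] [DecidableEq Θ] [Fintype I] [DecidableEq I]
  [Fintype K] [DecidableEq K]

/-- Families of functions indexed by the vertices of a cube. -/
abbrev Fam (Θ I : Type*) := Finset I → ∀ j, (Θ → ℤ) → S.Z j → ℝ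

/-- The dual function of a family. -/
noncomputable def dual (c : I → (Θ → ℤ) → ℤ) (G : S.Fam Θ I) (j : ℕ) (θ : Θ → ℤ) (x : S.Z j) : ℝ :=
  𝔼 b ∈ bx fun _ : Bool × I => S.L 1 j, ∏ D : Finset I with D.Nonempty,
    G D j θ (S.pt j x (∑ i ∈ D, c i θ * (b (false, i) - b (true, i))))

lemma E_inr {V : Type*} [Fintype V] [DecidableEq V] (r : Fin 3) (j : ℕ)
    (w : S.Z j → (Θ → ℤ) → ℝ) (F : S.Z j → (Θ → ℤ) → (V → ℤ) → ℝ) :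
    (S.E (Sum.elim (fun _ : Θ => 0) fun _ : V => r) j fun x a =>
      w x (a ∘ Sum.inl) * F x (a ∘ Sum.inl) (a ∘ Sum.inr)) =
    S.E (fun _ : Θ => 0) j fun x θ => w x θ * 𝔼 b ∈ bx fun _ : V => S.L r j, F x θ b := by
  rw [E, expect_bx_sum]
  refine Finset.expect_congr rfl fun θ _ => ?_
  rw [Finset.expect_comm]
  refine Finset.expect_congr rfl fun x _ => ?_
  change _ = w x θ * _
  rw [Finset.mul_expect]
  rfl

lemma Box_eq (c : I → (Θ → ℤ) → ℤ) (G : S.Fam Θ I) (j : ℕ) :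
    S.Box c G j = S.E (fun _ : Θ => 0) j fun x θ => G ∅ j θ x * S.dual c G j θ x := by
  simp only [dual]
  rw [← S.E_inr 1 j (fun x θ => G ∅ j θ x) fun x θ b => ∏ D : Finset I with D.Nonempty,
    G D j θ (S.pt j x (∑ i ∈ D, c i θ * (b (false, i) - b (true, i))))]
  refine S.E_congr _ fun x a => ?_
  rw [← Finset.mul_prod_erase _ _ (Finset.mem_univ (∅ : Finset I))]
  simp only [Finset.sum_empty, pt_zero]
  congr 2
  ext D
  simp [Finset.nonempty_iff_ne_empty]

lemma E_prod_dual (c : K → I → (Θ → ℤ) → ℤ) (G : K → S.Fam Θ I) (j : ℕ) (w : S.Z j → ℝ) :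
    (S.E (fun _ : Θ => 0) j fun x θ => w x * ∏ k, S.dual (c k) (G k) j θ x) =
    S.E (Sum.elim (fun _ : Θ => 0) fun _ : K × Bool × I => 1) j fun x a => w x *
      ∏ p : K × Finset I with p.2.Nonempty, G p.1 p.2 j (a ∘ Sum.inl) (S.pt j x (clin c p a)) := by
  simp only [dual, ← prod_expect_bx (R := fun _ : K × Bool × I => S.L 1 j)]
  rw [← S.E_inr 1 j (fun x _ => w x)]
  refine S.E_congr _ fun x a => ?_
  congr 1
  simp only [Finset.prod_filter, Fintype.prod_prod_type]
  rfl

/-- The weight is indistinguishable from one by products of dual functions. -/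
theorem tendsto_sub_one_mul_dual {c : K → I → (Θ → ℤ) → ℤ} (hc : ∀ k i, IsPoly (c k i))
    {θ₀ : Θ → ℤ} (h0 : ∀ k i, c k i θ₀ ≠ 0) {Sp : Finset (K × Finset I)}
    (hSp : ∀ p ∈ Sp, p.2.Nonempty) (hk : (Sp.card + 1) * 2 ^ Fintype.card I ≤ k₀) {e : S.Fn}
    (he : ∀ j x, |e j x| ≤ S.ν j x) (G : K → S.Fam Θ I)
    (hGe : ∀ p ∈ Sp, ∀ j θ x, G p.1 p.2 j θ x = e j x)
    (hG : ∀ p ∉ Sp, p.2.Nonempty → ∀ j θ x, |G p.1 p.2 j θ x| ≤ 1) :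
    Tendsto (fun j => S.E (fun _ : Θ => 0) j fun x θ =>
      (S.ν j x - 1) * ∏ k, S.dual (c k) (G k) j θ x) atTop (𝓝 0) := by
  simp only [S.E_prod_dual c G _ fun x => S.ν _ x - 1]
  exact S.tendsto_cube hc h0 hSp hk he (fun p => G p.1 p.2) hGe hG

lemma tendsto_prod_dual {c : K → I → (Θ → ℤ) → ℤ} (hc : ∀ k i, IsPoly (c k i))
    {θ₀ : Θ → ℤ} (h0 : ∀ k i, c k i θ₀ ≠ 0) {Sp : Finset (K × Finset I)}
    (hSp : ∀ p ∈ Sp, p.2.Nonempty) (hk : Sp.card ≤ k₀) (G : K → S.Fam Θ I)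
    (hGe : ∀ p ∈ Sp, ∀ j θ x, G p.1 p.2 j θ x = S.ν j x)
    (hG : ∀ p ∉ Sp, p.2.Nonempty → ∀ j θ x, G p.1 p.2 j θ x = 1) :
    Tendsto (fun j => S.E (fun _ : Θ => 0) j fun x θ => ∏ k, S.dual (c k) (G k) j θ x)
      atTop (𝓝 1) := by
  classical
  have hinj : Set.InjOn (clin c) (Sp : Set (K × Finset I)) :=
    (clin_injOn h0).mono fun p hp => hSp p hp
  refine (S.tendsto_prod_weights (Sum.elim (fun _ : Θ => 0) fun _ : K × Bool × I => 1)
    (A := Sp.image (clin c)) (fun p hp => ?_) (Finset.card_image_le.trans hk)).congr fun j => ?_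
  · obtain ⟨q, -, rfl⟩ := Finset.mem_image.1 hp
    exact clin_isPoly hc q
  · have := S.E_prod_dual c G j fun _ => 1
    simp only [one_mul] at this
    rw [this]
    refine S.E_congr _ fun x a => ?_
    rw [Finset.prod_image hinj]
    have h2 : Sp ⊆ Finset.univ.filter fun p : K × Finset I => p.2.Nonempty :=
      fun p hp => by simp [hSp p hp]
    rw [← Finset.prod_subset h2 fun p hp hn => hG p hn (Finset.mem_filter.1 hp).2 _ _ _]
    exact Finset.prod_congr rfl fun p hp => (hGe p hp _ _ _).symm

/-- Reflections of the cube leave box averages invariant. -/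
lemma Box_symmDiff (c : I → (Θ → ℤ) → ℤ) (G : S.Fam Θ I) (D₀ : Finset I) (j : ℕ) :
    S.Box c (fun D => G (symmDiff D D₀)) j = S.Box c G j := by
  let σ : Θ ⊕ (Bool × I) → Θ ⊕ (Bool × I) :=
    Sum.map id fun w => if w.2 ∈ D₀ then (!w.1, w.2) else w
  have hσ : Function.Injective σ := by
    have : Function.Involutive σ := by
      rintro (t | ⟨b, i⟩)
      · rfl
      · by_cases h : i ∈ D₀ <;> simp [σ, h]
    exact this.injective
  have hr : (Sum.elim (fun _ : Θ => (0 : Fin 3)) fun _ : Bool × I => 1) ∘ σ =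
      Sum.elim (fun _ => 0) fun _ => 1 := by
    ext (t | w) <;> rfl
  unfold Box
  rw [← S.E_pt _ j fun a => ∑ i ∈ D₀, c i (a ∘ Sum.inl) * (a (.inr (true, i)) - a (.inr (false, i)))]
  conv_rhs => rw [← hr, ← S.E_comp _ hσ]
  refine S.E_congr _ fun x a => ?_
  have hinv : Function.Involutive fun D => symmDiff D D₀ :=
    fun D => symmDiff_symmDiff_cancel_right D₀ D
  refine Fintype.prod_equiv hinv.toPerm _ _ fun D => ?_
  simp only [Function.Involutive.coe_toPerm, pt_pt]
  have h1 : (a ∘ σ) ∘ Sum.inl = a ∘ Sum.inl := rfl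
  rw [h1]
  congr 2
  have h2 : ∀ (D : Finset I) (f : I → ℤ), ∑ i ∈ D, f i = ∑ i, if i ∈ D then f i else 0 :=
    fun D f => by simp
  change _ = ∑ i ∈ symmDiff D D₀, _
  rw [h2 D₀, h2 D, h2 (symmDiff D D₀), ← Finset.sum_add_distrib]
  refine Finset.sum_congr rfl fun i _ => ?_
  by_cases hi : i ∈ D <;> by_cases hi' : i ∈ D₀ <;>
    simp [σ, hi, hi', Finset.mem_symmDiff] <;> ring

end Sys

/-- Truncation at height two. -/
noncomputable def clip (t : ℝ) : ℝ := max (-2) (min t 2)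

lemma abs_clip_half_le (t : ℝ) : |clip t / 2| ≤ 1 := by
  have h1 : -2 ≤ clip t := le_max_left _ _
  have h2 : clip t ≤ 2 := max_le (by norm_num) (min_le_right _ _)
  rw [abs_le]
  constructor <;> linarith

lemma abs_mul_sub_clip_le {t s : ℝ} (h : |t| ≤ s) : |t * (t - clip t)| ≤ (s - 1) ^ 2 := by
  rw [abs_le] at h
  have h0 : 0 ≤ s := by linarith
  unfold clip
  rcases le_total t 2 with h1 | h1
  · rw [min_eq_left h1]
    rcases le_total (-2) t with h2 | h2
    · rw [max_eq_right h2, sub_self, mul_zero, abs_zero]; positivity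
    · rw [max_eq_left h2, abs_le]
      constructor <;> nlinarith
  · rw [min_eq_right h1, max_eq_right (by norm_num), abs_le]
    constructor <;> nlinarith

namespace Sys
variable {k₀ : ℕ} (S : Sys k₀)
variable {Θ I : Type*} [Fintype Θ] [DecidableEq Θ] [Fintype I] [DecidableEq I]
  {c : I → (Θ → ℤ) → ℤ}

lemma abs_dual_le {G G' : S.Fam Θ I}
    (h : ∀ D, D.Nonempty → ∀ j θ x, |G D j θ x| ≤ G' D j θ x) (j : ℕ) (θ : Θ → ℤ) (x : S.Z j) :
    |S.dual c G j θ x| ≤ S.dual c G' j θ x := by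
  refine (Finset.abs_expect_le _ _).trans (Finset.expect_le_expect fun b _ => ?_)
  rw [Finset.abs_prod]
  exact Finset.prod_le_prod (fun _ _ => abs_nonneg _) fun D hD =>
    h D (Finset.mem_filter.1 hD).2 _ _ _

lemma dual_congr {G G' : S.Fam Θ I} (h : ∀ D, D.Nonempty → G D = G' D) :
    S.dual c G = S.dual c G' := by
  ext j θ x
  refine Finset.expect_congr rfl fun b _ => Finset.prod_congr rfl fun D hD => ?_
  rw [h D (Finset.mem_filter.1 hD).2]

lemma tendsto_E_weight {V : Type*} [Fintype V] [DecidableEq V] (ρ : V → Fin 3) (hk : 1 ≤ k₀) :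
    Tendsto (fun j => S.E ρ j fun x _ => S.ν j x) atTop (𝓝 1) := by
  refine (S.tendsto_prod_weights ρ (A := {fun _ => 0})
    (by simpa using IsPoly.const 0) (by simpa using hk)).congr fun j => S.E_congr _ fun x a => ?_
  rw [Finset.prod_singleton, pt_zero]

variable (hc : ∀ i, IsPoly (c i)) {θ₀ : Θ → ℤ} (h0 : ∀ i, c i θ₀ ≠ 0)
  (hk : 2 ^ (2 * Fintype.card I + 2) ≤ k₀)
include hc h0 hk

lemma tendsto_sq_dual_sub_one {Sp : Finset (Finset I)} (hSp : ∀ D ∈ Sp, D.Nonempty) :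
    Tendsto (fun j => S.E (fun _ : Θ => 0) j fun x θ =>
      (S.dual c (fun D j _ x => if D ∈ Sp then S.ν j x else 1) j θ x - 1) ^ 2) atTop (𝓝 0) := by
  have hcard : Sp.card ≤ 2 ^ Fintype.card I := by
    simpa using Finset.card_le_univ Sp
  have hpow : 2 ^ (2 * Fintype.card I + 2) = 4 * (2 ^ Fintype.card I * 2 ^ Fintype.card I) := by ring
  have hpos : 1 ≤ 2 ^ Fintype.card I := Nat.one_le_two_pow
  have key : ∀ (K : Type) [Fintype K] [DecidableEq K], Fintype.card K ≤ 2 →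
      Tendsto (fun j => S.E (fun _ : Θ => 0) j fun x θ => ∏ _k : K,
        S.dual c (fun D j _ x => if D ∈ Sp then S.ν j x else 1) j θ x) atTop (𝓝 1) := by
    intro K _ _ hK
    refine S.tendsto_prod_dual (K := K) (c := fun _ => c) (fun _ => hc) (fun _ => h0)
      (Sp := Finset.univ ×ˢ Sp) (by simpa using fun _ => hSp) ?_ _ ?_ ?_
    · rw [Finset.card_product, Finset.card_univ]
      nlinarith
    · intro p hp j θ x
      exact if_pos (Finset.mem_product.1 hp).2
    · intro p hp _ j θ x
      exact if_neg fun h => hp (Finset.mem_product.2 ⟨Finset.mem_univ _, h⟩)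
  have h2 := (key Bool (by simp)).sub ((key Unit (by simp)).const_mul 2)
  have h3 := h2.add_const 1
  rw [show (1 : ℝ) - 2 * 1 + 1 = 0 by norm_num] at h3
  refine h3.congr fun j => ?_
  rw [← S.E_const_mul, ← S.E_sub]
  refine (congrArg₂ (· + ·) rfl (S.E_const (fun _ : Θ => 0) j 1).symm).trans ?_
  beta_reduce
  rw [← S.E_add]
  refine S.E_congr _ fun x θ => ?_
  simp only [Finset.prod_const, Finset.card_univ, Fintype.card_bool, Fintype.card_unit]
  ring

/-- A function bounded by the weight whose correlations with bounded dual functions are small has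
small box averages. -/
theorem tendsto_Box_of_dual {e : S.Fn} (he : ∀ j x, |e j x| ≤ S.ν j x)
    (hdense : ∀ G : S.Fam Θ I, (∀ D, D.Nonempty → ∀ j θ x, |G D j θ x| ≤ 1) →
      Tendsto (fun j => S.E (fun _ : Θ => 0) j fun x θ => e j x * S.dual c G j θ x)
        atTop (𝓝 0)) :
    Tendsto (S.Box c fun _ j _ => e j) atTop (𝓝 0) := by
  have hcard : ∀ s : Finset (Finset I), s.card ≤ 2 ^ Fintype.card I := fun s => by
    simpa using Finset.card_le_univ s
  have hpow : 2 ^ (2 * Fintype.card I + 2) = 4 * (2 ^ Fintype.card I * 2 ^ Fintype.card I) := by ring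
  have hpos : 1 ≤ 2 ^ Fintype.card I := Nat.one_le_two_pow
  have main : ∀ n, ∀ Sp : Finset (Finset I), Sp.card = n + 1 → ∀ G : S.Fam Θ I,
      (∀ D ∈ Sp, ∀ j θ x, G D j θ x = e j x) → (∀ D ∉ Sp, ∀ j θ x, |G D j θ x| ≤ 1) →
      Tendsto (S.Box c G) atTop (𝓝 0) := by
    intro n
    induction n with
    | zero =>
      intro Sp hSp G hGe hG
      obtain ⟨D₀, rfl⟩ := Finset.card_eq_one.1 hSp
      refine (hdense (fun D => G (symmDiff D D₀)) fun D hD => hG _ ?_).congr fun j => ?_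
      · rw [Finset.mem_singleton, symmDiff_eq_right]
        exact hD.ne_empty
      · rw [← S.Box_symmDiff c G D₀, Box_eq]
        refine S.E_congr _ fun x θ => ?_
        rw [hGe _ (by simp)]
    | succ n ih =>
      suffices key : ∀ Sp : Finset (Finset I), Sp.card = n + 1 + 1 → ∅ ∈ Sp → ∀ G : S.Fam Θ I,
          (∀ D ∈ Sp, ∀ j θ x, G D j θ x = e j x) → (∀ D ∉ Sp, ∀ j θ x, |G D j θ x| ≤ 1) →
          Tendsto (S.Box c G) atTop (𝓝 0) by
        intro Sp hSp G hGe hG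
        obtain ⟨D₀, hD₀⟩ : Sp.Nonempty := Finset.card_pos.1 (by omega)
        have hinj : Function.Injective fun D : Finset I => symmDiff D D₀ :=
          symmDiff_left_injective D₀
        have hmem : ∀ D, D ∈ Sp.image (fun D => symmDiff D D₀) ↔ symmDiff D D₀ ∈ Sp := fun D => by
          constructor
          · intro h
            obtain ⟨D', h, rfl⟩ := Finset.mem_image.1 h
            rwa [symmDiff_symmDiff_cancel_right]
          · exact fun h => Finset.mem_image.2 ⟨_, h, symmDiff_symmDiff_cancel_right _ _⟩
        refine (key (Sp.image fun D => symmDiff D D₀)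
          (by rw [Finset.card_image_of_injective _ hinj, hSp]) ((hmem _).2 (by
            rw [← Finset.bot_eq_empty, bot_symmDiff]; exact hD₀))
          (fun D => G (symmDiff D D₀)) (fun D hD => hGe _ ((hmem D).1 hD))
          fun D hD => hG _ fun h => hD ((hmem D).2 h)).congr fun j => S.Box_symmDiff c G D₀ j
      intro Sp hSp hSp0 G hGe hG
      set Sp₁ := Sp.erase ∅ with hSp₁
      have hne : ∀ D ∈ Sp₁, D.Nonempty := fun D hD =>
        Finset.nonempty_iff_ne_empty.2 (Finset.mem_erase.1 hD).1
      have hGe₁ : ∀ D ∈ Sp₁, ∀ j θ x, G D j θ x = e j x := fun D hD => hGe D (Finset.mem_erase.1 hD).2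
      have hG₁ : ∀ D ∉ Sp₁, D.Nonempty → ∀ j θ x, |G D j θ x| ≤ 1 := fun D hD hDn =>
        hG D fun h => hD (Finset.mem_erase.2 ⟨hDn.ne_empty, h⟩)
      let F := S.dual c G
      let F' := S.dual c fun D j (_ : Θ → ℤ) x => if D ∈ Sp₁ then S.ν j x else 1
      have hFF' : ∀ j θ x, |F j θ x| ≤ F' j θ x := S.abs_dual_le fun D hD j θ x => by
        split_ifs with h
        · rw [hGe₁ D h]; exact he j x
        · exact hG₁ D h hD j θ x
      have h1 : Tendsto (fun j => S.E (fun _ : Θ => 0) j fun x θ => F j θ x * clip (F j θ x))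
          atTop (𝓝 0) := by
        let G' : S.Fam Θ I := fun D j θ x => if D = ∅ then clip (F j θ x) / 2 else G D j θ x
        have h := (ih Sp₁ (by rw [Finset.card_erase_of_mem hSp0, hSp]; rfl) G'
          (fun D hD j θ x => by
            simp only [G', if_neg (hne D hD).ne_empty]
            exact hGe₁ D hD j θ x)
          fun D hD j θ x => by
            simp only [G']
            split_ifs with h
            · exact abs_clip_half_le _
            · exact hG₁ D hD (Finset.nonempty_iff_ne_empty.2 h) j θ x).const_mul 2
        rw [mul_zero] at h
        refine h.congr fun j => ?_
        rw [Box_eq, ← S.E_const_mul]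
        refine S.E_congr _ fun x θ => ?_
        rw [S.dual_congr (G' := G) fun D hD => by
          ext j θ x; simp only [G', if_neg hD.ne_empty]]
        simp only [G', if_true]
        change 2 * (clip (F j θ x) / 2 * F j θ x) = _
        ring
      have h2 : Tendsto (fun j => S.E (fun _ : Θ => 0) j fun x θ =>
          F j θ x * (F j θ x - clip (F j θ x))) atTop (𝓝 0) := by
        refine squeeze_zero_norm (fun j => ?_) (S.tendsto_sq_dual_sub_one hc h0 hk hne)
        exact (S.abs_E_le _ j _).trans (S.E_mono _ fun x θ => abs_mul_sub_clip_le (hFF' j θ x))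
      have h3 : Tendsto (fun j => S.E (fun _ : Θ => 0) j fun x θ => (S.ν j x - 1) * F j θ x ^ 2)
          atTop (𝓝 0) := by
        refine (S.tendsto_sub_one_mul_dual (K := Bool) (c := fun _ => c) (fun _ => hc) (fun _ => h0)
          (Sp := Finset.univ ×ˢ Sp₁) (by simpa using hne) ?_ he (fun _ => G) ?_ ?_).congr
          fun j => ?_
        · rw [Finset.card_product, Finset.card_univ, Fintype.card_bool]
          have := hcard Sp₁
          nlinarith
        · exact fun p hp => hGe₁ _ (Finset.mem_product.1 hp).2
        · exact fun p hp => hG₁ _ fun h => hp (Finset.mem_product.2 ⟨Finset.mem_univ _, h⟩)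
        · simp only [Finset.prod_const, Finset.card_univ, Fintype.card_bool]
          rfl
      refine sq_tendsto (m := fun j => S.E (fun _ : Θ => 0) j fun x _ => S.ν j x)
        (v := fun j => S.E (fun _ : Θ => 0) j fun x θ => S.ν j x * F j θ x ^ 2) (fun j => ?_)
        (S.tendsto_E_weight _ (by nlinarith)) ?_
      · rw [Box_eq]
        refine S.E_cs' _ j _ _ (fun x θ => F j θ x) fun x θ => ?_
        rw [hGe _ hSp0]
        exact he j x
      · have h := (h1.add h2).add h3
        simp only [add_zero] at h
        refine h.congr fun j => ?_
        rw [← S.E_add, ← S.E_add]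
        exact S.E_congr _ fun x θ => by ring
  refine main ((Finset.univ : Finset (Finset I)).card - 1) Finset.univ ?_ _ (fun _ _ _ _ _ => rfl)
    fun D hD => absurd (Finset.mem_univ D) hD
  have : 0 < (Finset.univ : Finset (Finset I)).card := Finset.card_pos.2 ⟨∅, Finset.mem_univ _⟩
  omega

end Sys

section DenseModel

/-- Truncation to the unit interval. -/
noncomputable def unitClip (t : ℝ) : ℝ := max 0 (min t 1)

lemma unitClip_nonneg (t : ℝ) : 0 ≤ unitClip t := le_max_left _ _
lemma unitClip_le_one (t : ℝ) : unitClip t ≤ 1 := max_le zero_le_one (min_le_right _ _)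

lemma abs_unitClip_sub_le (s t : ℝ) : |unitClip s - unitClip t| ≤ |s - t| := by
  unfold unitClip
  refine (abs_max_sub_max_le_max _ _ _ _).trans (max_le (by simp) ?_)
  exact (abs_min_sub_min_le_max _ _ _ _).trans (by simp)

/-- Convex potential whose derivative is a truncated linear function. -/
noncomputable def pot (η s : ℝ) : ℝ := unitClip (η * s) * s - unitClip (η * s) ^ 2 / (2 * η)

lemma le_pot {η a : ℝ} (hη : 0 < η) (h0 : 0 ≤ a) (h1 : a ≤ 1) (s : ℝ) :
    a * s - a ^ 2 / (2 * η) ≤ pot η s := by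
  have key : 2 * (a * (η * s)) - a ^ 2 ≤
      2 * (unitClip (η * s) * (η * s)) - unitClip (η * s) ^ 2 := by
    generalize η * s = u
    unfold unitClip
    rcases le_total u 1 with h | h
    · rw [min_eq_left h]
      rcases le_total 0 u with h' | h'
      · rw [max_eq_right h']; nlinarith [sq_nonneg (a - u)]
      · rw [max_eq_left h']; nlinarith
    · rw [min_eq_right h, max_eq_right zero_le_one]
      nlinarith [mul_nonneg (sub_nonneg.2 h1) (sub_nonneg.2 h)]
  have e : ∀ b : ℝ, b * s - b ^ 2 / (2 * η) = (2 * (b * (η * s)) - b ^ 2) / (2 * η) := fun b => by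
    field_simp
  rw [pot, e, e]
  gcongr

lemma pot_zero (η : ℝ) : pot η 0 = 0 := by simp [pot, unitClip]

lemma max_le_pot {η : ℝ} (hη : 0 < η) (s : ℝ) : max s 0 - 1 / (2 * η) ≤ pot η s := by
  have h1 := le_pot hη zero_le_one le_rfl s
  have h2 := le_pot hη le_rfl zero_le_one s
  have h3 : 0 < 1 / (2 * η) := by positivity
  rw [zero_mul, zero_pow two_ne_zero, zero_div, sub_zero] at h2
  rw [one_mul, one_pow] at h1
  rcases max_cases s 0 with ⟨h, -⟩ | ⟨h, -⟩ <;> rw [h] <;> linarith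

lemma pot_add_sub_le {η : ℝ} (hη : 0 < η) (s : ℝ) {φ : ℝ} (hφ : |φ| ≤ 1) :
    pot η (s + φ) - pot η s ≤ unitClip (η * s) * φ + η := by
  have h1 := le_pot hη (unitClip_nonneg (η * (s + φ))) (unitClip_le_one _) s
  have h2 : pot η (s + φ) = unitClip (η * (s + φ)) * s - unitClip (η * (s + φ)) ^ 2 / (2 * η) +
    unitClip (η * (s + φ)) * φ := by rw [pot]; ring
  have h3 := abs_unitClip_sub_le (η * (s + φ)) (η * s)
  rw [show η * (s + φ) - η * s = η * φ by ring, abs_mul, abs_of_pos hη] at h3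
  have h4 : (unitClip (η * (s + φ)) - unitClip (η * s)) * φ ≤ η := by
    refine (le_abs_self _).trans ?_
    rw [abs_mul]
    have := abs_nonneg φ
    calc _ ≤ (η * |φ|) * |φ| := by gcongr
      _ ≤ (η * 1) * 1 := by gcongr
      _ = η := by ring
  linarith

/-- Dense model theorem, by boosting. -/
lemma exists_model {X : Type*} [Fintype X] [Nonempty X] {ν f : X → ℝ} (hf : ∀ x, 0 ≤ f x)
    (hfν : ∀ x, f x ≤ ν x) {Φ : Set (X → ℝ)} (hΦ : ∀ φ ∈ Φ, ∀ x, |φ x| ≤ 1) {ε : ℝ} (hε : 0 < ε)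
    (hε1 : ε ≤ 1) {T : ℕ} (hT : 4 / ε ^ 2 ≤ T)
    (hpos : ∀ φ : ℕ → X → ℝ, (∀ t, φ t ∈ Φ) →
      𝔼 x, (ν x - 1) * max (∑ t ∈ Finset.range T, φ t x) 0 ≤ 1 / 2) :
    ∃ g : X → ℝ, (∀ x, 0 ≤ g x ∧ g x ≤ 1) ∧ ∀ φ ∈ Φ, 𝔼 x, (f x - g x) * φ x ≤ ε := by
  classical
  by_contra! hcon
  have hstep : ∀ g : X → ℝ, ∃ φ : X → ℝ, (∀ x, 0 ≤ g x ∧ g x ≤ 1) →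
      φ ∈ Φ ∧ ε < 𝔼 x, (f x - g x) * φ x := fun g => by
    by_cases hg : ∀ x, 0 ≤ g x ∧ g x ≤ 1
    · obtain ⟨φ, h1, h2⟩ := hcon g hg
      exact ⟨φ, fun _ => ⟨h1, h2⟩⟩
    · exact ⟨0, fun h => absurd h hg⟩
  choose F hF using hstep
  set η := ε / 2 with hη
  have hη0 : 0 < η := by positivity
  let S : ℕ → X → ℝ := fun t => Nat.rec 0 (fun _ s => s + F fun x => unitClip (η * s x)) t
  let φ : ℕ → X → ℝ := fun t => F fun x => unitClip (η * S t x)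
  have hS : ∀ t x, S (t + 1) x = S t x + φ t x := fun t x => rfl
  have hφ : ∀ t, φ t ∈ Φ ∧ ε < 𝔼 x, (f x - unitClip (η * S t x)) * φ t x := fun t =>
    hF _ fun x => ⟨unitClip_nonneg _, unitClip_le_one _⟩
  have hsum : ∀ t x, S t x = ∑ i ∈ Finset.range t, φ i x := fun t x => by
    induction t with
    | zero => rfl
    | succ t ih => rw [hS, ih, Finset.sum_range_succ]
  have hmain : ∀ t : ℕ, t * ε ≤ 𝔼 x, (f x * S t x - pot η (S t x)) + t * η := fun t => by
    induction t with
    | zero =>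
      have : ∀ x, S 0 x = 0 := fun _ => rfl
      simp [this, pot_zero]
    | succ t ih =>
      have h1 : 𝔼 x, ((f x - unitClip (η * S t x)) * φ t x + (f x * S t x - pot η (S t x))) ≤
          𝔼 x, ((f x * S (t + 1) x - pot η (S (t + 1) x)) + η) := by
        refine Finset.expect_le_expect fun x _ => ?_
        have := pot_add_sub_le hη0 (S t x) (hΦ _ (hφ t).1 x)
        rw [hS]
        linarith
      rw [Finset.expect_add_distrib, Finset.expect_add_distrib,
        Finset.expect_const Finset.univ_nonempty] at h1
      have := (hφ t).2
      push_cast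
      linarith
  have h1 := hmain T
  have h2 : 𝔼 x, (f x * S T x - pot η (S T x)) ≤
      𝔼 x, ((ν x - 1) * max (S T x) 0 + 1 / (2 * η)) := by
    refine Finset.expect_le_expect fun x _ => ?_
    have h3 := max_le_pot hη0 (S T x)
    have h4 : f x * S T x ≤ ν x * max (S T x) 0 :=
      (mul_le_mul_of_nonneg_left (le_max_left _ _) (hf x)).trans
        (mul_le_mul_of_nonneg_right (hfν x) (le_max_right _ _))
    linarith
  rw [Finset.expect_add_distrib, Finset.expect_const Finset.univ_nonempty] at h2
  have h3 := hpos φ fun t => (hφ t).1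
  simp only [← hsum] at h3
  have h5 : 4 / ε ^ 2 * (ε / 2) ≤ T * (ε / 2) := by gcongr
  have h6 : 4 / ε ^ 2 * (ε / 2) = 2 / ε := by field_simp; norm_num
  have h7 : 1 / (2 * η) = 1 / ε := by rw [hη]; field_simp
  have h8 : 1 ≤ 1 / ε := by rwa [le_div_iff₀ hε, one_mul]
  have h9 : 2 / ε = 2 * (1 / ε) := by ring
  rw [h7] at h2
  nlinarith

end DenseModel

namespace Sys
variable {k₀ : ℕ} (S : Sys k₀)
variable {Θ I R : Type*} [Fintype Θ] [DecidableEq Θ] [Fintype I] [DecidableEq I]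
  [Fintype R] [DecidableEq R]

/-- The signed averages of bounded dual functions. -/
def tests (c : R → I → (Θ → ℤ) → ℤ) (j : ℕ) : Set (S.Z j → ℝ) :=
  {φ | ∃ (r : R) (s : ℝ) (G : S.Fam Θ I), |s| ≤ 1 ∧
    (∀ D, D.Nonempty → ∀ j θ x, |G D j θ x| ≤ 1) ∧
    φ = fun x => s * 𝔼 θ ∈ bx fun _ : Θ => S.L 0 j, S.dual (c r) G j θ x}

lemma abs_dual_le_one {c : I → (Θ → ℤ) → ℤ} {G : S.Fam Θ I}
    (h : ∀ D, D.Nonempty → ∀ j θ x, |G D j θ x| ≤ 1) (j : ℕ) (θ : Θ → ℤ) (x : S.Z j) :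
    |S.dual c G j θ x| ≤ 1 := by
  refine (S.abs_dual_le (G' := fun _ _ _ _ => 1) h j θ x).trans ?_
  simp [dual, Finset.expect_const (bx_nonempty fun _ : Bool × I => S.L_pos 1 j)]

lemma abs_le_one_of_mem_tests {c : R → I → (Θ → ℤ) → ℤ} {j : ℕ} {φ : S.Z j → ℝ}
    (h : φ ∈ S.tests c j) (x : S.Z j) : |φ x| ≤ 1 := by
  obtain ⟨r, s, G, hs, hG, rfl⟩ := h
  have h1 : |𝔼 θ ∈ bx fun _ : Θ => S.L 0 j, S.dual (c r) G j θ x| ≤ 1 :=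
    (Finset.abs_expect_le _ _).trans (Finset.expect_le (bx_nonempty fun _ => S.L_pos 0 j)
      fun θ _ => S.abs_dual_le_one hG j θ x)
  rw [abs_mul]
  exact mul_le_one₀ hs (abs_nonneg _) h1

variable {c : R → I → (Θ → ℤ) → ℤ} (hc : ∀ r i, IsPoly (c r i)) {θ₀ : Θ → ℤ}
  (h0 : ∀ r i, c r i θ₀ ≠ 0) (hk : 2 ^ Fintype.card I ≤ k₀)
include hc h0 hk

lemma tendsto_prod_averages {n : ℕ} (r : Fin n → R) {G : Fin n → S.Fam Θ I}
    (hG : ∀ k D, D.Nonempty → ∀ j θ x, |G k D j θ x| ≤ 1) :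
    Tendsto (fun j => 𝔼 x, (S.ν j x - 1) *
      ∏ k, 𝔼 θ ∈ bx fun _ : Θ => S.L 0 j, S.dual (c (r k)) (G k) j θ x) atTop (𝓝 0) := by
  refine (S.tendsto_sub_one_mul_dual (K := Fin n) (Θ := Fin n × Θ) (I := I)
    (c := fun k i θ => c (r k) i fun v => θ (k, v))
    (fun k i => (hc (r k) i).comp fun v => (k, v)) (θ₀ := fun p => θ₀ p.2)
    (fun k i => h0 (r k) i) (Sp := ∅) (by simp) (by simpa using hk)
    (e := fun j x => 0) (fun j x => by simpa using S.nonneg j x)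
    (fun k D j θ x => G k D j (fun v => θ (k, v)) x) (by simp)
    fun p _ hp j θ x => hG _ _ hp _ _ _).congr fun j => ?_
  rw [E, Finset.expect_comm]
  refine Finset.expect_congr rfl fun x _ => ?_
  rw [← Finset.mul_expect]
  congr 1
  exact prod_expect_bx (R := fun _ : Fin n × Θ => S.L 0 j)
    fun k θ => S.dual (c (r k)) (G k) j θ x

lemma eventually_prod_tests (n : ℕ) {κ : ℝ} (hκ : 0 < κ) :
    ∀ᶠ j in atTop, ∀ φ : Fin n → S.Z j → ℝ, (∀ k, φ k ∈ S.tests c j) →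
      |𝔼 x, (S.ν j x - 1) * ∏ k, φ k x| ≤ κ := by
  have key : ∀ r : Fin n → R, ∀ᶠ j in atTop, ∀ G : Fin n → S.Fam Θ I,
      (∀ k D, D.Nonempty → ∀ j θ x, |G k D j θ x| ≤ 1) → |𝔼 x, (S.ν j x - 1) *
        ∏ k, 𝔼 θ ∈ bx fun _ : Θ => S.L 0 j, S.dual (c (r k)) (G k) j θ x| ≤ κ := by
    intro r
    by_contra hcon
    rw [not_eventually] at hcon
    have hch : ∀ j, ∃ G : Fin n → S.Fam Θ I, (∀ k D, D.Nonempty → ∀ j θ x, |G k D j θ x| ≤ 1) ∧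
        ((¬ ∀ G : Fin n → S.Fam Θ I,
      (∀ k D, D.Nonempty → ∀ j θ x, |G k D j θ x| ≤ 1) → |𝔼 x, (S.ν j x - 1) *
        ∏ k, 𝔼 θ ∈ bx fun _ : Θ => S.L 0 j, S.dual (c (r k)) (G k) j θ x| ≤ κ) →
        κ < |𝔼 x, (S.ν j x - 1) *
        ∏ k, 𝔼 θ ∈ bx fun _ : Θ => S.L 0 j, S.dual (c (r k)) (G k) j θ x|) := by
      intro j
      by_cases h : ∀ G : Fin n → S.Fam Θ I,
        (∀ k D, D.Nonempty → ∀ j θ x, |G k D j θ x| ≤ 1) → |𝔼 x, (S.ν j x - 1) *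
          ∏ k, 𝔼 θ ∈ bx fun _ : Θ => S.L 0 j, S.dual (c (r k)) (G k) j θ x| ≤ κ
      · exact ⟨fun _ _ _ _ _ => 0, by simp, fun h' => absurd h h'⟩
      · have h' := h
        push Not at h'
        obtain ⟨G, h1, h2⟩ := h'
        exact ⟨G, h1, fun _ => h2⟩
    choose G hG1 hG2 using hch
    have hlim := S.tendsto_prod_averages hc h0 hk r (G := fun k D j => G j k D j)
      fun k D hD j => hG1 j k D hD j
    have hev := (tendsto_zero_iff_abs_tendsto_zero _).1 hlim |>.eventually_lt_const hκ
    obtain ⟨j, hj, hj'⟩ := (hcon.and_eventually hev).exists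
    exact absurd (hG2 j hj) (not_lt.2 hj'.le)
  filter_upwards [eventually_all.2 key] with j hj φ hφ
  choose r s G hs hG hφ using hφ
  have : ∀ x, (S.ν j x - 1) * ∏ k, φ k x = (∏ k, s k) * ((S.ν j x - 1) *
      ∏ k, 𝔼 θ ∈ bx fun _ : Θ => S.L 0 j, S.dual (c (r k)) (G k) j θ x) := fun x => by
    simp only [hφ, Finset.prod_mul_distrib]; ring
  simp only [this, ← Finset.mul_expect]
  rw [abs_mul, Finset.abs_prod]
  exact (mul_le_of_le_one_left (abs_nonneg _)
    (Finset.prod_le_one (fun _ _ => abs_nonneg _) fun k _ => hs k)).trans (hj r G hG)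

end Sys

namespace Sys
variable {k₀ : ℕ} (S : Sys k₀)
variable {Θ I R : Type*} [Fintype Θ] [DecidableEq Θ] [Fintype I] [DecidableEq I]
  [Fintype R] [DecidableEq R]
variable {c : R → I → (Θ → ℤ) → ℤ} (hc : ∀ r i, IsPoly (c r i)) {θ₀ : Θ → ℤ}
  (h0 : ∀ r i, c r i θ₀ ≠ 0) (hk : 2 ^ Fintype.card I ≤ k₀)
include hc h0 hk

lemma eventually_pos_part (T : ℕ) :
    ∀ᶠ j in atTop, ∀ φ : ℕ → S.Z j → ℝ, (∀ t, φ t ∈ S.tests c j) →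
      𝔼 x, (S.ν j x - 1) * max (∑ t ∈ Finset.range T, φ t x) 0 ≤ 1 / 2 := by
  obtain ⟨P, hP⟩ := exists_polynomial_near_of_continuousOn (-T) T (fun t => max t 0)
    (by fun_prop) (1 / 16) (by norm_num)
  set A := ∑ n ∈ Finset.range (P.natDegree + 1), |P.coeff n| * (T : ℝ) ^ n with hA
  have hA0 : 0 ≤ A := Finset.sum_nonneg fun n _ => by positivity
  have hκ : 0 < 1 / (16 * (A + 1)) := by positivity
  have hAκ : A * (1 / (16 * (A + 1))) ≤ 1 / 16 := by
    rw [mul_one_div, div_le_div_iff₀ (by positivity) (by norm_num)]; linarith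
  filter_upwards [(eventually_all_finset (Finset.range (P.natDegree + 1))).2 fun n _ =>
    S.eventually_prod_tests hc h0 hk n hκ, S.eventually_prod_tests hc h0 hk 0 one_pos]
    with j hj hj0 φ hφ
  set s : S.Z j → ℝ := fun x => ∑ t ∈ Finset.range T, φ t x with hs
  have hsT : ∀ x, s x ∈ Set.Icc (-T : ℝ) T := fun x => by
    rw [Set.mem_Icc, ← abs_le]
    refine (Finset.abs_sum_le_sum_abs _ _).trans ?_
    refine (Finset.sum_le_sum fun t _ => S.abs_le_one_of_mem_tests (hφ t) x).trans ?_
    simp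
  have h1 : ∀ n ∈ Finset.range (P.natDegree + 1),
      |𝔼 x, (S.ν j x - 1) * s x ^ n| ≤ (T : ℝ) ^ n * (1 / (16 * (A + 1))) := fun n hn => by
    simp only [hs, Finset.sum_pow', Finset.mul_sum, Finset.expect_sum_comm]
    refine (Finset.abs_sum_le_sum_abs _ _).trans ?_
    refine (Finset.sum_le_sum fun p _ => hj n hn (fun i => φ (p i)) fun i => hφ _).trans ?_
    simp
  have h2 : 𝔼 x, (S.ν j x - 1) * P.eval (s x) ≤ 1 / 16 := by
    have : ∀ x, (S.ν j x - 1) * P.eval (s x) =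
        ∑ n ∈ Finset.range (P.natDegree + 1), P.coeff n * ((S.ν j x - 1) * s x ^ n) := fun x => by
      rw [Polynomial.eval_eq_sum_range, Finset.mul_sum]
      exact Finset.sum_congr rfl fun n _ => by ring
    simp only [this, Finset.expect_sum_comm, ← Finset.mul_expect]
    refine le_trans ?_ hAκ
    rw [hA, Finset.sum_mul]
    refine Finset.sum_le_sum fun n hn => (le_abs_self _).trans ?_
    rw [abs_mul, mul_assoc]
    exact mul_le_mul_of_nonneg_left (h1 n hn) (abs_nonneg _)
  have h3 : 𝔼 x, S.ν j x ≤ 2 := by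
    have := hj0 (fun i => φ 0) fun i => hφ _
    simp only [Finset.univ_eq_empty, Finset.prod_empty, mul_one, Finset.expect_sub_distrib,
      Finset.expect_const Finset.univ_nonempty] at this
    linarith [(abs_le.1 this).2]
  have h4 : 𝔼 x, (S.ν j x - 1) * max (s x) 0 ≤
      𝔼 x, ((S.ν j x - 1) * P.eval (s x) + (S.ν j x * (1 / 16) + 1 / 16)) := by
    refine Finset.expect_le_expect fun x _ => ?_
    have h5 := abs_le.1 (hP _ (hsT x)).le
    have h6 := S.nonneg j x
    nlinarith [mul_nonneg h6 (by linarith [h5.1] : 0 ≤ P.eval (s x) - max (s x) 0 + 1 / 16)]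
  rw [Finset.expect_add_distrib, Finset.expect_add_distrib, ← Finset.expect_mul,
    Finset.expect_const Finset.univ_nonempty] at h4
  linarith

/-- Every nonnegative function bounded by the weight agrees with a bounded function on all dual
functions. -/
theorem exists_dense_model {f : S.Fn} (hf : ∀ j x, 0 ≤ f j x) (hfν : ∀ j x, f j x ≤ S.ν j x) :
    ∃ g : S.Fn, (∀ j x, 0 ≤ g j x ∧ g j x ≤ 1) ∧ ∀ (r : R) (G : S.Fam Θ I),
      (∀ D, D.Nonempty → ∀ j θ x, |G D j θ x| ≤ 1) →
      Tendsto (fun j => S.E (fun _ : Θ => 0) j fun x θ => (f j x - g j x) * S.dual (c r) G j θ x)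
        atTop (𝓝 0) := by
  classical
  let Q : ℕ → ∀ j, (S.Z j → ℝ) → Prop := fun n j g => (∀ x, 0 ≤ g x ∧ g x ≤ 1) ∧
    ∀ φ ∈ S.tests c j, 𝔼 x, (f j x - g x) * φ x ≤ 1 / (n + 1)
  have hQ : ∀ n, ∀ᶠ j in atTop, ∃ g, Q n j g := fun n => by
    obtain ⟨T, hT⟩ := exists_nat_ge (4 / (1 / ((n : ℝ) + 1)) ^ 2)
    filter_upwards [S.eventually_pos_part hc h0 hk T] with j hj
    exact exists_model (hf j) (hfν j) (fun φ h => S.abs_le_one_of_mem_tests h) (by positivity)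
      (by rw [div_le_one (by positivity)]; linarith [(Nat.cast_nonneg n : (0 : ℝ) ≤ n)]) hT hj
  let m : ℕ → ℕ := fun j => Nat.findGreatest (fun n => ∃ g, Q n j g) j
  have hg : ∀ j, ∃ g : S.Z j → ℝ, (∀ x, 0 ≤ g x ∧ g x ≤ 1) ∧ ((∃ g, Q (m j) j g) → Q (m j) j g) :=
    fun j => by
      by_cases h : ∃ g, Q (m j) j g
      · obtain ⟨g, hg⟩ := h
        exact ⟨g, hg.1, fun _ => hg⟩
      · exact ⟨0, by simp, fun h' => absurd h' h⟩
  choose g hg1 hg2 using hg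
  have hone : ∀ n : ℕ, ∀ᶠ j in atTop, ∀ φ ∈ S.tests c j,
      𝔼 x, (f j x - g j x) * φ x ≤ 1 / ((n : ℝ) + 1) := fun n => by
    filter_upwards [hQ n, eventually_ge_atTop n] with j hj hnj φ hφ
    have h1 : ∃ g, Q (m j) j g := Nat.findGreatest_spec (P := fun n => ∃ g, Q n j g) hnj hj
    have h2 : n ≤ m j := Nat.le_findGreatest hnj hj
    exact ((hg2 j h1).2 φ hφ).trans (by gcongr)
  refine ⟨g, hg1, fun r G hG => ?_⟩
  have hE : ∀ j, (S.E (fun _ : Θ => 0) j fun x θ => (f j x - g j x) * S.dual (c r) G j θ x) =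
      𝔼 x, (f j x - g j x) * 𝔼 θ ∈ bx fun _ : Θ => S.L 0 j, S.dual (c r) G j θ x := fun j => by
    rw [E, Finset.expect_comm]
    simp only [← Finset.mul_expect]
    rfl
  rw [Metric.tendsto_nhds]
  intro ε hε
  obtain ⟨n, hn⟩ := exists_nat_one_div_lt hε
  filter_upwards [hone n] with j hj
  have h1 := hj _ ⟨r, 1, G, by simp, hG, rfl⟩
  have h2 := hj _ ⟨r, -1, G, by simp, hG, rfl⟩
  simp only [one_mul, neg_mul, mul_neg, Finset.expect_neg_distrib] at h1 h2
  rw [Real.dist_eq, sub_zero, hE, abs_lt]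
  constructor <;> linarith

end Sys

namespace Sys
variable {k₀ : ℕ} (S : Sys k₀)

/-- Coefficient pairs of the pattern seen from its three points. -/
abbrev Coeff := {p : ℤ × ℤ // p ∈ ({(16, 25), (9, -16), (25, 16)} : Finset (ℤ × ℤ))}

/-- Transference: in averages over the pattern, a function bounded by the weight may be replaced by
one taking values in the unit interval. -/
theorem exists_dense_T (hk : 2 ^ 16 ≤ k₀) (hν : ∀ j x, 1 / 2 ≤ S.ν j x) {f : S.Fn}
    (hf : ∀ j x, 0 ≤ f j x) (hfν : ∀ j x, f j x ≤ S.ν j x) :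
    ∃ g : S.Fn, (∀ j x, 0 ≤ g j x ∧ g j x ≤ 1) ∧
      Tendsto (fun j => 𝔼 x, f j x - 𝔼 x, g j x) atTop (𝓝 0) ∧
      Tendsto (fun j => S.T 16 25 f f f j - S.T 16 25 g g g j) atTop (𝓝 0) := by
  have hcard : Fintype.card Vert = 7 := by decide
  obtain ⟨g, hg, hd⟩ := S.exists_dense_model (R := Coeff) (I := Vert)
    (c := fun r i => dir r.1.1 r.1.2 i.1) (θ₀ := val 0 ∘ par)
    (fun r i => dir_isPoly _ _ _) (fun r i => (nondegenerate_coeffs r.2).2.2.2 i)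
    (by rw [hcard]; omega) hf hfν
  refine ⟨g, hg, ?_, ?_⟩
  · refine (hd ⟨(16, 25), by decide⟩ (fun _ _ _ _ => 1) (by simp)).congr fun j => ?_
    simp only [dual, Finset.prod_const_one,
      Finset.expect_const (bx_nonempty fun _ : Bool × Vert => S.L_pos 1 j), mul_one, E,
      Finset.expect_sub_distrib, Finset.expect_const (bx_nonempty (S.R_pos (fun _ : Bool × Fin 3 => 0) j))]
  let f' : S.Fn := fun j x => f j x / 2
  let g' : S.Fn := fun j x => g j x / 2
  let e : S.Fn := fun j x => f' j x - g' j x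
  have hf' : ∀ j x, |f' j x| ≤ S.ν j x := fun j x => by
    rw [abs_of_nonneg (by simp only [f']; linarith [hf j x])]
    simp only [f']; linarith [hf j x, hfν j x]
  have hg' : ∀ j x, |g' j x| ≤ S.ν j x := fun j x => by
    rw [abs_of_nonneg (by simp only [g']; linarith [(hg j x).1])]
    simp only [g']; linarith [(hg j x).2, hν j x]
  have he : ∀ j x, |e j x| ≤ S.ν j x := fun j x => by
    have h1 := hf' j x
    have h2 := hg' j x
    rw [abs_of_nonneg (by simp only [f']; linarith [hf j x])] at h1
    rw [abs_of_nonneg (by simp only [g']; linarith [(hg j x).1])] at h2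
    have := hf j x
    have := (hg j x).1
    rw [abs_le]
    simp only [e, f', g'] at *
    constructor <;> linarith
  have key : ∀ r : Coeff, ∀ f₀ f₁ : S.Fn, (∀ j x, |f₀ j x| ≤ S.ν j x) →
      (∀ j x, |f₁ j x| ≤ S.ν j x) → Tendsto (S.T r.1.1 r.1.2 f₀ f₁ e) atTop (𝓝 0) := by
    intro r f₀ f₁ h₀ h₁
    obtain ⟨hA, hinj, hdep, hdir⟩ := nondegenerate_coeffs r.2
    refine S.tendsto_T_of_Box (by omega) hA hinj hdep hdir h₀ h₁ he
      (S.tendsto_Box_of_dual (θ₀ := val 0 ∘ par) (fun i => dir_isPoly _ _ _) (fun i => hdir i)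
        (by rw [hcard]; omega) he fun G hG => ?_)
    have h := (hd r G hG).const_mul (1 / 2)
    rw [mul_zero] at h
    refine h.congr fun j => ?_
    rw [← S.E_const_mul]
    exact S.E_congr _ fun x θ => by simp only [e, f', g']; ring
  have h := (((key ⟨(16, 25), by decide⟩ g' g' hg' hg').add
    (key ⟨(25, 16), by decide⟩ g' f' hg' hf')).add
    (key ⟨(9, -16), by decide⟩ f' f' hf' hf')).const_mul 8
  simp only [add_zero, mul_zero] at h
  refine h.congr fun j => ?_
  simp only [T]
  rw [← S.E_pt (fun _ : Unit => 2) j (fun a => 16 * a () ^ 2) fun x a =>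
    f' j x * f' j (S.pt j x (9 * a () ^ 2)) * e j (S.pt j x (-16 * a () ^ 2)),
    ← S.E_add, ← S.E_add, ← S.E_const_mul, ← S.E_sub]
  refine S.E_congr _ fun x a => ?_
  simp only [pt_pt]
  rw [show 16 * a () ^ 2 + 9 * a () ^ 2 = 25 * a () ^ 2 by ring,
    show 16 * a () ^ 2 + -16 * a () ^ 2 = 0 by ring, pt_zero]
  simp only [e, f', g']
  ring

end Sys

namespace Sys
variable {k₀ : ℕ} (S : Sys k₀)

lemma sum_le_T {g : S.Fn} (hg : ∀ j x, 0 ≤ g j x) {j K n L : ℕ} (hn : 1 ≤ n) (hnL : n ≤ L)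
    (hK : K * L ≤ S.L 2 j) :
    ∑ k ∈ Finset.range K, 𝔼 y, g j y * g j (S.pt j y (16 * ((k * n : ℕ) : ℤ) ^ 2)) *
      g j (S.pt j y (25 * ((k * n : ℕ) : ℤ) ^ 2)) ≤ S.L 2 j * S.T 16 25 g g g j := by
  have hcard : (bx (S.R (fun _ : Unit => 2) j)).card = S.L 2 j := by simp [bx, R]
  rw [T, E, Finset.expect_eq_sum_div_card, hcard, mul_div_cancel₀ _
    (by have := S.L_pos 2 j; positivity)]
  have hinj : Function.Injective fun (k : ℕ) (_ : Unit) => ((k * n : ℕ) : ℤ) := fun k k' h =>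
    Nat.eq_of_mul_eq_mul_right hn (Int.ofNat_inj.1 (congrFun h ()))
  refine le_trans (le_of_eq ?_) (Finset.sum_le_sum_of_subset_of_nonneg
    (s := (Finset.range K).image fun (k : ℕ) (_ : Unit) => ((k * n : ℕ) : ℤ)) ?_ fun a _ _ =>
      Finset.expect_nonneg fun x _ => mul_nonneg (mul_nonneg (hg _ _) (hg _ _)) (hg _ _))
  · rw [Finset.sum_image hinj.injOn]
  · intro a ha
    obtain ⟨k, hk, rfl⟩ := Finset.mem_image.1 ha
    rw [mem_bx]
    intro v
    have h1 : (k + 1) * n ≤ K * L := Nat.mul_le_mul (Finset.mem_range.1 hk) hnL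
    refine ⟨by positivity, ?_⟩
    simp only [R]
    exact_mod_cast (by nlinarith : k * n < S.L 2 j)

/-- Bounded functions of positive mean have many weighted patterns. -/
theorem exists_le_T {δ : ℝ} (hδ : 0 < δ) (hδ1 : δ ≤ 1) : ∃ c : ℝ, 0 < c ∧ ∀ᶠ j in atTop, ∀ g : S.Fn,
    (∀ j x, 0 ≤ g j x ∧ g j x ≤ 1) → δ ≤ 𝔼 x, g j x → c ≤ S.T 16 25 g g g j := by
  classical
  obtain ⟨L, hL⟩ := square_pattern_in_dense_set (δ := δ / 4) (by positivity)
  refine ⟨δ / 2 * (δ / 4) ^ 3 / (2 * (L + 1) ^ 3), by positivity, ?_⟩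
  filter_upwards [S.eventually_le_L (2 * (L + 1)) 2] with j hj g hg hE
  set F : ℕ → ℝ := fun m => 𝔼 y, g j y * g j (S.pt j y (16 * (m : ℤ) ^ 2)) *
    g j (S.pt j y (25 * (m : ℤ) ^ 2)) with hF
  have hpt : ∀ k : ℕ, δ / 2 * (δ / 4) ^ 3 ≤ ∑ n ∈ Finset.Icc 1 L, (L + 1) * F (k * n) := by
    intro k
    let pr : S.Z j → ℕ → ℕ → ℝ := fun y t n => g j (S.pt j y (k ^ 2 * t : ℕ)) *
      g j (S.pt j y (k ^ 2 * (t + 16 * n ^ 2) : ℕ)) * g j (S.pt j y (k ^ 2 * (t + 25 * n ^ 2) : ℕ))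
    have hpr : ∀ y t n, 0 ≤ pr y t n := fun y t n =>
      mul_nonneg (mul_nonneg (hg _ _).1 (hg _ _).1) (hg _ _).1
    have h1 : ∀ y, (((L : ℝ) + 1)⁻¹ * ∑ t ∈ Finset.range (L + 1), g j (S.pt j y (k ^ 2 * t : ℕ)) -
        δ / 2) * (δ / 4) ^ 3 ≤ ∑ n ∈ Finset.Icc 1 L, ∑ t ∈ Finset.range (L + 1), pr y t n := by
      intro y
      set A := (Finset.range (L + 1)).filter fun t : ℕ => δ / 4 ≤ g j (S.pt j y (k ^ 2 * t : ℕ))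
        with hA
      have hsum : ∑ t ∈ Finset.range (L + 1), g j (S.pt j y (k ^ 2 * t : ℕ)) ≤
          A.card + (L + 1) * (δ / 4) := by
        calc _ ≤ ∑ t ∈ Finset.range (L + 1),
              ((if δ / 4 ≤ g j (S.pt j y (k ^ 2 * t : ℕ)) then (1 : ℝ) else 0) + δ / 4) := by
              refine Finset.sum_le_sum fun t _ => ?_
              split_ifs with h
              · linarith [(hg j (S.pt j y (k ^ 2 * t : ℕ))).2]
              · linarith
          _ = _ := by
              rw [Finset.sum_add_distrib, Finset.sum_boole, Finset.sum_const, Finset.card_range]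
              simp [hA]
      have hL0 : (0 : ℝ) < (L : ℝ) + 1 := by positivity
      have hnn : 0 ≤ ∑ n ∈ Finset.Icc 1 L, ∑ t ∈ Finset.range (L + 1), pr y t n :=
        Finset.sum_nonneg fun n _ => Finset.sum_nonneg fun t _ => hpr _ _ _
      by_cases hbig : δ / 4 * (L + 1 : ℕ) ≤ A.card
      · obtain ⟨t, n, hn, ht, ht1, ht2⟩ := hL A (Finset.filter_subset _ _) hbig
        have hmem : ∀ s, s ∈ A → s < L + 1 ∧ δ / 4 ≤ g j (S.pt j y (k ^ 2 * s : ℕ)) := fun s hs => by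
          simpa [hA] using hs
        have hu : ((L : ℝ) + 1)⁻¹ * ∑ t ∈ Finset.range (L + 1), g j (S.pt j y (k ^ 2 * t : ℕ)) ≤ 1 := by
          rw [inv_mul_le_iff₀ hL0, mul_one]
          refine (Finset.sum_le_sum fun t _ => (hg j _).2).trans ?_
          simp
        have hnL : n ≤ L := by nlinarith [(hmem _ ht2).1]
        calc _ ≤ 1 * (δ / 4) ^ 3 := by gcongr; linarith
          _ = δ / 4 * (δ / 4) * (δ / 4) := by ring
          _ ≤ pr y t n := mul_le_mul (mul_le_mul (hmem _ ht).2 (hmem _ ht1).2 (by positivity)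
              (hg _ _).1) (hmem _ ht2).2 (by positivity) (mul_nonneg (hg _ _).1 (hg _ _).1)
          _ ≤ ∑ t ∈ Finset.range (L + 1), pr y t n :=
              Finset.single_le_sum (f := fun t => pr y t n) (fun t _ => hpr y t n)
                (Finset.mem_range.2 (hmem _ ht).1)
          _ ≤ _ := Finset.single_le_sum (f := fun n => ∑ t ∈ Finset.range (L + 1), pr y t n)
              (fun n _ => Finset.sum_nonneg fun t _ => hpr y t n) (Finset.mem_Icc.2 ⟨hn, hnL⟩)
      · refine le_trans (mul_nonpos_of_nonpos_of_nonneg ?_ (by positivity)) hnn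
        rw [sub_nonpos, inv_mul_le_iff₀ hL0]
        push Not at hbig
        push_cast at hbig
        linarith
    have h2 := Finset.expect_le_expect (s := Finset.univ) fun y _ => h1 y
    have h3 : ∀ (t : ℕ), 𝔼 y, g j (S.pt j y (k ^ 2 * t : ℕ)) = 𝔼 y, g j y := fun t =>
      S.expect_pt j _ (g j)
    have h4 : ∀ t n : ℕ, 𝔼 y, pr y t n = F (k * n) := fun t n => by
      refine (Finset.expect_congr rfl fun y _ => ?_).trans (S.expect_pt j ((k ^ 2 * t : ℕ) : ℤ)
        fun y => g j y * g j (S.pt j y (16 * ((k * n : ℕ) : ℤ) ^ 2)) *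
          g j (S.pt j y (25 * ((k * n : ℕ) : ℤ) ^ 2)))
      simp only [pr, pt_pt]
      congr 4 <;> push_cast <;> ring
    rw [← Finset.expect_mul, Finset.expect_sub_distrib, ← Finset.mul_expect,
      Finset.expect_sum_comm, Finset.expect_const Finset.univ_nonempty, Finset.expect_sum_comm] at h2
    simp only [h3, Finset.expect_sum_comm, h4, Finset.sum_const, Finset.card_range, nsmul_eq_mul,
      Nat.cast_add, Nat.cast_one] at h2
    rw [inv_mul_cancel_left₀ (by positivity)] at h2
    refine le_trans ?_ h2
    gcongr
    linarith
  set K := S.L 2 j / (L + 1) with hK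
  have hKL : K * (L + 1) ≤ S.L 2 j := Nat.div_mul_le_self _ _
  have hK2 : S.L 2 j ≤ 2 * (L + 1) * K := by
    have h1 := Nat.div_add_mod (S.L 2 j) (L + 1)
    have h2 := Nat.mod_lt (S.L 2 j) (Nat.succ_pos L)
    have h3 : 2 ≤ K := (Nat.le_div_iff_mul_le (Nat.succ_pos L)).2 hj
    rw [← hK] at h1
    simp only [Nat.succ_eq_add_one] at h2
    nlinarith
  have h5 := Finset.sum_le_sum (s := Finset.range K) fun k _ => hpt k
  rw [Finset.sum_comm] at h5
  have h6 : ∑ n ∈ Finset.Icc 1 L, ∑ k ∈ Finset.range K, ((L : ℝ) + 1) * F (k * n) ≤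
      ∑ n ∈ Finset.Icc 1 L, (L + 1) * (S.L 2 j * S.T 16 25 g g g j) :=
    Finset.sum_le_sum fun n hn => by
      rw [← Finset.mul_sum]
      exact mul_le_mul_of_nonneg_left (S.sum_le_T (fun j x => (hg j x).1) (Finset.mem_Icc.1 hn).1
        (Finset.mem_Icc.1 hn).2 ((Nat.mul_le_mul_left _ (Nat.le_succ L)).trans hKL)) (by positivity)
  have h7 := h5.trans h6
  simp only [Finset.sum_const, Finset.card_range, Nat.card_Icc, nsmul_eq_mul, add_tsub_cancel_right] at h7
  have hT : 0 ≤ S.T 16 25 g g g j := Finset.expect_nonneg fun a _ => Finset.expect_nonneg fun x _ =>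
    mul_nonneg (mul_nonneg (hg _ _).1 (hg _ _).1) (hg _ _).1
  have hL2 : (0 : ℝ) < S.L 2 j := by exact_mod_cast S.L_pos 2 j
  have hK2' : (S.L 2 j : ℝ) ≤ 2 * (L + 1) * K := by exact_mod_cast hK2
  rw [div_le_iff₀ (by positivity)]
  set q := δ / 2 * (δ / 4) ^ 3 with hq
  have hq0 : 0 < q := by positivity
  have h8 : S.L 2 j * q ≤ S.L 2 j * (S.T 16 25 g g g j * (2 * ((L : ℝ) + 1) ^ 3)) := by
    calc S.L 2 j * q ≤ 2 * (L + 1) * K * q := by gcongr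
      _ = 2 * (L + 1) * (K * q) := by ring
      _ ≤ 2 * (L + 1) * (L * ((L + 1) * (S.L 2 j * S.T 16 25 g g g j))) := by gcongr
      _ ≤ 2 * (L + 1) * ((L + 1) * ((L + 1) * (S.L 2 j * S.T 16 25 g g g j))) := by
          gcongr; linarith
      _ = _ := by ring
  exact le_of_mul_le_mul_left h8 hL2

end Sys

namespace Sys
variable {k₀ : ℕ} (S : Sys k₀)

/-- Patterns in the support of a function of positive mean dominated by the weight. -/
theorem exists_pattern (hk : 2 ^ 16 ≤ k₀) (hν : ∀ j x, 1 / 2 ≤ S.ν j x) {f : S.Fn}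
    (hf : ∀ j x, 0 ≤ f j x) (hfν : ∀ j x, f j x ≤ S.ν j x) {δ : ℝ} (hδ : 0 < δ)
    (hE : ∀ᶠ j in atTop, δ ≤ 𝔼 x, f j x) :
    ∀ᶠ j in atTop, ∃ (x : S.Z j) (n : ℕ), 1 ≤ n ∧ n < S.L 2 j ∧ f j x ≠ 0 ∧
      f j (S.pt j x (16 * (n : ℤ) ^ 2)) ≠ 0 ∧ f j (S.pt j x (25 * (n : ℤ) ^ 2)) ≠ 0 := by
  obtain ⟨g, hg, hfg, hT⟩ := S.exists_dense_T hk hν hf hfν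
  obtain ⟨c, hc, hgT⟩ := S.exists_le_T (δ := min (δ / 2) 1) (by positivity) (min_le_right _ _)
  obtain ⟨C, -, hz⟩ := (IsPoly.coord ()).zeros fun h => by
    simpa using congrFun h fun _ => 1
  have hB := (S.B_L 3).mul_const C
  rw [zero_mul] at hB
  filter_upwards [hE, hgT, hfg.eventually_lt_const (show 0 < δ / 2 by positivity),
    hT.eventually_const_lt (show -(c / 2) < 0 by linarith),
    hB.eventually_lt_const (show 0 < c / 2 by positivity)] with j h1 h2 h3 h4 h5
  have h6 := h2 g hg ((min_le_left _ _).trans (by linarith))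
  by_contra! hcon
  have h7 : S.T 16 25 f f f j ≤ S.B j ^ 3 / S.L 0 j * C := by
    calc S.T 16 25 f f f j
        ≤ S.E (fun _ : Unit => 2) j fun _ a => S.B j ^ 3 * if a () = 0 then 1 else 0 := by
          refine S.E_mono_box _ fun x a ha => ?_
          have hfB : ∀ x, f j x ≤ S.B j := fun x => (hfν j x).trans (S.le_B j x)
          have hB0 : 0 ≤ S.B j := zero_le_one.trans (S.one_le_B j)
          split_ifs with h
          · calc _ ≤ S.B j * S.B j * S.B j := mul_le_mul (mul_le_mul (hfB _) (hfB _) (hf _ _) hB0)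
                  (hfB _) (hf _ _) (by positivity)
              _ = _ := by ring
          · rw [mul_zero]
            have ha' := (mem_bx.1 ha) ()
            obtain ⟨n, hn⟩ := Int.eq_ofNat_of_zero_le ha'.1
            by_cases hx : f j x = 0
            · simp [hx]
            by_cases hx1 : f j (S.pt j x (16 * a () ^ 2)) = 0
            · simp [hx1]
            · rw [hn] at hx1 h ha' ⊢
              simp only [R] at ha'
              rw [hcon x n (by omega) (by omega) hx hx1, mul_zero]
      _ = S.B j ^ 3 * 𝔼 a ∈ bx (S.R (fun _ : Unit => 2) j), if a () = 0 then (1 : ℝ) else 0 := by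
          rw [S.E_const_mul]
          simp only [E, Finset.expect_const Finset.univ_nonempty]
      _ ≤ S.B j ^ 3 * (C / S.L 0 j) :=
          mul_le_mul_of_nonneg_left (hz _ _ (S.L_pos 0 j) fun v => S.L0_le _ _)
            (pow_nonneg (zero_le_one.trans (S.one_le_B j)) 3)
      _ = _ := by ring
  linarith

end Sys

section Selberg
variable {P s : Finset ℕ} {R : ℕ}

lemma sum_powerset_split (hs : s ⊆ P) (F : Finset ℕ → ℝ) :
    ∑ M ∈ P.powerset, F M = ∑ M ∈ (P \ s).powerset, ∑ t ∈ s.powerset, F (M ∪ t) := by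
  rw [← Finset.sum_product']
  refine Finset.sum_bij' (fun M _ => (M \ s, M ∩ s)) (fun p _ => p.1 ∪ p.2) ?_ ?_ ?_ ?_ ?_
  · intro M hM
    rw [Finset.mem_powerset] at hM
    simp only [Finset.mem_product, Finset.mem_powerset]
    exact ⟨Finset.sdiff_subset_sdiff hM le_rfl, Finset.inter_subset_right⟩
  · intro p hp
    simp only [Finset.mem_product, Finset.mem_powerset] at hp ⊢
    exact Finset.union_subset (hp.1.trans Finset.sdiff_subset) (hp.2.trans hs)
  · intro M _
    exact Finset.sdiff_union_inter M s
  · rintro ⟨A, t⟩ hp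
    simp only [Finset.mem_product, Finset.mem_powerset, Finset.subset_iff, Finset.mem_sdiff] at hp
    ext x
    · have := @hp.1 x; have := @hp.2 x; simp; tauto
    · have := @hp.1 x; have := @hp.2 x; simp; tauto
  · intro M _
    rw [Finset.sdiff_union_inter]

lemma sum_Icc_neg_one_pow (L M : Finset ℕ) :
    ∑ D ∈ Finset.Icc L M, (-1 : ℝ) ^ D.card = if L = M then (-1) ^ L.card else 0 := by
  by_cases h : L ⊆ M
  · rw [Finset.Icc_eq_image_powerset h, Finset.sum_image]
    · have h1 : ∀ D ∈ (M \ L).powerset, (-1 : ℝ) ^ (L ∪ D).card = (-1) ^ L.card * (-1) ^ D.card :=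
        fun D hD => by
          rw [Finset.card_union_of_disjoint, pow_add]
          exact Finset.disjoint_of_subset_right (Finset.mem_powerset.1 hD) Finset.disjoint_sdiff
      rw [Finset.sum_congr rfl h1, ← Finset.mul_sum]
      have h2 := congrArg (Int.cast : ℤ → ℝ) (Finset.sum_powerset_neg_one_pow_card (x := M \ L))
      push_cast at h2
      rw [h2]
      simp only [Finset.sdiff_eq_empty_iff_subset]
      by_cases h3 : M ⊆ L
      · rw [if_pos h3, if_pos (h.antisymm h3), mul_one]
      · rw [if_neg h3, if_neg fun h4 => h3 h4.symm.subset, mul_zero]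
    · intro A hA B hB hAB
      have hA' := Finset.mem_powerset.1 hA
      have hB' := Finset.mem_powerset.1 hB
      have hc : ∀ C : Finset ℕ, C ⊆ M \ L → (L ∪ C) \ L = C := fun C hC => by
        rw [Finset.union_sdiff_left, Finset.sdiff_eq_self_of_disjoint]
        exact Finset.disjoint_of_subset_left hC Finset.sdiff_disjoint
      rw [← hc A hA', ← hc B hB']
      exact congrArg (· \ L) hAB
  · rw [Finset.Icc_eq_empty h, Finset.sum_empty, if_neg fun h' => h h'.subset]

/-- The multiplicative function with value `1 / (p - 1)` at primes. -/
noncomputable def hw (L : Finset ℕ) : ℝ := ∏ p ∈ L, ((p : ℝ) - 1)⁻¹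

/-- Truncation of `hw` to products at most `R`. -/
noncomputable def sel (R : ℕ) (L : Finset ℕ) : ℝ := if ∏ p ∈ L, p ≤ R then hw L else 0

/-- Total Selberg mass. -/
noncomputable def mass (P : Finset ℕ) (R : ℕ) : ℝ := ∑ L ∈ P.powerset, sel R L

/-- Unnormalised Selberg weights. -/
noncomputable def lam (P : Finset ℕ) (R : ℕ) (D : Finset ℕ) : ℝ :=
  (-1) ^ D.card * (∏ p ∈ D, (p : ℝ)) * ∑ M ∈ P.powerset with D ⊆ M, sel R M

/-- Selberg's quadratic form with prescribed divisibility on `s`. -/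
noncomputable def quad (P : Finset ℕ) (R : ℕ) (s e e' : Finset ℕ) : ℝ :=
  ∑ D ∈ (P \ s).powerset, ∑ D' ∈ (P \ s).powerset,
    lam P R (D ∪ e) * lam P R (D' ∪ e') * ∏ p ∈ D ∪ D', (p : ℝ)⁻¹

variable (hP : ∀ p ∈ P, 2 ≤ p)
include hP

lemma hw_nonneg {L : Finset ℕ} (hL : L ⊆ P) : 0 ≤ hw L := Finset.prod_nonneg fun p hp => by
  have : (2 : ℝ) ≤ p := by exact_mod_cast hP p (hL hp)
  exact inv_nonneg.2 (by linarith)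

lemma sel_nonneg {L : Finset ℕ} (hL : L ⊆ P) : 0 ≤ sel R L := by
  unfold sel
  split_ifs
  · exact hw_nonneg hP hL
  · exact le_rfl

lemma mass_nonneg : 0 ≤ mass P R := Finset.sum_nonneg fun _ hL => sel_nonneg hP (Finset.mem_powerset.1 hL)

lemma sel_union_le {L t : Finset ℕ} (hL : L ⊆ P) (ht : t ⊆ P) (hd : Disjoint L t) :
    sel R (L ∪ t) ≤ sel R L * hw t := by
  unfold sel
  rw [Finset.prod_union hd, hw, Finset.prod_union hd]
  have h1 : 1 ≤ ∏ p ∈ t, p := Finset.one_le_prod' fun p hp => by have := hP p (ht hp); omega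
  split_ifs with h2 h3 h3
  · exact le_rfl
  · exact absurd ((Nat.le_mul_of_pos_right _ h1).trans h2) h3
  · exact mul_nonneg (hw_nonneg hP hL) (hw_nonneg hP ht)
  · simp

lemma one_le_mass (hR : 1 ≤ R) : 1 ≤ mass P R :=
  (show (1 : ℝ) = sel R ∅ by simp [sel, hw, hR]).trans_le
    (Finset.single_le_sum (f := sel R) (fun _ hL => sel_nonneg hP (Finset.mem_powerset.1 hL))
      (Finset.empty_mem_powerset P))

omit hP in
lemma lam_empty : lam P R ∅ = mass P R := by simp [lam, mass]

lemma sum_lam {e L : Finset ℕ} (hs : s ⊆ P) (he : e ⊆ s) (hL : L ⊆ P \ s) :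
    ∑ D ∈ (P \ s).powerset with L ⊆ D, lam P R (D ∪ e) * ∏ p ∈ D, (p : ℝ)⁻¹ =
      (-1) ^ (L.card + e.card) * (∏ p ∈ e, (p : ℝ)) * ∑ t ∈ s.powerset with e ⊆ t, sel R (L ∪ t) := by
  have h1 : ∀ D ∈ (P \ s).powerset, lam P R (D ∪ e) * ∏ p ∈ D, (p : ℝ)⁻¹ =
      ∑ M ∈ (P \ s).powerset, ∑ t ∈ s.powerset with e ⊆ t,
        (-1) ^ e.card * (∏ p ∈ e, (p : ℝ)) * sel R (M ∪ t) *
          if D ⊆ M then (-1) ^ D.card else 0 := by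
    intro D hD
    rw [Finset.mem_powerset] at hD
    have hDe : Disjoint D e := Finset.disjoint_of_subset_right he
      (Finset.disjoint_of_subset_left hD Finset.sdiff_disjoint)
    have hD1 : (∏ p ∈ D, (p : ℝ)) * ∏ p ∈ D, (p : ℝ)⁻¹ = 1 := by
      rw [← Finset.prod_mul_distrib]
      refine Finset.prod_eq_one fun p hp => mul_inv_cancel₀ ?_
      have := hP p (Finset.sdiff_subset (hD hp))
      positivity
    rw [lam, Finset.card_union_of_disjoint hDe, Finset.prod_union hDe, pow_add, Finset.sum_filter,
      sum_powerset_split hs, mul_comm, Finset.mul_sum, Finset.mul_sum]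
    refine Finset.sum_congr rfl fun M hM => ?_
    rw [Finset.mul_sum, Finset.mul_sum, Finset.sum_filter]
    refine Finset.sum_congr rfl fun t ht => ?_
    rw [Finset.mem_powerset] at hM ht
    have hiff : D ∪ e ⊆ M ∪ t ↔ e ⊆ t ∧ D ⊆ M := by
      simp only [Finset.subset_iff, Finset.mem_sdiff, Finset.mem_union] at *
      constructor
      · intro h
        exact ⟨fun x hx => (h (.inr hx)).resolve_left fun h' => (hM h').2 (he hx),
          fun x hx => (h (.inl hx)).resolve_right fun h' => (hD hx).2 (ht h')⟩
      · rintro ⟨h, h'⟩ x (hx | hx)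
        · exact .inl (h' hx)
        · exact .inr (h hx)
    simp only [hiff]
    by_cases h2 : e ⊆ t <;> by_cases h3 : D ⊆ M <;> simp only [h2, h3, and_self, and_true, and_false,
      if_true, if_false, mul_zero]
    linear_combination ((-1) ^ D.card * (-1) ^ e.card * (∏ p ∈ e, (p : ℝ)) * sel R (M ∪ t)) * hD1
  rw [Finset.sum_congr rfl fun D hD => h1 D (Finset.mem_filter.1 hD).1, Finset.sum_comm,
    Finset.sum_eq_single L]
  · rw [Finset.sum_comm, Finset.mul_sum]
    refine Finset.sum_congr rfl fun t _ => ?_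
    rw [← Finset.mul_sum, Finset.sum_eq_single L]
    · rw [if_pos le_rfl]; ring
    · intro D hD hDL
      exact if_neg fun h => hDL (h.antisymm (Finset.mem_filter.1 hD).2)
    · exact fun h => absurd (Finset.mem_filter.2 ⟨Finset.mem_powerset.2 hL, le_rfl⟩) h
  · intro M hM hML
    rw [Finset.sum_comm]
    refine Finset.sum_eq_zero fun t _ => ?_
    rw [← Finset.mul_sum, ← Finset.sum_filter, Finset.filter_filter]
    have : (P \ s).powerset.filter (fun D => L ⊆ D ∧ D ⊆ M) = Finset.Icc L M := by
      ext D
      simp only [Finset.mem_filter, Finset.mem_powerset, Finset.mem_Icc, Finset.le_eq_subset]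
      exact ⟨fun h => h.2, fun h => ⟨h.2.trans (Finset.mem_powerset.1 hM), h⟩⟩
    rw [this, sum_Icc_neg_one_pow, if_neg hML.symm, mul_zero]
  · exact fun h => absurd (Finset.mem_powerset.2 hL) h

lemma abs_sum_lam_le {e L : Finset ℕ} (hs : s ⊆ P) (he : e ⊆ s) (hL : L ⊆ P \ s) :
    |∑ D ∈ (P \ s).powerset with L ⊆ D, lam P R (D ∪ e) * ∏ p ∈ D, (p : ℝ)⁻¹| ≤
      sel R L * 2 ^ s.card := by
  have hLP := hL.trans Finset.sdiff_subset
  have hprod : (0 : ℝ) ≤ ∏ p ∈ e, (p : ℝ) := Finset.prod_nonneg fun _ _ => by positivity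
  have hdisj : ∀ t ⊆ s, Disjoint L t := fun t ht => Finset.disjoint_of_subset_right ht
    (Finset.disjoint_of_subset_left hL Finset.sdiff_disjoint)
  rw [sum_lam hP hs he hL, abs_mul, abs_mul, abs_pow, abs_neg, abs_one, one_pow, one_mul,
    abs_of_nonneg hprod, abs_of_nonneg (Finset.sum_nonneg fun t ht => sel_nonneg hP
      (Finset.union_subset hLP ((Finset.mem_powerset.1 (Finset.mem_filter.1 ht).1).trans hs)))]
  have hsel := sel_nonneg (R := R) hP hLP
  have h1 : ∑ t ∈ s.powerset with e ⊆ t, sel R (L ∪ t) ≤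
      sel R L * (hw e * ∏ p ∈ s \ e, (1 + ((p : ℝ) - 1)⁻¹)) := by
    rw [Finset.prod_one_add, Finset.mul_sum, Finset.mul_sum]
    refine (Finset.sum_le_sum fun t ht => sel_union_le (t := t) hP hLP
      ((Finset.mem_powerset.1 (Finset.mem_filter.1 ht).1).trans hs)
      (hdisj t (Finset.mem_powerset.1 (Finset.mem_filter.1 ht).1))).trans (le_of_eq ?_)
    refine Finset.sum_bij' (fun t _ => t \ e) (fun t _ => e ∪ t) ?_ ?_ ?_ ?_ ?_
    · intro t ht
      simp only [Finset.mem_filter, Finset.mem_powerset] at ht ⊢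
      exact Finset.sdiff_subset_sdiff ht.1 le_rfl
    · intro t ht
      simp only [Finset.mem_filter, Finset.mem_powerset] at ht ⊢
      exact ⟨Finset.union_subset he (ht.trans Finset.sdiff_subset), Finset.subset_union_left⟩
    · intro t ht
      exact Finset.union_sdiff_of_subset (Finset.mem_filter.1 ht).2
    · intro t ht
      rw [Finset.mem_powerset] at ht
      rw [Finset.union_sdiff_left, Finset.sdiff_eq_self_of_disjoint]
      exact Finset.disjoint_of_subset_left ht Finset.sdiff_disjoint
    · intro t ht
      rw [hw, hw, mul_comm (∏ p ∈ e, _), ← Finset.prod_sdiff (Finset.mem_filter.1 ht).2]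
  have h2 : (∏ p ∈ e, (p : ℝ)) * (hw e * ∏ p ∈ s \ e, (1 + ((p : ℝ) - 1)⁻¹)) ≤ 2 ^ s.card := by
    rw [hw, ← mul_assoc, ← Finset.prod_mul_distrib, mul_comm, ← Finset.prod_const,
      ← Finset.prod_sdiff he]
    have hb : ∀ p ∈ s, (0 : ℝ) ≤ ((p : ℝ) - 1)⁻¹ ∧ ((p : ℝ) - 1)⁻¹ ≤ 1 ∧
        (p : ℝ) * ((p : ℝ) - 1)⁻¹ ≤ 2 := fun p hp => by
      have : (2 : ℝ) ≤ p := by exact_mod_cast hP p (hs hp)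
      refine ⟨inv_nonneg.2 (by linarith), inv_le_one_of_one_le₀ (by linarith), ?_⟩
      rw [← div_eq_mul_inv, div_le_iff₀ (by linarith)]
      linarith
    refine mul_le_mul (Finset.prod_le_prod ?_ ?_) (Finset.prod_le_prod ?_ ?_)
      (Finset.prod_nonneg ?_) (Finset.prod_nonneg fun _ _ => by norm_num)
    · exact fun p hp => by linarith [(hb p (Finset.sdiff_subset hp)).1]
    · exact fun p hp => by linarith [(hb p (Finset.sdiff_subset hp)).2.1]
    · exact fun p hp => mul_nonneg (by positivity) (hb p (he hp)).1
    · exact fun p hp => (hb p (he hp)).2.2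
    · exact fun p hp => mul_nonneg (by positivity) (hb p (he hp)).1
  calc _ ≤ (∏ p ∈ e, (p : ℝ)) * (sel R L * (hw e * ∏ p ∈ s \ e, (1 + ((p : ℝ) - 1)⁻¹))) := by gcongr
    _ = sel R L * ((∏ p ∈ e, (p : ℝ)) * (hw e * ∏ p ∈ s \ e, (1 + ((p : ℝ) - 1)⁻¹))) := by ring
    _ ≤ _ := by gcongr

lemma quad_eq {e e' : Finset ℕ} : quad P R s e e' = ∑ L ∈ (P \ s).powerset,
    (∏ p ∈ L, ((p : ℝ) - 1)) *
      ((∑ D ∈ (P \ s).powerset with L ⊆ D, lam P R (D ∪ e) * ∏ p ∈ D, (p : ℝ)⁻¹) *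
        ∑ D ∈ (P \ s).powerset with L ⊆ D, lam P R (D ∪ e') * ∏ p ∈ D, (p : ℝ)⁻¹) := by
  simp only [Finset.sum_filter, Finset.sum_mul_sum]
  simp only [Finset.mul_sum]
  rw [quad]
  conv_rhs => rw [Finset.sum_comm]
  refine Finset.sum_congr rfl fun D hD => ?_
  conv_rhs => rw [Finset.sum_comm]
  refine Finset.sum_congr rfl fun D' hD' => ?_
  rw [Finset.mem_powerset] at hD hD'
  have h0 : ∀ p ∈ P \ s, (p : ℝ) ≠ 0 := fun p hp => by
    have := hP p (Finset.sdiff_subset hp); positivity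
  have h1 : (∏ p ∈ D, (p : ℝ)⁻¹) * ∏ p ∈ D', (p : ℝ)⁻¹ =
      (∏ p ∈ D ∪ D', (p : ℝ)⁻¹) * ∏ p ∈ D ∩ D', (p : ℝ)⁻¹ := Finset.prod_union_inter.symm
  have h2 : (∏ p ∈ D ∩ D', (p : ℝ)⁻¹) * ∏ p ∈ D ∩ D', (1 + ((p : ℝ) - 1)) = 1 := by
    rw [← Finset.prod_mul_distrib]
    refine Finset.prod_eq_one fun p hp => ?_
    rw [add_sub_cancel, inv_mul_cancel₀ (h0 p (hD (Finset.mem_inter.1 hp).1))]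
  have h3 : ∏ p ∈ D ∩ D', (1 + ((p : ℝ) - 1)) =
      ∑ L ∈ (P \ s).powerset, if L ⊆ D ∧ L ⊆ D' then ∏ p ∈ L, ((p : ℝ) - 1) else 0 := by
    rw [Finset.prod_one_add, ← Finset.sum_filter]
    refine Finset.sum_congr ?_ fun _ _ => rfl
    ext L
    simp only [Finset.mem_powerset, Finset.mem_filter, Finset.subset_inter_iff]
    exact ⟨fun h => ⟨h.1.trans hD, h⟩, fun h => h.2⟩
  calc _ = lam P R (D ∪ e) * lam P R (D' ∪ e') * ((∏ p ∈ D, (p : ℝ)⁻¹) * ∏ p ∈ D', (p : ℝ)⁻¹) *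
        ∏ p ∈ D ∩ D', (1 + ((p : ℝ) - 1)) := by
        rw [h1]; linear_combination -(lam P R (D ∪ e) * lam P R (D' ∪ e') *
          ∏ p ∈ D ∪ D', (p : ℝ)⁻¹) * h2
    _ = _ := by
        rw [h3, Finset.mul_sum]
        refine Finset.sum_congr rfl fun L _ => ?_
        by_cases h4 : L ⊆ D <;> by_cases h5 : L ⊆ D' <;> simp [h4, h5]
        ring

lemma prod_mul_sq_sel {L : Finset ℕ} (hL : L ⊆ P) :
    (∏ p ∈ L, ((p : ℝ) - 1)) * (sel R L * sel R L) = sel R L := by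
  unfold sel
  split_ifs
  · rw [← mul_assoc]
    nth_rewrite 1 [hw]
    rw [← Finset.prod_mul_distrib, Finset.prod_eq_one, one_mul]
    intro p hp
    have : (2 : ℝ) ≤ p := by exact_mod_cast hP p (hL hp)
    exact mul_inv_cancel₀ (by linarith)
  · simp

theorem abs_quad_le {e e' : Finset ℕ} (hs : s ⊆ P) (he : e ⊆ s) (he' : e' ⊆ s) :
    |quad P R s e e'| ≤ 4 ^ s.card * mass P R := by
  rw [quad_eq hP]
  refine (Finset.abs_sum_le_sum_abs _ _).trans ?_
  calc _ ≤ ∑ L ∈ (P \ s).powerset, 4 ^ s.card * sel R L := by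
        refine Finset.sum_le_sum fun L hL => ?_
        have hL' := Finset.mem_powerset.1 hL
        have hLP := hL'.trans Finset.sdiff_subset
        have h0 : 0 ≤ ∏ p ∈ L, ((p : ℝ) - 1) := Finset.prod_nonneg fun p hp => by
          have : (2 : ℝ) ≤ p := by exact_mod_cast hP p (hLP hp)
          linarith
        have hsel := sel_nonneg (R := R) hP hLP
        rw [abs_mul, abs_mul, abs_of_nonneg h0]
        calc _ ≤ (∏ p ∈ L, ((p : ℝ) - 1)) * ((sel R L * 2 ^ s.card) * (sel R L * 2 ^ s.card)) := by
              gcongr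
              · exact abs_sum_lam_le hP hs he hL'
              · exact abs_sum_lam_le hP hs he' hL'
          _ = 4 ^ s.card * ((∏ p ∈ L, ((p : ℝ) - 1)) * (sel R L * sel R L)) := by
              rw [show (4 : ℝ) = 2 * 2 by norm_num, mul_pow]; ring
          _ = _ := by rw [prod_mul_sq_sel hP hLP]
    _ ≤ _ := by
        rw [← Finset.mul_sum, mass]
        exact mul_le_mul_of_nonneg_left (Finset.sum_le_sum_of_subset_of_nonneg
          (Finset.powerset_mono.2 Finset.sdiff_subset) fun L hL _ =>
            sel_nonneg hP (Finset.mem_powerset.1 hL)) (by positivity)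

theorem quad_empty : quad P R ∅ ∅ ∅ = mass P R := by
  rw [quad_eq hP, Finset.sdiff_empty, mass]
  refine Finset.sum_congr rfl fun L hL => ?_
  have hL' := Finset.mem_powerset.1 hL
  have h := sum_lam (R := R) hP (Finset.empty_subset P) (Finset.Subset.refl ∅) (by simpa using hL')
  rw [Finset.sdiff_empty] at h
  rw [h]
  simp only [Finset.powerset_empty, Finset.prod_empty, mul_one, Finset.card_empty, add_zero,
    Finset.filter_singleton, Finset.subset_empty, if_true, Finset.sum_singleton, Finset.union_empty]
  have hsq := prod_mul_sq_sel (R := R) hP hL'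
  have : ((-1 : ℝ) ^ L.card) * (-1) ^ L.card = 1 := by rw [← mul_pow]; simp
  linear_combination ((∏ p ∈ L, ((p : ℝ) - 1)) * (sel R L * sel R L)) * this + hsq

end Selberg

section Correlation
variable {ι : Type*} [Fintype ι] [DecidableEq ι] {P s : Finset ℕ} {R : ℕ}

/-- Pairs of subsets of `P` indexed by `ι`. -/
def fam (ι : Type*) [Fintype ι] [DecidableEq ι] (P : Finset ℕ) : Finset (ι → Finset ℕ × Finset ℕ) :=
  Fintype.piFinset fun _ => P.powerset ×ˢ P.powerset

/-- The indices whose members contain `p`. -/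
def hits (c : ι → Finset ℕ × Finset ℕ) (p : ℕ) : Finset ι := {i | p ∈ (c i).1 ∪ (c i).2}

lemma mem_fam {c : ι → Finset ℕ × Finset ℕ} :
    c ∈ fam ι P ↔ ∀ i, (c i).1 ⊆ P ∧ (c i).2 ⊆ P := by
  simp [fam]

lemma sum_fam_split (hs : s ⊆ P) (F : (ι → Finset ℕ × Finset ℕ) → ℝ) :
    ∑ c ∈ fam ι P, F c = ∑ e ∈ fam ι s, ∑ d ∈ fam ι (P \ s), F (d ⊔ e) := by
  rw [← Finset.sum_product' (f := fun e d => F (d ⊔ e))]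
  refine Finset.sum_bij' (fun c _ => (fun i => ((c i).1 ∩ s, (c i).2 ∩ s),
    fun i => ((c i).1 \ s, (c i).2 \ s))) (fun q _ => q.2 ⊔ q.1) ?_ ?_ ?_ ?_ ?_
  · intro c hc
    rw [mem_fam] at hc
    simp only [Finset.mem_product, mem_fam]
    exact ⟨fun i => ⟨Finset.inter_subset_right, Finset.inter_subset_right⟩, fun i =>
      ⟨Finset.sdiff_subset_sdiff (hc i).1 le_rfl, Finset.sdiff_subset_sdiff (hc i).2 le_rfl⟩⟩
  · intro q hq
    simp only [Finset.mem_product, mem_fam] at hq ⊢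
    exact fun i => ⟨Finset.union_subset ((hq.2 i).1.trans Finset.sdiff_subset) ((hq.1 i).1.trans hs),
      Finset.union_subset ((hq.2 i).2.trans Finset.sdiff_subset) ((hq.1 i).2.trans hs)⟩
  · intro c _
    funext i
    exact Prod.ext (Finset.sdiff_union_inter _ s) (Finset.sdiff_union_inter _ s)
  · rintro ⟨e, d⟩ hq
    simp only [Finset.mem_product, mem_fam] at hq
    have key : ∀ A B : Finset ℕ, A ⊆ s → B ⊆ P \ s → (B ∪ A) ∩ s = A ∧ (B ∪ A) \ s = B := by
      intro A B hA hB
      have := fun x => @hA x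
      simp only [Finset.subset_iff, Finset.mem_sdiff] at hB
      constructor <;> ext x <;> have := @hA x <;> have := @hB x <;> simp <;> tauto
    refine Prod.ext (funext fun i => Prod.ext ?_ ?_) (funext fun i => Prod.ext ?_ ?_)
    · exact (key _ _ (hq.1 i).1 (hq.2 i).1).1
    · exact (key _ _ (hq.1 i).2 (hq.2 i).2).1
    · exact (key _ _ (hq.1 i).1 (hq.2 i).1).2
    · exact (key _ _ (hq.1 i).2 (hq.2 i).2).2
  · intro c _
    congr 1
    funext i
    exact Prod.ext (Finset.sdiff_union_inter _ s).symm (Finset.sdiff_union_inter _ s).symm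

lemma hits_sup_of_mem {d e : ι → Finset ℕ × Finset ℕ} (hd : d ∈ fam ι (P \ s)) {p : ℕ} (hp : p ∈ s) :
    hits (d ⊔ e) p = hits e p := by
  rw [mem_fam] at hd
  ext i
  have h1 := fun h => (Finset.mem_sdiff.1 ((hd i).1 h)).2 hp
  have h2 := fun h => (Finset.mem_sdiff.1 ((hd i).2 h)).2 hp
  simp only [hits, Finset.mem_filter, Pi.sup_apply, Prod.fst_sup, Prod.snd_sup, Finset.sup_eq_union,
    Finset.mem_union]
  tauto

lemma hits_sup_of_notMem {d e : ι → Finset ℕ × Finset ℕ} (he : e ∈ fam ι s) {p : ℕ} (hp : p ∉ s) :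
    hits (d ⊔ e) p = hits d p := by
  rw [mem_fam] at he
  ext i
  have h1 := fun h => hp ((he i).1 h)
  have h2 := fun h => hp ((he i).2 h)
  simp only [hits, Finset.mem_filter, Pi.sup_apply, Prod.fst_sup, Prod.snd_sup, Finset.sup_eq_union,
    Finset.mem_union]
  tauto

lemma prod_pow_hits {c : ι → Finset ℕ × Finset ℕ} (hc : c ∈ fam ι P) :
    ∏ p ∈ P, (p : ℝ)⁻¹ ^ (hits c p).card = ∏ i, ∏ p ∈ (c i).1 ∪ (c i).2, (p : ℝ)⁻¹ := by
  rw [mem_fam] at hc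
  have h1 : ∀ i, ∏ p ∈ (c i).1 ∪ (c i).2, (p : ℝ)⁻¹ =
      ∏ p ∈ P, if p ∈ (c i).1 ∪ (c i).2 then (p : ℝ)⁻¹ else 1 := fun i => by
    rw [Finset.prod_ite_mem, Finset.inter_eq_right.2 (Finset.union_subset (hc i).1 (hc i).2)]
  rw [Finset.prod_congr rfl fun i _ => h1 i, Finset.prod_comm]
  refine Finset.prod_congr rfl fun p _ => ?_
  rw [← Finset.prod_filter, Finset.prod_const]
  rfl

lemma sum_fam_lam (e : ι → Finset ℕ × Finset ℕ) :
    ∑ d ∈ fam ι (P \ s), (∏ i, lam P R ((d ⊔ e) i).1 * lam P R ((d ⊔ e) i).2) *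
      ∏ p ∈ P \ s, (p : ℝ)⁻¹ ^ (hits d p).card = ∏ i, quad P R s (e i).1 (e i).2 := by
  simp only [quad]
  have h : ∀ i, ∑ D ∈ (P \ s).powerset, ∑ D' ∈ (P \ s).powerset,
      lam P R (D ∪ (e i).1) * lam P R (D' ∪ (e i).2) * ∏ p ∈ D ∪ D', (p : ℝ)⁻¹ =
      ∑ q ∈ (P \ s).powerset ×ˢ (P \ s).powerset,
      lam P R (q.1 ∪ (e i).1) * lam P R (q.2 ∪ (e i).2) * ∏ p ∈ q.1 ∪ q.2, (p : ℝ)⁻¹ := fun i => by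
    rw [Finset.sum_product]
  rw [Finset.prod_congr rfl fun i _ => h i, Finset.prod_univ_sum]
  refine Finset.sum_congr rfl fun d hd => ?_
  rw [prod_pow_hits hd, ← Finset.prod_mul_distrib]
  rfl

theorem abs_sum_fam_sub_le (hP : ∀ p ∈ P, 2 ≤ p) {δ : ℕ → Finset ι → ℝ} {ε : ℕ → ℝ}
    (hδ : ∀ p ∈ P, ∀ A, |δ p A| ≤ ε p) :
    |∑ c ∈ fam ι P, (∏ i, lam P R (c i).1 * lam P R (c i).2) *
      ∏ p ∈ P, (δ p (hits c p) + (p : ℝ)⁻¹ ^ (hits c p).card) - mass P R ^ Fintype.card ι| ≤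
      mass P R ^ Fintype.card ι * (∏ p ∈ P, (1 + 16 ^ Fintype.card ι * ε p) - 1) := by
  set k := Fintype.card ι
  set G := mass P R
  have hG : 0 ≤ G := mass_nonneg hP
  set T : Finset ℕ → ℝ := fun s => ∑ e ∈ fam ι s, (∏ p ∈ s, δ p (hits e p)) *
    ∏ i, quad P R s (e i).1 (e i).2
  have h1 : ∑ c ∈ fam ι P, (∏ i, lam P R (c i).1 * lam P R (c i).2) *
      ∏ p ∈ P, (δ p (hits c p) + (p : ℝ)⁻¹ ^ (hits c p).card) = ∑ s ∈ P.powerset, T s := by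
    simp only [Finset.prod_add, Finset.mul_sum]
    rw [Finset.sum_comm]
    refine Finset.sum_congr rfl fun s hs => ?_
    rw [sum_fam_split (Finset.mem_powerset.1 hs)]
    refine Finset.sum_congr rfl fun e he => ?_
    rw [← sum_fam_lam, Finset.mul_sum]
    refine Finset.sum_congr rfl fun d hd => ?_
    have e1 : ∏ p ∈ s, δ p (hits (d ⊔ e) p) = ∏ p ∈ s, δ p (hits e p) :=
      Finset.prod_congr rfl fun p hp => by rw [hits_sup_of_mem hd hp]
    have e2 : ∏ p ∈ P \ s, (p : ℝ)⁻¹ ^ (hits (d ⊔ e) p).card =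
        ∏ p ∈ P \ s, (p : ℝ)⁻¹ ^ (hits d p).card := Finset.prod_congr rfl fun p hp => by
      rw [hits_sup_of_notMem he (Finset.mem_sdiff.1 hp).2]
    rw [e1, e2]
    ring
  have h0 : T ∅ = G ^ k := by
    have : fam ι ∅ = {fun _ => (∅, ∅)} := by
      ext c
      simp only [mem_fam, Finset.subset_empty, Finset.mem_singleton, funext_iff, Prod.ext_iff]
    simp only [T, this, Finset.sum_singleton, Finset.prod_empty, one_mul, quad_empty hP,
      Finset.prod_const, Finset.card_univ, G, k]
  have h2 : ∀ s ∈ P.powerset, |T s| ≤ G ^ k * ∏ p ∈ s, (16 ^ k * ε p) := by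
    intro s hs
    rw [Finset.mem_powerset] at hs
    have hcard : ((fam ι s).card : ℝ) = (4 ^ s.card) ^ k := by
      rw [fam, Fintype.card_piFinset, Finset.prod_const, Finset.card_product, Finset.card_powerset,
        Finset.card_univ, show (4 : ℝ) = 2 * 2 by norm_num, mul_pow, mul_pow]
      push_cast
      rw [mul_pow]
    calc |T s| ≤ ∑ e ∈ fam ι s, (∏ p ∈ s, ε p) * (4 ^ s.card * G) ^ k := by
          refine (Finset.abs_sum_le_sum_abs _ _).trans (Finset.sum_le_sum fun e he => ?_)
          rw [mem_fam] at he
          rw [abs_mul, Finset.abs_prod, Finset.abs_prod]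
          refine mul_le_mul (Finset.prod_le_prod (fun _ _ => abs_nonneg _) fun p hp => hδ p (hs hp) _)
            ?_ (Finset.prod_nonneg fun _ _ => abs_nonneg _)
            (Finset.prod_nonneg fun p hp => (abs_nonneg _).trans (hδ p (hs hp) ∅))
          rw [show k = (Finset.univ : Finset ι).card from rfl, ← Finset.prod_const]
          exact Finset.prod_le_prod (fun _ _ => abs_nonneg _) fun i _ =>
            abs_quad_le hP hs (he i).1 (he i).2
      _ = _ := by
          rw [Finset.sum_const, nsmul_eq_mul, hcard, Finset.prod_mul_distrib, Finset.prod_const,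
            show (16 : ℝ) = 4 * 4 by norm_num, mul_pow, mul_pow, mul_pow, ← pow_mul, ← pow_mul,
            mul_comm k]
          ring
  rw [h1, ← Finset.add_sum_erase _ _ (Finset.empty_mem_powerset P), h0, add_sub_cancel_left,
    Finset.prod_one_add, ← Finset.add_sum_erase _ _ (Finset.empty_mem_powerset P), Finset.prod_empty,
    add_sub_cancel_left, Finset.mul_sum]
  exact (Finset.abs_sum_le_sum_abs _ _).trans
    (Finset.sum_le_sum fun s hs => h2 s (Finset.mem_of_mem_erase hs))

end Correlation

section Counting
variable {ι : Type*} [Fintype ι] [DecidableEq ι] {P : Finset ℕ} {R N : ℕ} {W b : ℤ} {t : ι → ℤ}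

open Classical in
/-- Density of integers `x` with `p ∣ W (x + t i) + b` for `i ∈ A`, for `p` prime to `W`. -/
noncomputable def locdens (W b : ℤ) (t : ι → ℤ) (p : ℕ) (A : Finset ι) : ℝ :=
  if A = ∅ then 1 else if ∃ x : ℤ, ∀ i ∈ A, (p : ℤ) ∣ W * (x + t i) + b then (p : ℝ)⁻¹ else 0

/-- The product of all differences of the shifts. -/
def discr (t : ι → ℤ) : ℕ := ∏ x ∈ (Finset.univ : Finset ι).offDiag, (t x.1 - t x.2).natAbs

lemma abs_card_modEq_sub_le {q : ℕ} (hq : 0 < q) (v : ℕ) :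
    |(((Finset.range N).filter (· ≡ v [MOD q])).card : ℝ) - N * (q : ℝ)⁻¹| ≤ 1 := by
  have hq' : (0 : ℝ) < q := by exact_mod_cast hq
  rw [← Nat.count_eq_card_filter_range, Nat.count_modEq_card _ hq]
  have h1 : (N : ℝ) * (q : ℝ)⁻¹ = (N / q : ℕ) + ((N % q : ℕ) : ℝ) * (q : ℝ)⁻¹ := by
    have : (q : ℝ) * (N / q : ℕ) + (N % q : ℕ) = N := by exact_mod_cast Nat.div_add_mod N q
    rw [← this]; field_simp
  have h2 : ((N % q : ℕ) : ℝ) * (q : ℝ)⁻¹ ≤ 1 := by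
    rw [← div_eq_mul_inv, div_le_one hq']
    exact_mod_cast (Nat.mod_lt N hq).le
  have h3 : 0 ≤ ((N % q : ℕ) : ℝ) * (q : ℝ)⁻¹ := by positivity
  rw [h1, abs_le]
  push_cast
  split_ifs <;> constructor <;> push_cast <;> linarith

lemma dvd_iff_of_coprime {p : ℕ} (hW : IsCoprime (p : ℤ) W) {x y s : ℤ} (hx : (p : ℤ) ∣ W * (x + s) + b) :
    (p : ℤ) ∣ W * (y + s) + b ↔ (p : ℤ) ∣ y - x := by
  rw [show W * (y + s) + b = W * (y - x) + (W * (x + s) + b) by ring, dvd_add_left hx]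
  exact ⟨hW.dvd_of_dvd_mul_left, fun h => h.mul_left _⟩

lemma abs_card_sub_le (hP : ∀ p ∈ P, p.Prime ∧ IsCoprime (p : ℤ) W)
    {c : ι → Finset ℕ × Finset ℕ} (hc : c ∈ fam ι P) :
    |(((Finset.range N).filter fun n : ℕ => ∀ i, ∀ p ∈ (c i).1 ∪ (c i).2,
      (p : ℤ) ∣ W * (n + t i) + b).card : ℝ) - N * ∏ p ∈ P, locdens W b t p (hits c p)| ≤ 1 := by
  classical
  rw [mem_fam] at hc
  have hmem : ∀ i p, p ∈ (c i).1 ∪ (c i).2 ↔ i ∈ hits c p := fun i p => by simp [hits]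
  have hcP : ∀ i p, i ∈ hits c p → p ∈ P := fun i p h =>
    Finset.union_subset (hc i).1 (hc i).2 ((hmem i p).2 h)
  by_cases hsol : ∀ p ∈ P, ∃ x : ℤ, ∀ i ∈ hits c p, (p : ℤ) ∣ W * (x + t i) + b
  · set U := P.filter fun p => hits c p ≠ ∅
    choose! v hv using hsol
    have hprime : ∀ p ∈ U, p.Prime := fun p hp => (hP p (Finset.mem_filter.1 hp).1).1
    have hcop : (U : Set ℕ).Pairwise (Function.onFun Nat.Coprime fun p => p) := fun p hp q hq hpq =>
      (Nat.coprime_primes (hprime p hp) (hprime q hq)).2 hpq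
    obtain ⟨n₀, hn₀⟩ := Nat.chineseRemainderOfFinset (fun p => (v p % p).toNat) (fun p => p) U
      (fun p hp => (hprime p hp).ne_zero) hcop
    have hn₀' : ∀ p ∈ U, (p : ℤ) ∣ n₀ - v p := fun p hp => by
      have h1 := (Nat.modEq_iff_dvd.1 (hn₀ p hp).symm)
      have hp0 : (p : ℤ) ≠ 0 := by exact_mod_cast (hprime p hp).ne_zero
      rw [Int.toNat_of_nonneg (Int.emod_nonneg _ hp0)] at h1
      have h2 : (p : ℤ) ∣ v p % p - v p := (Int.modEq_iff_dvd.1 (Int.mod_modEq (v p) p).symm)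
      simpa using h1.add h2
    have hdens : ∏ p ∈ P, locdens W b t p (hits c p) = ((∏ p ∈ U, p : ℕ) : ℝ)⁻¹ := by
      push_cast
      rw [← Finset.prod_inv_distrib, Finset.prod_filter]
      refine Finset.prod_congr rfl fun p hp => ?_
      rw [locdens]
      by_cases h : hits c p = ∅
      · rw [if_pos h, if_neg (not_not.2 h)]
      · rw [if_neg h, if_pos h, if_pos ⟨v p, hv p hp⟩]
    have hcount : ((Finset.range N).filter fun n : ℕ => ∀ i, ∀ p ∈ (c i).1 ∪ (c i).2,
        (p : ℤ) ∣ W * (n + t i) + b) = (Finset.range N).filter (· ≡ n₀ [MOD ∏ p ∈ U, p]) := by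
      refine Finset.filter_congr fun n _ => ?_
      have hiff : ∀ p ∈ U, ∀ i ∈ hits c p, ((p : ℤ) ∣ W * (n + t i) + b ↔ (p : ℤ) ∣ n - n₀) :=
        fun p hp i hi => by
          have hpP := (Finset.mem_filter.1 hp).1
          rw [dvd_iff_of_coprime (hP p hpP).2 (hv p hpP i hi),
            ← dvd_sub_left (hn₀' p hp) (b := (n : ℤ) - v p)]
          ring_nf
      rw [Nat.ModEq.comm, Nat.modEq_iff_dvd]
      constructor
      · intro h
        push_cast
        refine Finset.prod_dvd_of_coprime (fun p hp q hq hpq => Nat.isCoprime_iff_coprime.2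
          (hcop hp hq hpq)) fun p hp => ?_
        obtain ⟨i, hi⟩ := Finset.nonempty_iff_ne_empty.2 (Finset.mem_filter.1 hp).2
        exact (hiff p hp i hi).1 (h i p ((hmem i p).2 hi))
      · intro h i p hp
        rw [hmem] at hp
        have hpU : p ∈ U := Finset.mem_filter.2 ⟨hcP i p hp, Finset.ne_empty_of_mem hp⟩
        exact (hiff p hpU i hp).2 ((Int.natCast_dvd_natCast.2 (Finset.dvd_prod_of_mem _ hpU)).trans h)
    rw [hdens, hcount]
    exact abs_card_modEq_sub_le (Finset.prod_pos fun p hp => (hprime p hp).pos) _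
  · push Not at hsol
    obtain ⟨p, hp, hx⟩ := hsol
    have hne : hits c p ≠ ∅ := fun h => by
      obtain ⟨i, hi, -⟩ := hx 0
      rw [h] at hi
      exact Finset.notMem_empty i hi
    have h0 : locdens W b t p (hits c p) = 0 := by
      rw [locdens, if_neg hne, if_neg]
      push Not
      exact hx
    rw [Finset.prod_eq_zero hp h0, Finset.filter_false_of_mem]
    · simp
    · intro n _ h
      obtain ⟨i, hi, hi'⟩ := hx n
      exact hi' (h i p ((hmem i p).2 hi))

lemma abs_locdens_sub_le {p : ℕ} (hp : p.Prime) (hW : IsCoprime (p : ℤ) W) (A : Finset ι) :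
    |locdens W b t p A - (p : ℝ)⁻¹ ^ A.card| ≤
      (p : ℝ)⁻¹ ^ 2 + if p ∣ discr t then (p : ℝ)⁻¹ else 0 := by
  have hp1 : (1 : ℝ) ≤ p := by exact_mod_cast hp.one_lt.le
  have hi0 : 0 ≤ (p : ℝ)⁻¹ := by positivity
  have hi1 : (p : ℝ)⁻¹ ≤ 1 := inv_le_one_of_one_le₀ hp1
  have hnn : 0 ≤ (p : ℝ)⁻¹ ^ 2 + if p ∣ discr t then (p : ℝ)⁻¹ else 0 := by positivity
  rcases Nat.lt_or_ge A.card 2 with h | h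
  · rcases Nat.lt_or_ge A.card 1 with h0 | h0
    · rw [Finset.card_eq_zero.1 (Nat.lt_one_iff.1 h0)]
      simpa [locdens] using hnn
    · obtain ⟨i, rfl⟩ := Finset.card_eq_one.1 (by omega : A.card = 1)
      obtain ⟨u, v, huv⟩ := hW
      have hx : ∃ x : ℤ, ∀ j ∈ ({i} : Finset ι), (p : ℤ) ∣ W * (x + t j) + b := by
        refine ⟨-(v * b) - t i, fun j hj => ?_⟩
        rw [Finset.mem_singleton.1 hj]
        exact ⟨u * b, by linear_combination -b * huv⟩
      rw [locdens, if_neg (Finset.singleton_ne_empty i), if_pos hx]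
      simpa using hnn
  · have hpow : (p : ℝ)⁻¹ ^ A.card ≤ (p : ℝ)⁻¹ ^ 2 := pow_le_pow_of_le_one hi0 hi1 h
    have hpow0 : 0 ≤ (p : ℝ)⁻¹ ^ A.card := by positivity
    have hne : A ≠ ∅ := fun h' => by simp [h'] at h
    rw [locdens, if_neg hne]
    split_ifs with hx hd hd
    · rw [abs_le]; constructor <;> nlinarith
    · obtain ⟨i, hi, j, hj, hij⟩ := Finset.one_lt_card.1 h
      obtain ⟨x, hx⟩ := hx
      have h1 : (p : ℤ) ∣ W * (t i - t j) := by
        have := dvd_sub (hx i hi) (hx j hj)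
        ring_nf at this ⊢
        exact this
      have h2 : p ∣ (t i - t j).natAbs := Int.natCast_dvd.1 (hW.dvd_of_dvd_mul_left h1)
      have h3 : (t i - t j).natAbs ∣ discr t :=
        Finset.dvd_prod_of_mem (fun x : ι × ι => (t x.1 - t x.2).natAbs)
          (Finset.mem_offDiag.2 ⟨Finset.mem_univ i, Finset.mem_univ j, hij⟩ : (i, j) ∈ _)
      exact absurd (h2.trans h3) hd
    · rw [abs_le]; constructor <;> linarith
    · rw [abs_le]; constructor <;> linarith

/-- Selberg's divisor sum. -/
noncomputable def divsum (P : Finset ℕ) (R : ℕ) (y : ℤ) : ℝ :=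
  ∑ D ∈ P.powerset with ∀ p ∈ D, ((p : ℕ) : ℤ) ∣ y, lam P R D

theorem abs_sum_prod_divsum_sub_le (hP : ∀ p ∈ P, p.Prime ∧ IsCoprime (p : ℤ) W) :
    |∑ n ∈ Finset.range N, ∏ i, divsum P R (W * (n + t i) + b) ^ 2 - N * mass P R ^ Fintype.card ι| ≤
      N * (mass P R ^ Fintype.card ι * (Real.exp (16 ^ Fintype.card ι *
        ∑ p ∈ P, ((p : ℝ)⁻¹ ^ 2 + if p ∣ discr t then (p : ℝ)⁻¹ else 0)) - 1)) +
      (∑ D ∈ P.powerset, |lam P R D|) ^ (2 * Fintype.card ι) := by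
  have h2P : ∀ p ∈ P, 2 ≤ p := fun p hp => (hP p hp).1.two_le
  set k := Fintype.card ι
  set ε : ℕ → ℝ := fun p => (p : ℝ)⁻¹ ^ 2 + if p ∣ discr t then (p : ℝ)⁻¹ else 0
  have hε : ∀ p, 0 ≤ ε p := fun p => by simp only [ε]; positivity
  set M := ∑ c ∈ fam ι P, (∏ i, lam P R (c i).1 * lam P R (c i).2) *
    ∏ p ∈ P, locdens W b t p (hits c p)
  have h1 : ∑ n ∈ Finset.range N, ∏ i, divsum P R (W * (n + t i) + b) ^ 2 =
      ∑ c ∈ fam ι P, (∏ i, lam P R (c i).1 * lam P R (c i).2) *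
        ((Finset.range N).filter fun n : ℕ => ∀ i, ∀ p ∈ (c i).1 ∪ (c i).2,
          (p : ℤ) ∣ W * (n + t i) + b).card := by
    have hsq : ∀ y, divsum P R y ^ 2 = ∑ q ∈ P.powerset ×ˢ P.powerset,
        if ∀ p ∈ q.1 ∪ q.2, (p : ℤ) ∣ y then lam P R q.1 * lam P R q.2 else 0 := fun y => by
      rw [sq, divsum, Finset.sum_filter, Finset.sum_mul_sum, ← Finset.sum_product']
      refine Finset.sum_congr rfl fun q _ => ?_
      simp only [Finset.forall_mem_union]
      by_cases ha : ∀ p ∈ q.1, (p : ℤ) ∣ y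
      · by_cases hb : ∀ p ∈ q.2, (p : ℤ) ∣ y
        · rw [if_pos ha, if_pos hb, if_pos ⟨ha, hb⟩]
        · rw [if_neg hb, mul_zero, if_neg fun h => hb h.2]
      · rw [if_neg ha, zero_mul, if_neg fun h => ha h.1]
    simp only [hsq, Finset.prod_univ_sum]
    rw [Finset.sum_comm]
    refine Finset.sum_congr rfl fun c _ => ?_
    rw [Finset.card_filter, Nat.cast_sum, Finset.mul_sum]
    refine Finset.sum_congr rfl fun n _ => ?_
    rw [Finset.prod_ite_zero]
    by_cases h : ∀ i, ∀ p ∈ (c i).1 ∪ (c i).2, (p : ℤ) ∣ W * (n + t i) + b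
    · rw [if_pos h, if_pos fun i _ => h i, Nat.cast_one, mul_one]
    · rw [if_neg h, if_neg fun h' => h fun i => h' i (Finset.mem_univ i), Nat.cast_zero, mul_zero]
  have h2 : |∑ n ∈ Finset.range N, ∏ i, divsum P R (W * (n + t i) + b) ^ 2 - N * M| ≤
      (∑ D ∈ P.powerset, |lam P R D|) ^ (2 * k) := by
    rw [h1, Finset.mul_sum, ← Finset.sum_sub_distrib]
    calc _ ≤ ∑ c ∈ fam ι P, ∏ i, |lam P R (c i).1| * |lam P R (c i).2| := by
          refine (Finset.abs_sum_le_sum_abs _ _).trans (Finset.sum_le_sum fun c hc => ?_)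
          rw [show ∀ x y z w : ℝ, x * y - z * (x * w) = x * (y - z * w) by intros; ring, abs_mul,
            Finset.abs_prod]
          simp only [abs_mul]
          exact mul_le_of_le_one_right (Finset.prod_nonneg fun _ _ => by positivity)
            (abs_card_sub_le hP hc)
      _ = _ := by
          rw [pow_mul, sq, Finset.sum_mul_sum, ← Finset.sum_product',
            show k = (Finset.univ : Finset ι).card from rfl, ← Finset.prod_const, Finset.prod_univ_sum]
          rfl
  have h3 : |M - mass P R ^ k| ≤ mass P R ^ k * (∏ p ∈ P, (1 + 16 ^ k * ε p) - 1) := by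
    have := abs_sum_fam_sub_le (ι := ι) (R := R) h2P
      (δ := fun p A => locdens W b t p A - (p : ℝ)⁻¹ ^ A.card) (ε := ε) fun p hp A =>
        abs_locdens_sub_le (hP p hp).1 (hP p hp).2 A
    simpa only [sub_add_cancel] using this
  have h4 : ∏ p ∈ P, (1 + 16 ^ k * ε p) ≤ Real.exp (16 ^ k * ∑ p ∈ P, ε p) := by
    rw [Finset.mul_sum, Real.exp_sum]
    refine Finset.prod_le_prod (fun p _ => by have := hε p; positivity) fun p _ => ?_
    rw [add_comm]
    exact Real.add_one_le_exp _
  have h5 : |(N : ℝ) * M - N * mass P R ^ k| ≤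
      N * (mass P R ^ k * (Real.exp (16 ^ k * ∑ p ∈ P, ε p) - 1)) := by
    rw [← mul_sub, abs_mul, Nat.abs_cast]
    have := mass_nonneg (R := R) h2P
    exact mul_le_mul_of_nonneg_left (h3.trans (by gcongr)) (Nat.cast_nonneg N)
  have := (abs_add_le _ _).trans (add_le_add h2 h5)
  rw [sub_add_sub_cancel, add_comm] at this
  exact this

end Counting

section Bounds
variable {P : Finset ℕ} {R : ℕ}

lemma pow_card_le_of_forall_dvd {T : Finset ℕ} {r y : ℕ} (hT : ∀ p ∈ T, p.Prime ∧ r ≤ p ∧ p ∣ y)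
    (hy : y ≠ 0) : r ^ T.card ≤ y :=
  (Finset.pow_card_le_prod _ _ _ fun p hp => (hT p hp).2.1).trans (Nat.le_of_dvd (Nat.pos_of_ne_zero hy)
    (Finset.prod_primes_dvd y (fun p hp => (hT p hp).1.prime) fun p hp => (hT p hp).2.2))

lemma mul_card_le_of_forall_dvd {T : Finset ℕ} {r y u m : ℕ}
    (hT : ∀ p ∈ T, p.Prime ∧ r ≤ p ∧ p ∣ y) (hy : y ≠ 0) (hu : 2 ^ u ≤ r) (hm : y ≤ 2 ^ m) :
    u * T.card ≤ m := by
  rw [← Nat.pow_le_pow_iff_right one_lt_two, pow_mul]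
  exact (Nat.pow_le_pow_left hu _).trans ((pow_card_le_of_forall_dvd hT hy).trans hm)

variable (hP : ∀ p ∈ P, p.Prime)
include hP

lemma injOn_prod : Set.InjOn (fun D : Finset ℕ => ∏ p ∈ D, p) (P.powerset : Set (Finset ℕ)) := by
  intro D hD E hE h
  rw [Finset.mem_coe, Finset.mem_powerset] at hD hE
  rw [← Nat.primeFactors_prod fun p hp => hP p (hD hp), ← Nat.primeFactors_prod fun p hp => hP p (hE hp)]
  exact congrArg _ h

lemma sum_prod_le {F : ℕ → ℝ} (hF : ∀ n, 0 ≤ F n) :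
    ∑ D ∈ P.powerset with ∏ p ∈ D, p ≤ R, F (∏ p ∈ D, p) ≤ ∑ n ∈ Finset.Icc 1 R, F n := by
  rw [← Finset.sum_image (f := F) (g := fun D : Finset ℕ => ∏ p ∈ D, p)
    fun D hD E hE => injOn_prod hP (Finset.mem_filter.1 hD).1 (Finset.mem_filter.1 hE).1]
  refine Finset.sum_le_sum_of_subset_of_nonneg ?_ fun n _ _ => hF n
  intro n hn
  obtain ⟨D, hD, rfl⟩ := Finset.mem_image.1 hn
  rw [Finset.mem_filter, Finset.mem_powerset] at hD
  exact Finset.mem_Icc.2 ⟨Finset.prod_pos fun p hp => (hP p (hD.1 hp)).pos, hD.2⟩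

lemma hw_le_one {L : Finset ℕ} (hL : L ⊆ P) : hw L ≤ 1 := by
  refine Finset.prod_le_one (fun p hp => ?_) fun p hp => ?_
  all_goals have : (2 : ℝ) ≤ p := by exact_mod_cast (hP p (hL hp)).two_le
  · exact inv_nonneg.2 (by linarith)
  · exact inv_le_one_of_one_le₀ (by linarith)

lemma mass_eq : mass P R = ∑ L ∈ P.powerset with ∏ p ∈ L, p ≤ R, hw L := by
  rw [Finset.sum_filter]; rfl

lemma mass_le : mass P R ≤ R := by
  rw [mass_eq hP]
  refine (Finset.sum_le_sum fun L hL =>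
    hw_le_one hP (Finset.mem_powerset.1 (Finset.mem_filter.1 hL).1)).trans ?_
  simpa using sum_prod_le (R := R) hP (F := fun _ => 1) fun _ => zero_le_one

lemma sum_abs_lam_le : ∑ D ∈ P.powerset, |lam P R D| ≤ (R : ℝ) ^ 3 := by
  have h2P : ∀ p ∈ P, 2 ≤ p := fun p hp => (hP p hp).two_le
  have h1 : ∀ D ∈ P.powerset, |lam P R D| ≤ if ∏ p ∈ D, p ≤ R then (R : ℝ) ^ 2 else 0 := by
    intro D hD
    rw [Finset.mem_powerset] at hD
    have hsel : ∀ M ∈ P.powerset, 0 ≤ sel R M := fun M hM => sel_nonneg h2P (Finset.mem_powerset.1 hM)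
    rw [lam, abs_mul, abs_mul, abs_pow, abs_neg, abs_one, one_pow, one_mul,
      abs_of_nonneg (Finset.prod_nonneg fun _ _ => Nat.cast_nonneg _),
      abs_of_nonneg (Finset.sum_nonneg fun M hM => hsel M (Finset.mem_filter.1 hM).1)]
    split_ifs with h
    · rw [sq]
      refine mul_le_mul (by rw [← Nat.cast_prod]; exact_mod_cast h) ((Finset.sum_le_sum_of_subset_of_nonneg
        (Finset.filter_subset _ _) fun M hM _ => hsel M hM).trans (mass_le hP))
        (Finset.sum_nonneg fun M hM => hsel M (Finset.mem_filter.1 hM).1) (Nat.cast_nonneg R)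
    · rw [Finset.sum_eq_zero, mul_zero]
      intro M hM
      rw [Finset.mem_filter, Finset.mem_powerset] at hM
      exact if_neg fun h' => h ((Finset.prod_le_prod_of_subset_of_one_le' hM.2 fun p hp _ =>
        (hP p (hM.1 hp)).one_lt.le).trans h')
  refine (Finset.sum_le_sum h1).trans ?_
  rw [← Finset.sum_filter]
  have := sum_prod_le (R := R) hP (F := fun _ => (R : ℝ) ^ 2) fun _ => by positivity
  refine this.trans (le_of_eq ?_)
  rw [Finset.sum_const, Nat.card_Icc, nsmul_eq_mul, Nat.add_sub_cancel]
  ring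

lemma abs_divsum_le (y : ℤ) : |divsum P R y| ≤ (R : ℝ) ^ 3 :=
  (Finset.abs_sum_le_sum_abs _ _).trans ((Finset.sum_le_sum_of_subset_of_nonneg
    (Finset.filter_subset _ _) fun _ _ _ => abs_nonneg _).trans (sum_abs_lam_le hP))

lemma abs_lam_le {D : Finset ℕ} (hD : D ⊆ P) : |lam P R D| ≤ 2 ^ D.card * mass P R := by
  have h2P : ∀ p ∈ P, 2 ≤ p := fun p hp => (hP p hp).two_le
  have hsel : ∀ M ∈ P.powerset, 0 ≤ sel R M := fun M hM => sel_nonneg h2P (Finset.mem_powerset.1 hM)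
  have h1 : ∑ M ∈ P.powerset with D ⊆ M, sel R M ≤ mass P R * hw D := by
    rw [Finset.sum_filter, sum_powerset_split hD]
    calc _ ≤ ∑ M ∈ (P \ D).powerset, sel R M * hw D := by
          refine Finset.sum_le_sum fun M hM => ?_
          rw [Finset.mem_powerset] at hM
          have hd : Disjoint M D := Finset.disjoint_of_subset_left hM Finset.sdiff_disjoint
          rw [Finset.sum_eq_single D]
          · rw [if_pos Finset.subset_union_right]
            exact sel_union_le h2P (hM.trans Finset.sdiff_subset) hD hd
          · intro t ht htD
            refine if_neg fun h => htD ((Finset.mem_powerset.1 ht).antisymm fun x hx => ?_)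
            exact (Finset.mem_union.1 (h hx)).resolve_left fun h' => Finset.disjoint_left.1 hd h' hx
          · exact fun h => absurd (Finset.mem_powerset_self D) h
      _ ≤ _ := by
          rw [← Finset.sum_mul]
          exact mul_le_mul_of_nonneg_right (Finset.sum_le_sum_of_subset_of_nonneg
            (Finset.powerset_mono.2 Finset.sdiff_subset) fun M hM _ => hsel M hM) (hw_nonneg h2P hD)
  have h2 : (∏ p ∈ D, (p : ℝ)) * hw D ≤ 2 ^ D.card := by
    rw [hw, ← Finset.prod_mul_distrib, ← Finset.prod_const]
    refine Finset.prod_le_prod (fun p hp => ?_) fun p hp => ?_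
    all_goals have : (2 : ℝ) ≤ p := by exact_mod_cast h2P p (hD hp)
    · exact mul_nonneg (by linarith) (inv_nonneg.2 (by linarith))
    · rw [← div_eq_mul_inv, div_le_iff₀ (by linarith)]
      linarith
  have h3 : (0 : ℝ) ≤ ∏ p ∈ D, (p : ℝ) := Finset.prod_nonneg fun _ _ => Nat.cast_nonneg _
  rw [lam, abs_mul, abs_mul, abs_pow, abs_neg, abs_one, one_pow, one_mul, abs_of_nonneg h3,
    abs_of_nonneg (Finset.sum_nonneg fun M hM => hsel M (Finset.mem_filter.1 hM).1)]
  have hm := mass_nonneg (R := R) h2P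
  calc _ ≤ (∏ p ∈ D, (p : ℝ)) * (mass P R * hw D) := by gcongr
    _ = (∏ p ∈ D, (p : ℝ)) * hw D * mass P R := by ring
    _ ≤ _ := by gcongr

lemma abs_divsum_le' (y : ℤ) :
    |divsum P R y| ≤ 4 ^ (P.filter fun p : ℕ => (p : ℤ) ∣ y).card * mass P R := by
  set Z := P.filter fun p : ℕ => (p : ℤ) ∣ y
  have hZ : P.powerset.filter (fun D => ∀ p ∈ D, ((p : ℕ) : ℤ) ∣ y) = Z.powerset := by
    ext D
    simp only [Finset.mem_filter, Finset.mem_powerset, Z, Finset.subset_iff]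
    exact ⟨fun h x hx => ⟨h.1 hx, h.2 x hx⟩, fun h => ⟨fun x hx => (h hx).1, fun x hx => (h hx).2⟩⟩
  have hm := mass_nonneg (R := R) fun p hp => (hP p hp).two_le
  rw [divsum, hZ]
  calc _ ≤ ∑ D ∈ Z.powerset, 2 ^ Z.card * mass P R := by
        refine (Finset.abs_sum_le_sum_abs _ _).trans (Finset.sum_le_sum fun D hD => ?_)
        rw [Finset.mem_powerset] at hD
        refine (abs_lam_le hP (hD.trans (Finset.filter_subset _ _))).trans ?_
        gcongr
        exact one_le_two
    _ = _ := by
        rw [Finset.sum_const, Finset.card_powerset, nsmul_eq_mul, show (4 : ℝ) = 2 * 2 by norm_num,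
          mul_pow]
        push_cast
        ring

lemma mass_le_of_card_le {z : ℕ} (hz : ∀ L ⊆ P, ∏ p ∈ L, p ≤ R → L.card ≤ z) :
    mass P R ≤ 2 ^ z * (1 + Real.log R) := by
  rw [mass_eq hP]
  calc _ ≤ ∑ L ∈ P.powerset with ∏ p ∈ L, p ≤ R, 2 ^ z * ((∏ p ∈ L, p : ℕ) : ℝ)⁻¹ := by
        refine Finset.sum_le_sum fun L hL => ?_
        rw [Finset.mem_filter, Finset.mem_powerset] at hL
        refine le_trans (b := 2 ^ L.card * ((∏ p ∈ L, p : ℕ) : ℝ)⁻¹) ?_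
          (mul_le_mul_of_nonneg_right (pow_le_pow_right₀ one_le_two (hz L hL.1 hL.2)) (by positivity))
        push_cast
        rw [← Finset.prod_const, ← Finset.prod_inv_distrib, ← Finset.prod_mul_distrib, hw]
        refine Finset.prod_le_prod (fun p hp => ?_) fun p hp => ?_
        all_goals have : (2 : ℝ) ≤ p := by exact_mod_cast (hP p (hL.1 hp)).two_le
        · exact inv_nonneg.2 (by linarith)
        · rw [← div_eq_mul_inv, inv_le_comm₀ (by linarith) (by positivity), inv_div]
          linarith
    _ ≤ 2 ^ z * ∑ n ∈ Finset.Icc 1 R, (n : ℝ)⁻¹ := by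
        rw [← Finset.mul_sum]
        gcongr
        exact sum_prod_le hP (F := fun n => (n : ℝ)⁻¹) fun _ => by positivity
    _ ≤ _ := by
        gcongr
        have := harmonic_le_one_add_log R
        rw [harmonic_eq_sum_Icc] at this
        push_cast at this
        exact this

omit hP in
lemma sum_Icc_inv_le : ∑ n ∈ Finset.Icc 1 R, (n : ℝ)⁻¹ ≤
    2 * mass ((Finset.Icc 1 R).filter Nat.Prime) R := by
  set Q := (Finset.Icc 1 R).filter Nat.Prime
  have hQ : ∀ p ∈ Q, p.Prime := fun p hp => (Finset.mem_filter.1 hp).2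
  have h2 : ∑ m ∈ Finset.Icc 1 R, (m ^ 2 : ℝ)⁻¹ ≤ 2 := by
    rcases Nat.eq_zero_or_pos R with rfl | hR
    · simp
    · rw [← Finset.add_sum_Ioc_eq_sum_Icc hR]
      have := sum_Ioc_inv_sq_le_sub (α := ℝ) one_ne_zero hR
      have h3 : (0 : ℝ) ≤ (R : ℝ)⁻¹ := by positivity
      simp only [Nat.cast_one, inv_one, one_pow] at this ⊢
      linarith
  have hex : ∀ n ∈ Finset.Icc 1 R, ∃ q ∈ (Finset.Icc 1 R) ×ˢ Q.powerset.filter (∏ p ∈ ·, p ≤ R),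
      q.1 ^ 2 * ∏ p ∈ q.2, p = n := by
    intro n hn
    rw [Finset.mem_Icc] at hn
    obtain ⟨l, m, hl, hm, hlm, hsq⟩ := Nat.sq_mul_squarefree_of_pos hn.1
    have hln : l ≤ R := (Nat.le_of_dvd hn.1 ⟨m ^ 2, by rw [← hlm, mul_comm]⟩).trans hn.2
    have hprod := Nat.prod_primeFactors_of_squarefree hsq
    refine ⟨(m, l.primeFactors), ?_, by rw [hprod, hlm]⟩
    simp only [Finset.mem_product, Finset.mem_Icc, Finset.mem_filter, Finset.mem_powerset]
    refine ⟨⟨hm, ?_⟩, fun p hp => ?_, hprod.trans_le hln⟩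
    · exact (Nat.le_self_pow two_ne_zero m).trans
        ((Nat.le_of_dvd hn.1 ⟨l, hlm.symm⟩).trans hn.2)
    · have hp' := Nat.prime_of_mem_primeFactors hp
      exact Finset.mem_filter.2 ⟨Finset.mem_Icc.2 ⟨hp'.pos,
        (Nat.le_of_dvd hl (Nat.dvd_of_mem_primeFactors hp)).trans hln⟩, hp'⟩
  choose! g hg hgn using hex
  have hinj : Set.InjOn g (Finset.Icc 1 R) := fun a ha b hb h => by
    rw [← hgn a ha, ← hgn b hb, h]
  calc ∑ n ∈ Finset.Icc 1 R, (n : ℝ)⁻¹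
      = ∑ q ∈ (Finset.Icc 1 R).image g, ((q.1 : ℝ) ^ 2)⁻¹ * ((∏ p ∈ q.2, p : ℕ) : ℝ)⁻¹ := by
        rw [Finset.sum_image hinj]
        refine Finset.sum_congr rfl fun n hn => ?_
        rw [← mul_inv]
        exact_mod_cast congrArg (fun n : ℕ => (n : ℝ)⁻¹) (hgn n hn).symm
    _ ≤ ∑ q ∈ (Finset.Icc 1 R) ×ˢ Q.powerset.filter (∏ p ∈ ·, p ≤ R),
        ((q.1 : ℝ) ^ 2)⁻¹ * ((∏ p ∈ q.2, p : ℕ) : ℝ)⁻¹ :=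
        Finset.sum_le_sum_of_subset_of_nonneg (Finset.image_subset_iff.2 hg) fun _ _ _ => by positivity
    _ = (∑ m ∈ Finset.Icc 1 R, (m ^ 2 : ℝ)⁻¹) *
        ∑ L ∈ Q.powerset.filter (∏ p ∈ ·, p ≤ R), ((∏ p ∈ L, p : ℕ) : ℝ)⁻¹ := by
        rw [Finset.sum_mul_sum, ← Finset.sum_product']
    _ ≤ 2 * mass Q R := by
        rw [mass_eq hQ]
        refine mul_le_mul h2 (Finset.sum_le_sum fun L hL => ?_)
          (Finset.sum_nonneg fun _ _ => by positivity) zero_le_two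
        rw [Finset.mem_filter, Finset.mem_powerset] at hL
        push_cast
        rw [hw, ← Finset.prod_inv_distrib]
        refine Finset.prod_le_prod (fun p hp => by positivity) fun p hp => ?_
        have : (2 : ℝ) ≤ p := by exact_mod_cast (hQ p (hL.1 hp)).two_le
        exact inv_anti₀ (by linarith) (by linarith)

omit hP in
theorem log_le_mass {r : ℕ} (hr : r ≤ R) : Real.log R ≤ 2 * (mass ((Finset.Ioc r R).filter Nat.Prime) R *
    ∏ p ∈ (Finset.Icc 1 r).filter Nat.Prime, (1 + ((p : ℝ) - 1)⁻¹)) := by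
  have h1 : Real.log R ≤ ∑ n ∈ Finset.Icc 1 R, (n : ℝ)⁻¹ := by
    rcases Nat.eq_zero_or_pos R with rfl | hR
    · simp
    have := log_add_one_le_harmonic R
    rw [harmonic_eq_sum_Icc] at this
    push_cast at this
    exact (Real.log_le_log (by exact_mod_cast hR) (by linarith)).trans this
  refine (h1.trans sum_Icc_inv_le).trans (mul_le_mul_of_nonneg_left ?_ zero_le_two)
  set Q := (Finset.Icc 1 R).filter Nat.Prime
  set S := (Finset.Icc 1 r).filter Nat.Prime
  have hSQ : S ⊆ Q := Finset.filter_subset_filter _ (Finset.Icc_subset_Icc_right hr)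
  have h2Q : ∀ p ∈ Q, 2 ≤ p := fun p hp => (Finset.mem_filter.1 hp).2.two_le
  have hQS : Q \ S = (Finset.Ioc r R).filter Nat.Prime := by
    ext p
    simp only [Q, S, Finset.mem_sdiff, Finset.mem_filter, Finset.mem_Icc, Finset.mem_Ioc]
    constructor
    · rintro ⟨h, h'⟩; exact ⟨⟨by by_contra h3; exact h' ⟨⟨h.1.1, by omega⟩, h.2⟩, h.1.2⟩, h.2⟩
    · rintro ⟨h, h'⟩; exact ⟨⟨⟨by omega, h.2⟩, h'⟩, fun h3 => by omega⟩
  rw [mass, sum_powerset_split hSQ, hQS, mass, Finset.prod_one_add, Finset.sum_mul_sum, ← hQS]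
  refine Finset.sum_le_sum fun M hM => Finset.sum_le_sum fun t ht => ?_
  rw [Finset.mem_powerset] at hM ht
  exact sel_union_le h2Q (hM.trans Finset.sdiff_subset) (ht.trans hSQ)
    (Finset.disjoint_of_subset_right ht (Finset.disjoint_of_subset_left hM Finset.sdiff_disjoint))

end Bounds

section LinearForms
variable {P : Finset ℕ} {R N : ℕ} [NeZero N] {W b : ℤ} {H : Finset ℤ}

/-- The normalised Selberg majorant on the progression `b` modulo `W`. -/
noncomputable def maj (P : Finset ℕ) (R N : ℕ) (W b : ℤ) (x : ZMod N) : ℝ :=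
  divsum P R (W * (x.val : ℤ) + b) ^ 2 / mass P R

lemma sum_zmod (F : ℕ → ℝ) : ∑ x : ZMod N, F x.val = ∑ n ∈ Finset.range N, F n := by
  refine Finset.sum_bij' (fun x _ => x.val) (fun n _ => (n : ZMod N)) ?_ ?_ ?_ ?_ ?_
  · exact fun x _ => Finset.mem_range.2 x.val_lt
  · exact fun n _ => Finset.mem_univ _
  · exact fun x _ => ZMod.natCast_zmod_val x
  · exact fun n hn => ZMod.val_cast_of_lt (Finset.mem_range.1 hn)
  · exact fun _ _ => rfl

lemma val_natCast_add_intCast {n : ℕ} {h : ℤ} (h0 : 0 ≤ n + h) (h1 : n + h < N) :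
    (((n : ZMod N) + (h : ZMod N)).val : ℤ) = n + h := by
  rw [show (n : ZMod N) + (h : ZMod N) = ((n + h : ℤ) : ZMod N) by push_cast; rfl, ZMod.val_intCast,
    Int.emod_eq_of_lt h0 h1]

variable (hP : ∀ p ∈ P, p.Prime)
include hP

lemma sq_divsum_le (y : ℤ) : divsum P R y ^ 2 ≤ (R : ℝ) ^ 6 := by
  rw [← sq_abs]
  exact (pow_le_pow_left₀ (abs_nonneg _) (abs_divsum_le hP y) 2).trans_eq (by ring)

lemma prod_sq_divsum_le (hR : 1 ≤ R) {k : ℕ} (hk : H.card ≤ k) (y : ℤ → ℤ) :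
    ∏ h ∈ H, divsum P R (y h) ^ 2 ≤ (R : ℝ) ^ (6 * k) := by
  have hR' : (1 : ℝ) ≤ R := by exact_mod_cast hR
  refine (Finset.prod_le_prod (fun _ _ => sq_nonneg _) fun h _ => sq_divsum_le hP _).trans ?_
  rw [Finset.prod_const, ← pow_mul]
  exact pow_le_pow_right₀ hR' (Nat.mul_le_mul_left _ hk)

lemma abs_sum_wrap_sub_le (hR : 1 ≤ R) {k : ℕ} (hk : H.card ≤ k) (hH : ∀ h ∈ H, h ^ 2 ≤ N) :
    |∑ x : ZMod N, ∏ h ∈ H, divsum P R (W * ((x + (h : ZMod N)).val : ℤ) + b) ^ 2 -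
      ∑ n ∈ Finset.range N, ∏ h ∈ H, divsum P R (W * (n + h) + b) ^ 2| ≤
      2 * Nat.sqrt N * (R : ℝ) ^ (6 * k) := by
  set s := Nat.sqrt N with hs
  have hHs : ∀ h ∈ H, -(s : ℤ) ≤ h ∧ h ≤ s := fun h hh => by
    have h1 : h.natAbs ≤ s := Nat.le_sqrt'.2 (by zify; simpa using hH h hh)
    omega
  have h1 := sum_zmod (N := N) fun n => ∏ h ∈ H, divsum P R (W * (((n : ZMod N) + (h : ZMod N)).val : ℤ) + b) ^ 2
  simp only [ZMod.natCast_zmod_val] at h1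
  rw [h1, ← Finset.sum_sub_distrib]
  refine (Finset.abs_sum_le_sum_abs _ _).trans ?_
  calc _ ≤ ∑ n ∈ Finset.range N, if n ∈ Finset.range s ∪ Finset.Ico (N - s) N then (R : ℝ) ^ (6 * k) else 0 := by
        refine Finset.sum_le_sum fun n hn => ?_
        rw [Finset.mem_range] at hn
        split_ifs with hb
        · exact abs_sub_le_of_nonneg_of_le (Finset.prod_nonneg fun _ _ => sq_nonneg _)
            (prod_sq_divsum_le hP hR hk _) (Finset.prod_nonneg fun _ _ => sq_nonneg _)
            (prod_sq_divsum_le hP hR hk _)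
        · simp only [Finset.mem_union, Finset.mem_range, Finset.mem_Ico] at hb
          rw [Finset.prod_congr rfl fun h hh => by
            rw [val_natCast_add_intCast (by have := hHs h hh; omega) (by have := hHs h hh; omega)],
            sub_self, abs_zero]
    _ ≤ _ := by
        rw [← Finset.sum_filter, Finset.sum_const, nsmul_eq_mul]
        refine mul_le_mul_of_nonneg_right ?_ (by positivity)
        have h2 : ((Finset.range N).filter (· ∈ Finset.range s ∪ Finset.Ico (N - s) N)).card ≤ 2 * s := by
          refine (Finset.card_le_card fun n hn => (Finset.mem_filter.1 hn).2).trans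
            ((Finset.card_union_le _ _).trans ?_)
          rw [Finset.card_range, Nat.card_Ico]
          omega
        exact_mod_cast h2

theorem abs_expect_prod_maj_sub_le (hR : 1 ≤ R) (hW : ∀ p ∈ P, IsCoprime (p : ℤ) W) {k : ℕ}
    (hk : H.card ≤ k) (hH : ∀ h ∈ H, h ^ 2 ≤ N) :
    |𝔼 x : ZMod N, ∏ h ∈ H, maj P R N W b (x + (h : ZMod N)) - 1| ≤
      (Real.exp (16 ^ H.card * ∑ p ∈ P, ((p : ℝ)⁻¹ ^ 2 +
        if p ∣ discr (fun h : H => (h : ℤ)) then (p : ℝ)⁻¹ else 0)) - 1) +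
        3 * R ^ (6 * k) / Nat.sqrt N := by
  have hN : (0 : ℝ) < N := by exact_mod_cast Nat.pos_of_neZero N
  have hs1 : 1 ≤ Nat.sqrt N := Nat.sqrt_pos.2 (Nat.pos_of_neZero N)
  have hs : (1 : ℝ) ≤ Nat.sqrt N := by exact_mod_cast hs1
  have hsN : (Nat.sqrt N : ℝ) * Nat.sqrt N ≤ N := by exact_mod_cast Nat.sqrt_le N
  have hR' : (1 : ℝ) ≤ R := by exact_mod_cast hR
  have hG := one_le_mass (R := R) (fun p hp => (hP p hp).two_le) hR
  have hGk := one_le_pow₀ (n := H.card) hG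
  have h1 := abs_sum_prod_divsum_sub_le (N := N) (R := R) (b := b) (t := fun h : H => (h : ℤ))
    fun p hp => ⟨hP p hp, hW p hp⟩
  have h0 : ∀ n : ℕ, ∏ i : H, divsum P R (W * ((n : ℤ) + (i : ℤ)) + b) ^ 2 =
      ∏ h ∈ H, divsum P R (W * ((n : ℤ) + h) + b) ^ 2 :=
    fun n => Finset.prod_coe_sort H fun h => divsum P R (W * ((n : ℤ) + h) + b) ^ 2
  simp only [Fintype.card_coe, h0] at h1
  have h2 := abs_sum_wrap_sub_le (W := W) (b := b) hP hR hk hH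
  have h3 : (∑ D ∈ P.powerset, |lam P R D|) ^ (2 * H.card) ≤ (R : ℝ) ^ (6 * k) := by
    refine (pow_le_pow_left₀ (Finset.sum_nonneg fun _ _ => abs_nonneg _) (sum_abs_lam_le hP) _).trans ?_
    rw [← pow_mul]
    exact pow_le_pow_right₀ hR' (by omega)
  simp only [maj, Finset.prod_div_distrib, Finset.prod_const]
  rw [← Finset.expect_div, Finset.expect_eq_sum_div_card, Finset.card_univ, ZMod.card, div_div]
  set G := mass P R ^ H.card with hGdef
  set A := ∑ x : ZMod N, ∏ h ∈ H, divsum P R (W * ((x + (h : ZMod N)).val : ℤ) + b) ^ 2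
  set e := Real.exp (16 ^ H.card * ∑ p ∈ P, ((p : ℝ)⁻¹ ^ 2 +
        if p ∣ discr (fun h : H => (h : ℤ)) then (p : ℝ)⁻¹ else 0)) - 1
  set K : ℝ := R ^ (6 * k)
  have hK : 0 ≤ K := by positivity
  have h4 : |A - N * G| ≤ N * (G * e) + 3 * K * Nat.sqrt N := by
    refine (abs_sub_le _ _ _).trans ((add_le_add h2 h1).trans ?_)
    nlinarith [mul_le_mul_of_nonneg_left hs hK]
  have hNG : 0 < N * G := by positivity
  rw [show A / (N * G) - 1 = (A - N * G) / (N * G) by field_simp, abs_div, abs_of_pos hNG, div_le_iff₀ hNG]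
  refine h4.trans ?_
  have h5 : 3 * K * Nat.sqrt N ≤ 3 * K / Nat.sqrt N * (N * G) := by
    rw [div_mul_eq_mul_div, le_div_iff₀ (by linarith), mul_assoc]
    refine mul_le_mul_of_nonneg_left ?_ (by positivity)
    nlinarith
  linarith

end LinearForms

section Parameters
variable {q r k : ℕ}

/-- The modulus at stage `r`. -/
def modulus (r : ℕ) : ℕ := 24 * primorial r

/-- The length of the cyclic group at stage `r`. -/
def len (q r : ℕ) : ℕ := 2 ^ (q * (r + 1) + 1) / modulus r + 1

/-- The sieving primes at stage `r`. -/
def sievePrimes (r : ℕ) : Finset ℕ := (Finset.Ioc r (2 ^ r)).filter Nat.Prime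

instance : NeZero (len q r) := ⟨Nat.succ_ne_zero _⟩

lemma modulus_ge : 24 ≤ modulus r := Nat.le_mul_of_pos_right _ (primorial_pos r)

lemma modulus_le : modulus r ≤ 2 ^ (5 + 2 * r) := by
  rw [pow_add, pow_mul]
  exact Nat.mul_le_mul (by norm_num) (primorial_le_four_pow r)

lemma lt_modulus_mul_len : 2 ^ (q * (r + 1) + 1) < modulus r * len q r :=
  Nat.lt_mul_div_succ _ (by have := modulus_ge (r := r); omega)

lemma modulus_mul_len_le (hq : 5 ≤ q) : modulus r * len q r ≤ 2 ^ (q * (r + 1) + 2) := by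
  have h1 : modulus r ≤ 2 ^ (q * (r + 1) + 1) :=
    modulus_le.trans (Nat.pow_le_pow_right two_pos (by nlinarith))
  rw [len, mul_add, pow_succ _ (q * (r + 1) + 1)]
  have := Nat.mul_div_le (2 ^ (q * (r + 1) + 1)) (modulus r)
  omega

lemma two_pow_le_len (hq : 5 ≤ q) : 2 ^ ((q - 2) * r) ≤ len q r := by
  by_contra! h
  have h1 := lt_modulus_mul_len (q := q) (r := r)
  have h2 := Nat.mul_le_mul (modulus_le (r := r)) h.le
  rw [← pow_add] at h2
  have h3 := (Nat.pow_lt_pow_iff_right one_lt_two).1 (h1.trans_le h2)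
  obtain ⟨q', rfl⟩ := Nat.exists_eq_add_of_le' (show 2 ≤ q by omega)
  rw [Nat.add_sub_cancel] at h3
  nlinarith

lemma len_le : len q r ≤ 2 ^ (q * (r + 1) + 1) := by
  have h1 := Nat.div_le_div_left (a := 2 ^ (q * (r + 1) + 1)) (modulus_ge (r := r)) (by norm_num)
  have h2 : 2 ≤ 2 ^ (q * (r + 1) + 1) := Nat.le_self_pow (by omega) 2
  rw [len]
  omega

lemma prime_of_mem_sievePrimes : ∀ p ∈ sievePrimes r, p.Prime := fun _ hp => (Finset.mem_filter.1 hp).2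

lemma coprime_modulus (hr : 3 ≤ r) : ∀ p ∈ sievePrimes r, IsCoprime (p : ℤ) (modulus r : ℤ) := by
  intro p hp
  obtain ⟨h1, h2⟩ := Finset.mem_filter.1 hp
  rw [Finset.mem_Ioc] at h1
  rw [Nat.isCoprime_iff_coprime, h2.coprime_iff_not_dvd, modulus, h2.dvd_mul]
  rintro (h | h)
  · rw [show 24 = 2 ^ 3 * 3 by norm_num, h2.dvd_mul] at h
    rcases h with h | h
    · have := Nat.le_of_dvd two_pos (h2.dvd_of_dvd_pow h); omega
    · have := Nat.le_of_dvd three_pos h; omega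
  · have := h2.dvd_primorial_iff.1 h; omega

lemma discr_le {H : Finset ℤ} (hk : H.card ≤ k) (hH : ∀ h ∈ H, h ^ 2 ≤ len q r) :
    discr (fun h : H => (h : ℤ)) ≤ 2 ^ ((q * (r + 1) + 2) * k ^ 2) := by
  have h1 : ∀ h : H, (h : ℤ).natAbs ≤ len q r := fun h => by
    have h1 := hH h h.2
    have h2 : (h : ℤ).natAbs ^ 2 ≤ len q r := by zify; simpa using h1
    nlinarith [Nat.zero_le (h : ℤ).natAbs]
  rw [discr, pow_mul]
  refine (Finset.prod_le_pow_card _ _ (2 ^ (q * (r + 1) + 2)) fun x _ => ?_).trans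
    (Nat.pow_le_pow_right (by positivity) ?_)
  · have := h1 x.1
    have := h1 x.2
    have := len_le (q := q) (r := r)
    rw [pow_succ _ (q * (r + 1) + 1)]
    omega
  · rw [Finset.offDiag_card, Finset.card_univ, Fintype.card_coe, sq]
    exact (Nat.sub_le _ _).trans (Nat.mul_le_mul hk hk)

lemma discr_ne_zero {H : Finset ℤ} : discr (fun h : H => (h : ℤ)) ≠ 0 := by
  refine Finset.prod_ne_zero_iff.2 fun x hx => ?_
  have := (Finset.mem_offDiag.1 hx).2.2
  rw [Ne, Int.natAbs_eq_zero, sub_eq_zero]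
  exact fun h => this (Subtype.ext h)

lemma sum_error_le {H : Finset ℤ} (hq : 1 ≤ q) (hr : 2 ≤ r) (hk : H.card ≤ k)
    (hH : ∀ h ∈ H, h ^ 2 ≤ len q r) :
    ∑ p ∈ sievePrimes r, ((p : ℝ)⁻¹ ^ 2 + if p ∣ discr (fun h : H => (h : ℤ)) then (p : ℝ)⁻¹ else 0) ≤
      (1 + 4 * q * k ^ 2) / Nat.log 2 r := by
  have hr0 : (0 : ℝ) < r := by exact_mod_cast (by omega : 0 < r)
  have hu : 0 < Nat.log 2 r := Nat.log_pos one_lt_two hr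
  have hu0 : (0 : ℝ) < Nat.log 2 r := by exact_mod_cast hu
  rw [Finset.sum_add_distrib, add_div]
  refine add_le_add ?_ ?_
  · have hm : r ≤ 2 ^ r := Nat.lt_two_pow_self.le
    calc _ ≤ ∑ p ∈ Finset.Ioc r (2 ^ r), ((p : ℝ) ^ 2)⁻¹ := by
          simp only [inv_pow]
          exact Finset.sum_le_sum_of_subset_of_nonneg (Finset.filter_subset _ _) fun _ _ _ => by positivity
      _ ≤ (r : ℝ)⁻¹ := (sum_Ioc_inv_sq_le_sub (by omega) hm).trans (sub_le_self _ (by positivity))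
      _ ≤ _ := by
          rw [one_div]
          exact inv_anti₀ hu0 (by exact_mod_cast Nat.log_le_self 2 r)
  · rw [← Finset.sum_filter]
    set T := (sievePrimes r).filter (· ∣ discr (fun h : H => (h : ℤ)))
    have hT : ∀ p ∈ T, p.Prime ∧ r ≤ p ∧ p ∣ discr (fun h : H => (h : ℤ)) := fun p hp => by
      obtain ⟨h1, h2⟩ := Finset.mem_filter.1 hp
      obtain ⟨h3, h4⟩ := Finset.mem_filter.1 h1
      exact ⟨h4, (Finset.mem_Ioc.1 h3).1.le, h2⟩
    have h1 := mul_card_le_of_forall_dvd hT discr_ne_zero (Nat.pow_log_le_self 2 (by omega))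
      (discr_le hk hH)
    have h2 : Nat.log 2 r * T.card ≤ 4 * q * k ^ 2 * r := by
      have h3 : q * (r + 1) + 2 ≤ 4 * q * r := by nlinarith
      exact h1.trans ((Nat.mul_le_mul_right _ h3).trans_eq (by ring))
    calc ∑ p ∈ T, (p : ℝ)⁻¹ ≤ ∑ p ∈ T, (r : ℝ)⁻¹ := Finset.sum_le_sum fun p hp =>
          inv_anti₀ hr0 (by exact_mod_cast (hT p hp).2.1)
      _ = T.card / r := by rw [Finset.sum_const, nsmul_eq_mul, div_eq_mul_inv]
      _ ≤ _ := by
          rw [div_le_div_iff₀ hr0 hu0]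
          rw [mul_comm]
          exact_mod_cast h2

lemma two_pow_mul_le_sqrt_len (hk : 1 ≤ k) (hq : 100 * k ≤ q) :
    2 ^ r * (2 ^ r) ^ (6 * k) ≤ Nat.sqrt (len q r) := by
  rw [Nat.le_sqrt']
  refine le_trans ?_ (two_pow_le_len (by omega))
  rw [← pow_mul, ← pow_add, ← pow_mul]
  refine Nat.pow_le_pow_right two_pos ?_
  have : 14 * k ≤ q - 2 := by omega
  have := Nat.mul_le_mul_right r this
  nlinarith

theorem maj_linear_forms (hk : 1 ≤ k) (hq : 100 * k ≤ q) {κ : ℝ} (hκ : 0 < κ) :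
    ∀ᶠ r in atTop, ∀ (b : ℤ) (H : Finset ℤ), H.card ≤ k → (∀ h ∈ H, h ^ 2 ≤ len q r) →
      |𝔼 x : ZMod (len q r), ∏ h ∈ H, maj (sievePrimes r) (2 ^ r) (len q r) (modulus r) b
        (x + (h : ZMod (len q r))) - 1| ≤ κ := by
  have hlog : Tendsto (fun r : ℕ => ((Nat.log 2 r : ℕ) : ℝ)) atTop atTop :=
    tendsto_natCast_atTop_atTop.comp (tendsto_atTop_atTop.2 fun b => ⟨2 ^ b, fun a ha =>
      Nat.le_log_of_pow_le one_lt_two ha⟩)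
  have h1 : Tendsto (fun r : ℕ => Real.exp (16 ^ k * ((1 + 4 * q * k ^ 2) / (Nat.log 2 r : ℝ))) - 1 +
      3 * ((1 : ℝ) / 2) ^ r) atTop (𝓝 ((Real.exp (16 ^ k * 0) - 1) + 3 * 0)) := by
    refine Tendsto.add ((Real.continuous_exp.tendsto _).comp ((hlog.const_div_atTop _).const_mul _) |>.sub_const 1) ?_
    exact (tendsto_pow_atTop_nhds_zero_of_lt_one (by norm_num) (by norm_num)).const_mul 3
  rw [mul_zero, Real.exp_zero, sub_self, mul_zero, add_zero] at h1
  filter_upwards [h1.eventually_lt_const hκ, eventually_ge_atTop 3] with r h2 hr b H hH hHN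
  refine (abs_expect_prod_maj_sub_le prime_of_mem_sievePrimes Nat.one_le_two_pow (coprime_modulus hr)
    hH hHN).trans (le_trans ?_ h2.le)
  have h3 := sum_error_le (by omega) (by omega) hH hHN
  have h4 := two_pow_mul_le_sqrt_len (r := r) hk hq
  refine add_le_add (sub_le_sub_right (Real.exp_le_exp.2 (mul_le_mul ?_ h3 ?_ (by positivity))) 1) ?_
  · exact pow_le_pow_right₀ (by norm_num) hH
  · exact Finset.sum_nonneg fun p _ => by split_ifs <;> positivity
  · have h5 : (2 : ℝ) ^ r * (2 ^ r) ^ (6 * k) ≤ Nat.sqrt (len q r) := by exact_mod_cast h4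
    have h6 : (0 : ℝ) < Nat.sqrt (len q r) := lt_of_lt_of_le (by positivity) h5
    rw [one_div, inv_pow, div_le_iff₀ h6, mul_assoc, ← div_eq_inv_mul]
    push_cast
    gcongr
    rw [le_div_iff₀ (by positivity)]
    linarith

end Parameters

section Scales
variable {q r k : ℕ}

lemma abs_expect_prod_half_sub_le {N : ℕ} [NeZero N] {g : ZMod N → ℝ} {H : Finset ℤ} {κ : ℝ}
    (h : ∀ T ⊆ H, |𝔼 x, ∏ h ∈ T, g (x + (h : ZMod N)) - 1| ≤ κ) :
    |𝔼 x, ∏ h ∈ H, (g (x + (h : ZMod N)) + 1) / 2 - 1| ≤ κ := by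
  have h2 : (0 : ℝ) < 2 ^ H.card := by positivity
  have h1 : 𝔼 x, ∏ h ∈ H, (g (x + (h : ZMod N)) + 1) / 2 - 1 =
      (∑ T ∈ H.powerset, (𝔼 x, ∏ h ∈ T, g (x + (h : ZMod N)) - 1)) / 2 ^ H.card := by
    rw [Finset.sum_sub_distrib, Finset.sum_const, Finset.card_powerset, nsmul_eq_mul, mul_one]
    push_cast
    rw [sub_div, div_self h2.ne', ← Finset.expect_sum_comm, Finset.expect_div]
    simp only [Finset.prod_div_distrib, Finset.prod_const, Finset.prod_add_one]
  rw [h1, abs_div, abs_of_pos h2, div_le_iff₀ h2]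
  refine (Finset.abs_sum_le_sum_abs _ _).trans ((Finset.sum_le_sum fun T hT =>
    h T (Finset.mem_powerset.1 hT)).trans_eq ?_)
  rw [Finset.sum_const, Finset.card_powerset, nsmul_eq_mul, mul_comm]
  push_cast
  rfl

/-- The slowly growing parameter separating the scales. -/
def slow (r : ℕ) : ℕ := Nat.log 2 (Nat.log 2 r)

/-- Binary logarithms of the scales, in decreasing order. -/
def expo (i r : ℕ) : ℕ := r / slow r ^ i

/-- The binary logarithm of a bound for the majorant. -/
def bexpo (q r : ℕ) : ℕ := 4 * (3 * q * r / Nat.log 2 r) + r / Nat.log 2 r + Nat.log 2 r + 1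

lemma tendsto_log_two : Tendsto (Nat.log 2) atTop atTop :=
  tendsto_atTop_atTop.2 fun b => ⟨2 ^ b, fun _ ha => Nat.le_log_of_pow_le one_lt_two ha⟩

lemma tendsto_slow : Tendsto slow atTop atTop := tendsto_log_two.comp tendsto_log_two

lemma expo_succ (i : ℕ) : expo (i + 1) r = expo i r / slow r := by
  rw [expo, expo, pow_succ, Nat.div_div_eq_div_mul]

lemma expo_succ_le (i : ℕ) : expo (i + 1) r ≤ expo i r := expo_succ i ▸ Nat.div_le_self _ _

lemma eventually_mul_pow_le_two_pow (c i : ℕ) : ∀ᶠ n : ℕ in atTop, c * n ^ i ≤ 2 ^ n := by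
  have h1 := (tendsto_pow_const_div_const_pow_of_one_lt i (one_lt_two (α := ℝ))).const_mul (c : ℝ)
  rw [mul_zero] at h1
  filter_upwards [h1.eventually_le_const one_pos] with n hn
  rw [← mul_div_assoc, div_le_one (by positivity)] at hn
  exact_mod_cast hn

lemma eventually_bexpo_le (q : ℕ) : ∀ᶠ r in atTop, bexpo q r ≤ expo 4 r := by
  filter_upwards [tendsto_slow.eventually (eventually_mul_pow_le_two_pow (26 * (q + 1)) 4),
    tendsto_log_two.eventually (eventually_mul_pow_le_two_pow 4 2), tendsto_slow.eventually_ge_atTop 1,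
    tendsto_log_two.eventually_ge_atTop 1, eventually_ge_atTop 1] with r h1 h2 h3 h4 h5
  have h6 : 26 * (q + 1) * slow r ^ 4 ≤ Nat.log 2 r := h1.trans (Nat.pow_log_le_self 2 (by omega))
  have h7 : 4 * Nat.log 2 r ^ 2 ≤ r := h2.trans (Nat.pow_log_le_self 2 (by omega))
  set u := Nat.log 2 r
  rw [expo, Nat.le_div_iff_mul_le (by positivity)]
  set V := slow r ^ 4
  have h8 : 4 * (3 * q * r / u) + r / u ≤ 13 * (q + 1) * r / u := by
    rw [Nat.le_div_iff_mul_le h4, add_mul, mul_assoc 4]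
    have := Nat.div_mul_le_self (3 * q * r) u
    have := Nat.div_mul_le_self r u
    nlinarith
  have h9 : 13 * (q + 1) * r / u * V * 2 ≤ r := by
    refine Nat.le_of_mul_le_mul_left ?_ (show 0 < u by omega)
    have := Nat.div_mul_le_self (13 * (q + 1) * r) u
    calc _ = 13 * (q + 1) * r / u * u * (V * 2) := by ring
      _ ≤ 13 * (q + 1) * r * (V * 2) := Nat.mul_le_mul_right _ this
      _ = 26 * (q + 1) * V * r := by ring
      _ ≤ u * r := Nat.mul_le_mul_right _ h6
  have h10 : (u + 1) * V * 2 ≤ r := by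
    have : V ≤ u := by nlinarith
    nlinarith
  change (4 * (3 * q * r / u) + r / u + u + 1) * V ≤ r
  rw [add_assoc _ u, add_mul]
  have := Nat.mul_le_mul_right V h8
  omega

lemma maj_le (hq : 5 ≤ q) (hr : 2 ≤ r) {b : ℕ} (hb : 1 ≤ b) (hbW : b < modulus r)
    (x : ZMod (len q r)) :
    maj (sievePrimes r) (2 ^ r) (len q r) (modulus r) b x ≤ 2 ^ bexpo q r := by
  set u := Nat.log 2 r with hu
  have hu0 : 0 < u := Nat.log_pos one_lt_two hr
  have hur : 2 ^ u ≤ r := Nat.pow_log_le_self 2 (by omega)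
  set y := modulus r * x.val + b with hy
  have hcast : (modulus r : ℤ) * (x.val : ℤ) + (b : ℤ) = (y : ℤ) := by push_cast [hy]; rfl
  have hym : y ≤ 2 ^ (3 * q * r) := by
    have h1 : y ≤ modulus r * len q r := by
      have := Nat.mul_le_mul_left (modulus r) (Nat.succ_le_of_lt x.val_lt)
      rw [Nat.succ_eq_add_one, mul_add] at this
      omega
    exact (h1.trans (modulus_mul_len_le hq)).trans (Nat.pow_le_pow_right two_pos (by nlinarith))
  set G := mass (sievePrimes r) (2 ^ r) with hG
  have hG1 : 1 ≤ G := one_le_mass (fun p hp => (prime_of_mem_sievePrimes p hp).two_le) Nat.one_le_two_pow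
  set Z := (sievePrimes r).filter fun p : ℕ => (p : ℤ) ∣ (y : ℤ) with hZ
  have hZc : Z.card ≤ 3 * q * r / u := by
    rw [Nat.le_div_iff_mul_le hu0, mul_comm]
    refine mul_card_le_of_forall_dvd (fun p hp => ?_) (by omega : y ≠ 0) hur hym
    obtain ⟨h1, h2⟩ := Finset.mem_filter.1 hp
    obtain ⟨h3, h4⟩ := Finset.mem_filter.1 h1
    exact ⟨h4, (Finset.mem_Ioc.1 h3).1.le, Int.natCast_dvd_natCast.1 h2⟩
  have hGle : G ≤ 2 ^ (r / u + u + 1) := by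
    have h1 : G ≤ 2 ^ (r / u) * (1 + Real.log ((2 ^ r : ℕ) : ℝ)) := by
      refine mass_le_of_card_le prime_of_mem_sievePrimes fun L hL hLR => ?_
      rw [Nat.le_div_iff_mul_le hu0, mul_comm]
      refine mul_card_le_of_forall_dvd (y := ∏ p ∈ L, p) (fun p hp => ?_)
        (Finset.prod_ne_zero_iff.2 fun p hp => (prime_of_mem_sievePrimes p (hL hp)).ne_zero) hur hLR
      obtain ⟨h3, h4⟩ := Finset.mem_filter.1 (hL hp)
      exact ⟨h4, (Finset.mem_Ioc.1 h3).1.le, Finset.dvd_prod_of_mem _ hp⟩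
    refine h1.trans ?_
    rw [add_assoc, pow_add]
    refine mul_le_mul_of_nonneg_left ?_ (by positivity)
    have h2 : r + 1 ≤ 2 ^ (u + 1) := Nat.lt_pow_succ_log_self one_lt_two r
    have h3 : (r : ℝ) + 1 ≤ 2 ^ (u + 1) := by exact_mod_cast h2
    push_cast
    rw [Real.log_pow]
    nlinarith [Real.log_two_lt_d9]
  have h1 := abs_divsum_le' (R := 2 ^ r) prime_of_mem_sievePrimes (y : ℤ) (P := sievePrimes r)
  have h2 : divsum (sievePrimes r) (2 ^ r) y ^ 2 ≤ (4 ^ (3 * q * r / u) * G) ^ 2 := by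
    rw [← sq_abs]
    refine pow_le_pow_left₀ (abs_nonneg _) (h1.trans ?_) 2
    exact mul_le_mul_of_nonneg_right (pow_le_pow_right₀ (by norm_num) hZc) (by linarith)
  rw [maj, hcast, div_le_iff₀ (by linarith)]
  refine h2.trans ?_
  rw [mul_pow, sq G, ← mul_assoc]
  refine mul_le_mul_of_nonneg_right ?_ (by linarith)
  refine (mul_le_mul_of_nonneg_left hGle (by positivity)).trans_eq ?_
  rw [show (4 : ℝ) = 2 ^ 2 by norm_num, ← pow_mul, ← pow_mul, ← pow_add, bexpo]
  congr 1
  ring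

lemma le_bexpo : Nat.log 2 r ≤ bexpo q r :=
  (Nat.le_add_left _ _).trans (Nat.le_succ _)

lemma tendsto_expo_four : Tendsto (expo 4) atTop atTop :=
  tendsto_atTop_mono' _ ((eventually_bexpo_le 0).mono fun _ h => le_bexpo.trans h) tendsto_log_two

lemma tendsto_expo {i : ℕ} (hi : i ≤ 4) : Tendsto (expo i) atTop atTop :=
  tendsto_atTop_mono (fun r => antitone_nat_of_succ_le (f := fun i => expo i r)
    (fun i => expo_succ_le i) hi) tendsto_expo_four

lemma tendsto_scale {i : ℕ} (hi : i + 1 ≤ 4) (k : ℕ) :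
    Tendsto (fun r => ((2 : ℝ) ^ expo (i + 1) r) ^ k / 2 ^ expo i r) atTop (𝓝 0) := by
  have h1 : Tendsto (fun r => ((1 : ℝ) / 2) ^ expo (i + 1) r) atTop (𝓝 0) :=
    (tendsto_pow_atTop_nhds_zero_of_lt_one (by norm_num) (by norm_num)).comp (tendsto_expo hi)
  refine squeeze_zero' (Eventually.of_forall fun r => by positivity) ?_ h1
  filter_upwards [tendsto_slow.eventually_ge_atTop (k + 1)] with r hr
  rw [one_div, inv_pow, div_le_iff₀ (by positivity), ← div_eq_inv_mul, le_div_iff₀ (by positivity),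
    ← pow_mul, ← pow_add]
  refine pow_le_pow_right₀ one_le_two ?_
  have h2 := Nat.div_mul_le_self (expo i r) (slow r)
  rw [← expo_succ] at h2
  nlinarith

lemma eventually_sq_le_len (hq : 100 ≤ q) (k : ℕ) :
    ∀ᶠ r in atTop, (modulus r * (2 ^ expo 1 r) ^ k) ^ 2 ≤ len q r := by
  filter_upwards [tendsto_slow.eventually_ge_atTop k, eventually_ge_atTop 10] with r h1 h2
  refine le_trans ?_ (two_pow_le_len (by omega))
  have h3 : expo 1 r * k ≤ r := by
    rw [expo, pow_one]
    exact (Nat.mul_le_mul_left _ h1).trans (Nat.div_mul_le_self _ _)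
  refine (Nat.pow_le_pow_left (Nat.mul_le_mul modulus_le
    ((pow_mul 2 _ _).symm.trans_le (Nat.pow_le_pow_right two_pos h3))) 2).trans ?_
  rw [← pow_add, ← pow_mul]
  refine Nat.pow_le_pow_right two_pos ?_
  have : 98 * r ≤ (q - 2) * r := Nat.mul_le_mul_right _ (by omega)
  omega

/-- The weighted system defined by the Selberg majorants along a sequence of stages. -/
noncomputable def selbergSys (k q : ℕ) (hk : 1 ≤ k) (hq : 100 * k ≤ q) (ρ b : ℕ → ℕ)
    (hρ : Tendsto ρ atTop atTop) (hb : ∀ j, 1 ≤ b j ∧ b j < modulus (ρ j))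
    (hB : ∀ j, 2 ≤ ρ j ∧ bexpo q (ρ j) ≤ expo 4 (ρ j)) : Sys k where
  N j := len q (ρ j)
  N_ne _ := inferInstance
  W j := modulus (ρ j)
  W_pos j := by have := modulus_ge (r := ρ j); omega
  ν j x := (maj (sievePrimes (ρ j)) (2 ^ ρ j) (len q (ρ j)) (modulus (ρ j)) (b j) x + 1) / 2
  L i j := 2 ^ expo (3 - (i : ℕ)) (ρ j)
  B j := 2 ^ expo 4 (ρ j)
  one_le_B j := one_le_pow₀ one_le_two
  nonneg j x := by
    have := one_le_mass (R := 2 ^ ρ j) (fun p hp => (prime_of_mem_sievePrimes p hp).two_le) Nat.one_le_two_pow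
      (P := sievePrimes (ρ j))
    rw [maj]
    positivity
  le_B j x := by
    have h1 := maj_le (q := q) (by omega) (hB j).1 (hb j).1 (hb j).2 x
    have h2 : (2 : ℝ) ^ bexpo q (ρ j) ≤ 2 ^ expo 4 (ρ j) := pow_le_pow_right₀ one_le_two (hB j).2
    have h3 : (1 : ℝ) ≤ 2 ^ expo 4 (ρ j) := one_le_pow₀ one_le_two
    linarith
  L_pos i j := Nat.one_le_two_pow
  L_mono j := ⟨Nat.pow_le_pow_right two_pos (expo_succ_le 2), Nat.pow_le_pow_right two_pos (expo_succ_le 1)⟩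
  B_L i := by simpa [Function.comp_def] using (tendsto_scale (i := 3) (by norm_num) i).comp hρ
  L01 i := by simpa [Function.comp_def] using (tendsto_scale (i := 2) (by norm_num) i).comp hρ
  L12 i := by simpa [Function.comp_def] using (tendsto_scale (i := 1) (by norm_num) i).comp hρ
  LN i := (hρ.eventually (eventually_sq_le_len (show 100 ≤ q by omega) i)).mono fun j hj => by exact_mod_cast hj
  linear_forms κ hκ := (hρ.eventually (maj_linear_forms hk hq hκ)).mono fun j hj H hH hHN =>
    abs_expect_prod_half_sub_le fun T hT => hj (b j) T ((Finset.card_le_card hT).trans hH)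
      fun h hh => hHN h (hT hh)

end Scales

section Density
variable {q r : ℕ}

lemma primeFactors_modulus (hr : 3 ≤ r) :
    (modulus r).primeFactors = (Finset.Icc 1 r).filter Nat.Prime := by
  ext p
  rw [Nat.mem_primeFactors_of_ne_zero (by have := modulus_ge (r := r); omega), Finset.mem_filter,
    Finset.mem_Icc]
  refine ⟨fun ⟨h1, h2⟩ => ⟨⟨h1.one_lt.le, ?_⟩, h1⟩, fun ⟨h1, h2⟩ => ⟨h2, ?_⟩⟩
  · rw [modulus, h1.dvd_mul, show 24 = 2 ^ 3 * 3 by norm_num, h1.dvd_mul, h1.dvd_primorial_iff] at h2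
    rcases h2 with (h | h) | h
    · have := Nat.le_of_dvd two_pos (h1.dvd_of_dvd_pow h); omega
    · have := Nat.le_of_dvd three_pos h; omega
    · exact h
  · exact (h2.dvd_primorial_iff.2 h1.2).mul_left _

lemma totient_modulus_mul_le (hr : 3 ≤ r) :
    ((modulus r).totient : ℝ) * (r * Real.log 2) ≤ 2 * modulus r * mass (sievePrimes r) (2 ^ r) := by
  have h1 := log_le_mass (Nat.lt_two_pow_self (n := r)).le
  have h2 : ((modulus r).totient : ℝ) * ∏ p ∈ (Finset.Icc 1 r).filter Nat.Prime,
      (1 + ((p : ℝ) - 1)⁻¹) = modulus r := by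
    have h3 : ((modulus r).totient : ℝ) = modulus r * ∏ p ∈ (modulus r).primeFactors, (1 - (p : ℝ)⁻¹) := by
      have h := congrArg (Rat.cast : ℚ → ℝ) (Nat.totient_eq_mul_prod_factors (modulus r))
      push_cast at h
      exact h
    rw [h3, primeFactors_modulus hr, mul_assoc, ← Finset.prod_mul_distrib, Finset.prod_congr rfl fun p hp => ?_,
      Finset.prod_const_one, mul_one]
    have : (2 : ℝ) ≤ p := by exact_mod_cast (Finset.mem_filter.1 hp).2.two_le
    have : (p : ℝ) - 1 ≠ 0 := by linarith
    field_simp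
    ring
  push_cast at h1
  rw [Real.log_pow] at h1
  calc _ ≤ ((modulus r).totient : ℝ) * (2 * (mass (sievePrimes r) (2 ^ r) *
        ∏ p ∈ (Finset.Icc 1 r).filter Nat.Prime, (1 + ((p : ℝ) - 1)⁻¹))) :=
        mul_le_mul_of_nonneg_left h1 (by positivity)
    _ = _ := by rw [← h2]; ring

/-- Primes congruent to `11` modulo `24` in a geometric block. -/
def blockPrimes (q r : ℕ) : Finset ℕ :=
  (Finset.Ico (2 ^ (q * r)) (2 ^ (q * (r + 1)))).filter fun n => n.Prime ∧ n % 24 = 11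

open ArithmeticFunction.vonMangoldt in
lemma sum_block_le {x : ℝ} (hx : 1 < x) :
    ∑ n ∈ (Finset.Ico (2 ^ (q * r)) (2 ^ (q * (r + 1))) : Finset ℕ),
      (if n.Prime then residueClass (11 : ZMod 24) n else 0) / (n : ℝ) ^ x ≤
      (blockPrimes q r).card * (q * (r + 1)) * ((2 : ℝ) ^ (q * r))⁻¹ * ((2 : ℝ) ^ (-(q * (x - 1)))) ^ r := by
  have hQ : ((2 : ℝ) ^ (q * r))⁻¹ * ((2 : ℝ) ^ (-(q * (x - 1)))) ^ r = (((2 : ℝ) ^ (q * r)) ^ x)⁻¹ := by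
    rw [← Real.rpow_natCast, ← Real.rpow_natCast, ← Real.rpow_mul two_pos.le, ← Real.rpow_mul two_pos.le,
      ← Real.rpow_neg two_pos.le, ← Real.rpow_neg two_pos.le, ← Real.rpow_add two_pos]
    push_cast
    ring_nf
  rw [mul_assoc _ (_⁻¹), hQ, mul_assoc, ← nsmul_eq_mul, ← Finset.sum_const, blockPrimes, Finset.sum_filter]
  refine Finset.sum_le_sum fun n hn => ?_
  obtain ⟨h1, h2⟩ := Finset.mem_Ico.1 hn
  by_cases hp : n.Prime
  swap
  · rw [if_neg hp, if_neg fun h => hp h.1, zero_div]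
  by_cases ha : n % 24 = 11
  swap
  · have : n ∉ {n : ℕ | (n : ZMod 24) = 11} := fun h =>
      ha ((ZMod.natCast_eq_natCast_iff' n 11 24).1 h)
    rw [if_pos hp, if_neg fun h => ha h.2, residueClass, Set.indicator_of_notMem this, zero_div]
  have hn0 : (0 : ℝ) < n := by exact_mod_cast hp.pos
  have h3 : (2 : ℝ) ^ (q * r) ≤ n := by exact_mod_cast h1
  have h4 : (n : ℝ) ≤ 2 ^ (q * (r + 1)) := by exact_mod_cast h2.le
  rw [if_pos hp, if_pos ⟨hp, ha⟩, div_eq_mul_inv]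
  refine mul_le_mul ((residueClass_le _ _).trans ?_) (inv_anti₀ (by positivity)
    (Real.rpow_le_rpow (by positivity) h3 (by linarith))) (by positivity) (by positivity)
  rw [ArithmeticFunction.vonMangoldt_apply_prime hp]
  refine (Real.log_le_log hn0 h4).trans ?_
  rw [Real.log_pow]
  push_cast
  exact mul_le_of_le_one_right (by positivity) (by linarith [Real.log_two_lt_d9])

lemma sum_geom_le {t : ℝ} (hq : 1 ≤ q) (ht : 0 < t) (n : ℕ) :
    ∑ r ∈ Finset.range n, ((2 : ℝ) ^ (-(q * t))) ^ r ≤ 1 + 2 / t := by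
  set y := q * t * Real.log 2 with hy
  have hq' : (1 : ℝ) ≤ q := by exact_mod_cast hq
  have hyt : t / 2 ≤ y := by
    have : t ≤ q * t := le_mul_of_one_le_left ht.le hq'
    nlinarith [Real.log_two_gt_d9]
  have hy0 : 0 < y := by linarith
  have hz : (2 : ℝ) ^ (-(q * t)) = Real.exp (-y) := by
    rw [Real.rpow_def_of_pos two_pos, hy]
    ring_nf
  have hz1 : Real.exp (-y) < 1 := Real.exp_lt_one_iff.2 (by linarith)
  rw [hz]
  refine ((summable_geometric_of_lt_one (Real.exp_pos _).le hz1).sum_le_tsum _ fun _ _ => by positivity).trans ?_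
  rw [tsum_geometric_of_lt_one (Real.exp_pos _).le hz1]
  have h1 : Real.exp (-y) ≤ (1 + y)⁻¹ := by
    rw [Real.exp_neg]
    exact inv_anti₀ (by positivity) (by linarith [Real.add_one_le_exp y])
  have h2 : (1 - Real.exp (-y))⁻¹ ≤ 1 + 1 / y := by
    have h3 : 1 - (1 + y)⁻¹ = y / (1 + y) := by
      field_simp
      ring
    have h4 : 1 + 1 / y = (1 - (1 + y)⁻¹)⁻¹ := by
      rw [h3, inv_div]
      field_simp
      ring
    rw [h4]
    refine inv_anti₀ ?_ (by linarith)
    rw [sub_pos]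
    exact inv_lt_one_of_one_lt₀ (by linarith)
  refine h2.trans ?_
  rw [add_le_add_iff_left, div_le_div_iff₀ hy0 ht]
  linarith

open ArithmeticFunction.vonMangoldt in
lemma frequently_card_blockPrimes (hq : 1 ≤ q) :
    ∃ᶠ r in atTop, (2 : ℝ) ^ (q * r) ≤ 64 * q * r * (blockPrimes q r).card := by
  intro hcon
  obtain ⟨r₀, hr₀⟩ := eventually_atTop.1 hcon
  obtain ⟨C, hC⟩ := LSeries_residueClass_lower_bound (a := (11 : ZMod 24))
    ((ZMod.isUnit_iff_coprime 11 24).2 (by norm_num))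
  have hS := summable_residueClass_non_primes_div (11 : ZMod 24)
  set G : ℕ → ℝ := fun n => (if n.Prime then 0 else residueClass (11 : ZMod 24) n) / (n : ℝ) with hG
  set r₁ := r₀ + 1
  set K := ∑ n ∈ Finset.range (2 ^ (q * r₁)), residueClass (11 : ZMod 24) n / n
  have hpow : ∀ {x : ℝ}, 1 < x → ∀ n : ℕ, ∀ {A : ℝ}, 0 ≤ A → A / (n : ℝ) ^ x ≤ A / n := by
    intro x hx n A hA
    rcases Nat.eq_zero_or_pos n with rfl | hn
    · simp [Real.zero_rpow (show x ≠ 0 by linarith)]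
    · have hn' : (1 : ℝ) ≤ n := by exact_mod_cast hn
      exact div_le_div_of_nonneg_left hA (by linarith) (Real.self_le_rpow_of_one_le hn' hx.le)
  have hmain : ∀ x : ℝ, 1 < x →
      ∑' n : ℕ, residueClass (11 : ZMod 24) n / (n : ℝ) ^ x ≤ K + 1 / 32 * (1 + 2 / (x - 1)) + ∑' n, G n := by
    intro x hx
    set F : ℕ → ℝ := fun n => (if n.Prime then residueClass (11 : ZMod 24) n else 0) / (n : ℝ) ^ x with hF
    have hF0 : ∀ n, 0 ≤ F n := fun n => by
      have := residueClass_nonneg (11 : ZMod 24) n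
      rw [hF]
      positivity
    set z := (2 : ℝ) ^ (-(q * (x - 1)))
    have hz0 : 0 ≤ z := by positivity
    have hblk : ∀ r, r₁ ≤ r → ∑ n ∈ Finset.range (2 ^ (q * r)), F n ≤
        K + 1 / 32 * ∑ i ∈ Finset.range r, z ^ i := by
      intro r hr
      induction r, hr using Nat.le_induction with
      | base =>
        refine (Finset.sum_le_sum fun n _ => ?_).trans (le_add_of_nonneg_right (by positivity))
        refine (hpow hx n ?_).trans ?_
        · split_ifs
          exacts [residueClass_nonneg _ _, le_rfl]
        · refine div_le_div_of_nonneg_right ?_ (by positivity)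
          split_ifs
          exacts [le_rfl, residueClass_nonneg _ _]
      | succ r hr ih =>
        have h1 := hr₀ r (by omega)
        rw [not_le] at h1
        have hr1 : (1 : ℝ) ≤ r := by exact_mod_cast (by omega : 1 ≤ r)
        rw [← Finset.sum_range_add_sum_Ico F (Nat.pow_le_pow_right two_pos
          (Nat.mul_le_mul_left q (Nat.le_succ r))), Finset.sum_range_succ, mul_add, ← add_assoc]
        refine add_le_add ih ((sum_block_le hx).trans ?_)
        refine mul_le_mul_of_nonneg_right ?_ (by positivity)
        rw [← div_eq_mul_inv, div_le_iff₀ (by positivity)]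
        have h2 : (0 : ℝ) ≤ (blockPrimes q r).card * q := by positivity
        nlinarith
    refine Real.tsum_le_of_sum_range_le (fun n => by have := residueClass_nonneg (11 : ZMod 24) n; positivity)
      fun n => ?_
    have h1 : ∀ i, residueClass (11 : ZMod 24) i / (i : ℝ) ^ x ≤ F i + G i := fun i => by
      simp only [hF, hG]
      split_ifs
      · rw [zero_div, add_zero]
      · rw [zero_div, zero_add]
        exact hpow hx i (residueClass_nonneg _ _)
    refine (Finset.sum_le_sum fun i _ => h1 i).trans ?_
    rw [Finset.sum_add_distrib]
    refine add_le_add ?_ (hS.sum_le_tsum _ fun i _ => ?_)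
    · have h2 : n ≤ 2 ^ (q * (n + r₁)) := Nat.lt_two_pow_self.le.trans
        (Nat.pow_le_pow_right two_pos (by nlinarith))
      refine (Finset.sum_le_sum_of_subset_of_nonneg (Finset.range_mono h2) fun i _ _ => hF0 i).trans
        ((hblk (n + r₁) (Nat.le_add_left _ _)).trans ?_)
      have := sum_geom_le hq (show 0 < x - 1 by linarith) (n + r₁)
      linarith
    · have := residueClass_nonneg (11 : ZMod 24) i
      positivity
  set M := |C + K + 1 / 32 + ∑' n, G n| with hM
  set t : ℝ := 1 / (16 * (M + 1)) with ht
  have hM0 : 0 ≤ M := abs_nonneg _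
  have ht0 : 0 < t := by positivity
  have ht1 : t ≤ 1 := by
    rw [ht, div_le_one (by positivity)]
    linarith
  have h1 := hC (x := 1 + t) ⟨by linarith, by linarith⟩
  have h2 := hmain (1 + t) (by linarith)
  rw [show Nat.totient 24 = 8 by decide, add_sub_cancel_left] at h1
  rw [add_sub_cancel_left] at h2
  have h3 : 1 / t = 16 * (M + 1) := by rw [ht, one_div_one_div]
  have h4 := le_abs_self (C + K + 1 / 32 + ∑' n, G n)
  have h5 : (((8 : ℕ) : ℝ))⁻¹ / t = 2 * (M + 1) := by
    rw [div_eq_mul_one_div, h3]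
    push_cast
    ring
  rw [h5] at h1
  rw [show 2 / t = 2 * (1 / t) by ring, h3] at h2
  linarith

end Density

section Main
variable {q r k : ℕ}

lemma coprime_of_mem_blockPrimes (hq : 2 ≤ q) (hr : 3 ≤ r) {n : ℕ} (hn : n ∈ blockPrimes q r) :
    n.Coprime (modulus r) := by
  obtain ⟨h1, h2, -⟩ := Finset.mem_filter.1 hn
  refine (Nat.Prime.coprime_iff_not_dvd h2).2 fun h => ?_
  have h3 := primeFactors_modulus hr ▸ Nat.mem_primeFactors.2 ⟨h2, h, by have := modulus_ge (r := r); omega⟩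
  have h4 := (Finset.mem_Icc.1 (Finset.mem_filter.1 h3).1).2
  have h5 : r < 2 ^ (q * r) := Nat.lt_two_pow_self.trans_le (Nat.pow_le_pow_right two_pos (by nlinarith))
  have := (Finset.mem_Ico.1 h1).1
  omega

lemma exists_residue (hq : 2 ≤ q) (hr : 3 ≤ r) (hA : 0 < (blockPrimes q r).card) :
    ∃ b, 1 ≤ b ∧ b < modulus r ∧ b % 24 = 11 ∧ ((blockPrimes q r).card : ℝ) / (modulus r).totient ≤
      ((blockPrimes q r).filter (· % modulus r = b)).card := by
  have hW : 0 < modulus r := by have := modulus_ge (r := r); omega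
  have hφ : (0 : ℝ) < (modulus r).totient := by exact_mod_cast Nat.totient_pos.2 hW
  have hmap : ∀ n ∈ blockPrimes q r, n % modulus r ∈ (Finset.range (modulus r)).filter (modulus r).Coprime :=
    fun n hn => Finset.mem_filter.2 ⟨Finset.mem_range.2 (Nat.mod_lt _ hW), by
      rw [Nat.coprime_comm, Nat.Coprime, ← Nat.gcd_rec, Nat.gcd_comm]
      exact coprime_of_mem_blockPrimes hq hr hn⟩
  obtain ⟨n₀, hn₀⟩ := Finset.card_pos.1 hA
  obtain ⟨b, hb, hcard⟩ := Finset.exists_le_card_fiber_of_nsmul_le_card_of_maps_to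
    (b := ((blockPrimes q r).card : ℝ) / (modulus r).totient) hmap ⟨_, hmap n₀ hn₀⟩ (by
      rw [← Nat.totient_eq_card_coprime, nsmul_eq_mul, mul_div_cancel₀ _ hφ.ne'])
  obtain ⟨h1, h2⟩ := Finset.mem_filter.1 hb
  have h3 : (0 : ℝ) < ((blockPrimes q r).filter (· % modulus r = b)).card :=
    lt_of_lt_of_le (div_pos (by exact_mod_cast hA) hφ) hcard
  obtain ⟨n, hn⟩ := Finset.card_pos.1 (show 0 < ((blockPrimes q r).filter (· % modulus r = b)).card by
    exact_mod_cast h3)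
  obtain ⟨h4, h5⟩ := Finset.mem_filter.1 hn
  have h6 : b % 24 = 11 := by
    rw [← h5, Nat.mod_mod_of_dvd n (Dvd.intro _ rfl : 24 ∣ modulus r)]
    exact (Finset.mem_filter.1 h4).2.2
  exact ⟨b, by omega, Finset.mem_range.1 h1, h6, hcard⟩

/-- The restriction of the majorant to a block of primes. -/
noncomputable def primeWeight (q r b : ℕ) (x : ZMod (len q r)) : ℝ :=
  if modulus r * x.val + b ∈ blockPrimes q r then mass (sievePrimes r) (2 ^ r) / 2 else 0

lemma one_le_mass_sievePrimes : 1 ≤ mass (sievePrimes r) (2 ^ r) :=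
  one_le_mass (fun p hp => (prime_of_mem_sievePrimes p hp).two_le) Nat.one_le_two_pow

lemma maj_nonneg {b : ℤ} (x : ZMod (len q r)) :
    0 ≤ maj (sievePrimes r) (2 ^ r) (len q r) (modulus r) b x :=
  div_nonneg (sq_nonneg _) (zero_le_one.trans one_le_mass_sievePrimes)

lemma divsum_of_mem_blockPrimes (hq : 2 ≤ q) (hr : 1 ≤ r) {n : ℕ} (hn : n ∈ blockPrimes q r) :
    divsum (sievePrimes r) (2 ^ r) n = mass (sievePrimes r) (2 ^ r) := by
  obtain ⟨h1, h2, -⟩ := Finset.mem_filter.1 hn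
  rw [divsum, ← lam_empty]
  refine Finset.sum_eq_single_of_mem ∅ (by simp) fun D hD hne => ?_
  obtain ⟨h3, h4⟩ := Finset.mem_filter.1 hD
  obtain ⟨p, hp⟩ := Finset.nonempty_iff_ne_empty.2 hne
  have h5 := Finset.mem_powerset.1 h3 hp
  have h6 := (Nat.prime_dvd_prime_iff_eq (prime_of_mem_sievePrimes p h5) h2).1
    (Int.natCast_dvd_natCast.1 (h4 p hp))
  have h7 := (Finset.mem_Ioc.1 (Finset.mem_filter.1 h5).1).2
  have h8 : 2 ^ r < 2 ^ (q * r) := Nat.pow_lt_pow_right one_lt_two (by nlinarith)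
  have := (Finset.mem_Ico.1 h1).1
  omega

lemma primeWeight_le (hq : 2 ≤ q) (hr : 1 ≤ r) {b : ℕ} (x : ZMod (len q r)) :
    primeWeight q r b x ≤ (maj (sievePrimes r) (2 ^ r) (len q r) (modulus r) b x + 1) / 2 := by
  have h0 := one_le_mass_sievePrimes (r := r)
  rw [primeWeight]
  split_ifs with h
  · have h1 := divsum_of_mem_blockPrimes hq hr h
    push_cast at h1
    rw [maj, h1, sq, mul_self_div_self]
    linarith
  · have := maj_nonneg (b := b) x
    positivity

lemma le_expect_primeWeight (hq : 5 ≤ q) (hr : 3 ≤ r) {b : ℕ} (hb : b < modulus r)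
    (hA : (2 : ℝ) ^ (q * r) ≤ 64 * q * r * (blockPrimes q r).card)
    (hbA : ((blockPrimes q r).card : ℝ) / (modulus r).totient ≤
      ((blockPrimes q r).filter (· % modulus r = b)).card) :
    Real.log 2 / (1024 * q * 2 ^ q) ≤ 𝔼 x, primeWeight q r b x := by
  have hW0 : 0 < modulus r := by have := modulus_ge (r := r); omega
  have hW : (0 : ℝ) < modulus r := by exact_mod_cast hW0
  have hφ : (0 : ℝ) < (modulus r).totient := by exact_mod_cast Nat.totient_pos.2 hW0
  have hN : (0 : ℝ) < len q r := by exact_mod_cast Nat.pos_of_neZero (len q r)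
  have hq0 : (0 : ℝ) < q := by exact_mod_cast (by omega : 0 < q)
  have hr0 : (0 : ℝ) < r := by exact_mod_cast (by omega : 0 < r)
  have hl : 0 < Real.log 2 := Real.log_pos one_lt_two
  set G := mass (sievePrimes r) (2 ^ r) with hG
  have hG1 : 1 ≤ G := one_le_mass_sievePrimes
  set A := ((blockPrimes q r).filter (· % modulus r = b)).card with hAdef
  have h1 : (A : ℝ) * (G / 2) ≤ ∑ x, primeWeight q r b x := by
    have h2 := sum_zmod (N := len q r) fun n => if modulus r * n + b ∈ blockPrimes q r then G / 2 else 0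
    change _ ≤ ∑ x : ZMod (len q r), if modulus r * x.val + b ∈ blockPrimes q r then G / 2 else 0
    rw [h2, ← Finset.sum_filter, Finset.sum_const, nsmul_eq_mul]
    refine mul_le_mul_of_nonneg_right ?_ (by linarith)
    have h3 : A ≤ ((Finset.range (len q r)).filter fun n => modulus r * n + b ∈ blockPrimes q r).card := by
      refine Finset.card_le_card_of_injOn (· / modulus r) (fun n hn => ?_) fun m hm n hn hmn => ?_
      · obtain ⟨h4, h5⟩ := Finset.mem_filter.1 (Finset.mem_coe.1 hn)
        have h6 := Nat.div_add_mod n (modulus r)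
        rw [h5] at h6
        refine Finset.mem_coe.2 (Finset.mem_filter.2 ⟨Finset.mem_range.2 ?_, by rwa [h6]⟩)
        rw [Nat.div_lt_iff_lt_mul hW0, mul_comm]
        exact ((Finset.mem_Ico.1 (Finset.mem_filter.1 h4).1).2.trans_le
          (Nat.pow_le_pow_right two_pos (by omega))).trans lt_modulus_mul_len
      · have h5 := (Finset.mem_filter.1 (Finset.mem_coe.1 hm)).2
        have h6 := (Finset.mem_filter.1 (Finset.mem_coe.1 hn)).2
        rw [← Nat.div_add_mod m (modulus r), ← Nat.div_add_mod n (modulus r), h5, h6]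
        exact congrArg (fun t => modulus r * t + b) hmn
    exact_mod_cast h3
  rw [Finset.expect_eq_sum_div_card, Finset.card_univ, ZMod.card, le_div_iff₀ hN]
  refine le_trans ?_ h1
  have h2 := totient_modulus_mul_le hr
  rw [div_le_iff₀ hφ] at hbA
  have h3 : (modulus r : ℝ) * len q r ≤ 4 * (2 ^ (q * r) * 2 ^ q) := by
    have h4 := modulus_mul_len_le (q := q) (r := r) hq
    rw [show q * (r + 1) + 2 = 2 + (q * r + q) by ring, pow_add, pow_add] at h4
    exact_mod_cast h4
  have h5 : (2 : ℝ) ^ (q * r) * Real.log 2 ≤ 128 * q * (A * (modulus r * G)) := by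
    calc _ ≤ 64 * q * r * (A * (modulus r).totient) * Real.log 2 := by
          refine mul_le_mul_of_nonneg_right (hA.trans ?_) hl.le
          exact mul_le_mul_of_nonneg_left hbA (by positivity)
      _ = 64 * q * A * ((modulus r).totient * (r * Real.log 2)) := by ring
      _ ≤ 64 * q * A * (2 * modulus r * G) := mul_le_mul_of_nonneg_left h2 (by positivity)
      _ = _ := by ring
  rw [div_mul_eq_mul_div, div_le_iff₀ (by positivity)]
  refine le_of_mul_le_mul_left ?_ hW
  calc (modulus r : ℝ) * (Real.log 2 * len q r) = Real.log 2 * (modulus r * len q r) := by ring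
    _ ≤ Real.log 2 * (4 * (2 ^ (q * r) * 2 ^ q)) := mul_le_mul_of_nonneg_left h3 hl.le
    _ = 4 * 2 ^ q * (2 ^ (q * r) * Real.log 2) := by ring
    _ ≤ 4 * 2 ^ q * (128 * q * (A * (modulus r * G))) := mul_le_mul_of_nonneg_left h5 (by positivity)
    _ = _ := by ring

lemma add_mem_blockPrimes {b n c : ℕ} {x : ZMod (len q r)} (hc : c ≤ 25) (hn : 1 ≤ n) {l : ℕ} (hnl : n < l)
    (hl : (modulus r * l ^ 2) ^ 2 ≤ len q r) (hx : primeWeight q r b x ≠ 0)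
    (hy : primeWeight q r b (x + (((modulus r : ℤ) * (c * (n : ℤ) ^ 2) : ℤ) : ZMod (len q r))) ≠ 0) :
    modulus r * x.val + b + c * (modulus r * n) ^ 2 ∈ blockPrimes q r := by
  have hx' := (ite_ne_right_iff.1 hx).1
  have hy' := (ite_ne_right_iff.1 hy).1
  set W := modulus r
  have hW : 24 ≤ W := modulus_ge
  have h1 : 2 * x.val < len q r := by
    have h2 := (Finset.mem_Ico.1 (Finset.mem_filter.1 hx').1).2
    have h3 := lt_modulus_mul_len (q := q) (r := r)
    rw [pow_succ] at h3
    change _ < W * _ at h3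
    refine Nat.lt_of_mul_lt_mul_left (a := W) ?_
    rw [mul_left_comm]
    omega
  have h2 : 2 * (W * (c * n ^ 2)) ≤ len q r := by
    refine le_trans ?_ hl
    have h3 : n ^ 2 ≤ l ^ 2 := Nat.pow_le_pow_left hnl.le 2
    have h4 : 4 ≤ l ^ 2 := by nlinarith
    have h5 : 50 ≤ W * l ^ 2 := by nlinarith
    calc 2 * (W * (c * n ^ 2)) ≤ 2 * (W * (25 * l ^ 2)) := by gcongr
      _ = 50 * (W * l ^ 2) := by ring
      _ ≤ _ := by rw [sq (W * l ^ 2)]; exact Nat.mul_le_mul_right _ h5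
  have h3 : (x + (((W : ℤ) * (c * (n : ℤ) ^ 2) : ℤ) : ZMod (len q r))).val = x.val + W * (c * n ^ 2) := by
    have h4 := val_natCast_add_intCast (N := len q r) (n := x.val) (h := (W : ℤ) * (c * (n : ℤ) ^ 2))
      (by positivity) (by
        have : x.val + W * (c * n ^ 2) < len q r := by omega
        exact_mod_cast this)
    rw [ZMod.natCast_zmod_val] at h4
    exact_mod_cast h4
  rw [h3] at hy'
  rwa [show W * x.val + b + c * (W * n) ^ 2 = W * (x.val + W * (c * n ^ 2)) + b by ring]

theorem exists_prime_pattern (hk : 2 ^ 16 ≤ k) (M : ℕ) : ∃ m n : ℕ, M < m ∧ 0 < n ∧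
    ∀ c ∈ ({0, 16, 25} : Set ℕ), (m + c * n ^ 2).Prime ∧ (m + c * n ^ 2) % 24 = 11 := by
  have hk1 : 1 ≤ k := Nat.one_le_two_pow.trans hk
  obtain ⟨q, hq⟩ : ∃ q, q = 100 * k := ⟨_, rfl⟩
  have hq1 : 100 ≤ q := by omega
  obtain ⟨ρ, hρ, hρP⟩ := extraction_of_frequently_atTop
    ((frequently_card_blockPrimes (q := q) (by omega)).and_eventually
      ((eventually_ge_atTop 3).and (eventually_bexpo_le q)))
  have hpos : ∀ j, 0 < (blockPrimes q (ρ j)).card := fun j => by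
    by_contra! h
    have h1 := (hρP j).1
    rw [Nat.le_zero.1 h, Nat.cast_zero, mul_zero] at h1
    exact absurd h1 (not_le.2 (by positivity))
  choose b hb1 hbW hb24 hbA using fun j => exists_residue (by omega) (hρP j).2.1 (hpos j)
  let S := selbergSys k q hk1 hq.ge ρ b hρ.tendsto_atTop (fun j => ⟨hb1 j, hbW j⟩)
    fun j => ⟨by have := (hρP j).2.1; omega, (hρP j).2.2⟩
  have hpat := S.exists_pattern hk (fun j x => by
      have h : 0 ≤ maj (sievePrimes (ρ j)) (2 ^ ρ j) (len q (ρ j)) (modulus (ρ j)) (b j) x := maj_nonneg x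
      change 1 / 2 ≤ (maj (sievePrimes (ρ j)) (2 ^ ρ j) (len q (ρ j)) (modulus (ρ j)) (b j) x + 1) / 2
      linarith)
    (f := fun j x => primeWeight q (ρ j) (b j) x)
    (fun j x => by
      have h := one_le_mass_sievePrimes (r := ρ j)
      change 0 ≤ ite _ _ _
      split_ifs
      · positivity
      · exact le_rfl)
    (fun j x => primeWeight_le (by omega) (by have := (hρP j).2.1; omega) x)
    (δ := Real.log 2 / (1024 * q * 2 ^ q))
    (div_pos (Real.log_pos one_lt_two) (by have : (0 : ℝ) < q := by exact_mod_cast (by omega : 0 < q)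
                                           positivity))
    (Eventually.of_forall fun j =>
      le_expect_primeWeight (by omega) (hρP j).2.1 (hbW j) (hρP j).1 (hbA j))
  obtain ⟨j, ⟨x, n, hn1, hnL, h0, h16, h25⟩, hLN, hM⟩ := (hpat.and
    ((hρ.tendsto_atTop.eventually (eventually_sq_le_len hq1 2)).and
      (hρ.tendsto_atTop.eventually_ge_atTop M))).exists
  have hW := modulus_ge (r := ρ j)
  have h0' : modulus (ρ j) * ZMod.val (n := len q (ρ j)) x + b j ∈ blockPrimes q (ρ j) := (ite_ne_right_iff.1 h0).1
  refine ⟨modulus (ρ j) * ZMod.val (n := len q (ρ j)) x + b j, modulus (ρ j) * n, ?_, by positivity, fun c hc => ?_⟩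
  · have h1 := (Finset.mem_Ico.1 (Finset.mem_filter.1 h0').1).1
    have h2 : ρ j < 2 ^ (q * ρ j) := Nat.lt_two_pow_self.trans_le
      (Nat.pow_le_pow_right two_pos (Nat.le_mul_of_pos_left _ (by omega)))
    omega
  · refine (Finset.mem_filter.1 (show _ ∈ blockPrimes q (ρ j) from ?_)).2
    rcases hc with rfl | rfl | rfl
    · rwa [zero_mul, add_zero]
    · exact add_mem_blockPrimes (by norm_num) hn1 hnL hLN h0 h16
    · exact add_mem_blockPrimes le_rfl hn1 hnL hLN h0 h25

end Main

end

end PolyPattern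
/-- There are infinitely many pairs `(m, n)` of positive integers for which `m`, `m+16n²` and
`m+25n²` are all primes congruent to `11` modulo `24`. -/
theorem infinitely_many_good_pairs :
    {p : ℕ × ℕ | 0 < p.1 ∧ 0 < p.2 ∧
      Nat.Prime p.1 ∧ Nat.Prime (p.1 + 16 * p.2 ^ 2) ∧ Nat.Prime (p.1 + 25 * p.2 ^ 2) ∧
      p.1 % 24 = 11 ∧ (p.1 + 16 * p.2 ^ 2) % 24 = 11 ∧
      (p.1 + 25 * p.2 ^ 2) % 24 = 11}.Infinite := by
  refine Set.Infinite.of_image Prod.fst (Set.infinite_of_forall_exists_gt fun M => ?_)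
  obtain ⟨m, n, hm, hn, h⟩ := PolyPattern.exists_prime_pattern le_rfl M
  have h0 := h 0 (by simp)
  have h1 := h 16 (by simp)
  have h2 := h 25 (by simp)
  rw [zero_mul, add_zero] at h0
  exact ⟨m, ⟨(m, n), ⟨h0.1.pos, hn, h0.1, h1.1, h2.1, h0.2, h1.2, h2.2⟩, rfl⟩, hm⟩
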